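/- Assume S = S(a,b,c) is a finitely generated module over its center Z := Z(S). Let ε : S → k be the algebra homomorphism sending x, y, z to 0 and let m₀ := Z ∩ ker(ε). If m and m' are maximal ideals of Z, both different from m₀, such that dim(m/m²) ≠ 3 and dim(m'/m'²) ≠ 3 over the respective residue fields Z/m ≅ Z/m' ≅ k, then the quotient algebras S/(mS) and S/(m'S) are isomorphic as k-algebras. (Any two points of the singular locus of maxSpec Z other than the origin give isomorphic central quotients of S.) -/

import Mathlib

noncomputable section

/-- The defining relations of the 3-dimensional Sklyanin algebra `S(a,b,c)`:
`a·yz + b·zy + c·x²`, `a·zx + b·xz + c·y²`, `a·xy + b·yx + c·z²` are set to zero.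
The generators `x, y, z` are the images of `FreeAlgebra.ι k 0, 1, 2`. -/
inductive SklyaninRel (k : Type*) [CommRing k] (a b c : k) :
    FreeAlgebra k (Fin 3) → FreeAlgebra k (Fin 3) → Prop
  | r1 : SklyaninRel k a b c
      (a • (FreeAlgebra.ι k 1 * FreeAlgebra.ι k 2) + b • (FreeAlgebra.ι k 2 * FreeAlgebra.ι k 1)
        + c • (FreeAlgebra.ι k 0 * FreeAlgebra.ι k 0)) 0
  | r2 : SklyaninRel k a b c
      (a • (FreeAlgebra.ι k 2 * FreeAlgebra.ι k 0) + b • (FreeAlgebra.ι k 0 * FreeAlgebra.ι k 2)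
        + c • (FreeAlgebra.ι k 1 * FreeAlgebra.ι k 1)) 0
  | r3 : SklyaninRel k a b c
      (a • (FreeAlgebra.ι k 0 * FreeAlgebra.ι k 1) + b • (FreeAlgebra.ι k 1 * FreeAlgebra.ι k 0)
        + c • (FreeAlgebra.ι k 2 * FreeAlgebra.ι k 2)) 0

/-- The 3-dimensional Sklyanin algebra `S(a,b,c)`: the quotient of the free algebra
`k⟨x,y,z⟩` by the two-sided ideal generated by the three Sklyanin relations. -/
def Sklyanin (k : Type*) [CommRing k] (a b c : k) : Type _ := RingQuot (SklyaninRel k a b c)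

instance (k : Type*) [CommRing k] (a b c : k) : Ring (Sklyanin k a b c) :=
  inferInstanceAs (Ring (RingQuot (SklyaninRel k a b c)))

instance (k : Type*) [CommRing k] (a b c : k) : Algebra k (Sklyanin k a b c) :=
  inferInstanceAs (Algebra k (RingQuot (SklyaninRel k a b c)))

namespace Sklyanin

variable (k : Type*) [CommRing k] (a b c : k)

/-- The generator `x` of `S(a,b,c)`. -/
def X : Sklyanin k a b c := RingQuot.mkAlgHom k (SklyaninRel k a b c) (FreeAlgebra.ι k 0)
/-- The generator `y` of `S(a,b,c)`. -/
def Y : Sklyanin k a b c := RingQuot.mkAlgHom k (SklyaninRel k a b c) (FreeAlgebra.ι k 1)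
/-- The generator `z` of `S(a,b,c)`. -/
def Z : Sklyanin k a b c := RingQuot.mkAlgHom k (SklyaninRel k a b c) (FreeAlgebra.ι k 2)

/-- The canonical central element
`g = c(c³−b³)y³ + b(c³−a³)yxz + a(b³−c³)xyz + c(a³−c³)x³` of `S(a,b,c)`. -/
def g : Sklyanin k a b c :=
  (c * (c ^ 3 - b ^ 3)) • (Y k a b c * Y k a b c * Y k a b c)
    + (b * (c ^ 3 - a ^ 3)) • (Y k a b c * X k a b c * Z k a b c)
    + (a * (b ^ 3 - c ^ 3)) • (X k a b c * Y k a b c * Z k a b c)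
    + (c * (a ^ 3 - c ^ 3)) • (X k a b c * X k a b c * X k a b c)

end Sklyanin


/-- The two-sided ideal `mS` of `S(a,b,c)` generated by a set `m` of central elements,
and the corresponding central quotient `S/(mS)`. -/
def Sklyanin.centralQuot (k : Type*) [CommRing k] (a b c : k)
    (m : Ideal ↥(Subalgebra.center k (Sklyanin k a b c))) : Type _ :=
  (TwoSidedIdeal.span
    ((fun z : ↥(Subalgebra.center k (Sklyanin k a b c)) => (z : Sklyanin k a b c)) ''
      (m : Set ↥(Subalgebra.center k (Sklyanin k a b c))))).ringCon.Quotient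

noncomputable instance (k : Type*) [CommRing k] (a b c : k)
    (m : Ideal ↥(Subalgebra.center k (Sklyanin k a b c))) :
    Ring (Sklyanin.centralQuot k a b c m) :=
  inferInstanceAs (Ring (RingCon.Quotient _))

noncomputable instance (k : Type*) [CommRing k] (a b c : k)
    (m : Ideal ↥(Subalgebra.center k (Sklyanin k a b c))) :
    Algebra k (Sklyanin.centralQuot k a b c m) :=
  inferInstanceAs (Algebra k (RingCon.Quotient _))

/-- The augmentation map `ε : S(a,b,c) → k` sending the generators `x, y, z` to `0`. -/
noncomputable def Sklyanin.aug (k : Type*) [CommRing k] (a b c : k) :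
    Sklyanin k a b c →ₐ[k] k :=
  RingQuot.liftAlgHom k (s := SklyaninRel k a b c)
    ⟨FreeAlgebra.lift k (fun _ : Fin 3 => (0 : k)), by
      intro x y h
      cases h <;> simp⟩

/-- The maximal ideal `m₀ = Z ∩ ker ε` of the center, corresponding to the origin. -/
noncomputable def Sklyanin.augCenterIdeal (k : Type*) [CommRing k] (a b c : k) :
    Ideal ↥(Subalgebra.center k (Sklyanin k a b c)) :=
  Ideal.comap ((Subalgebra.center k (Sklyanin k a b c)).val.toRingHom)
    (RingHom.ker (Sklyanin.aug k a b c).toRingHom)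

namespace SklyaninAux

universe u

set_option linter.unusedSectionVars false
set_option linter.unusedDecidableInType false
set_option linter.unusedFintypeInType false

open Matrix

section Complex

variable {k R : Type u} [Field k] [CommRing R] [Algebra k R]
variable {m n : Type} [Fintype m] [Fintype n] [DecidableEq m] [DecidableEq n]

/-- Evaluation of noncommutative polynomials at a triple of matrices. -/
abbrev ev (X : Fin 3 → Matrix n n R) : FreeAlgebra k (Fin 3) →ₐ[k] Matrix n n R :=
  FreeAlgebra.lift k X

/-- The quadratic noncommutative polynomials attached to a tensor `w`. -/
def rel (w : Fin 3 → Fin 3 → Fin 3 → k) (j : Fin 3) : FreeAlgebra k (Fin 3) :=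
  ∑ i, ∑ l, w j i l • (FreeAlgebra.ι k i * FreeAlgebra.ι k l)

/-- The relation values at a triple of elements of an algebra. -/
def relAt {A : Type*} [Ring A] [Algebra k A] (w : Fin 3 → Fin 3 → Fin 3 → k) (x : Fin 3 → A)
    (j : Fin 3) : A :=
  ∑ i, ∑ l, w j i l • (x i * x l)

lemma lift_rel {A : Type*} [Ring A] [Algebra k A] (w : Fin 3 → Fin 3 → Fin 3 → k)
    (x : Fin 3 → A) (j : Fin 3) : FreeAlgebra.lift k x (rel w j) = relAt w x j := by
  simp [rel, relAt]

/-- The differential `f ↦ (X'_k f - f X_k)_k`. -/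
def d0 (X' : Fin 3 → Matrix m m R) (X : Fin 3 → Matrix n n R) :
    Matrix m n R →ₗ[R] (Fin 3 → Matrix m n R) where
  toFun f := fun i => X' i * f - f * X i
  map_add' f g := by ext1 i; simp only [Pi.add_apply, Matrix.mul_add, Matrix.add_mul]; abel
  map_smul' r f := by ext1 i; simp [smul_sub]

/-- The linearisation of the relations. -/
def d1 (w : Fin 3 → Fin 3 → Fin 3 → k) (X' : Fin 3 → Matrix m m R) (X : Fin 3 → Matrix n n R) :
    (Fin 3 → Matrix m n R) →ₗ[R] (Fin 3 → Matrix m n R) where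
  toFun v := fun j => ∑ i, ∑ l, w j i l • (X' i * v l + v i * X l)
  map_add' f g := by
    ext1 j
    simp only [Pi.add_apply, ← Finset.sum_add_distrib, ← smul_add, Matrix.mul_add, Matrix.add_mul]
    refine Finset.sum_congr rfl fun i _ => Finset.sum_congr rfl fun l _ => ?_
    congr 1; abel
  map_smul' r f := by
    ext1 j
    simp only [Pi.smul_apply, Finset.smul_sum, RingHom.id_apply, Matrix.mul_smul, Matrix.smul_mul,
      ← smul_add]
    refine Finset.sum_congr rfl fun i _ => Finset.sum_congr rfl fun l _ => ?_
    rw [smul_comm]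

/-- The differential `o ↦ ∑ X'_j o_j - o_j X_j`. -/
def d2 (X' : Fin 3 → Matrix m m R) (X : Fin 3 → Matrix n n R) :
    (Fin 3 → Matrix m n R) →ₗ[R] Matrix m n R where
  toFun o := ∑ j, (X' j * o j - o j * X j)
  map_add' f g := by
    simp only [Pi.add_apply, ← Finset.sum_add_distrib, Matrix.mul_add, Matrix.add_mul]
    refine Finset.sum_congr rfl fun i _ => ?_
    abel
  map_smul' r f := by simp [Finset.smul_sum, smul_sub]

lemma d0_apply (X' : Fin 3 → Matrix m m R) (X : Fin 3 → Matrix n n R) (f : Matrix m n R)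
    (i : Fin 3) : d0 X' X f i = X' i * f - f * X i := rfl

lemma d1_apply (w : Fin 3 → Fin 3 → Fin 3 → k) (X' : Fin 3 → Matrix m m R)
    (X : Fin 3 → Matrix n n R) (v : Fin 3 → Matrix m n R) (j : Fin 3) :
    d1 w X' X v j = ∑ i, ∑ l, w j i l • (X' i * v l + v i * X l) := rfl

lemma d2_apply (X' : Fin 3 → Matrix m m R) (X : Fin 3 → Matrix n n R) (o : Fin 3 → Matrix m n R) :
    d2 X' X o = ∑ j, (X' j * o j - o j * X j) := rfl

/-- The off-diagonal block of a noncommutative polynomial evaluated at block triangular matrices: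
the value at `z` of the derivation sending the `i`-th variable to `v i`. -/
def dlt (X' : Fin 3 → Matrix m m R) (X : Fin 3 → Matrix n n R) (v : Fin 3 → Matrix m n R)
    (z : FreeAlgebra k (Fin 3)) : Matrix m n R :=
  (ev (k := k) (fun i => fromBlocks (X' i) (v i) 0 (X i)) z).toBlocks₁₂

lemma ev_block (X' : Fin 3 → Matrix m m R) (X : Fin 3 → Matrix n n R) (v : Fin 3 → Matrix m n R)
    (z : FreeAlgebra k (Fin 3)) :
    ev (fun i => fromBlocks (X' i) (v i) 0 (X i)) z
      = fromBlocks (ev X' z) (dlt X' X v z) 0 (ev X z) := by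
  have key : ∃ D, ev (fun i => fromBlocks (X' i) (v i) 0 (X i)) z
      = fromBlocks (ev X' z) D 0 (ev X z) := by
    induction z using FreeAlgebra.induction with
    | grade0 r =>
      refine ⟨0, ?_⟩
      simp only [AlgHom.commutes]
      rw [Algebra.algebraMap_eq_smul_one, Algebra.algebraMap_eq_smul_one,
        Algebra.algebraMap_eq_smul_one, ← fromBlocks_one, fromBlocks_smul]
      simp
    | grade1 i => exact ⟨v i, by simp⟩
    | mul a b ha hb =>
      obtain ⟨A, hA⟩ := ha
      obtain ⟨B, hB⟩ := hb
      exact ⟨ev X' a * B + A * ev X b, by rw [map_mul, hA, hB, fromBlocks_multiply]; simp⟩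
    | add a b ha hb =>
      obtain ⟨A, hA⟩ := ha
      obtain ⟨B, hB⟩ := hb
      exact ⟨A + B, by rw [map_add, hA, hB, fromBlocks_add]; simp⟩
  obtain ⟨D, hD⟩ := key
  rw [dlt, hD, toBlocks_fromBlocks₁₂]

lemma dlt_add (X' : Fin 3 → Matrix m m R) (X : Fin 3 → Matrix n n R) (v : Fin 3 → Matrix m n R)
    (y z : FreeAlgebra k (Fin 3)) : dlt X' X v (y + z) = dlt X' X v y + dlt X' X v z := by
  have h := ev_block X' X v (y + z)
  rw [map_add, ev_block, ev_block, fromBlocks_add] at h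
  exact (fromBlocks_inj.1 h).2.1.symm

lemma dlt_mul (X' : Fin 3 → Matrix m m R) (X : Fin 3 → Matrix n n R) (v : Fin 3 → Matrix m n R)
    (y z : FreeAlgebra k (Fin 3)) :
    dlt X' X v (y * z) = ev X' y * dlt X' X v z + dlt X' X v y * ev X z := by
  have h := ev_block X' X v (y * z)
  rw [map_mul, ev_block, ev_block, fromBlocks_multiply] at h
  exact (fromBlocks_inj.1 h).2.1.symm

lemma dlt_smul (X' : Fin 3 → Matrix m m R) (X : Fin 3 → Matrix n n R) (v : Fin 3 → Matrix m n R)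
    (r : k) (z : FreeAlgebra k (Fin 3)) : dlt X' X v (r • z) = r • dlt X' X v z := by
  have h := ev_block X' X v (r • z)
  rw [map_smul, ev_block, fromBlocks_smul] at h
  exact (fromBlocks_inj.1 h).2.1.symm

lemma dlt_ι (X' : Fin 3 → Matrix m m R) (X : Fin 3 → Matrix n n R) (v : Fin 3 → Matrix m n R)
    (i : Fin 3) : dlt X' X v (FreeAlgebra.ι k i) = v i := by
  simp [dlt]

lemma dlt_algebraMap (X' : Fin 3 → Matrix m m R) (X : Fin 3 → Matrix n n R)
    (v : Fin 3 → Matrix m n R) (r : k) :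
    dlt X' X v (algebraMap k (FreeAlgebra k (Fin 3)) r) = 0 := by
  have h := dlt_mul X' X v (1 : FreeAlgebra k (Fin 3)) 1
  rw [_root_.mul_one, map_one, map_one, Matrix.one_mul, Matrix.mul_one, left_eq_add] at h
  rw [Algebra.algebraMap_eq_smul_one, dlt_smul, h, smul_zero]

lemma dlt_sum (X' : Fin 3 → Matrix m m R) (X : Fin 3 → Matrix n n R) (v : Fin 3 → Matrix m n R)
    {ι : Type*} (s : Finset ι) (z : ι → FreeAlgebra k (Fin 3)) :
    dlt X' X v (∑ i ∈ s, z i) = ∑ i ∈ s, dlt X' X v (z i) := by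
  classical
  induction s using Finset.induction_on with
  | empty => simpa using dlt_algebraMap (k := k) X' X v 0
  | insert i s hi ih => rw [Finset.sum_insert hi, Finset.sum_insert hi, dlt_add, ih]

lemma dlt_rel (w : Fin 3 → Fin 3 → Fin 3 → k) (X' : Fin 3 → Matrix m m R)
    (X : Fin 3 → Matrix n n R) (v : Fin 3 → Matrix m n R) (j : Fin 3) :
    dlt X' X v (rel w j) = d1 w X' X v j := by
  simp only [rel, dlt_sum, dlt_smul, dlt_mul, dlt_ι, d1_apply, FreeAlgebra.lift_ι_apply]

/-- A sandwich list: a finite sum of operators `v ↦ p(X') v_i q(X)`. -/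
abbrev Sand (k : Type u) [Field k] : Type u :=
  List (FreeAlgebra k (Fin 3) × Fin 3 × FreeAlgebra k (Fin 3))

/-- The operator attached to a sandwich list. -/
def evL (L : Sand k) (X' : Fin 3 → Matrix m m R) (X : Fin 3 → Matrix n n R) :
    (Fin 3 → Matrix m n R) →ₗ[R] Matrix m n R where
  toFun v := (L.map fun t => ev X' t.1 * v t.2.1 * ev X t.2.2).sum
  map_add' f g := by
    rw [← List.sum_map_add]
    simp [Matrix.mul_add, Matrix.add_mul]
  map_smul' r f := by
    induction L with
    | nil => simp
    | cons t L ih => simp only [List.map_cons, List.sum_cons, ih]; simp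

lemma evL_apply (L : Sand k) (X' : Fin 3 → Matrix m m R) (X : Fin 3 → Matrix n n R)
    (v : Fin 3 → Matrix m n R) :
    evL L X' X v = (L.map fun t => ev X' t.1 * v t.2.1 * ev X t.2.2).sum := rfl

/-- The transpose of `evL` for the trace pairing. -/
def evT (L : Sand k) (X' : Fin 3 → Matrix m m R) (X : Fin 3 → Matrix n n R) :
    Matrix m n R →ₗ[R] (Fin 3 → Matrix m n R) where
  toFun M := fun i => (L.map fun t => if t.2.1 = i then ev X' t.2.2 * M * ev X t.1 else 0).sum
  map_add' f g := by
    ext1 i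
    rw [Pi.add_apply, ← List.sum_map_add]
    congr 1
    refine List.map_congr_left fun t _ => ?_
    split_ifs <;> simp [Matrix.mul_add, Matrix.add_mul]
  map_smul' r f := by
    ext1 i
    induction L with
    | nil => simp
    | cons t L ih =>
      simp only [List.map_cons, List.sum_cons, Pi.smul_apply, RingHom.id_apply, smul_add] at ih ⊢
      rw [ih]
      split_ifs <;> simp

lemma evT_apply (L : Sand k) (X' : Fin 3 → Matrix m m R) (X : Fin 3 → Matrix n n R)
    (M : Matrix m n R) (i : Fin 3) :
    evT L X' X M i
      = (L.map fun t => if t.2.1 = i then ev X' t.2.2 * M * ev X t.1 else 0).sum := rfl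

lemma evT_trace (L : Sand k) (X' : Fin 3 → Matrix m m R) (X : Fin 3 → Matrix n n R)
    (M : Matrix m n R) (v : Fin 3 → Matrix n m R) :
    ∑ i, trace (evT L X' X M i * v i) = trace (M * evL L X X' v) := by
  simp only [evT_apply, evL_apply]
  induction L with
  | nil => simp
  | cons t L ih =>
    simp only [List.map_cons, List.sum_cons, Matrix.add_mul, Matrix.mul_add, trace_add,
      Finset.sum_add_distrib, ih]
    congr 1
    rw [Finset.sum_eq_single t.2.1]
    · simp only [if_true]
      rw [Matrix.trace_mul_comm, ← Matrix.mul_assoc, ← Matrix.mul_assoc, Matrix.trace_mul_comm,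
        ← Matrix.mul_assoc, ← Matrix.mul_assoc, ← Matrix.mul_assoc, Matrix.trace_mul_comm]
      simp only [Matrix.mul_assoc]
    · intro b _ hb
      rw [if_neg (Ne.symm hb)]; simp
    · simp

/-- The noncommutative polynomials which are `∑ p · rel j · q` for a given sandwich list. -/
def sandRel (w : Fin 3 → Fin 3 → Fin 3 → k) (L : Sand k) : FreeAlgebra k (Fin 3) :=
  (L.map fun t => t.1 * rel w t.2.1 * t.2.2).sum

lemma dlt_sandRel (w : Fin 3 → Fin 3 → Fin 3 → k) (L : Sand k) (X' : Fin 3 → Matrix m m R)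
    (X : Fin 3 → Matrix n n R) (hX' : ∀ j, relAt w X' j = 0) (hX : ∀ j, relAt w X j = 0)
    (v : Fin 3 → Matrix m n R) :
    dlt X' X v (sandRel w L) = evL L X' X (d1 w X' X v) := by
  rw [evL_apply, sandRel]
  induction L with
  | nil => simpa using dlt_algebraMap (k := k) X' X v 0
  | cons t L ih =>
    simp only [List.map_cons, List.sum_cons, dlt_add, ih, dlt_mul, dlt_rel, map_mul, lift_rel,
      hX', hX]
    simp

lemma exists_deriv (z : FreeAlgebra k (Fin 3)) :
    ∃ L : Sand k, ∀ (R : Type u) [CommRing R] [Algebra k R] (m n : Type) [Fintype m] [Fintype n]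
      [DecidableEq m] [DecidableEq n] (X' : Fin 3 → Matrix m m R) (X : Fin 3 → Matrix n n R)
      (v : Fin 3 → Matrix m n R), dlt X' X v z = evL L X' X v := by
  induction z using FreeAlgebra.induction with
  | grade0 r => exact ⟨[], fun R _ _ m n _ _ _ _ X' X v => by rw [dlt_algebraMap]; simp [evL_apply]⟩
  | grade1 i => exact ⟨[(1, i, 1)], fun R _ _ m n _ _ _ _ X' X v => by
      rw [dlt_ι]; simp [evL_apply]⟩
  | mul a b ha hb =>
    obtain ⟨A, hA⟩ := ha
    obtain ⟨B, hB⟩ := hb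
    refine ⟨B.map (fun t => (a * t.1, t.2.1, t.2.2)) ++ A.map (fun t => (t.1, t.2.1, t.2.2 * b)),
      fun R _ _ m n _ _ _ _ X' X v => ?_⟩
    rw [dlt_mul, hA, hB]
    simp only [evL_apply, List.map_append, List.sum_append, List.map_map, Function.comp_def,
      map_mul]
    congr 1
    · clear hA hB
      induction B with
      | nil => simp
      | cons t L ih =>
        simp only [Matrix.mul_assoc] at ih ⊢
        simp only [List.map_cons, List.sum_cons, Matrix.mul_add, ih]
    · clear hA hB
      induction A with
      | nil => simp
      | cons t L ih =>
        simp only [Matrix.mul_assoc] at ih ⊢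
        simp only [List.map_cons, List.sum_cons, Matrix.add_mul, ih, Matrix.mul_assoc]
  | add a b ha hb =>
    obtain ⟨A, hA⟩ := ha
    obtain ⟨B, hB⟩ := hb
    exact ⟨A ++ B, fun R _ _ m n _ _ _ _ X' X v => by
      rw [dlt_add, hA, hB]; simp [evL_apply]⟩

end Complex

section Homotopy

variable {k R : Type u} [Field k] [CommRing R] [Algebra k R]
variable {m n : Type} [Fintype m] [Fintype n] [DecidableEq m] [DecidableEq n]

/-- The trace pairing of triples of matrices. -/
def pr (v : Fin 3 → Matrix m n R) (v' : Fin 3 → Matrix n m R) : R := ∑ i, trace (v i * v' i)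

lemma pr_add_left (v v₁ : Fin 3 → Matrix m n R) (v' : Fin 3 → Matrix n m R) :
    pr (v + v₁) v' = pr v v' + pr v₁ v' := by
  simp [pr, Matrix.add_mul, Finset.sum_add_distrib]

lemma pr_neg_left (v : Fin 3 → Matrix m n R) (v' : Fin 3 → Matrix n m R) :
    pr (-v) v' = - pr v v' := by
  simp [pr]

lemma pr_add_right (v : Fin 3 → Matrix m n R) (v' v₁ : Fin 3 → Matrix n m R) :
    pr v (v' + v₁) = pr v v' + pr v v₁ := by
  simp [pr, Matrix.mul_add, Finset.sum_add_distrib]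

lemma pr_smul_right (r : R) (v : Fin 3 → Matrix m n R) (v' : Fin 3 → Matrix n m R) :
    pr v (r • v') = r * pr v v' := by
  simp [pr, Finset.mul_sum]

lemma pr_smul_left (r : R) (v : Fin 3 → Matrix m n R) (v' : Fin 3 → Matrix n m R) :
    pr (r • v) v' = r * pr v v' := by
  simp [pr, Finset.mul_sum]

lemma pr_comm (v : Fin 3 → Matrix m n R) (v' : Fin 3 → Matrix n m R) : pr v v' = pr v' v := by
  simp only [pr]
  exact Finset.sum_congr rfl fun i _ => Matrix.trace_mul_comm _ _

lemma pr_ext {v v₁ : Fin 3 → Matrix m n R} (h : ∀ v' : Fin 3 → Matrix n m R, pr v v' = pr v₁ v') :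
    v = v₁ := by
  ext1 i
  rw [Matrix.ext_iff_trace_mul_right]
  intro M
  simpa [pr, Pi.single_apply, apply_ite, Finset.sum_ite_eq] using h (Pi.single i M)

lemma pr_d0 (X' : Fin 3 → Matrix m m R) (X : Fin 3 → Matrix n n R) (f : Matrix m n R)
    (o : Fin 3 → Matrix n m R) : pr (d0 X' X f) o = - trace (f * d2 X X' o) := by
  simp only [pr, d0_apply, d2_apply, Matrix.mul_sum, trace_sum, ← Finset.sum_neg_distrib]
  refine Finset.sum_congr rfl fun i _ => ?_
  rw [Matrix.sub_mul, Matrix.mul_sub, trace_sub, trace_sub, Matrix.mul_assoc,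
    Matrix.trace_mul_comm (X' i), Matrix.mul_assoc, Matrix.mul_assoc]
  ring

lemma sum_rot {M : Type*} [AddCommMonoid M] (f : Fin 3 → Fin 3 → Fin 3 → M) :
    ∑ j, ∑ i, ∑ l, f j i l = ∑ j, ∑ i, ∑ l, f i l j := by
  symm
  rw [Finset.sum_comm]
  exact Finset.sum_congr rfl fun i _ => Finset.sum_comm

lemma pr_d1 {w : Fin 3 → Fin 3 → Fin 3 → k} (hw : ∀ i j l, w i j l = w j l i)
    (X' : Fin 3 → Matrix m m R) (X : Fin 3 → Matrix n n R) (v : Fin 3 → Matrix m n R)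
    (v' : Fin 3 → Matrix n m R) : pr (d1 w X' X v) v' = pr v (d1 w X X' v') := by
  have h1 : pr (d1 w X' X v) v' = ∑ j, ∑ i, ∑ l, (w j i l • trace (v l * v' j * X' i)
      + w j i l • trace (v i * X l * v' j)) := by
    simp only [pr, d1_apply, Matrix.sum_mul, trace_sum]
    refine Finset.sum_congr rfl fun j _ => Finset.sum_congr rfl fun i _ =>
      Finset.sum_congr rfl fun l _ => ?_
    rw [Matrix.smul_mul, trace_smul, Matrix.add_mul, trace_add, smul_add, Matrix.mul_assoc,
      Matrix.trace_mul_comm (X' i)]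
  have h2 : pr v (d1 w X X' v') = ∑ j, ∑ i, ∑ l, (w j i l • trace (v j * v' i * X' l)
      + w j i l • trace (v j * X i * v' l)) := by
    simp only [pr, d1_apply, Matrix.mul_sum, trace_sum]
    refine Finset.sum_congr rfl fun j _ => Finset.sum_congr rfl fun i _ =>
      Finset.sum_congr rfl fun l _ => ?_
    rw [Matrix.mul_smul, trace_smul, Matrix.mul_add, trace_add, smul_add, ← Matrix.mul_assoc,
      ← Matrix.mul_assoc, add_comm]
  rw [h1, h2]
  simp only [Finset.sum_add_distrib]
  refine congrArg₂ (· + ·) ?_ ?_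
  · rw [sum_rot]
    refine Finset.sum_congr rfl fun j _ => Finset.sum_congr rfl fun i _ =>
      Finset.sum_congr rfl fun l _ => ?_
    rw [hw j i l]
  · rw [sum_rot, sum_rot]
    refine Finset.sum_congr rfl fun j _ => Finset.sum_congr rfl fun i _ =>
      Finset.sum_congr rfl fun l _ => ?_
    rw [hw l j i]

lemma pr_evT (L : Sand k) (X' : Fin 3 → Matrix m m R) (X : Fin 3 → Matrix n n R)
    (M : Matrix m n R) (v : Fin 3 → Matrix n m R) :
    pr (evT L X' X M) v = trace (M * evL L X X' v) := evT_trace L X' X M v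

/-- The operator `u ↦ z(X') u - u z(X)`. -/
def cz (z : FreeAlgebra k (Fin 3)) (X' : Fin 3 → Matrix m m R) (X : Fin 3 → Matrix n n R)
    (u : Matrix m n R) : Matrix m n R := ev X' z * u - u * ev X z

lemma dlt_d0 (z : FreeAlgebra k (Fin 3)) (X' : Fin 3 → Matrix m m R) (X : Fin 3 → Matrix n n R)
    (f : Matrix m n R) : dlt X' X (d0 X' X f) z = cz z X' X f := by
  unfold cz
  induction z using FreeAlgebra.induction with
  | grade0 r =>
    rw [dlt_algebraMap, AlgHom.commutes, AlgHom.commutes, Algebra.algebraMap_eq_smul_one,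
      Algebra.algebraMap_eq_smul_one]
    simp
  | grade1 i => rw [dlt_ι]; simp [d0_apply]
  | mul a b ha hb =>
    rw [dlt_mul, ha, hb, map_mul, map_mul]
    simp only [Matrix.mul_sub, Matrix.sub_mul, Matrix.mul_assoc]
    abel
  | add a b ha hb =>
    rw [dlt_add, ha, hb, map_add, map_add]
    simp only [Matrix.add_mul, Matrix.mul_add]
    abel

/-- Data witnessing that `z` is central modulo the relations. -/
structure CenData (w : Fin 3 → Fin 3 → Fin 3 → k) (z : FreeAlgebra k (Fin 3)) where
  /-- the derivative of `z` -/
  L1 : Sand k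
  /-- the commutators of `z` with the variables -/
  L2 : Fin 3 → Sand k
  h1 : ∀ (R : Type u) [CommRing R] [Algebra k R] (m n : Type) [Fintype m] [Fintype n]
      [DecidableEq m] [DecidableEq n] (X' : Fin 3 → Matrix m m R) (X : Fin 3 → Matrix n n R)
      (v : Fin 3 → Matrix m n R), dlt X' X v z = evL L1 X' X v
  h2 : ∀ i, z * FreeAlgebra.ι k i - FreeAlgebra.ι k i * z = sandRel w (L2 i)

variable {w : Fin 3 → Fin 3 → Fin 3 → k} {z : FreeAlgebra k (Fin 3)}

/-- The second contracting homotopy. -/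
def CenData.hh2 (D : CenData w z) (X' : Fin 3 → Matrix m m R) (X : Fin 3 → Matrix n n R) :
    (Fin 3 → Matrix m n R) →ₗ[R] (Fin 3 → Matrix m n R) :=
  LinearMap.pi fun i => evL (D.L2 i) X' X

/-- The transposed second homotopy. -/
def CenData.hh2T (D : CenData w z) (X' : Fin 3 → Matrix m m R) (X : Fin 3 → Matrix n n R) :
    (Fin 3 → Matrix m n R) →ₗ[R] (Fin 3 → Matrix m n R) :=
  -∑ l, (evT (D.L2 l) X' X).comp (LinearMap.proj l)

lemma CenData.hk0 (D : CenData w z) (X' : Fin 3 → Matrix m m R) (X : Fin 3 → Matrix n n R)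
    (f : Matrix m n R) : cz z X' X f = evL D.L1 X' X (d0 X' X f) := by
  rw [← D.h1, dlt_d0]

lemma CenData.hk1 (D : CenData w z) (X' : Fin 3 → Matrix m m R) (X : Fin 3 → Matrix n n R)
    (hX' : ∀ j, relAt w X' j = 0) (hX : ∀ j, relAt w X j = 0)
    (v : Fin 3 → Matrix m n R) :
    (fun i => cz z X' X (v i)) = d0 X' X (evL D.L1 X' X v) + D.hh2 X' X (d1 w X' X v) := by
  ext1 i
  have h := congrArg (dlt X' X v) (D.h2 i)
  rw [dlt_sandRel w _ X' X hX' hX, sub_eq_add_neg, ← neg_one_smul k, dlt_add, dlt_smul, dlt_mul,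
    dlt_mul, dlt_ι, D.h1, FreeAlgebra.lift_ι_apply, FreeAlgebra.lift_ι_apply] at h
  simp only [CenData.hh2, Pi.add_apply, LinearMap.pi_apply, d0_apply, cz, ← h]
  rw [neg_one_smul]
  abel

lemma pr_cz (X' : Fin 3 → Matrix m m R) (X : Fin 3 → Matrix n n R) (o : Fin 3 → Matrix m n R)
    (v : Fin 3 → Matrix n m R) :
    pr (fun i => cz z X' X (o i)) v = - pr o (fun i => cz z X X' (v i)) := by
  simp only [pr, cz, ← Finset.sum_neg_distrib]
  refine Finset.sum_congr rfl fun i _ => ?_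
  rw [Matrix.sub_mul, Matrix.mul_sub, trace_sub, trace_sub, Matrix.mul_assoc,
    Matrix.trace_mul_comm (ev X' z), Matrix.mul_assoc, Matrix.mul_assoc]
  ring

lemma CenData.pr_hh2T (D : CenData w z) (X' : Fin 3 → Matrix m m R) (X : Fin 3 → Matrix n n R)
    (o : Fin 3 → Matrix m n R) (v : Fin 3 → Matrix n m R) :
    pr (D.hh2T X' X o) v = - pr o (D.hh2 X X' v) := by
  have : pr (D.hh2T X' X o) v = - ∑ l, pr (evT (D.L2 l) X' X (o l)) v := by
    simp only [pr, CenData.hh2T, LinearMap.neg_apply, LinearMap.sum_apply, LinearMap.comp_apply,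
      LinearMap.proj_apply, Pi.neg_apply, Finset.sum_apply, Matrix.neg_mul, Matrix.sum_mul,
      trace_neg, trace_sum, Finset.sum_neg_distrib]
    rw [Finset.sum_comm]
  rw [this]
  simp only [pr_evT]
  rfl

lemma CenData.hk2 (D : CenData w z) (hw : ∀ i j l, w i j l = w j l i)
    (X' : Fin 3 → Matrix m m R) (X : Fin 3 → Matrix n n R)
    (hX' : ∀ j, relAt w X' j = 0) (hX : ∀ j, relAt w X j = 0)
    (o : Fin 3 → Matrix m n R) :
    (fun i => cz z X' X (o i)) = evT D.L1 X' X (d2 X' X o) + d1 w X' X (D.hh2T X' X o) := by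
  refine pr_ext fun v => ?_
  rw [pr_cz, D.hk1 X X' hX hX', pr_add_left, pr_evT, pr_d1 hw, D.pr_hh2T, pr_add_right,
    pr_comm o (d0 _ _ _), pr_d0, Matrix.trace_mul_comm]
  ring

lemma CenData.hk3 (D : CenData w z)
    (X' : Fin 3 → Matrix m m R) (X : Fin 3 → Matrix n n R) (M : Matrix m n R) :
    cz z X' X M = d2 X' X (evT D.L1 X' X M) := by
  rw [Matrix.ext_iff_trace_mul_right]
  intro f
  have h1 : trace (cz z X' X M * f) = - trace (M * cz z X X' f) := by
    rw [cz, cz, Matrix.sub_mul, Matrix.mul_sub, trace_sub, trace_sub, Matrix.mul_assoc,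
      Matrix.trace_mul_comm (ev X' z), Matrix.mul_assoc, Matrix.mul_assoc]
    ring
  have h2 := pr_d0 X X' f (evT D.L1 X' X M)
  rw [pr_comm, pr_evT] at h2
  rw [h1, D.hk0, h2, neg_neg, Matrix.trace_mul_comm]

end Homotopy

section Natural

variable {k R R' : Type u} [Field k] [CommRing R] [Algebra k R] [CommRing R'] [Algebra k R']
variable {n : Type} [Fintype n] [DecidableEq n]

lemma map_ev (φ : R →ₐ[k] R') (X : Fin 3 → Matrix n n R) (z : FreeAlgebra k (Fin 3)) :
    φ.mapMatrix (ev X z) = ev (fun i => φ.mapMatrix (X i)) z := by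
  have : (φ.mapMatrix (m := n)).comp (ev (k := k) X) = ev (fun i => φ.mapMatrix (X i)) := by
    apply FreeAlgebra.hom_ext
    ext1 i
    simp
  exact DFunLike.congr_fun this z

lemma map_d0 (φ : R →ₐ[k] R') (X' X : Fin 3 → Matrix n n R) (f : Matrix n n R) (i : Fin 3) :
    φ.mapMatrix (d0 X' X f i)
      = d0 (fun i => φ.mapMatrix (X' i)) (fun i => φ.mapMatrix (X i)) (φ.mapMatrix f) i := by
  simp only [d0_apply, map_sub, map_mul]

lemma map_d1 (w : Fin 3 → Fin 3 → Fin 3 → k) (φ : R →ₐ[k] R') (X' X v : Fin 3 → Matrix n n R)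
    (j : Fin 3) : φ.mapMatrix (d1 w X' X v j)
      = d1 w (fun i => φ.mapMatrix (X' i)) (fun i => φ.mapMatrix (X i))
        (fun i => φ.mapMatrix (v i)) j := by
  simp only [d1_apply, map_sum, map_smul, map_add, map_mul]

lemma map_evL (φ : R →ₐ[k] R') (L : Sand k) (X' X v : Fin 3 → Matrix n n R) :
    φ.mapMatrix (evL L X' X v)
      = evL L (fun i => φ.mapMatrix (X' i)) (fun i => φ.mapMatrix (X i))
        (fun i => φ.mapMatrix (v i)) := by
  simp only [evL_apply, map_list_sum, List.map_map, Function.comp_def, map_mul, map_ev]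

lemma map_relAt (w : Fin 3 → Fin 3 → Fin 3 → k) {A B : Type*} [Ring A] [Ring B] [Algebra k A]
    [Algebra k B] (φ : A →ₐ[k] B) (x : Fin 3 → A) (j : Fin 3) :
    φ (relAt w x j) = relAt w (fun i => φ (x i)) j := by
  simp [relAt]

lemma relAt_smul (w : Fin 3 → Fin 3 → Fin 3 → k) (r : R) (x : Fin 3 → Matrix n n R)
    (j : Fin 3) : relAt w (fun i => r • x i) j = (r * r) • relAt w x j := by
  simp only [relAt, Finset.smul_sum]
  refine Finset.sum_congr rfl fun i _ => Finset.sum_congr rfl fun l _ => ?_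
  rw [Matrix.smul_mul, Matrix.mul_smul, smul_smul, smul_comm]

lemma d1_d0 {m : Type} [Fintype m] [DecidableEq m] (w : Fin 3 → Fin 3 → Fin 3 → k)
    (X' : Fin 3 → Matrix m m R) (X : Fin 3 → Matrix n n R)
    (hX' : ∀ j, relAt w X' j = 0) (hX : ∀ j, relAt w X j = 0) (f : Matrix m n R) :
    d1 w X' X (d0 X' X f) = 0 := by
  ext1 j
  have h1 : relAt w X' j * f - f * relAt w X j = 0 := by rw [hX', hX]; simp
  rw [Pi.zero_apply, ← h1]
  simp only [d1_apply, d0_apply, relAt, Matrix.sum_mul, Matrix.mul_sum, ← Finset.sum_sub_distrib]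
  refine Finset.sum_congr rfl fun i _ => Finset.sum_congr rfl fun l _ => ?_
  rw [Matrix.smul_mul, Matrix.mul_smul, ← smul_sub]
  simp only [Matrix.mul_sub, Matrix.sub_mul, Matrix.mul_assoc]
  congr 1
  abel

/-- Homogeneity of degree `N`. -/
def Homog (N : ℕ) (z : FreeAlgebra k (Fin 3)) : Prop :=
  z ∈ Submodule.span k (Set.range (FreeAlgebra.ι k : Fin 3 → FreeAlgebra k (Fin 3))) ^ N

lemma Homog.lift_smul {N : ℕ} {z : FreeAlgebra k (Fin 3)} (hz : Homog N z) {A : Type*} [Ring A]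
    [Algebra k A] [Algebra R A] [IsScalarTower k R A] (r : R) (x : Fin 3 → A) :
    FreeAlgebra.lift k (fun i => r • x i) z = r ^ N • FreeAlgebra.lift k x z := by
  unfold Homog at hz
  refine Submodule.pow_induction_on_left' (Submodule.span k (Set.range (FreeAlgebra.ι k)))
    (C := fun n z _ => FreeAlgebra.lift k (fun i => r • x i) z = r ^ n • FreeAlgebra.lift k x z)
    ?_ ?_ ?_ hz
  · intro a; simp
  · intro y z i _ _ hy hz; rw [map_add, map_add, hy, hz, smul_add]
  · intro m hm i z hz ih
    rw [map_mul, map_mul, ih, pow_succ']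
    have : FreeAlgebra.lift k (fun i => r • x i) m = r • FreeAlgebra.lift k x m := by
      clear ih
      induction hm using Submodule.span_induction with
      | mem y hy => obtain ⟨i, rfl⟩ := hy; simp
      | zero => simp
      | add y z _ _ hy hz => rw [map_add, map_add, hy, hz, smul_add]
      | smul c y _ hy => rw [map_smul, map_smul, hy, smul_comm]
    rw [this, smul_mul_smul_comm]

end Natural

section Lambda

open Polynomial

variable {k : Type u} [Field k]

/-- A cyclic tensor together with a homogeneous polynomial central modulo the relations. -/
structure Env (k : Type u) [Field k] where
  /-- the tensor -/
  w : Fin 3 → Fin 3 → Fin 3 → k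
  hw : ∀ i j l, w i j l = w j l i
  /-- the central polynomial -/
  z : FreeAlgebra k (Fin 3)
  /-- its degree -/
  N : ℕ
  hN : N ≠ 0
  hz : Homog N z
  /-- witnesses of centrality -/
  D : CenData w z

variable {n : Type} [Fintype n] [DecidableEq n]

/-- An irreducible matrix solution of the relations at which the central polynomial takes the
nonzero value `ζ`. -/
structure IsPt (E : Env k) (ζ : k) (x : Fin 3 → Matrix n n k) : Prop where
  rel : ∀ j, relAt E.w x j = 0
  surj : Function.Surjective (ev (k := k) x)
  cen : ev x E.z = ζ • (1 : Matrix n n k)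
  hζ : ζ ≠ 0

lemma IsPt.irr {E : Env k} {ζ : k} {x : Fin 3 → Matrix n n k} (h : IsPt E ζ x) (M : Matrix n n k)
    (hM : ∀ i, x i * M = M * x i) : ∃ c : k, M = c • (1 : Matrix n n k) := by
  have : ∀ B : Matrix n n k, B * M = M * B := by
    intro B
    obtain ⟨b, rfl⟩ := h.surj B
    induction b using FreeAlgebra.induction with
    | grade0 r => rw [AlgHom.commutes]; exact Algebra.commutes _ _
    | grade1 i => simpa using hM i
    | mul a b ha hb => rw [map_mul, mul_assoc, hb, ← mul_assoc, ha, mul_assoc]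
    | add a b ha hb => rw [map_add, add_mul, mul_add, ha, hb]
  obtain ⟨c, rfl⟩ := Matrix.mem_range_scalar_of_commute_single fun i j _ => this _
  exact ⟨c, by ext; simp [Matrix.one_apply, Matrix.diagonal_apply]⟩

/-- Constant matrices over the polynomial ring. -/
def cM (A : Matrix n n k) : Matrix n n k[X] := (CAlgHom (R := k) (A := k)).mapMatrix A

/-- Evaluation of polynomial matrices at `1`. -/
def e1 : Matrix n n k[X] →ₐ[k] Matrix n n k := (aeval (1 : k)).mapMatrix

lemma e1_cM (A : Matrix n n k) : e1 (cM A) = A := by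
  ext i j
  simp [e1, cM]

lemma e1_smul (p : k[X]) (A : Matrix n n k[X]) : e1 (p • A) = p.eval 1 • e1 A := by
  ext i j
  simp [e1, coe_aeval_eq_eval]

lemma cM_add (A B : Matrix n n k) : cM (A + B) = cM A + cM B := map_add _ _ _
lemma cM_sub (A B : Matrix n n k) : cM (A - B) = cM A - cM B := map_sub _ _ _
lemma cM_mul (A B : Matrix n n k) : cM (A * B) = cM A * cM B := map_mul _ _ _
lemma cM_smul (c : k) (A : Matrix n n k) : cM (c • A) = c • cM A := map_smul _ _ _
lemma cM_one : cM (1 : Matrix n n k) = 1 := map_one _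

lemma exists_div {P : Matrix n n k[X]} (hP : e1 P = 0) :
    ∃ Q : Matrix n n k[X], P = (X - 1 : k[X]) • Q := by
  have : ∀ i j, ∃ q : k[X], P i j = (X - 1) * q := by
    intro i j
    have h : (P i j).eval 1 = 0 := by
      have := congrFun (congrFun hP i) j
      simpa [e1, coe_aeval_eq_eval] using this
    have h2 := dvd_iff_isRoot.2 h
    rwa [map_one] at h2
  choose Q hQ using this
  exact ⟨Matrix.of Q, by ext1 i j; simp [hQ]⟩

lemma X_sub_one_cancel {P Q : Matrix n n k[X]} (h : (X - 1 : k[X]) • P = (X - 1 : k[X]) • Q) :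
    P = Q := by
  have hne : (X - 1 : k[X]) ≠ 0 := by simpa using X_sub_C_ne_zero (1 : k)
  ext1 i j
  have := congrFun (congrFun h i) j
  simpa [hne] using this

lemma exists_expand (P : Matrix n n k[X]) :
    ∃ Q : Matrix n n k[X], P = cM (e1 P) + (X - 1 : k[X]) • Q := by
  obtain ⟨Q, hQ⟩ := exists_div (P := P - cM (e1 P)) (by rw [map_sub, e1_cM, sub_self])
  exact ⟨Q, by rw [← hQ]; abel⟩

/-- The polynomial `1 + X + ⋯ + X^(N-1)`. -/
def gs (N : ℕ) : k[X] := ∑ i ∈ Finset.range N, X ^ i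

lemma gs_mul (N : ℕ) : (X - 1 : k[X]) * gs N = X ^ N - 1 := by
  rw [gs, mul_comm, geom_sum_mul]

lemma gs_eval (N : ℕ) : (gs N : k[X]).eval 1 = N := by
  simp [gs, eval_finsetSum]

/-- The pencil member: the solution `λ x` over `k[λ]`. -/
def lx (x : Fin 3 → Matrix n n k) : Fin 3 → Matrix n n k[X] := fun i => (X : k[X]) • cM (x i)

/-- The constant solution. -/
def cx (x : Fin 3 → Matrix n n k) : Fin 3 → Matrix n n k[X] := fun i => cM (x i)

variable {E : Env k} {ζ : k} {x : Fin 3 → Matrix n n k}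

lemma e1_lx (x : Fin 3 → Matrix n n k) : (fun i => e1 (lx x i)) = x := by
  ext1 i; simp [lx, e1_smul, e1_cM]

lemma e1_cx (x : Fin 3 → Matrix n n k) : (fun i => e1 (cx x i)) = x := by
  ext1 i; simp [cx, e1_cM]

lemma relAt_cx (h : IsPt E ζ x) (j : Fin 3) : relAt E.w (cx x) j = 0 := by
  have := map_relAt E.w ((CAlgHom (R := k) (A := k)).mapMatrix (m := n)) x j
  rw [h.rel j, map_zero] at this
  exact this.symm

lemma relAt_lx (h : IsPt E ζ x) (j : Fin 3) : relAt E.w (lx x) j = 0 := by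
  have := relAt_smul E.w (X : k[X]) (cx x) j
  rw [relAt_cx h, smul_zero] at this
  exact this

lemma cz_lx (h : IsPt E ζ x) (u : Matrix n n k[X]) :
    cz E.z (lx x) (cx x) u = (X - 1 : k[X]) • ((gs E.N * C ζ : k[X]) • u) := by
  have h1 : ev (cx x) E.z = (C ζ : k[X]) • (1 : Matrix n n k[X]) := by
    have := map_ev (CAlgHom (R := k) (A := k)) x E.z
    rw [h.cen] at this
    rw [show cx x = fun i => (CAlgHom (R := k) (A := k)).mapMatrix (x i) from rfl, ← this, map_smul,
      map_one]
    exact Algebra.smul_def _ _ |>.trans (by ext i j; simp [Matrix.algebraMap_matrix_apply,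
      Matrix.one_apply])
  have h2 : ev (lx x) E.z = (X ^ E.N : k[X]) • ev (cx x) E.z := E.hz.lift_smul X (cx x)
  rw [cz, h2, h1, smul_smul, Matrix.smul_mul, Matrix.mul_smul, Matrix.mul_one, Matrix.one_mul,
    smul_smul, ← mul_assoc, gs_mul, ← sub_smul]
  congr 1
  ring

/-- The operator `u ↦ ū`. -/
def bar (w : Fin 3 → Fin 3 → Fin 3 → k) (x u : Fin 3 → Matrix n n k) : Fin 3 → Matrix n n k :=
  fun j => ∑ i, ∑ l, w j i l • (x i * u l)

/-- Gauge directions: multiples of `x` and commutators. -/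
def IsGauge (x u : Fin 3 → Matrix n n k) : Prop :=
  ∃ (c : k) (f : Matrix n n k), u = c • x + d0 x x f

lemma d1_lam (w : Fin 3 → Fin 3 → Fin 3 → k) (x u : Fin 3 → Matrix n n k) :
    d1 w (lx x) (cx x) (fun i => cM (u i))
      = fun j => cM (d1 w x x u j) + (X - 1 : k[X]) • cM (bar w x u j) := by
  ext1 j
  simp only [d1_apply, bar, lx, cx]
  rw [show ∀ A : Matrix n n k, cM A = (CAlgHom (R := k) (A := k)).mapMatrix A from fun _ => rfl]
  simp only [map_sum, map_smul, map_add, map_mul,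
    show ∀ A : Matrix n n k, cM A = (CAlgHom (R := k) (A := k)).mapMatrix A from
    fun _ => rfl, Finset.smul_sum, ← Finset.sum_add_distrib]
  refine Finset.sum_congr rfl fun i _ => Finset.sum_congr rfl fun l _ => ?_
  rw [smul_comm (X - 1 : k[X]), ← smul_add, sub_smul, one_smul, smul_mul_assoc]
  congr 1
  abel

end Lambda

section Duality

variable {k : Type u} [Field k] {m n : Type} [Fintype m] [Fintype n] [DecidableEq m] [DecidableEq n]

lemma exists_trace_repr (f : Matrix m n k →ₗ[k] k) :
    ∃ A : Matrix n m k, ∀ M, f M = trace (A * M) := by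
  refine ⟨Matrix.of fun j i => f (Matrix.single i j 1), fun M => ?_⟩
  conv_lhs => rw [Matrix.matrix_eq_sum_single M]
  simp only [map_sum, trace, diag_apply, Matrix.mul_apply, of_apply]
  rw [Finset.sum_comm]
  refine Finset.sum_congr rfl fun j _ => Finset.sum_congr rfl fun i _ => ?_
  rw [show Matrix.single i j (M i j) = M i j • Matrix.single i j (1 : k) by simp, map_smul,
    smul_eq_mul, mul_comm]

lemma exists_pr_repr (f : (Fin 3 → Matrix m n k) →ₗ[k] k) :
    ∃ A : Fin 3 → Matrix n m k, ∀ o, f o = pr o A := by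
  choose A hA using fun i =>
    exists_trace_repr (f.comp (LinearMap.single k (fun _ : Fin 3 => Matrix m n k) i))
  refine ⟨A, fun o => ?_⟩
  conv_lhs => rw [← Finset.univ_sum_single o]
  simp only [map_sum, pr]
  refine Finset.sum_congr rfl fun i _ => ?_
  rw [Matrix.trace_mul_comm, ← hA]
  rfl

lemma mem_range_of_forall {V W : Type*} [AddCommGroup V] [Module k V] [AddCommGroup W] [Module k W]
    (T : V →ₗ[k] W) (y : W) (h : ∀ f : W →ₗ[k] k, (∀ v, f (T v) = 0) → f y = 0) :
    ∃ v, T v = y := by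
  by_contra hy
  have hy' : y ∉ LinearMap.range T := fun ⟨v, hv⟩ => hy ⟨v, hv⟩
  obtain ⟨f, hf, hle⟩ := Submodule.exists_le_ker_of_notMem hy'
  exact hf (h f fun v => hle ⟨v, rfl⟩)

lemma trace_eq_zero_ext {A : Matrix n m k} (h : ∀ B : Matrix m n k, trace (A * B) = 0) : A = 0 := by
  rw [Matrix.ext_iff_trace_mul_right]
  intro B
  rw [h B]; simp

end Duality

section Lambda

open Polynomial

variable {k : Type u} [Field k] [CharZero k] {n : Type} [Fintype n] [DecidableEq n]
variable {E : Env k} {ζ : k} {x : Fin 3 → Matrix n n k}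

lemma exists_d1_of_orthogonal (w : Fin 3 → Fin 3 → Fin 3 → k) (hw : ∀ i j l, w i j l = w j l i)
    (x o : Fin 3 → Matrix n n k) (h : ∀ u, d1 w x x u = 0 → pr o u = 0) :
    ∃ y, d1 w x x y = o := by
  refine mem_range_of_forall _ _ fun f hf => ?_
  obtain ⟨A, hA⟩ := exists_pr_repr f
  rw [hA]
  refine h A (pr_ext (n := n) (m := n) fun v => ?_)
  rw [pr_d1 hw, pr_comm, ← hA, hf]
  simp [pr]

lemma exists_d2_of_trace (h : IsPt E ζ x) (M : Matrix n n k) (hM : trace M = 0) :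
    ∃ b, d2 x x b = M := by
  refine mem_range_of_forall _ _ fun f hf => ?_
  obtain ⟨A, hA⟩ := exists_trace_repr f
  have h0 : d0 x x A = 0 := pr_ext (n := n) (m := n) fun v => by
    rw [pr_d0, ← hA, hf]; simp [pr]
  obtain ⟨c, rfl⟩ := h.irr A fun i => by
    have := congrFun h0 i
    rwa [d0_apply, Pi.zero_apply, sub_eq_zero] at this
  rw [hA]
  simp [hM]

lemma scalar_of_d0 (h : IsPt E ζ x) (a : Matrix n n k) (ha : ∀ i, d0 x x a i = 0) :
    ∃ c : k, a = c • (1 : Matrix n n k) :=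
  h.irr a fun i => by simpa [d0_apply, sub_eq_zero] using ha i

lemma e1_d0 (P : Matrix n n k[X]) (i : Fin 3) :
    e1 (d0 (lx x) (cx x) P i) = d0 x x (e1 P) i := by
  have := map_d0 (aeval (R := k) (1 : k)) (lx x) (cx x) P i
  change e1 (d0 (lx x) (cx x) P i) = d0 (fun i => e1 (lx x i)) (fun i => e1 (cx x i)) (e1 P) i at this
  rwa [e1_lx, e1_cx] at this

lemma e1_d1 (w : Fin 3 → Fin 3 → Fin 3 → k) (v : Fin 3 → Matrix n n k[X]) (i : Fin 3) :
    e1 (d1 w (lx x) (cx x) v i) = d1 w x x (fun i => e1 (v i)) i := by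
  have := map_d1 w (aeval (R := k) (1 : k)) (lx x) (cx x) v i
  change e1 (d1 w (lx x) (cx x) v i)
    = d1 w (fun i => e1 (lx x i)) (fun i => e1 (cx x i)) (fun i => e1 (v i)) i at this
  rwa [e1_lx, e1_cx] at this

lemma e1_hh2 (v : Fin 3 → Matrix n n k[X]) (i : Fin 3) :
    e1 (E.D.hh2 (lx x) (cx x) v i) = E.D.hh2 x x (fun i => e1 (v i)) i := by
  have := map_evL (aeval (R := k) (1 : k)) (E.D.L2 i) (lx x) (cx x) v
  change e1 (E.D.hh2 (lx x) (cx x) v i)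
    = evL (E.D.L2 i) (fun i => e1 (lx x i)) (fun i => e1 (cx x i)) (fun i => e1 (v i)) at this
  rwa [e1_lx, e1_cx] at this

lemma d0_scalar (β : k) (i : Fin 3) :
    d0 (lx x) (cx x) (cM (β • (1 : Matrix n n k))) i = (X - 1 : k[X]) • cM (β • x i) := by
  rw [d0_apply, lx, cx, smul_mul_assoc, ← cM_mul, ← cM_mul, sub_smul, one_smul]
  simp

/-- The unit polynomial `[N] ζ`. -/
def gz (E : Env k) (ζ : k) : k[X] := gs E.N * C ζ

lemma gz_eval : (gz E ζ).eval 1 = E.N * ζ := by simp [gz, gs_eval]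

lemma gz_ne (h : IsPt E ζ x) : (E.N * ζ : k) ≠ 0 :=
  mul_ne_zero (Nat.cast_ne_zero.2 E.hN) h.hζ

/-- Dividing the first homotopy identity by `λ - 1`. -/
lemma div_hk1 (h : IsPt E ζ x) (u v : Fin 3 → Matrix n n k[X])
    (huv : ∀ i, (X - 1 : k[X]) • v i
      = cz E.z (lx x) (cx x) (u i) - E.D.hh2 (lx x) (cx x) (d1 E.w (lx x) (cx x) u) i) :
    ∃ (β : k) (Q : Matrix n n k[X]), ∀ i, v i = cM (β • x i) + d0 (lx x) (cx x) Q i := by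
  have key := E.D.hk1 (lx x) (cx x) (relAt_lx h) (relAt_cx h) u
  set a := evL E.D.L1 (lx x) (cx x) u with ha
  have key2 : ∀ i, (X - 1 : k[X]) • v i = d0 (lx x) (cx x) a i := fun i => by
    rw [huv, congrFun key i, Pi.add_apply, add_sub_cancel_right]
  obtain ⟨β, hβ⟩ := scalar_of_d0 h (e1 a) fun i => by
    rw [← e1_d0, ← key2, e1_smul]; simp
  obtain ⟨Q, hQ⟩ := exists_expand a
  refine ⟨β, Q, fun i => X_sub_one_cancel ?_⟩
  rw [key2, hQ, hβ, map_add, map_smul, Pi.add_apply, Pi.smul_apply, d0_scalar, smul_add]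

lemma isGauge_of_smul {c : k} (hc : c ≠ 0) {u : Fin 3 → Matrix n n k} (h : IsGauge x (c • u)) :
    IsGauge x u := by
  obtain ⟨β, f, hf⟩ := h
  refine ⟨c⁻¹ * β, c⁻¹ • f, ?_⟩
  rw [map_smul, mul_smul, ← smul_add, ← hf, smul_smul, inv_mul_cancel₀ hc, one_smul]

lemma gauge_of_bar_mem (h : IsPt E ζ x) {u v₀ : Fin 3 → Matrix n n k}
    (hu : d1 E.w x x u = 0) (hbar : bar E.w x u = d1 E.w x x v₀) : IsGauge x u := by
  set u' : Fin 3 → Matrix n n k[X] := (fun i => cM (u i)) - (X - 1 : k[X]) • fun i => cM (v₀ i)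
    with hu'
  have hd : d1 E.w (lx x) (cx x) u'
      = (-((X - 1) * (X - 1)) : k[X]) • fun i => cM (bar E.w x v₀ i) := by
    rw [hu', map_sub, map_smul, d1_lam, d1_lam, hu, hbar]
    ext1 i
    simp only [Pi.sub_apply, Pi.smul_apply, smul_add, smul_smul, neg_smul, Pi.zero_apply]
    rw [show cM (0 : Matrix n n k) = 0 from map_zero _]
    abel
  obtain ⟨β, Q, hQ⟩ := div_hk1 h u' (fun i => gz E ζ • u' i + (X - 1 : k[X]) •
      E.D.hh2 (lx x) (cx x) (fun i => cM (bar E.w x v₀ i)) i) (fun i => by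
    rw [hd, map_smul, cz_lx h, Pi.smul_apply, smul_add, smul_smul (X - 1 : k[X]) (X - 1), neg_smul,
      sub_neg_eq_add]
    rfl)
  refine isGauge_of_smul (gz_ne h) ⟨β, e1 Q, ?_⟩
  ext1 i
  have := congrArg e1 (hQ i)
  rw [map_add, map_add, e1_d0, e1_smul, e1_smul, e1_cM, gz_eval] at this
  simp only [hu', Pi.sub_apply, Pi.smul_apply, map_sub, e1_smul, e1_cM] at this
  simpa using this

lemma exists_d1_of_unobstructed (h : IsPt E ζ x) (o : Fin 3 → Matrix n n k)
    (ho1 : ∑ j, trace (x j * o j) = 0) (ho2 : d2 x x o = 0)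
    (ho3 : ∃ e, E.D.hh2 x x o = d0 x x e) : ∃ y, d1 E.w x x y = o := by
  obtain ⟨e, he⟩ := ho3
  obtain ⟨b, hb⟩ := exists_d2_of_trace h (∑ j, x j * o j) (by rw [trace_sum]; exact ho1)
  set M := ∑ j, x j * o j with hM
  have hM2 : M = ∑ j, o j * x j := by
    rw [d2_apply, Finset.sum_sub_distrib, sub_eq_zero] at ho2
    exact ho2
  set M' := ∑ j, x j * b j with hM'
  have hlam : ∀ c : Fin 3 → Matrix n n k, d2 (lx x) (cx x) (fun i => cM (c i))
      = cM (d2 x x c) + (X - 1 : k[X]) • cM (∑ j, x j * c j) := by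
    intro c
    simp only [d2_apply, lx, cx]
    rw [show ∀ A : Matrix n n k, cM A = (CAlgHom (R := k) (A := k)).mapMatrix A from fun _ => rfl]
    rw [show cM (∑ j, x j * c j) = (CAlgHom (R := k) (A := k)).mapMatrix (∑ j, x j * c j) from rfl]
    simp only [map_sum, map_sub, map_mul, Finset.smul_sum, ← Finset.sum_add_distrib]
    refine Finset.sum_congr rfl fun i _ => ?_
    rw [sub_smul, one_smul, smul_mul_assoc]
    simp only [cM]
    abel
  set b' : Fin 3 → Matrix n n k[X] := gz E ζ • (fun i => cM (b i))
    - evT E.D.L1 (lx x) (cx x) (cM M') with hb'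
  set o' : Fin 3 → Matrix n n k[X] := gz E ζ • (fun i => cM (o i)) - (X - 1 : k[X]) • b' with ho'
  have hcl : d2 (lx x) (cx x) o' = 0 := by
    rw [ho', map_sub, map_smul, map_smul, hb', map_sub, map_smul, hlam, hlam, ho2, hb,
      ← E.D.hk3, cz_lx h]
    rw [show cM (0 : Matrix n n k) = 0 from map_zero _, ← hM, ← hM', zero_add]
    rw [smul_add, show (gs E.N * C ζ : k[X]) = gz E ζ from rfl,
      smul_comm (gz E ζ) (X - 1 : k[X]) (cM M'), add_sub_cancel_right, smul_comm (gz E ζ), sub_self]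
  set y := E.D.hh2T (lx x) (cx x) o' with hy
  have hk2 : ∀ i, cz E.z (lx x) (cx x) (o' i) = d1 E.w (lx x) (cx x) y i := fun i => by
    have := congrFun (E.D.hk2 E.hw (lx x) (cx x) (relAt_lx h) (relAt_cx h) o') i
    rw [hcl, map_zero, zero_add] at this
    exact this
  have hdy : d1 E.w (lx x) (cx x) y = (X - 1 : k[X]) • gz E ζ • o' := by
    ext1 i
    rw [← hk2, cz_lx h]; rfl
  obtain ⟨β, Q, hQ⟩ := div_hk1 h y
    (fun i => gz E ζ • (y i - E.D.hh2 (lx x) (cx x) o' i)) (fun i => by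
      rw [hdy, map_smul, map_smul, cz_lx h, Pi.smul_apply, Pi.smul_apply, ← smul_sub,
        show (gs E.N * C ζ : k[X]) = gz E ζ from rfl, ← smul_sub])
  have he1o : ∀ i, e1 (o' i) = (E.N * ζ : k) • o i := fun i => by
    simp only [ho', Pi.sub_apply, Pi.smul_apply, map_sub, e1_smul, e1_cM, gz_eval]
    simp
  obtain ⟨β', f', hf'⟩ : IsGauge x (fun i => e1 (y i)) := by
    have h1 : ∀ i, (E.N * ζ : k) • e1 (y i)
        = β • x i + d0 x x (e1 Q + (E.N * ζ * (E.N * ζ) : k) • e) i := by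
      intro i
      have := congrArg e1 (hQ i)
      rw [map_add, e1_d0, e1_smul, e1_cM, gz_eval, map_sub, e1_hh2] at this
      rw [show (fun i => e1 (o' i)) = (E.N * ζ : k) • o from funext he1o, map_smul, he] at this
      rw [smul_sub, sub_eq_iff_eq_add] at this
      rw [this, map_add, map_smul, Pi.add_apply, Pi.smul_apply, Pi.smul_apply, smul_smul, add_assoc]
    exact isGauge_of_smul (gz_ne h) ⟨β, _, funext h1⟩
  have hrest : ∀ i, ∃ q : Matrix n n k[X],
      y i = cM (β' • x i) + d0 (lx x) (cx x) (cM f') i + (X - 1 : k[X]) • q := by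
    intro i
    obtain ⟨q, hq⟩ := exists_div (P := y i - (cM (β' • x i) + d0 (lx x) (cx x) (cM f') i)) (by
      rw [map_sub, map_add, e1_d0, e1_cM, e1_cM, congrFun hf' i]
      simp)
    exact ⟨q, by rw [← hq]; abel⟩
  choose q hq using hrest
  have hyq : y = (fun i => cM (β' • x i)) + d0 (lx x) (cx x) (cM f') + (X - 1 : k[X]) • q :=
    funext hq
  have hx0 : d1 E.w (lx x) (cx x) (fun i => cM (β' • x i)) = 0 := by
    rw [d1_lam E.w x (fun i => β' • x i)]
    have h1 : bar E.w x (fun i => β' • x i) = 0 := by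
      ext1 j
      have := h.rel j
      simp only [bar, mul_smul_comm, smul_comm _ β', ← Finset.smul_sum]
      rw [relAt] at this
      rw [this]; simp
    have h2 : d1 E.w x x (fun i => β' • x i) = 0 := by
      ext1 j
      have := h.rel j
      simp only [d1_apply, mul_smul_comm, smul_mul_assoc, smul_add, smul_comm _ β',
        Finset.sum_add_distrib, ← Finset.smul_sum]
      rw [relAt] at this
      rw [this]; simp
    rw [h1, h2]
    ext1 j
    simp [show cM (0 : Matrix n n k) = 0 from map_zero _]
  rw [hyq, map_add, map_add, map_smul, hx0, d1_d0 _ _ _ (relAt_lx h) (relAt_cx h), add_zero,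
    zero_add] at hdy
  have hfin : ∀ i, d1 E.w x x (fun i => e1 (q i)) i = (E.N * ζ * (E.N * ζ) : k) • o i := by
    intro i
    have := X_sub_one_cancel (congrFun hdy i)
    have := congrArg e1 this
    rw [e1_d1] at this
    rw [this, Pi.smul_apply, e1_smul, he1o, gz_eval, smul_smul]
  refine ⟨(E.N * ζ * (E.N * ζ) : k)⁻¹ • fun i => e1 (q i), ?_⟩
  rw [map_smul, funext hfin]
  ext1 i
  rw [Pi.smul_apply, smul_smul, inv_mul_cancel₀ (mul_ne_zero (gz_ne h) (gz_ne h)), one_smul]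

end Lambda

section Even

variable {k : Type u} [Field k] [CharZero k] {n : Type} [Fintype n] [DecidableEq n]
variable {E : Env k} {ζ : k} {x : Fin 3 → Matrix n n k}

/-- The form `Σ tr(ū_j u'_j)`. -/
def om (w : Fin 3 → Fin 3 → Fin 3 → k) (x u u' : Fin 3 → Matrix n n k) : k := pr (bar w x u) u'

lemma bar_add (w : Fin 3 → Fin 3 → Fin 3 → k) (x u u' : Fin 3 → Matrix n n k) :
    bar w x (u + u') = bar w x u + bar w x u' := by
  ext1 j
  simp [bar, mul_add, Finset.sum_add_distrib]

lemma bar_smul (w : Fin 3 → Fin 3 → Fin 3 → k) (c : k) (x u : Fin 3 → Matrix n n k) :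
    bar w x (c • u) = c • bar w x u := by
  ext1 j
  simp only [bar, Pi.smul_apply, mul_smul_comm, smul_comm _ c, ← Finset.smul_sum]

lemma om_add_left (w : Fin 3 → Fin 3 → Fin 3 → k) (x u v u' : Fin 3 → Matrix n n k) :
    om w x (u + v) u' = om w x u u' + om w x v u' := by
  rw [om, bar_add, pr_add_left]; rfl

lemma om_add_right (w : Fin 3 → Fin 3 → Fin 3 → k) (x u v u' : Fin 3 → Matrix n n k) :
    om w x u (v + u') = om w x u v + om w x u u' := pr_add_right _ _ _

lemma om_smul_right (w : Fin 3 → Fin 3 → Fin 3 → k) (c : k) (x u v : Fin 3 → Matrix n n k) :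
    om w x u (c • v) = c * om w x u v := pr_smul_right _ _ _

lemma om_smul_left (w : Fin 3 → Fin 3 → Fin 3 → k) (c : k) (x u v : Fin 3 → Matrix n n k) :
    om w x (c • u) v = c * om w x u v := by
  rw [om, bar_smul, pr_smul_left]; rfl

lemma om_eq (w : Fin 3 → Fin 3 → Fin 3 → k) (x u u' : Fin 3 → Matrix n n k) :
    om w x u u' = ∑ j, ∑ i, ∑ l, w j i l * trace (x i * u l * u' j) := by
  simp only [om, pr, bar, Finset.sum_mul, trace_sum, smul_mul_assoc, trace_smul, smul_eq_mul]

lemma om_self {w : Fin 3 → Fin 3 → Fin 3 → k} (hw : ∀ i j l, w i j l = w j l i)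
    {x u : Fin 3 → Matrix n n k} (hu : d1 w x x u = 0) : om w x u u = 0 := by
  have h : pr (d1 w x x u) u = om w x u u + om w x u u := by
    have : pr (d1 w x x u) u = ∑ j, ∑ i, ∑ l, w j i l * trace (x i * u l * u j)
        + ∑ j, ∑ i, ∑ l, w j i l * trace (u i * x l * u j) := by
      simp only [pr, d1_apply, Finset.sum_mul, trace_sum, smul_mul_assoc, trace_smul, smul_eq_mul,
        add_mul, trace_add, mul_add, Finset.sum_add_distrib]
    rw [this, om_eq]
    refine congrArg₂ (· + ·) rfl ?_
    rw [sum_rot, sum_rot]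
    refine Finset.sum_congr rfl fun j _ => Finset.sum_congr rfl fun i _ =>
      Finset.sum_congr rfl fun l _ => ?_
    rw [hw l j i, ← Matrix.trace_mul_cycle]
  rw [hu] at h
  have h2 : (2 : k) * om w x u u = 0 := by rw [two_mul, ← h]; simp [pr]
  simpa using h2

lemma om_antisymm {w : Fin 3 → Fin 3 → Fin 3 → k} (hw : ∀ i j l, w i j l = w j l i)
    {x u u' : Fin 3 → Matrix n n k} (hu : d1 w x x u = 0) (hu' : d1 w x x u' = 0) :
    om w x u u' = - om w x u' u := by
  have h := om_self hw (u := u + u') (x := x) (by rw [map_add, hu, hu', add_zero])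
  rw [om_add_left, om_add_right, om_add_right, om_self hw hu, om_self hw hu'] at h
  linear_combination h

lemma om_gauge (h : IsPt E ζ x) {u g : Fin 3 → Matrix n n k} (hu : d1 E.w x x u = 0)
    (hg : IsGauge x g) : om E.w x u g = 0 := by
  obtain ⟨c, f, rfl⟩ := hg
  rw [om_add_right, om_smul_right]
  have h1 : om E.w x u x = 0 := by
    have : ∑ l, trace (u l * relAt E.w x l) = 0 := by simp [h.rel]
    rw [om_eq, sum_rot, ← this]
    simp only [relAt, Finset.mul_sum, trace_sum, mul_smul_comm, trace_smul, smul_eq_mul]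
    refine Finset.sum_congr rfl fun j _ => Finset.sum_congr rfl fun i _ =>
      Finset.sum_congr rfl fun l _ => ?_
    rw [E.hw j i l, mul_assoc, Matrix.trace_mul_comm, mul_assoc]
  have h2 : om E.w x u (d0 x x f) = 0 := by
    rw [om, pr_comm, pr_d0]
    have h3 : ∑ j, x j * bar E.w x u j = 0 := by
      have : ∑ l, relAt E.w x l * u l = 0 := by simp [h.rel]
      rw [← this]
      simp only [relAt, bar, Finset.mul_sum, Finset.sum_mul, mul_smul_comm, smul_mul_assoc]
      symm
      rw [sum_rot, sum_rot]
      refine Finset.sum_congr rfl fun j _ => Finset.sum_congr rfl fun i _ =>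
        Finset.sum_congr rfl fun l _ => ?_
      rw [E.hw l j i, mul_assoc]
    have h4 : ∑ j, bar E.w x u j * x j = 0 := by
      have h5 : ∑ j, d1 E.w x x u j * x j = ∑ j, bar E.w x u j * x j
          + ∑ j, u j * relAt E.w x j := by
        simp only [relAt, bar, d1_apply, Finset.mul_sum, Finset.sum_mul, mul_smul_comm,
          smul_mul_assoc, add_mul, smul_add, Finset.sum_add_distrib]
        refine congrArg₂ (· + ·) rfl ?_
        rw [sum_rot, sum_rot]
        refine Finset.sum_congr rfl fun j _ => Finset.sum_congr rfl fun i _ =>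
          Finset.sum_congr rfl fun l _ => ?_
        rw [E.hw l j i, mul_assoc]
      simp only [hu, h.rel, Pi.zero_apply, zero_mul, mul_zero, Finset.sum_const_zero,
        add_zero] at h5
      exact h5.symm
    rw [d2_apply, Finset.sum_sub_distrib, h3, h4]
    simp
  rw [h1, h2]; simp

lemma exists_partner (h : IsPt E ζ x) {u : Fin 3 → Matrix n n k} (hu : d1 E.w x x u = 0)
    (hg : ¬ IsGauge x u) : ∃ u', d1 E.w x x u' = 0 ∧ om E.w x u u' ≠ 0 := by
  by_contra hcon
  push Not at hcon
  obtain ⟨v, hv⟩ := exists_d1_of_orthogonal E.w E.hw x (bar E.w x u) hcon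
  exact hg (gauge_of_bar_mem h hu hv.symm)

end Even

section Pencil

open Module

lemma trace_exact {k W E Q : Type*} [Field k] [AddCommGroup W] [Module k W] [FiniteDimensional k W]
    [AddCommGroup E] [Module k E] [FiniteDimensional k E] [AddCommGroup Q] [Module k Q]
    [FiniteDimensional k Q] (i : W →ₗ[k] E) (p : E →ₗ[k] Q) (fW : W →ₗ[k] W) (f : E →ₗ[k] E)
    (fQ : Q →ₗ[k] Q) (hi : Function.Injective i) (hp : Function.Surjective p)
    (hex : ∀ e, p e = 0 ↔ ∃ w, i w = e) (h1 : ∀ w, f (i w) = i (fW w))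
    (h2 : ∀ e, p (f e) = fQ (p e)) :
    LinearMap.trace k E f = LinearMap.trace k W fW + LinearMap.trace k Q fQ := by
  obtain ⟨s, hs⟩ := p.exists_rightInverse_of_surjective (LinearMap.range_eq_top.2 hp)
  have hs' : ∀ q, p (s q) = q := fun q => LinearMap.congr_fun hs q
  obtain ⟨r, hr⟩ := i.exists_leftInverse_of_injective (LinearMap.ker_eq_bot.2 hi)
  have hr' : ∀ w, r (i w) = w := fun q => LinearMap.congr_fun hr q
  set ρ : E →ₗ[k] W := r ∘ₗ (LinearMap.id - s ∘ₗ p) with hρ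
  have hiρ : ∀ e, i (ρ e) = e - s (p e) := by
    intro e
    obtain ⟨w, hw⟩ := (hex (e - s (p e))).1 (by rw [map_sub, hs', sub_self])
    simp only [hρ, LinearMap.comp_apply, LinearMap.sub_apply, LinearMap.id_apply]
    rw [← hw, hr']
  have hpi : ∀ w, p (i w) = 0 := fun w => (hex _).2 ⟨w, rfl⟩
  have e1 : f = (f ∘ₗ i) ∘ₗ ρ + (f ∘ₗ s) ∘ₗ p := by
    ext e
    simp only [LinearMap.add_apply, LinearMap.comp_apply, hiρ, ← map_add, sub_add_cancel]
  rw [e1, map_add, LinearMap.trace_comp_comm' ρ (f ∘ₗ i), LinearMap.trace_comp_comm' p (f ∘ₗ s)]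
  congr 2
  · ext w
    simp only [LinearMap.comp_apply]
    refine hi ?_
    rw [hiρ, h1, hpi, map_zero, sub_zero]
  · ext q
    simp only [LinearMap.comp_apply, h2, hs']

/-- A pencil of four term complexes with a contraction of the second differential. -/
structure Pen (k C0 C1 C2 C3 : Type*) [Field k] [AddCommGroup C0] [Module k C0] [AddCommGroup C1]
    [Module k C1] [AddCommGroup C2] [Module k C2] [AddCommGroup C3] [Module k C3] where
  A0 : C0 →ₗ[k] C1
  A1 : C1 →ₗ[k] C2
  A2 : C2 →ₗ[k] C3
  B0 : C0 →ₗ[k] C1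
  B1 : C1 →ₗ[k] C2
  B2 : C2 →ₗ[k] C3
  s0 : C1 →ₗ[k] C0
  s1 : C2 →ₗ[k] C1
  s2 : C3 →ₗ[k] C2
  hA1 : ∀ f, A1 (A0 f) = 0
  hA2 : ∀ v, A2 (A1 v) = 0
  hB1 : ∀ f, B1 (B0 f) = 0
  hB2 : ∀ v, B2 (B1 v) = 0
  hAB1 : ∀ f, B1 (A0 f) = - A1 (B0 f)
  hAB2 : ∀ v, B2 (A1 v) = - A2 (B1 v)
  hs0 : ∀ f, s0 (B0 f) = f
  hs1 : ∀ v, B0 (s0 v) + s1 (B1 v) = v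
  hs2 : ∀ o, B1 (s1 o) + s2 (B2 o) = o
  hs3 : ∀ M, B2 (s2 M) = M
  exA0 : ∀ f, A0 f = 0 → f = 0
  exA1 : ∀ v, A1 v = 0 → ∃ f, A0 f = v

namespace Pen

variable {k C0 C1 C2 C3 : Type*} [Field k] [AddCommGroup C0] [Module k C0]
  [AddCommGroup C1] [Module k C1]
  [AddCommGroup C2] [Module k C2] [AddCommGroup C3] [Module k C3]
  (P : Pen k C0 C1 C2 C3)

/-- Zeroth cohomology. -/
def H0 : Submodule k C0 := LinearMap.ker (P.A1 ∘ₗ P.B0)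
/-- Cocycles. -/
def Z1 : Submodule k C1 := LinearMap.ker (P.A2 ∘ₗ P.B1)
/-- The map with image the coboundaries. -/
def r : C0 × C0 →ₗ[k] C1 := P.A0.coprod P.B0
/-- Coboundaries. -/
def R1 : Submodule k C1 := LinearMap.range P.r
/-- Top coboundaries. -/
def I3 : Submodule k C3 := LinearMap.range (P.A2 ∘ₗ P.B1)

lemma mem_H0 {f : C0} : f ∈ P.H0 ↔ P.A1 (P.B0 f) = 0 := Iff.rfl
lemma mem_Z1 {v : C1} : v ∈ P.Z1 ↔ P.A2 (P.B1 v) = 0 := Iff.rfl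
lemma mem_R1 {v : C1} : v ∈ P.R1 ↔ ∃ f g, P.A0 f + P.B0 g = v :=
  ⟨fun ⟨p, hp⟩ => ⟨p.1, p.2, hp⟩, fun ⟨f, g, h⟩ => ⟨(f, g), h⟩⟩

/-- The operator in degree zero. -/
def p0 : C0 →ₗ[k] C0 := P.s0 ∘ₗ P.A0
/-- The operator in degree one. -/
def p1 : C1 →ₗ[k] C1 := P.s1 ∘ₗ P.A1
/-- The operator in degree three. -/
def p3 : C3 →ₗ[k] C3 := P.A2 ∘ₗ P.s2

lemma B0_p0 {f : C0} (hf : f ∈ P.H0) : P.B0 (P.p0 f) = P.A0 f := by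
  have := P.hs1 (P.A0 f)
  rw [P.hAB1, P.mem_H0.1 hf, neg_zero, map_zero, add_zero] at this
  exact this

lemma p0_mem {f : C0} (hf : f ∈ P.H0) : P.p0 f ∈ P.H0 := by
  rw [mem_H0, P.B0_p0 hf, P.hA1]

lemma B1_p1 {v : C1} (hv : v ∈ P.Z1) : P.B1 (P.p1 v) = P.A1 v := by
  have := P.hs2 (P.A1 v)
  rw [P.hAB2, P.mem_Z1.1 hv, neg_zero, map_zero, add_zero] at this
  exact this

lemma p1_mem {v : C1} (hv : v ∈ P.Z1) : P.p1 v ∈ P.Z1 := by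
  rw [mem_Z1, P.B1_p1 hv, P.hA2]

lemma p1_r (f g : C0) : P.p1 (P.A0 f + P.B0 g) = P.A0 (-g) + P.B0 (P.p0 g) := by
  have := P.hs1 (P.A0 g)
  rw [P.hAB1] at this
  simp only [p1, p0, map_add, LinearMap.comp_apply, P.hA1, map_zero, zero_add, map_neg] at this ⊢
  linear_combination (norm := module) (-1 : k) • this

lemma p1_R1 {v : C1} (hv : v ∈ P.R1) : P.p1 v ∈ P.R1 := by
  obtain ⟨f, g, rfl⟩ := P.mem_R1.1 hv
  exact P.mem_R1.2 ⟨_, _, (P.p1_r f g).symm⟩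

lemma R1_le : P.R1 ≤ P.Z1 := by
  intro v hv
  obtain ⟨f, g, rfl⟩ := P.mem_R1.1 hv
  rw [mem_Z1, map_add, P.hB1, P.hAB1, add_zero, map_neg, P.hA2, neg_zero]

lemma p3_I (v : C1) : P.A2 (P.B1 (P.p1 v)) = P.p3 (P.A2 (P.B1 v)) := by
  have := congrArg P.A2 (P.hs2 (P.A1 v))
  rw [P.hAB2, map_add, P.hA2, map_neg, map_neg] at this
  simp only [p1, p3, LinearMap.comp_apply]
  exact eq_of_sub_eq_zero (by rw [sub_eq_add_neg, this])

lemma ker_r {f g : C0} : P.A0 f + P.B0 g = 0 ↔ f ∈ P.H0 ∧ g = - P.p0 f := by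
  constructor
  · intro h
    have hf : f ∈ P.H0 := by
      have := congrArg P.B1 h
      rw [map_add, P.hB1, P.hAB1, map_zero, add_zero] at this
      exact neg_eq_zero.1 this
    refine ⟨hf, ?_⟩
    have := congrArg P.s0 h
    rw [map_add, P.hs0, map_zero] at this
    exact eq_neg_of_add_eq_zero_right this
  · rintro ⟨hf, rfl⟩
    rw [map_neg, P.B0_p0 hf, add_neg_cancel]

/-- The first cohomology. -/
abbrev H1 : Type _ := P.Z1 ⧸ P.R1.submoduleOf P.Z1

/-- The operator on the first cohomology. -/
def h1 : P.H1 →ₗ[k] P.H1 :=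
  Submodule.mapQ _ _ (P.p1.restrict fun _ h => P.p1_mem h) fun _ h => P.p1_R1 h

/-- The operator on the zeroth cohomology. -/
def h0 : P.H0 →ₗ[k] P.H0 := P.p0.restrict fun _ h => P.p0_mem h

lemma p3_mem {M : C3} (h : M ∈ P.I3) : P.p3 M ∈ P.I3 := by
  obtain ⟨v, rfl⟩ := h
  exact ⟨P.p1 v, P.p3_I v⟩

/-- The operator on the top cohomology. -/
def h2 : (C3 ⧸ P.I3) →ₗ[k] (C3 ⧸ P.I3) := Submodule.mapQ _ _ P.p3 fun _ h => P.p3_mem h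

section FD

variable [FiniteDimensional k C0] [FiniteDimensional k C1] [FiniteDimensional k C3]

lemma finrank_H1 (h : finrank k C1 = 2 * finrank k C0 + finrank k C3) :
    finrank k P.H1 = finrank k P.H0 + finrank k (C3 ⧸ P.I3) := by
  have e1 := P.r.finrank_range_add_finrank_ker
  have e2 := (P.A2 ∘ₗ P.B1).finrank_range_add_finrank_ker
  have e3 := P.I3.finrank_quotient_add_finrank
  have e4 := (P.R1.submoduleOf P.Z1).finrank_quotient_add_finrank
  have e5 : finrank k (P.R1.submoduleOf P.Z1) = finrank k P.R1 :=
    (Submodule.submoduleOfEquivOfLe P.R1_le).finrank_eq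
  have e6 : finrank k (LinearMap.ker P.r) = finrank k P.H0 := by
    have inj : Function.Injective ((LinearMap.fst k C0 C0) ∘ₗ (LinearMap.ker P.r).subtype) := by
      rw [← LinearMap.ker_eq_bot, LinearMap.ker_eq_bot']
      rintro ⟨⟨f, g⟩, hm⟩ h0
      have h1 := (P.ker_r (f := f) (g := g)).1 hm
      have h0' : f = 0 := h0
      ext
      · exact h0'
      · simp [h1.2, h0']
    rw [← LinearMap.finrank_range_of_inj inj]
    have : LinearMap.range ((LinearMap.fst k C0 C0) ∘ₗ (LinearMap.ker P.r).subtype) = P.H0 := by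
      ext f
      constructor
      · rintro ⟨⟨⟨f, g⟩, hm⟩, rfl⟩
        exact ((P.ker_r (f := f) (g := g)).1 hm).1
      · intro hf
        exact ⟨⟨(f, - P.p0 f), P.ker_r.2 ⟨hf, rfl⟩⟩, rfl⟩
    rw [this]
  rw [finrank_prod] at e1
  change finrank k P.R1 + _ = _ at e1
  change finrank k P.I3 + finrank k P.Z1 = _ at e2
  change finrank k P.H1 + _ = _ at e4
  omega

lemma lefschetz : LinearMap.trace k C0 P.p0 - LinearMap.trace k C1 P.p1 + LinearMap.trace k C3 P.p3
    = LinearMap.trace k _ P.h0 - LinearMap.trace k _ P.h1 + LinearMap.trace k _ P.h2 := by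
  have e3 := trace_exact P.I3.subtype P.I3.mkQ (P.p3.restrict fun _ h => P.p3_mem h) P.p3 P.h2
    Subtype.val_injective (Submodule.mkQ_surjective _) (fun e => by simp) (fun _ => rfl)
    (fun _ => rfl)
  have hI : FiniteDimensional k P.I3 := inferInstanceAs (FiniteDimensional k P.I3)
  have e1 := trace_exact P.Z1.subtype ((P.A2 ∘ₗ P.B1).codRestrict P.I3 fun v => ⟨v, rfl⟩)
    (P.p1.restrict fun _ h => P.p1_mem h) P.p1 (P.p3.restrict (p := P.I3) fun _ h => P.p3_mem h)
    Subtype.val_injective (by rintro ⟨_, v, rfl⟩; exact ⟨v, rfl⟩)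
    (fun e => by
      rw [← Subtype.coe_inj]
      exact ⟨fun h => ⟨⟨e, h⟩, rfl⟩, fun ⟨w, hw⟩ => hw ▸ w.2⟩) (fun _ => rfl)
    (fun v => Subtype.ext (P.p3_I v))
  have e4 := trace_exact (P.R1.submoduleOf P.Z1).subtype (P.R1.submoduleOf P.Z1).mkQ
    ((P.p1.restrict (p := P.Z1) fun _ h => P.p1_mem h).restrict
      (p := P.R1.submoduleOf P.Z1) fun _ h => P.p1_R1 h)
    (P.p1.restrict fun _ h => P.p1_mem h) P.h1
    Subtype.val_injective (Submodule.mkQ_surjective _) (fun e => by simp) (fun _ => rfl)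
    (fun _ => rfl)
  set ρ : C0 × C0 →ₗ[k] C0 × C0 := ((-LinearMap.snd k C0 C0).prod (P.p0 ∘ₗ LinearMap.snd k C0 C0))
    with hρ
  have hr : ∀ p, P.r p ∈ P.Z1 := fun p => P.R1_le ⟨p, rfl⟩
  have e5 := trace_exact (W := P.H0) (E := C0 × C0) (Q := P.R1.submoduleOf P.Z1)
    (P.H0.subtype.prod (-(P.p0 ∘ₗ P.H0.subtype)))
    ((P.r.codRestrict P.Z1 hr).codRestrict (P.R1.submoduleOf P.Z1) fun p => ⟨p, rfl⟩)
    P.h0 ρ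
    ((P.p1.restrict (p := P.Z1) fun _ h => P.p1_mem h).restrict
      (p := P.R1.submoduleOf P.Z1) fun _ h => P.p1_R1 h)
    (fun a b h => Subtype.ext (congrArg Prod.fst h))
    (by
      rintro ⟨⟨v, hv⟩, p, hp⟩
      exact ⟨p, Subtype.ext (Subtype.ext hp)⟩)
    (by
      rintro ⟨f, g⟩
      rw [← Subtype.coe_inj, ← Subtype.coe_inj]
      refine (P.ker_r (f := f) (g := g)).trans ⟨fun h => ⟨⟨f, h.1⟩, ?_⟩, ?_⟩
      · exact Prod.ext rfl h.2.symm
      · rintro ⟨w, hw⟩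
        have h1 : w.1 = f := congrArg Prod.fst hw
        have h2 : - P.p0 w.1 = g := congrArg Prod.snd hw
        rw [← h2, h1]
        exact ⟨h1 ▸ w.2, rfl⟩)
    (by
      intro w
      refine Prod.ext ?_ ?_
      · simp [hρ, h0]
      · simp [hρ, h0])
    (by
      rintro ⟨f, g⟩
      refine Subtype.ext (Subtype.ext ?_)
      exact (P.p1_r f g).symm)
  have e6 : LinearMap.trace k (C0 × C0) ρ = LinearMap.trace k C0 P.p0 := by
    rw [trace_exact (LinearMap.inl k C0 C0) (LinearMap.snd k C0 C0) 0 ρ P.p0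
      LinearMap.inl_injective LinearMap.snd_surjective (by
        rintro ⟨f, g⟩
        exact ⟨fun h => ⟨f, Prod.ext rfl h.symm⟩, fun ⟨w, hw⟩ => (congrArg Prod.snd hw).symm⟩)
      (fun w => by simp [hρ]) (fun w => by simp [hρ]), map_zero, zero_add]
  rw [e1, e3, e4, ← e6, e5]
  ring

/-- Vanishing of the cohomology gives exactness of the member at `1`. -/
lemma exact_of_trivial (h : finrank k C1 = 2 * finrank k C0 + finrank k C3) (h0 : P.H0 = ⊥)
    (h3 : P.I3 = ⊤) {v : C1} (hv : P.A1 v = - P.B1 v) : ∃ f, P.A0 f + P.B0 f = v := by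
  have h1 := P.finrank_H1 h
  have hq : finrank k (C3 ⧸ P.I3) = 0 := by
    rw [h3]; exact finrank_zero_of_subsingleton
  rw [h0, finrank_bot, hq] at h1
  have hvZ : v ∈ P.Z1 := by
    rw [mem_Z1, ← neg_neg (P.B1 v), ← hv, map_neg, P.hA2, neg_zero]
  have : Subsingleton P.H1 := finrank_zero_iff.1 h1
  have h2 : (P.R1.submoduleOf P.Z1).mkQ ⟨v, hvZ⟩ = 0 := Subsingleton.elim _ _
  rw [Submodule.mkQ_apply, Submodule.Quotient.mk_eq_zero] at h2
  obtain ⟨f, g, hfg⟩ := P.mem_R1.1 (show v ∈ P.R1 from h2)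
  have h4 : g - f ∈ P.H0 := by
    rw [← hfg, map_add, map_add, P.hA1, P.hB1, P.hAB1, zero_add, add_zero, neg_neg] at hv
    rw [mem_H0, map_sub, map_sub, hv, sub_self]
  rw [h0, Submodule.mem_bot, sub_eq_zero] at h4
  exact ⟨f, by rw [← hfg, h4]⟩

end FD

/-- A class which is an eigenvector comes from a cocycle of a member of the pencil. -/
lemma exists_cocycle {ψ : k} {v : C1} (hv : v ∈ P.Z1) (hnv : v ∉ P.R1)
    (he : P.p1 v - ψ • v ∈ P.R1) : ψ ≠ 0 ∧ ∃ v', v' ∉ P.R1 ∧ v' ∈ P.Z1 ∧ P.A1 v' = ψ • P.B1 v' := by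
  obtain ⟨f, g, hfg⟩ := P.mem_R1.1 he
  have h1 : P.A1 (v + P.B0 f) = ψ • P.B1 (v + P.B0 f) := by
    have := P.B1_p1 hv
    rw [← sub_add_cancel (P.p1 v) (ψ • v), ← hfg, map_add, map_add, P.hB1, P.hAB1, map_smul] at this
    rw [map_add, ← this, map_add, P.hB1]
    simp
  have h3 : v + P.B0 f ∉ P.R1 := fun h => hnv (by
    have := P.R1.sub_mem h (P.mem_R1.2 ⟨0, f, show _ = P.B0 f by simp⟩)
    simpa using this)
  refine ⟨?_, v + P.B0 f, h3, P.Z1.add_mem hv (P.R1_le (P.mem_R1.2 ⟨0, f, show _ = P.B0 f by simp⟩)), h1⟩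
  rintro rfl
  rw [zero_smul] at h1
  obtain ⟨f', hf'⟩ := P.exA1 _ h1
  exact h3 (P.mem_R1.2 ⟨f', 0, by simp [hf']⟩)

end Pen

end Pencil

section PencilMatrix

open Module

variable {k : Type u} [Field k] {m n : Type} [Fintype m] [DecidableEq m] [Fintype n] [DecidableEq n]

lemma d2_d1 {w : Fin 3 → Fin 3 → Fin 3 → k} (hw : ∀ i j l, w i j l = w j l i)
    (X' : Fin 3 → Matrix m m k) (X : Fin 3 → Matrix n n k)
    (hX' : ∀ j, relAt w X' j = 0) (hX : ∀ j, relAt w X j = 0) (v : Fin 3 → Matrix m n k) :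
    d2 X' X (d1 w X' X v) = 0 := by
  rw [Matrix.ext_iff_trace_mul_left]
  intro f
  have h := pr_d0 X X' f (d1 w X' X v)
  rw [pr_comm, pr_d1 hw, d1_d0 w X X' hX hX'] at h
  rw [Matrix.mul_zero, trace_zero, ← neg_eq_zero, ← h]
  simp [pr]

lemma relAt_zero (w : Fin 3 → Fin 3 → Fin 3 → k) (j : Fin 3) :
    relAt w (0 : Fin 3 → Matrix m m k) j = 0 := by
  simp [relAt]

lemma Env.ev_zero (E : Env k) : ev (0 : Fin 3 → Matrix m m k) E.z = 0 := by
  have h := E.hz.lift_smul (0 : k) (0 : Fin 3 → Matrix m m k)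
  rw [zero_pow E.hN, zero_smul] at h
  have h2 : (fun i => (0 : k) • (0 : Fin 3 → Matrix m m k) i) = 0 := by ext1 i; simp
  rwa [h2] at h

variable {E : Env k} {ζ ζ' : k} {x : Fin 3 → Matrix n n k} {x' : Fin 3 → Matrix m m k}

lemma IsPt.cz_right (h : IsPt E ζ x) (f : Matrix m n k) : cz E.z 0 x f = (-ζ) • f := by
  rw [cz, E.ev_zero, h.cen]; simp

lemma IsPt.cz_left (h : IsPt E ζ x) (f : Matrix n m k) : cz E.z x 0 f = ζ • f := by
  rw [cz, E.ev_zero, h.cen]; simp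

/-- The pencil of complexes attached to two points. -/
def pen (h : IsPt E ζ x) (h' : IsPt E ζ' x') :
    Pen k (Matrix m n k) (Fin 3 → Matrix m n k) (Fin 3 → Matrix m n k) (Matrix m n k) where
  A0 := d0 x' 0
  A1 := d1 E.w x' 0
  A2 := d2 x' 0
  B0 := d0 0 x
  B1 := d1 E.w 0 x
  B2 := d2 0 x
  s0 := (-ζ⁻¹) • evL E.D.L1 0 x
  s1 := (-ζ⁻¹) • E.D.hh2 0 x
  s2 := (LinearMap.id - d1 E.w 0 x ∘ₗ ((-ζ⁻¹) • E.D.hh2 0 x)) ∘ₗ ((-ζ⁻¹) • evT E.D.L1 0 x)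
  hA1 f := d1_d0 E.w x' 0 h'.rel (relAt_zero E.w) f
  hA2 v := d2_d1 E.hw x' 0 h'.rel (relAt_zero E.w) v
  hB1 f := d1_d0 E.w 0 x (relAt_zero E.w) h.rel f
  hB2 v := d2_d1 E.hw 0 x (relAt_zero E.w) h.rel v
  hAB1 f := by
    ext1 j
    simp [d1_apply, d0_apply, Matrix.mul_assoc]
  hAB2 v := by
    simp only [d1_apply, d2_apply, Pi.zero_apply, Matrix.zero_mul, Matrix.mul_zero, zero_add,
      add_zero, sub_zero, smul_zero, Finset.sum_const_zero, zero_sub, Finset.sum_neg_distrib,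
      Matrix.sum_mul, Matrix.mul_sum, Matrix.smul_mul, Matrix.mul_smul]
    rw [neg_inj]
    conv_rhs => rw [sum_rot]
    refine Finset.sum_congr rfl fun j _ => Finset.sum_congr rfl fun i _ =>
      Finset.sum_congr rfl fun l _ => ?_
    rw [E.hw j, Matrix.mul_assoc]
  hs0 f := by
    have := E.D.hk0 0 x f
    rw [h.cz_right] at this
    rw [LinearMap.smul_apply, ← this, smul_smul, neg_mul_neg, inv_mul_cancel₀ h.hζ, one_smul]
  hs1 v := by
    have := E.D.hk1 0 x (relAt_zero E.w) h.rel v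
    simp only [h.cz_right] at this
    rw [LinearMap.smul_apply, map_smul, LinearMap.smul_apply, ← smul_add, ← this]
    ext1 i
    rw [Pi.smul_apply, smul_smul, neg_mul_neg, inv_mul_cancel₀ h.hζ, one_smul]
  hs2 o := by
    have key : ∀ p : Fin 3 → Matrix m n k, d2 0 x p = 0 →
        d1 E.w 0 x (((-ζ⁻¹) • E.D.hh2 0 x) p) = p := by
      intro p hp
      have h2 := E.D.hk2 E.hw 0 x (relAt_zero E.w) h.rel p
      have h1 := E.D.hk1 0 x (relAt_zero E.w) h.rel (E.D.hh2T 0 x p)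
      simp only [h.cz_right] at h1 h2
      rw [hp, map_zero, zero_add] at h2
      have h3 := congrArg (d1 E.w 0 x) h1
      rw [map_add, d1_d0 E.w 0 x (relAt_zero E.w) h.rel, zero_add, ← h2] at h3
      have h4 : (fun i => (-ζ) • p i) = (-ζ) • p := rfl
      have h5 : (fun i => (-ζ) • (E.D.hh2T 0 x p) i) = (-ζ) • (E.D.hh2T 0 x p) := rfl
      rw [h5, map_smul, ← h2, h4, map_smul, map_smul] at h3
      have h6 := smul_right_injective _ (neg_ne_zero.2 h.hζ) h3
      rw [LinearMap.smul_apply, map_smul, ← h6, smul_smul, neg_mul_neg, inv_mul_cancel₀ h.hζ,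
        one_smul]
    have e3 : d2 0 x (((-ζ⁻¹) • evT E.D.L1 0 x) (d2 0 x o)) = d2 0 x o := by
      have := E.D.hk3 0 x (d2 0 x o)
      rw [h.cz_right] at this
      rw [LinearMap.smul_apply, map_smul, ← this, smul_smul, neg_mul_neg, inv_mul_cancel₀ h.hζ,
        one_smul]
    have := key (o - ((-ζ⁻¹) • evT E.D.L1 0 x) (d2 0 x o)) (by rw [map_sub, e3, sub_self])
    rw [map_sub, map_sub] at this
    rw [LinearMap.comp_apply, LinearMap.sub_apply, LinearMap.id_apply, LinearMap.comp_apply]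
    linear_combination (norm := module) (1 : k) • this
  hs3 M := by
    rw [LinearMap.comp_apply, LinearMap.sub_apply, LinearMap.id_apply, LinearMap.comp_apply,
      map_sub, d2_d1 E.hw 0 x (relAt_zero E.w) h.rel, sub_zero]
    have := E.D.hk3 0 x M
    rw [h.cz_right] at this
    rw [LinearMap.smul_apply, map_smul, ← this, smul_smul, neg_mul_neg, inv_mul_cancel₀ h.hζ,
      one_smul]
  exA0 f hf := by
    have := E.D.hk0 x' 0 f
    rw [h'.cz_left, hf, map_zero] at this
    exact (smul_eq_zero.1 this).resolve_left h'.hζ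
  exA1 v hv := by
    have := E.D.hk1 x' 0 h'.rel (relAt_zero E.w) v
    simp only [h'.cz_left] at this
    rw [hv, map_zero, add_zero] at this
    refine ⟨ζ'⁻¹ • evL E.D.L1 x' 0 v, ?_⟩
    rw [map_smul, ← this]
    ext1 i
    rw [Pi.smul_apply, smul_smul, inv_mul_cancel₀ h'.hζ, one_smul]

lemma ev_zero_eq (p : FreeAlgebra k (Fin 3)) :
    ev (0 : Fin 3 → Matrix m m k) p = FreeAlgebra.lift k (0 : Fin 3 → k) p • (1 : Matrix m m k) := by
  induction p using FreeAlgebra.induction with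
  | grade0 r => simp [Algebra.algebraMap_eq_smul_one]
  | grade1 i => simp
  | mul a b ha hb => rw [map_mul, map_mul, ha, hb, Matrix.smul_mul, Matrix.one_mul, smul_smul]
  | add a b ha hb => rw [map_add, map_add, ha, hb, add_smul]

/-- The matrices of the right multiplication operator `evL L 0 x`. -/
def rmat (L : Sand k) (x : Fin 3 → Matrix n n k) (i : Fin 3) : Matrix n n k :=
  (L.map fun t => if t.2.1 = i then FreeAlgebra.lift k (0 : Fin 3 → k) t.1 • ev x t.2.2 else 0).sum

/-- The matrices of the right multiplication operator `evT L 0 x`. -/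
def rmatT (L : Sand k) (x : Fin 3 → Matrix n n k) (i : Fin 3) : Matrix n n k :=
  (L.map fun t => if t.2.1 = i then FreeAlgebra.lift k (0 : Fin 3 → k) t.2.2 • ev x t.1 else 0).sum

lemma evL_zero (L : Sand k) (x : Fin 3 → Matrix n n k) (v : Fin 3 → Matrix m n k) :
    evL L 0 x v = ∑ i, v i * rmat L x i := by
  rw [evL_apply]
  induction L with
  | nil => simp [rmat]
  | cons t L ih =>
    have : ∀ i, rmat (t :: L) x i = (if t.2.1 = i then
      FreeAlgebra.lift k (0 : Fin 3 → k) t.1 • ev x t.2.2 else 0) + rmat L x i := fun i => rfl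
    simp only [List.map_cons, List.sum_cons, ih, this, Matrix.mul_add, Finset.sum_add_distrib]
    refine congrArg₂ (· + ·) ?_ rfl
    rw [Finset.sum_eq_single t.2.1]
    · simp [ev_zero_eq]
    · intro i _ hi
      rw [if_neg (Ne.symm hi), Matrix.mul_zero]
    · simp

lemma evT_zero (L : Sand k) (x : Fin 3 → Matrix n n k) (M : Matrix m n k) (i : Fin 3) :
    evT L 0 x M i = M * rmatT L x i := by
  rw [evT_apply]
  induction L with
  | nil => simp [rmatT]
  | cons t L ih =>
    have : rmatT (t :: L) x i = (if t.2.1 = i then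
      FreeAlgebra.lift k (0 : Fin 3 → k) t.2.2 • ev x t.1 else 0) + rmatT L x i := rfl
    simp only [List.map_cons, List.sum_cons, ih, this, Matrix.mul_add]
    congr 1
    split_ifs <;> simp [ev_zero_eq]

lemma trace_mul_mul (A : Matrix m m k) (B : Matrix n n k) (T : Matrix m n k →ₗ[k] Matrix m n k)
    (hT : ∀ M, T M = A * M * B) : LinearMap.trace k _ T = trace A * trace B := by
  rw [LinearMap.trace_eq_matrix_trace k (Matrix.stdBasis k m n)]
  simp only [Matrix.trace, Matrix.diag_apply, LinearMap.toMatrix_apply, Matrix.stdBasis_eq_single,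
    hT, Fintype.sum_prod_type, Finset.sum_mul_sum]
  refine Finset.sum_congr rfl fun i _ => Finset.sum_congr rfl fun j _ => ?_
  have : ∀ N : Matrix m n k, (Matrix.stdBasis k m n).repr N (i, j) = N i j := by
    intro N
    conv_lhs => rw [Matrix.matrix_eq_sum_single N]
    simp only [map_sum]
    simp only [Finsupp.coe_finsetSum, Finset.sum_apply]
    have : ∀ a b, (Matrix.stdBasis k m n).repr (Matrix.single a b (N a b)) (i, j)
        = if a = i ∧ b = j then N a b else 0 := by
      intro a b
      have : Matrix.single a b (N a b) = N a b • Matrix.stdBasis k m n (a, b) := by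
        rw [Matrix.stdBasis_eq_single, Matrix.smul_single, smul_eq_mul, mul_one]
      rw [this, map_smul, Basis.repr_self]
      simp [Finsupp.single_apply, Prod.ext_iff]
    simp only [this]
    rw [Finset.sum_eq_single i, Finset.sum_eq_single j]
    · simp
    · intro b _ hb; simp [hb]
    · simp
    · intro b _ hb; simp [hb]
    · simp
  rw [this]
  simp [Matrix.mul_apply, Matrix.single_apply, ite_and]

lemma trace_pi_comp {W : Type*} [AddCommGroup W] [Module k W] [FiniteDimensional k W]
    (T : (Fin 3 → W) →ₗ[k] (Fin 3 → W)) :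
    LinearMap.trace k _ T
      = ∑ j, LinearMap.trace k W (LinearMap.proj j ∘ₗ T ∘ₗ LinearMap.single k (fun _ => W) j) := by
  have : T = ∑ j, (LinearMap.single k (fun _ => W) j) ∘ₗ (LinearMap.proj j ∘ₗ T) := by
    ext1 i
    ext v l
    simp [Pi.single_apply]
  conv_lhs => rw [this, map_sum]
  refine Finset.sum_congr rfl fun j _ => ?_
  rw [LinearMap.trace_comp_comm']
  rfl

end PencilMatrix

section PencilApply

open Module

variable {k : Type u} [Field k] {m n : Type} [Fintype m] [DecidableEq m] [Fintype n] [DecidableEq n]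
variable {E : Env k} {ζ ζ' : k} {x : Fin 3 → Matrix n n k} {x' : Fin 3 → Matrix m m k}

lemma ev_smul_surj {l : k} (hl : l ≠ 0) (h : Function.Surjective (ev (k := k) x)) :
    Function.Surjective (ev (k := k) (l • x)) := by
  intro M
  obtain ⟨p, rfl⟩ := h M
  refine ⟨FreeAlgebra.lift k (fun i => l⁻¹ • FreeAlgebra.ι k i) p, ?_⟩
  have : (ev (k := k) (l • x)).comp (FreeAlgebra.lift k fun i => l⁻¹ • FreeAlgebra.ι k i)
      = ev x := by
    ext i : 2
    simp [smul_smul, hl]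
  exact congrArg (fun f => f p) this

lemma IsPt.smul (h : IsPt E ζ x) {l : k} (hl : l ≠ 0) : IsPt E (l ^ E.N * ζ) (l • x) where
  rel j := by
    have := relAt_smul E.w l x j
    rw [h.rel, smul_zero] at this
    exact this
  surj := ev_smul_surj hl h.surj
  cen := by
    have := E.hz.lift_smul l x
    rw [h.cen] at this
    rw [← smul_smul]
    exact this
  hζ := mul_ne_zero (pow_ne_zero _ hl) h.hζ

lemma ev_intertwine {f : Matrix m n k} (hf : ∀ i, x' i * f = f * x i) (p : FreeAlgebra k (Fin 3)) :
    ev x' p * f = f * ev x p := by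
  induction p using FreeAlgebra.induction with
  | grade0 r => simp [Algebra.algebraMap_eq_smul_one]
  | grade1 i => simpa using hf i
  | mul a b ha hb => rw [map_mul, map_mul, Matrix.mul_assoc, hb, ← Matrix.mul_assoc, ha,
      Matrix.mul_assoc]
  | add a b ha hb => rw [map_add, map_add, Matrix.add_mul, Matrix.mul_add, ha, hb]

/-- Schur's lemma. -/
lemma schur (h : Function.Surjective (ev (k := k) x)) (h' : Function.Surjective (ev (k := k) x'))
    {f : Matrix m n k} (hf0 : f ≠ 0)
    (hf : ∀ i, x' i * f = f * x i) : ∃ g : Matrix n m k, f * g = 1 ∧ g * f = 1 := by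
  obtain ⟨i₀, j₀, hij⟩ : ∃ i j, f i j ≠ 0 := by
    by_contra hc
    push Not at hc
    exact hf0 (Matrix.ext hc)
  have hr : ∃ g : Matrix n m k, f * g = 1 := by
    choose p hp using fun i => h' (Matrix.single i i₀ ((f i₀ j₀)⁻¹))
    refine ⟨Matrix.of fun j i => ev x (p i) j j₀, ?_⟩
    ext a b
    have e := congrArg (fun M => M a j₀) (ev_intertwine hf (p b))
    simp only [hp, Matrix.mul_apply] at e
    simp only [Matrix.mul_apply, Matrix.of_apply]
    rw [← e, Finset.sum_eq_single i₀]
    · by_cases hab : a = b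
      · subst hab; simp [hij]
      · rw [Matrix.single_apply_of_ne _ _ _ _ _ (by tauto), Matrix.one_apply_ne hab, zero_mul]
    · intro c _ hc
      rw [Matrix.single_apply_of_ne _ _ _ _ _ (by tauto), zero_mul]
    · simp
  have hl : ∃ g : Matrix n m k, g * f = 1 := by
    choose p hp using fun j => h (Matrix.single j₀ j ((f i₀ j₀)⁻¹))
    refine ⟨Matrix.of fun j i => ev x' (p j) i₀ i, ?_⟩
    ext a b
    have e := congrArg (fun M => M i₀ b) (ev_intertwine hf (p a))
    simp only [hp, Matrix.mul_apply] at e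
    simp only [Matrix.mul_apply, Matrix.of_apply]
    rw [e, Finset.sum_eq_single j₀]
    · by_cases hab : a = b
      · subst hab; simp [hij]
      · rw [Matrix.single_apply_of_ne _ _ _ _ _ (by tauto), Matrix.one_apply_ne hab, mul_zero]
    · intro c _ hc
      rw [Matrix.single_apply_of_ne _ _ _ _ _ (by tauto), mul_zero]
    · simp
  obtain ⟨g, hg⟩ := hr
  obtain ⟨g', hg'⟩ := hl
  have : g' = g := by
    rw [← Matrix.mul_one g', ← hg, ← Matrix.mul_assoc, hg', Matrix.one_mul]
  exact ⟨g, hg, this ▸ hg'⟩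

/-- The second solution is equivalent to a rescaling of the first one. -/
def Twist (x : Fin 3 → Matrix n n k) (x' : Fin 3 → Matrix m m k) : Prop :=
  ∃ (ψ : k) (f : Matrix m n k), ψ ≠ 0 ∧ f ≠ 0 ∧ ∀ i, x' i * f = ψ • (f * x i)

lemma pen_d1 (h : IsPt E ζ x) (h' : IsPt E ζ' x') (v : Fin 3 → Matrix m n k) (l : k) :
    d1 E.w (l • x') x v = l • (pen h h').A1 v + (pen h h').B1 v := by
  ext1 j
  simp [pen, d1_apply, Finset.smul_sum, Finset.sum_add_distrib, smul_comm l]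

lemma pen_d0 (h : IsPt E ζ x) (h' : IsPt E ζ' x') (f : Matrix m n k) (l : k) :
    d0 (l • x') x f = l • (pen h h').A0 f + (pen h h').B0 f := by
  ext1 j
  simp [pen, d0_apply, sub_eq_add_neg]

lemma pen_H0 (h : IsPt E ζ x) (h' : IsPt E ζ' x') (f : Matrix m n k) :
    f ∈ (pen h h').H0 ↔ ∀ j, ∑ i, ∑ l, E.w j i l • (x' i * (f * x l)) = 0 := by
  rw [Pen.mem_H0, funext_iff]
  simp [pen, d1_apply, d0_apply, Finset.sum_neg_distrib]

lemma pen_B0p0 (h : IsPt E ζ x) (h' : IsPt E ζ' x') {f : Matrix m n k} (hf : f ∈ (pen h h').H0)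
    (i : Fin 3) : x' i * f = - ((pen h h').p0 f * x i) := by
  have := congrFun ((pen h h').B0_p0 hf) i
  simpa [pen, d0_apply] using this.symm

lemma pen_eig (h : IsPt E ζ x) (h' : IsPt E ζ' x') {f : Matrix m n k} (hf : f ∈ (pen h h').H0)
    {μ : k} (hμ : (pen h h').p0 f = μ • f) (i : Fin 3) : x' i * f = (-μ) • (f * x i) := by
  rw [pen_B0p0 h h' hf, hμ, Matrix.smul_mul, neg_smul]

lemma pen_ne_zero (h : IsPt E ζ x) (h' : IsPt E ζ' x') {f : Matrix m n k} (hf : f ≠ 0)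
    {μ : k} (hμ : ∀ i, x' i * f = μ • (f * x i)) : μ ≠ 0 := by
  rintro rfl
  refine hf ((pen h h').exA0 f ?_)
  ext1 i
  simpa [pen, d0_apply] using hμ i

lemma twist_of_H0 [IsAlgClosed k] (h : IsPt E ζ x) (h' : IsPt E ζ' x') (hH : (pen h h').H0 ≠ ⊥) :
    Twist x x' := by
  have := Submodule.nontrivial_iff_ne_bot.2 hH
  obtain ⟨μ, hμ⟩ := Module.End.exists_eigenvalue (pen h h').h0
  obtain ⟨f, hf⟩ := hμ.exists_hasEigenvector
  have hf0 : (f : Matrix m n k) ≠ 0 := fun h => hf.2 (Subtype.ext h)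
  have key := pen_eig h h' f.2 (μ := μ) (congrArg Subtype.val hf.apply_eq_smul)
  exact ⟨-μ, f, pen_ne_zero h h' hf0 key, hf0, key⟩

lemma Twist.symm' (h : IsPt E ζ x) (h' : IsPt E ζ' x') (ht : Twist x x') : Twist x' x := by
  obtain ⟨ψ, f, hψ, hf0, hf⟩ := ht
  obtain ⟨g, hfg, hgf⟩ := schur (x := ψ • x) (ev_smul_surj hψ h.surj) h'.surj hf0 fun i => by
    rw [hf, Pi.smul_apply, Matrix.mul_smul]
  refine ⟨ψ⁻¹, g, inv_ne_zero hψ, ?_, fun i => ?_⟩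
  · rintro rfl
    rw [Matrix.mul_zero] at hfg
    apply hf0
    rw [← Matrix.one_mul f, ← hfg, Matrix.zero_mul]
  · rw [← Matrix.one_mul (x i * g), ← hgf, Matrix.mul_assoc, ← Matrix.mul_assoc f,
      eq_inv_smul_iff₀ hψ, ← Matrix.mul_smul, ← Matrix.smul_mul, ← hf, Matrix.mul_assoc, hfg,
      Matrix.mul_one]

lemma pen_dual (h : IsPt E ζ x) (h' : IsPt E ζ' x') (T : Matrix n m k)
    (v : Fin 3 → Matrix m n k) :
    trace (T * (pen h h').A2 ((pen h h').B1 v)) = pr ((pen h' h).A1 ((pen h' h).B0 T)) (-v) := by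
  have e1 : trace (T * (pen h h').A2 ((pen h h').B1 v))
      = ∑ j, ∑ i, ∑ l, E.w j i l • trace (T * x' j * v i * x l) := by
    simp [pen, d1_apply, d2_apply, Matrix.mul_sum, trace_sum, Matrix.mul_assoc]
  have e2 : pr ((pen h' h).A1 ((pen h' h).B0 T)) (-v)
      = ∑ j, ∑ i, ∑ l, E.w j i l • trace (x i * T * x' l * v j) := by
    simp [pen, d1_apply, d0_apply, pr, trace_sum, Matrix.mul_assoc, Matrix.sum_mul,
      Finset.sum_neg_distrib]
  rw [e1, e2, sum_rot]
  conv_lhs => rw [sum_rot]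
  refine Finset.sum_congr rfl fun j _ => Finset.sum_congr rfl fun i _ =>
    Finset.sum_congr rfl fun l _ => ?_
  rw [E.hw j, E.hw i, Matrix.trace_mul_comm, ← Matrix.mul_assoc, ← Matrix.mul_assoc]

lemma pen_I3_top [IsAlgClosed k] (h : IsPt E ζ x) (h' : IsPt E ζ' x') (hT : ¬ Twist x x') :
    (pen h h').I3 = ⊤ := by
  rw [Submodule.eq_top_iff']
  intro M
  refine mem_range_of_forall _ _ fun f hf => ?_
  obtain ⟨A, hA⟩ := exists_trace_repr f
  rw [hA]
  have hA0 : A ∈ (pen h' h).H0 := by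
    rw [Pen.mem_H0]
    refine pr_ext (n := m) (m := n) fun v => ?_
    have := hf (-v)
    rw [hA, LinearMap.comp_apply, pen_dual, neg_neg] at this
    rw [this]; simp [pr]
  have : (pen h' h).H0 = ⊥ := by
    by_contra hc
    exact hT ((twist_of_H0 h' h hc).symm' h' h)
  rw [this, Submodule.mem_bot] at hA0
  rw [hA0]; simp

lemma pen_finrank : finrank k (Fin 3 → Matrix m n k)
    = 2 * finrank k (Matrix m n k) + finrank k (Matrix m n k) := by
  rw [finrank_pi_fintype]; simp; ring

lemma pen_H0_bot [IsAlgClosed k] (h : IsPt E ζ x) (h' : IsPt E ζ' x') (hT : ¬ Twist x x') :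
    (pen h h').H0 = ⊥ := by
  by_contra hc
  exact hT (twist_of_H0 h h' hc)

/-- There are no nontrivial extensions between solutions which are not related by rescaling. -/
lemma ext_vanish [IsAlgClosed k] (h : IsPt E ζ x) (h' : IsPt E ζ' x') (hT : ¬ Twist x x')
    {v : Fin 3 → Matrix m n k} (hv : d1 E.w x' x v = 0) : ∃ f, d0 x' x f = v := by
  have h1 := pen_d1 h h' v 1
  rw [one_smul, one_smul, hv] at h1
  obtain ⟨f, hf⟩ := (pen h h').exact_of_trivial pen_finrank (pen_H0_bot h h' hT)
    (pen_I3_top h h' hT) (eq_neg_of_add_eq_zero_left h1.symm)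
  have h2 := pen_d0 h h' f 1
  rw [one_smul, one_smul] at h2
  exact ⟨f, h2.trans hf⟩

/-- The Lefschetz number. -/
def lef (h : IsPt E ζ x) (h' : IsPt E ζ' x') : k :=
  LinearMap.trace k _ (pen h h').p0 - LinearMap.trace k _ (pen h h').p1
    + LinearMap.trace k _ (pen h h').p3

lemma lef_eq_zero [IsAlgClosed k] (h : IsPt E ζ x) (h' : IsPt E ζ' x') (hT : ¬ Twist x x') :
    lef h h' = 0 := by
  have h0 := pen_H0_bot h h' hT
  have h3 := pen_I3_top h h' hT
  have e1 := (pen h h').finrank_H1 pen_finrank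
  have hq : finrank k (Matrix m n k ⧸ (pen h h').I3) = 0 := by
    rw [h3]; exact finrank_zero_of_subsingleton
  rw [h0, finrank_bot, hq] at e1
  have : Subsingleton (pen h h').H1 := finrank_zero_iff.1 e1
  have : Subsingleton (Matrix m n k ⧸ (pen h h').I3) := finrank_zero_iff.1 hq
  have : Subsingleton (pen h h').H0 := by rw [h0]; infer_instance
  rw [lef, (pen h h').lefschetz, Subsingleton.elim (pen h h').h0 0, Subsingleton.elim (pen h h').h1 0,
    Subsingleton.elim (pen h h').h2 0]
  simp

end PencilApply

section Kappa

variable {k : Type u} [Field k] {n : Type} [Fintype n] [DecidableEq n]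
variable {E : Env k} {ζ : k} {x : Fin 3 → Matrix n n k}

/-- Two-sided multiplication. -/
def lmul {m : Type} [Fintype m] (A : Matrix m m k) (B : Matrix n n k) :
    Matrix m n k →ₗ[k] Matrix m n k where
  toFun M := A * M * B
  map_add' M M' := by rw [Matrix.mul_add, Matrix.add_mul]
  map_smul' c M := by simp

lemma lmul_apply {m : Type} [Fintype m] (A : Matrix m m k) (B : Matrix n n k) (M : Matrix m n k) :
    lmul A B M = A * M * B := rfl

lemma exists_kappa (h : IsPt E ζ x) : ∃ κ : Fin 3 → k, ∀ (m : Type) [Fintype m] [DecidableEq m]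
    (ζ' : k) (x' : Fin 3 → Matrix m m k) (h' : IsPt E ζ' x'),
    lef h h' = ∑ i, trace (x' i) * κ i := by
  set ρ := fun i j => rmat (E.D.L2 i) x j with hρ
  set σ := fun i => rmatT E.D.L1 x i with hσ
  set κ0 : Fin 3 → k := fun i => trace ((-ζ⁻¹) • rmat E.D.L1 x i) with hκ0
  set κ1 : Fin 3 → k := fun i => ∑ l, trace ((-ζ⁻¹) • ∑ j, E.w j i l • ρ l j) with hκ1
  set τ : Fin 3 → Matrix n n k := fun j => (-ζ⁻¹) • σ j
    - (ζ⁻¹ * ζ⁻¹) • ∑ i, ∑ l, E.w j i l • ((∑ p, σ p * ρ i p) * x l) with hτ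
  refine ⟨fun i => κ0 i - κ1 i + trace (τ i), ?_⟩
  intro m _ _ ζ' x' h'
  have hL : ∀ (A : Matrix m m k) (B : Matrix n n k),
      LinearMap.trace k _ (lmul A B) = trace A * trace B := fun A B => trace_mul_mul _ _ _ fun _ => rfl
  have hh : ∀ (v : Fin 3 → Matrix m n k) (l : Fin 3), E.D.hh2 0 x v l = ∑ j, v j * ρ l j :=
    fun v l => evL_zero _ _ _
  have e0 : LinearMap.trace k _ (pen h h').p0 = ∑ i, trace (x' i) * κ0 i := by
    have : (pen h h').p0 = ∑ i, lmul (x' i) ((-ζ⁻¹) • rmat E.D.L1 x i) := by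
      refine LinearMap.ext fun M => ?_
      simp [Pen.p0, pen, evL_zero, d0_apply, lmul_apply, LinearMap.sum_apply, Finset.smul_sum]
    rw [this, map_sum]
    exact Finset.sum_congr rfl fun i _ => hL _ _
  have e1 : LinearMap.trace k _ (pen h h').p1 = ∑ i, trace (x' i) * κ1 i := by
    rw [trace_pi_comp]
    simp only [hκ1, Finset.mul_sum]
    rw [Finset.sum_comm]
    refine Finset.sum_congr rfl fun l _ => ?_
    have : LinearMap.proj l ∘ₗ (pen h h').p1 ∘ₗ LinearMap.single k (fun _ => Matrix m n k) l
        = ∑ i, lmul (x' i) ((-ζ⁻¹) • ∑ j, E.w j i l • ρ l j) := by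
      refine LinearMap.ext fun M => ?_
      have hd : ∀ j, d1 E.w x' 0 (Pi.single l M) j = ∑ i, E.w j i l • (x' i * M) := by
        intro j
        rw [d1_apply]
        refine Finset.sum_congr rfl fun i _ => ?_
        rw [Finset.sum_eq_single l]
        · simp
        · intro b _ hb; simp [Pi.single_eq_of_ne hb]
        · simp
      simp only [LinearMap.comp_apply, Pen.p1, pen, LinearMap.proj_apply, LinearMap.smul_apply,
        Pi.smul_apply, hh, LinearMap.single_apply, hd, lmul_apply, LinearMap.sum_apply,
        Matrix.sum_mul, Finset.smul_sum, Matrix.mul_sum, Matrix.smul_mul, Matrix.mul_smul]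
      rw [Finset.sum_comm]
    rw [this, map_sum]
    exact Finset.sum_congr rfl fun i _ => hL _ _
  have e3 : LinearMap.trace k _ (pen h h').p3 = ∑ i, trace (x' i) * trace (τ i) := by
    have hs2 : ∀ M : Matrix m n k, (pen h h').s2 M = fun j => M * τ j := by
      intro M
      have he : evT E.D.L1 0 x M = fun i => M * σ i := by ext1 i; rw [evT_zero]
      have hh' : E.D.hh2 0 x (fun i => M * σ i) = fun i => M * ∑ p, σ p * ρ i p := by
        ext1 i; rw [hh]; simp only [Matrix.mul_sum, Matrix.mul_assoc]
      simp only [pen, LinearMap.comp_apply, LinearMap.sub_apply, LinearMap.id_apply,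
        LinearMap.smul_apply, he, map_smul, hh']
      ext1 j
      simp only [Pi.sub_apply, Pi.smul_apply, d1_apply, hτ, Matrix.mul_sub, Matrix.mul_smul,
        Pi.zero_apply, Matrix.zero_mul, Matrix.mul_sum]
      simp only [Matrix.sum_mul, Matrix.mul_assoc, Matrix.mul_sum, Finset.sum_const_zero, zero_add,
        smul_sub, smul_smul, neg_mul_neg]
    have : (pen h h').p3 = ∑ i, lmul (x' i) (τ i) := by
      refine LinearMap.ext fun M => ?_
      rw [Pen.p3, LinearMap.comp_apply, hs2]
      simp [pen, d2_apply, lmul_apply, LinearMap.sum_apply, Matrix.mul_assoc]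
    rw [this, map_sum]
    exact Finset.sum_congr rfl fun i _ => hL _ _
  rw [lef, e0, e1, e3, ← Finset.sum_sub_distrib, ← Finset.sum_add_distrib]
  exact Finset.sum_congr rfl fun i _ => by ring

end Kappa

section SelfPencil

open Module

variable {k : Type u} [Field k] {n : Type} [Fintype n] [DecidableEq n]
variable {E : Env k} {ζ : k} {x : Fin 3 → Matrix n n k}

lemma psi_eq (h : IsPt E ζ x) {f : Matrix n n k} (hf : f ∈ (pen h h).H0) (i : Fin 3) :
    x i * f = (-(pen h h).p0 f) * x i := by
  rw [pen_B0p0 h h hf, Matrix.neg_mul]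

/-- The twist operator on the self intertwiners. -/
def psi (h : IsPt E ζ x) : End k (pen h h).H0 := -(pen h h).h0

lemma psi_coe (h : IsPt E ζ x) (f : (pen h h).H0) : (psi h f : Matrix n n k) = -(pen h h).p0 f := rfl

lemma psi_rel (h : IsPt E ζ x) (f : (pen h h).H0) (i : Fin 3) :
    x i * (f : Matrix n n k) = psi h f * x i := psi_eq h f.2 i

lemma psi_word (h : IsPt E ζ x) {N : ℕ} {z : FreeAlgebra k (Fin 3)} (hz : Homog N z)
    (f : (pen h h).H0) : ev x z * (f : Matrix n n k) = ((psi h ^ N) f : Matrix n n k) * ev x z := by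
  unfold Homog at hz
  revert f
  refine Submodule.pow_induction_on_left' (Submodule.span k (Set.range (FreeAlgebra.ι k)))
    (C := fun N z _ => ∀ f : (pen h h).H0,
      ev x z * (f : Matrix n n k) = ((psi h ^ N) f : Matrix n n k) * ev x z)
    ?_ ?_ ?_ hz
  · intro a f; simp [Algebra.algebraMap_eq_smul_one]
  · intro a b N _ _ ha hb f
    rw [map_add, Matrix.add_mul, ha, hb, Matrix.mul_add]
  · intro a ha N b _ hb f
    rw [map_mul, Matrix.mul_assoc, hb, ← Matrix.mul_assoc, ← Matrix.mul_assoc, pow_succ',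
      Module.End.mul_apply]
    congr 1
    induction ha using Submodule.span_induction with
    | mem a ha => obtain ⟨i, rfl⟩ := ha; simpa using psi_rel h _ i
    | zero => simp
    | add a b _ _ ha hb => rw [map_add, Matrix.add_mul, Matrix.mul_add, ha, hb]
    | smul c a _ ha => rw [map_smul, Matrix.smul_mul, ha, Matrix.mul_smul]

lemma psi_pow (h : IsPt E ζ x) : psi h ^ E.N = 1 := by
  ext1 f
  have := psi_word h E.hz f
  rw [h.cen] at this
  simp only [Matrix.smul_mul, Matrix.one_mul, Matrix.mul_smul, Matrix.mul_one] at this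
  exact Subtype.ext (smul_right_injective _ h.hζ this).symm

lemma one_mem_H0 (h : IsPt E ζ x) : (1 : Matrix n n k) ∈ (pen h h).H0 := by
  rw [pen_H0]
  intro j
  simpa [relAt] using h.rel j

lemma A0_one (h : IsPt E ζ x) : (pen h h).A0 1 = x := by
  ext1 i; simp [pen, d0_apply]

lemma A0_eq (h : IsPt E ζ x) (f : (pen h h).H0) :
    (pen h h).A0 (f : Matrix n n k) = -(pen h h).B0 (psi h f) := by
  rw [psi_coe, map_neg, neg_neg, (pen h h).B0_p0 f.2]

lemma one_sub_mul_sum_geom {R : Type*} [Ring R] (p : R) (N : ℕ) :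
    (1 - p) * ∑ j ∈ Finset.range N, ∑ i ∈ Finset.range j, p ^ i
      = N - ∑ j ∈ Finset.range N, p ^ j := by
  rw [Finset.mul_sum]
  simp [mul_neg_geom_sum]

lemma exists_decomp [CharZero k] (h : IsPt E ζ x) (t : (pen h h).H0) :
    ∃ (c : k) (t' : (pen h h).H0), (t : Matrix n n k) = c • (1 : Matrix n n k) + t' - psi h t' := by
  have hN : (E.N : k) ≠ 0 := Nat.cast_ne_zero.2 E.hN
  set P : End k (pen h h).H0 := ∑ j ∈ Finset.range E.N, psi h ^ j with hP
  have hfix : psi h (P t) = P t := by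
    have : (1 - psi h) * P = 0 := by
      have := mul_neg_geom_sum (psi h) E.N
      rw [psi_pow, sub_self] at this
      exact this
    have := congrArg (fun T => T t) this
    simp only [Module.End.mul_apply, LinearMap.sub_apply, Module.End.one_apply,
      LinearMap.zero_apply] at this
    exact (sub_eq_zero.1 this).symm
  obtain ⟨c, hc⟩ := h.irr (P t : Matrix n n k) fun i => by
    rw [psi_rel h, hfix]
  set Q : End k (pen h h).H0 := ∑ j ∈ Finset.range E.N, ∑ i ∈ Finset.range j, psi h ^ i with hQ
  have hPQ : (1 - psi h) * Q = (E.N : k) • 1 - P := by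
    have := one_sub_mul_sum_geom (psi h) E.N
    rw [← nsmul_one, ← Nat.cast_smul_eq_nsmul k] at this
    exact this
  refine ⟨(E.N : k)⁻¹ * c, (E.N : k)⁻¹ • Q t, ?_⟩
  have := congrArg (fun T => ((T t : (pen h h).H0) : Matrix n n k)) hPQ
  simp only [Module.End.mul_apply, LinearMap.sub_apply, Module.End.one_apply,
    LinearMap.smul_apply, Submodule.coe_sub, Submodule.coe_smul, hc] at this
  have e : (t : Matrix n n k) = (E.N : k)⁻¹ • ((E.N : k) • (t : Matrix n n k)) := by
    rw [smul_smul, inv_mul_cancel₀ hN, one_smul]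
  rw [e, map_smul, Submodule.coe_smul, Submodule.coe_smul]
  linear_combination (norm := module) (-(E.N : k)⁻¹) • this

/-- Cocycles for rescaled solutions which are trivial in the pencil. -/
lemma exists_of_mem_R1 (h : IsPt E ζ x) {l : k} {v : Fin 3 → Matrix n n k}
    (hv : d1 E.w (l • x) x v = 0) (hR : v ∈ (pen h h).R1) :
    ∃ (g : Matrix n n k) (t : (pen h h).H0), v = d0 (l • x) x g - (pen h h).A0 t := by
  obtain ⟨f, g, rfl⟩ := (pen h h).mem_R1.1 hR
  have ht : l • g - f ∈ (pen h h).H0 := by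
    rw [Pen.mem_H0]
    rw [pen_d1 h h, map_add, map_add, (pen h h).hA1, (pen h h).hB1, (pen h h).hAB1] at hv
    rw [map_sub, map_sub, map_smul, map_smul]
    linear_combination (norm := module) (1 : k) • hv
  refine ⟨g, ⟨_, ht⟩, ?_⟩
  rw [pen_d0 h h, map_sub, map_smul]
  module

lemma isGauge_of_mem_R1 [CharZero k] (h : IsPt E ζ x) {v : Fin 3 → Matrix n n k}
    (hv : d1 E.w x x v = 0) (hR : v ∈ (pen h h).R1) : IsGauge x v := by
  obtain ⟨g, t, hg⟩ := exists_of_mem_R1 h (l := 1) (by rwa [one_smul]) hR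
  obtain ⟨c, t', ht⟩ := exists_decomp h t
  refine ⟨-c, g + psi h t', ?_⟩
  have e1 := pen_d0 h h (psi h t' : Matrix n n k) 1
  have e2 := A0_eq h t'
  rw [one_smul, one_smul] at e1
  rw [one_smul] at hg
  rw [hg, map_add, e1, ht, map_sub, map_add, map_smul, A0_one, e2]
  module

lemma gauge_mem_R1 (h : IsPt E ζ x) {v : Fin 3 → Matrix n n k} (hv : IsGauge x v) :
    v ∈ (pen h h).R1 := by
  obtain ⟨c, f, rfl⟩ := hv
  have e1 := pen_d0 h h f 1
  rw [one_smul, one_smul] at e1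
  refine (pen h h).mem_R1.2 ⟨c • 1 + f, f, ?_⟩
  rw [e1, map_add, map_smul, A0_one]
  module

lemma psi_surj (h : IsPt E ζ x) : Function.Surjective (psi h) := by
  have hi : Function.Injective (psi h) := by
    rw [injective_iff_map_eq_zero]
    intro f hf
    refine Subtype.ext ((pen h h).exA0 f ?_)
    rw [A0_eq, hf]; simp
  exact LinearMap.injective_iff_surjective.1 hi

lemma B1_mul_psi (h : IsPt E ζ x) {v : Fin 3 → Matrix n n k} (hv : d1 E.w x x v = 0)
    (f : (pen h h).H0) : (pen h h).B1 (fun i => v i * (psi h f : Matrix n n k))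
      = - (pen h h).A1 (fun i => v i * (f : Matrix n n k)) := by
  ext1 j
  have := congrArg (fun M => M * (f : Matrix n n k)) (congrFun hv j)
  simp only [d1_apply, Matrix.sum_mul, Matrix.smul_mul, Matrix.add_mul, Pi.zero_apply,
    Matrix.zero_mul, Matrix.mul_assoc, psi_rel, smul_add, Finset.sum_add_distrib] at this
  simp only [pen, d1_apply, Pi.zero_apply, Matrix.zero_mul, Matrix.mul_zero, zero_add,
    add_zero, Pi.neg_apply, Matrix.mul_assoc]
  exact eq_neg_of_add_eq_zero_right this

lemma mul_mem_Z1 (h : IsPt E ζ x) {v : Fin 3 → Matrix n n k} (hv : d1 E.w x x v = 0)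
    (f : (pen h h).H0) : (fun i => v i * (f : Matrix n n k)) ∈ (pen h h).Z1 := by
  obtain ⟨f', rfl⟩ := psi_surj h f
  rw [Pen.mem_Z1, B1_mul_psi h hv, map_neg, (pen h h).hA2, neg_zero]

/-- Multiplication of a cocycle by intertwiners. -/
def mulH (h : IsPt E ζ x) (v : Fin 3 → Matrix n n k) (hv : d1 E.w x x v = 0) :
    (pen h h).H0 →ₗ[k] (pen h h).H1 :=
  Submodule.mkQ _ ∘ₗ LinearMap.codRestrict (pen h h).Z1
    (LinearMap.pi fun i => LinearMap.mulLeft k (v i) ∘ₗ (pen h h).H0.subtype)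
    fun f => mul_mem_Z1 h hv f

lemma h1_mulH (h : IsPt E ζ x) (v : Fin 3 → Matrix n n k) (hv : d1 E.w x x v = 0)
    (f : (pen h h).H0) : (pen h h).h1 (mulH h v hv f) = mulH h v hv ((pen h h).h0 f) := by
  have e : (pen h h).p1 (fun i => v i * (f : Matrix n n k)) =
      (fun i => v i * (pen h h).p0 (f : Matrix n n k)) +
        (pen h h).B0 ((pen h h).s0 (fun i => v i * (psi h f : Matrix n n k))) := by
    have e1 := (pen h h).hs1 (fun i => v i * (psi h f : Matrix n n k))
    have e2 : (fun i => v i * (psi h f : Matrix n n k))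
        = - fun i => v i * (pen h h).p0 (f : Matrix n n k) := by
      ext1 i; rw [psi_coe, Matrix.mul_neg]; rfl
    rw [B1_mul_psi h hv, map_neg] at e1
    rw [Pen.p1, LinearMap.comp_apply, ← neg_eq_iff_eq_neg.2 e2]
    linear_combination (norm := module) (-1 : k) • e1
  refine (Submodule.Quotient.eq _).2 ?_
  change (pen h h).p1 (fun i => v i * (f : Matrix n n k)) - _ ∈ (pen h h).R1
  rw [e]
  refine (pen h h).mem_R1.2 ⟨0, (pen h h).s0 (fun i => v i * (psi h f : Matrix n n k)), ?_⟩
  rw [map_zero, zero_add, add_comm]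
  exact (add_sub_cancel_right _ _).symm

end SelfPencil

section SelfPencil

open Module

variable {k : Type u} [Field k] {n : Type} [Fintype n] [DecidableEq n]
variable {E : Env k} {ζ : k} {x : Fin 3 → Matrix n n k}

lemma pen_I3_finrank (h : IsPt E ζ x) :
    finrank k (Matrix n n k ⧸ (pen h h).I3) ≤ finrank k (pen h h).H0 := by
  set t : Matrix n n k →ₗ[k] Dual k (Matrix n n k) :=
    (LinearMap.mul k (Matrix n n k)).compr₂ (Matrix.traceLinearMap n k k) with ht
  have hle : (pen h h).I3.dualAnnihilator ≤ (pen h h).H0.map t := by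
    intro φ hφ
    rw [Submodule.mem_dualAnnihilator] at hφ
    obtain ⟨T, hT⟩ := exists_trace_repr φ
    refine ⟨T, ?_, LinearMap.ext fun M => (hT M).symm⟩
    rw [SetLike.mem_coe, Pen.mem_H0]
    refine pr_ext fun v => ?_
    have := hφ ((pen h h).A2 ((pen h h).B1 (-v))) ⟨-v, rfl⟩
    rw [hT, pen_dual, neg_neg] at this
    rw [this, pr]; simp
  have e1 := Submodule.finrank_mono hle
  have e2 := Submodule.finrank_map_le t (pen h h).H0
  have e3 := Subspace.finrank_add_finrank_dualAnnihilator_eq (pen h h).I3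
  have e4 := (pen h h).I3.finrank_quotient_add_finrank
  omega

lemma R1_mul_right (h : IsPt E ζ x) {f g : Matrix n n k} {μ : k} (hμ : μ ≠ 0)
    (hf : ∀ i, x i * f = μ • (f * x i)) (hfg : f * g = 1) (hgf : g * f = 1)
    {v : Fin 3 → Matrix n n k} (hv : (fun i => v i * f) ∈ (pen h h).R1) : v ∈ (pen h h).R1 := by
  obtain ⟨p, q, hpq⟩ := (pen h h).mem_R1.1 hv
  have hg : ∀ i, x i * g = μ⁻¹ • (g * x i) := fun i => by
    rw [eq_inv_smul_iff₀ hμ, ← Matrix.one_mul (x i * g), ← hgf, Matrix.mul_assoc,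
      ← Matrix.mul_assoc f, ← Matrix.mul_smul, ← Matrix.smul_mul, ← hf, Matrix.mul_assoc, hfg,
      Matrix.mul_one]
  refine (pen h h).mem_R1.2 ⟨p * g, μ⁻¹ • (q * g), ?_⟩
  ext1 i
  have := congrFun hpq i
  simp only [pen, d0_apply, Pi.add_apply, Pi.zero_apply, Matrix.mul_zero, Matrix.zero_mul,
    sub_zero, zero_sub, Matrix.smul_mul] at this ⊢
  rw [← Matrix.mul_one (v i), ← hfg, ← Matrix.mul_assoc (v i), ← this, Matrix.add_mul,
    Matrix.neg_mul, Matrix.mul_assoc q (x i), hg]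
  simp [Matrix.mul_assoc]

lemma mulH_eq_zero (h : IsPt E ζ x) {v : Fin 3 → Matrix n n k} (hv : d1 E.w x x v = 0)
    (f : (pen h h).H0) : mulH h v hv f = 0 ↔ (fun i => v i * (f : Matrix n n k)) ∈ (pen h h).R1 :=
  Submodule.Quotient.mk_eq_zero _

/-- Two cocycles independent modulo gauge. -/
def Indep (x u₁ u₂ : Fin 3 → Matrix n n k) : Prop :=
  ∀ c₁ c₂ : k, IsGauge x (c₁ • u₁ + c₂ • u₂) → c₁ = 0 ∧ c₂ = 0

variable {u₁ u₂ : Fin 3 → Matrix n n k}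

/-- Pairs of intertwiners acting on a pair of cocycles. -/
def tmap (h : IsPt E ζ x) (h₁ : d1 E.w x x u₁ = 0) (h₂ : d1 E.w x x u₂ = 0) :
    (pen h h).H0 × (pen h h).H0 →ₗ[k] (pen h h).H1 :=
  (mulH h u₁ h₁).coprod (mulH h u₂ h₂)

lemma h1_tmap (h : IsPt E ζ x) (h₁ : d1 E.w x x u₁ = 0) (h₂ : d1 E.w x x u₂ = 0)
    (p : (pen h h).H0 × (pen h h).H0) :
    (pen h h).h1 (tmap h h₁ h₂ p)
      = tmap h h₁ h₂ ((pen h h).h0.prodMap (pen h h).h0 p) := by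
  obtain ⟨f₁, f₂⟩ := p
  simp [tmap, h1_mulH]

variable [IsAlgClosed k] [CharZero k]

lemma tmap_injective (h : IsPt E ζ x) (h₁ : d1 E.w x x u₁ = 0) (h₂ : d1 E.w x x u₂ = 0)
    (hI : Indep x u₁ u₂) : Function.Injective (tmap h h₁ h₂) := by
  rw [← LinearMap.ker_eq_bot]
  by_contra hne
  set P := (pen h h).h0.prodMap (pen h h).h0 with hP
  have hst : ∀ p ∈ LinearMap.ker (tmap h h₁ h₂), P p ∈ LinearMap.ker (tmap h h₁ h₂) := by
    intro p hp
    rw [LinearMap.mem_ker] at hp ⊢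
    rw [hP, ← h1_tmap, hp, map_zero]
  have := Submodule.nontrivial_iff_ne_bot.2 hne
  obtain ⟨μ, hμ⟩ := Module.End.exists_eigenvalue (K := k)
    (V := LinearMap.ker (tmap h h₁ h₂)) (P.restrict hst)
  obtain ⟨⟨⟨f₁, f₂⟩, hker⟩, hf⟩ := hμ.exists_hasEigenvector
  have hfe := congrArg Subtype.val hf.apply_eq_smul
  have e₁ : (pen h h).p0 f₁ = μ • (f₁ : Matrix n n k) := congrArg Subtype.val (congrArg Prod.fst hfe)
  have e₂ : (pen h h).p0 f₂ = μ • (f₂ : Matrix n n k) := congrArg Subtype.val (congrArg Prod.snd hfe)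
  have k₁ := pen_eig h h f₁.2 e₁
  have k₂ := pen_eig h h f₂.2 e₂
  have hn : (f₁ : Matrix n n k) ≠ 0 ∨ (f₂ : Matrix n n k) ≠ 0 := by
    by_contra hc
    push Not at hc
    exact hf.2 (Subtype.ext (Prod.ext (Subtype.ext hc.1) (Subtype.ext hc.2)))
  obtain ⟨f, hf0, hfi⟩ : ∃ f : Matrix n n k, f ≠ 0 ∧ ∀ i, x i * f = (-μ) • (f * x i) := by
    rcases hn with hn | hn
    exacts [⟨f₁, hn, k₁⟩, ⟨f₂, hn, k₂⟩]
  have hμ0 := pen_ne_zero h h hf0 hfi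
  obtain ⟨g, hfg, hgf⟩ := schur (x := (-μ) • x) (ev_smul_surj hμ0 h.surj) h.surj hf0 fun i => by
    rw [hfi, Pi.smul_apply, Matrix.mul_smul]
  have hsc : ∀ f' : Matrix n n k, (∀ i, x i * f' = (-μ) • (f' * x i)) →
      ∃ c : k, f' = c • f := by
    intro f' hf'
    obtain ⟨c, hc⟩ := h.irr (f' * g) fun i => by
      have hg : (-μ) • (x i * g) = g * x i := by
        rw [← Matrix.one_mul (x i * g), ← hgf, Matrix.mul_assoc,
          ← Matrix.mul_assoc f, ← Matrix.mul_smul, ← Matrix.smul_mul, ← hfi, Matrix.mul_assoc, hfg,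
          Matrix.mul_one]
      rw [← Matrix.mul_assoc, hf', Matrix.mul_assoc f', ← hg, Matrix.smul_mul, Matrix.mul_assoc,
        Matrix.mul_smul]
    refine ⟨c, ?_⟩
    rw [← Matrix.mul_one f', ← hgf, ← Matrix.mul_assoc, hc, Matrix.smul_mul, Matrix.one_mul]
  obtain ⟨c₁, hc₁⟩ := hsc _ k₁
  obtain ⟨c₂, hc₂⟩ := hsc _ k₂
  have hR : (fun i => (c₁ • u₁ + c₂ • u₂) i * f) ∈ (pen h h).R1 := by
    have : (fun i => u₁ i * (f₁ : Matrix n n k)) + (fun i => u₂ i * (f₂ : Matrix n n k))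
        ∈ (pen h h).R1 := (Submodule.Quotient.mk_eq_zero
          ((pen h h).R1.submoduleOf (pen h h).Z1)).1 (LinearMap.mem_ker.1 hker)
    rw [hc₁, hc₂] at this
    convert this using 1
    ext1 i
    simp [Matrix.add_mul]
  have hg := isGauge_of_mem_R1 h (by rw [map_add, map_smul, map_smul, h₁, h₂]; simp)
    (R1_mul_right h hμ0 hfi hfg hgf hR)
  obtain ⟨z₁, z₂⟩ := hI _ _ hg
  rw [hc₁, hc₂, z₁, z₂] at hn
  simp at hn

lemma tmap_surjective (h : IsPt E ζ x) (h₁ : d1 E.w x x u₁ = 0) (h₂ : d1 E.w x x u₂ = 0)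
    (hI : Indep x u₁ u₂) : Function.Surjective (tmap h h₁ h₂) := by
  have hi := tmap_injective h h₁ h₂ hI
  have e1 := (pen h h).finrank_H1 pen_finrank
  have e2 := pen_I3_finrank h
  have e3 := LinearMap.finrank_le_finrank_of_injective hi
  have e4 : finrank k ((pen h h).H0 × (pen h h).H0) = 2 * finrank k (pen h h).H0 := by
    rw [finrank_prod]; ring
  exact (LinearMap.injective_iff_surjective_of_finrank_eq_finrank (by omega)).1 hi

/-- A class in the first cohomology represented by a cocycle of a member of the pencil comes from
twisted intertwiners. -/
lemma exists_pair (h : IsPt E ζ x) (h₁ : d1 E.w x x u₁ = 0) (h₂ : d1 E.w x x u₂ = 0)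
    (hI : Indep x u₁ u₂) {l : k} (hl : l ≠ 0) {v : Fin 3 → Matrix n n k}
    (hv : d1 E.w (l • x) x v = 0) :
    ∃ f₁ f₂ : Matrix n n k, (∀ i, x i * f₁ = l⁻¹ • (f₁ * x i)) ∧
      (∀ i, x i * f₂ = l⁻¹ • (f₂ * x i)) ∧
      v - (fun i => u₁ i * f₁ + u₂ i * f₂) ∈ (pen h h).R1 := by
  rw [pen_d1 h h] at hv
  have hB : (pen h h).B1 v = (-l) • (pen h h).A1 v := by
    rw [neg_smul]; exact eq_neg_of_add_eq_zero_right hv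
  have hZ : v ∈ (pen h h).Z1 := by
    rw [Pen.mem_Z1, hB, map_smul, (pen h h).hA2, smul_zero]
  obtain ⟨⟨f₁, f₂⟩, hp⟩ := tmap_surjective h h₁ h₂ hI (Submodule.Quotient.mk ⟨v, hZ⟩)
  have hR : v - (fun i => u₁ i * (f₁ : Matrix n n k) + u₂ i * (f₂ : Matrix n n k))
      ∈ (pen h h).R1 :=
    (Submodule.Quotient.eq ((pen h h).R1.submoduleOf (pen h h).Z1)).1 hp.symm
  have he : (pen h h).h1 (Submodule.Quotient.mk ⟨v, hZ⟩)
      = (-l⁻¹) • (Submodule.Quotient.mk ⟨v, hZ⟩ : (pen h h).H1) := by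
    refine (Submodule.Quotient.eq _).2 ?_
    change (pen h h).p1 v - (-l⁻¹) • v ∈ (pen h h).R1
    have e1 := (pen h h).hs1 v
    have e2 : (pen h h).A1 v = (-l⁻¹) • (pen h h).B1 v := by
      rw [hB, smul_smul]; field_simp; simp
    rw [Pen.p1, LinearMap.comp_apply, e2, map_smul]
    refine (pen h h).mem_R1.2 ⟨0, l⁻¹ • (pen h h).s0 v, ?_⟩
    rw [map_zero, zero_add, map_smul]
    linear_combination (norm := module) (l⁻¹) • e1
  rw [← hp, h1_tmap, ← map_smul] at he
  have he' := tmap_injective h h₁ h₂ hI he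
  have e₁ : (pen h h).p0 f₁ = (-l⁻¹) • (f₁ : Matrix n n k) :=
    congrArg Subtype.val (congrArg Prod.fst he')
  have e₂ : (pen h h).p0 f₂ = (-l⁻¹) • (f₂ : Matrix n n k) :=
    congrArg Subtype.val (congrArg Prod.snd he')
  have k₁ := pen_eig h h f₁.2 e₁
  have k₂ := pen_eig h h f₂.2 e₂
  rw [neg_neg] at k₁ k₂
  exact ⟨f₁, f₂, k₁, k₂, hR⟩

/-- Two independent cocycles span all cocycles modulo gauge. -/
lemma exists_comb (h : IsPt E ζ x) (h₁ : d1 E.w x x u₁ = 0) (h₂ : d1 E.w x x u₂ = 0)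
    (hI : Indep x u₁ u₂) {v : Fin 3 → Matrix n n k} (hv : d1 E.w x x v = 0) :
    ∃ c₁ c₂ : k, IsGauge x (v - (c₁ • u₁ + c₂ • u₂)) := by
  obtain ⟨f₁, f₂, k₁, k₂, hR⟩ := exists_pair h h₁ h₂ hI (one_ne_zero) (by rwa [one_smul])
  simp only [inv_one, one_smul] at k₁ k₂
  obtain ⟨c₁, rfl⟩ := h.irr _ k₁
  obtain ⟨c₂, rfl⟩ := h.irr _ k₂
  refine ⟨c₁, c₂, isGauge_of_mem_R1 h (by simp [h₁, h₂, hv]) ?_⟩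
  convert hR using 2
  ext1 i
  simp

lemma self_ext_vanish (h : IsPt E ζ x) (h₁ : d1 E.w x x u₁ = 0) (h₂ : d1 E.w x x u₂ = 0)
    (hI : Indep x u₁ u₂) {l : k} (hl : l ≠ 0)
    (hno : ∀ f : Matrix n n k, (∀ i, x i * f = l⁻¹ • (f * x i)) → f = 0)
    {v : Fin 3 → Matrix n n k} (hv : d1 E.w (l • x) x v = 0) : ∃ f, d0 (l • x) x f = v := by
  obtain ⟨f₁, f₂, k₁, k₂, hR⟩ := exists_pair h h₁ h₂ hI hl hv
  rw [hno f₁ k₁, hno f₂ k₂] at hR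
  have hR' : v ∈ (pen h h).R1 := by
    convert hR using 1
    ext1 i
    simp
  obtain ⟨g, t, ht⟩ := exists_of_mem_R1 h hv hR'
  have hsurj : Function.Surjective
      (LinearMap.id + l • (pen h h).h0 : (pen h h).H0 →ₗ[k] (pen h h).H0) := by
    refine LinearMap.injective_iff_surjective.1 ((injective_iff_map_eq_zero _).2 fun f hf => ?_)
    refine Subtype.ext (hno f fun i => ?_)
    have : (pen h h).p0 (f : Matrix n n k) = (-l⁻¹) • (f : Matrix n n k) := by
      have := congrArg Subtype.val hf
      simp only [LinearMap.add_apply, LinearMap.id_apply, LinearMap.smul_apply,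
        Submodule.coe_add, Submodule.coe_smul, Submodule.coe_zero] at this
      change (f : Matrix n n k) + l • (pen h h).p0 (f : Matrix n n k) = 0 at this
      rw [← inv_smul_smul₀ hl ((pen h h).p0 (f : Matrix n n k)), eq_neg_of_add_eq_zero_right this,
        smul_neg, neg_smul]
    have := pen_eig h h f.2 this i
    rwa [neg_neg] at this
  obtain ⟨s, hs⟩ := hsurj t
  have hs' : (s : Matrix n n k) + l • (pen h h).p0 (s : Matrix n n k) = t := congrArg Subtype.val hs
  refine ⟨g - (pen h h).p0 s, ?_⟩
  have hm := (pen h h).p0_mem s.2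
  rw [ht, map_sub, pen_d0 h h ((pen h h).p0 s), (pen h h).B0_p0 s.2, ← hs', map_add, map_smul]
  module

end SelfPencil

section Consequences

open Module

variable {k : Type u} [Field k] {n : Type} [Fintype n] [DecidableEq n]
variable {m : Type} [Fintype m] [DecidableEq m]
variable {E : Env k} {ζ ζ' : k} {x : Fin 3 → Matrix n n k} {x' : Fin 3 → Matrix m m k}

variable [CharZero k]

lemma indep_of_om (h : IsPt E ζ x) {u₁ u₂ : Fin 3 → Matrix n n k} (h₁ : d1 E.w x x u₁ = 0)
    (h₂ : d1 E.w x x u₂ = 0) (ho : om E.w x u₁ u₂ ≠ 0) : Indep x u₁ u₂ := by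
  intro c₁ c₂ hg
  have e1 := om_gauge h h₁ hg
  have e2 := om_gauge h h₂ hg
  rw [om_add_right, om_smul_right, om_smul_right, om_self E.hw h₁, mul_zero, zero_add] at e1
  rw [om_add_right, om_smul_right, om_smul_right, om_self E.hw h₂, mul_zero, add_zero,
    om_antisymm E.hw h₂ h₁, mul_neg, neg_eq_zero] at e2
  exact ⟨(mul_eq_zero.1 e2).resolve_right ho, (mul_eq_zero.1 e1).resolve_right ho⟩

variable [IsAlgClosed k]

/-- Vanishing of extensions between inequivalent solutions, when the first one has nontrivial
deformations. -/
lemma ext_vanish_pair (h : IsPt E ζ x) (h' : IsPt E ζ' x') {u₁ u₂ : Fin 3 → Matrix n n k}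
    (h₁ : d1 E.w x x u₁ = 0) (h₂ : d1 E.w x x u₂ = 0) (hI : Indep x u₁ u₂)
    (hne : ∀ f : Matrix m n k, (∀ i, x' i * f = f * x i) → f = 0) :
    (∀ v : Fin 3 → Matrix m n k, d1 E.w x' x v = 0 → ∃ e, d0 x' x e = v) ∧
      (∀ v : Fin 3 → Matrix n m k, d1 E.w x x' v = 0 → ∃ e, d0 x x' e = v) := by
  by_cases hT : Twist x x'
  swap
  · exact ⟨fun v hv => ext_vanish h h' hT hv,
      fun v hv => ext_vanish h' h (fun hc => hT (hc.symm' h' h)) hv⟩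
  obtain ⟨ψ, f, hψ, hf0, hf⟩ := hT
  obtain ⟨g, hfg, hgf⟩ := schur (x := ψ • x) (ev_smul_surj hψ h.surj) h'.surj hf0 fun i => by
    rw [hf, Pi.smul_apply, Matrix.mul_smul]
  have hg : ∀ i, g * x' i = ψ • (x i * g) := fun i => by
    rw [← Matrix.mul_one (g * x' i), ← hfg, ← Matrix.mul_assoc, Matrix.mul_assoc g, hf,
      Matrix.mul_smul, Matrix.smul_mul, ← Matrix.mul_assoc g, hgf, Matrix.one_mul]
  constructor
  · intro v hv
    have hno : ∀ e : Matrix n n k, (∀ i, x i * e = ψ⁻¹ • (e * x i)) → e = 0 := by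
      intro e he
      have := hne (f * e) fun i => by
        rw [← Matrix.mul_assoc, hf, Matrix.smul_mul, Matrix.mul_assoc, he, Matrix.mul_smul,
          smul_inv_smul₀ hψ, Matrix.mul_assoc]
      rw [← Matrix.one_mul e, ← hgf, Matrix.mul_assoc, this, Matrix.mul_zero]
    obtain ⟨e, he⟩ := self_ext_vanish h h₁ h₂ hI hψ hno (v := fun i => g * v i) (by
      ext1 j
      have := congrArg (fun M => g * M) (congrFun hv j)
      simp only [d1_apply, Pi.zero_apply, Matrix.mul_zero, Matrix.mul_sum, Matrix.mul_smul,
        Matrix.mul_add, ← Matrix.mul_assoc, hg] at this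
      simpa only [d1_apply, Pi.zero_apply, Pi.smul_apply, Matrix.smul_mul, ← Matrix.mul_assoc]
        using this)
    refine ⟨f * e, ?_⟩
    ext1 i
    have := congrArg (fun M => f * M) (congrFun he i)
    simp only [d0_apply, Pi.smul_apply] at this ⊢
    rw [← Matrix.mul_assoc f g, hfg, Matrix.one_mul] at this
    rw [← this, ← Matrix.mul_assoc, hf, Matrix.mul_sub, Matrix.smul_mul, Matrix.smul_mul,
      Matrix.mul_smul, Matrix.mul_assoc, Matrix.mul_assoc]
  · intro v hv
    have hno : ∀ e : Matrix n n k, (∀ i, x i * e = ψ⁻¹⁻¹ • (e * x i)) → e = 0 := by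
      intro e he
      rw [inv_inv] at he
      by_contra hc
      obtain ⟨e', h1, h2⟩ := schur (x := ψ • x) (ev_smul_surj hψ h.surj) h.surj hc fun i => by
        rw [he, Pi.smul_apply, Matrix.mul_smul]
      have := hne (f * e') fun i => by
        rw [← Matrix.mul_assoc, hf, Matrix.smul_mul, Matrix.mul_assoc, ← Matrix.mul_smul,
          Matrix.mul_assoc]
        congr 1
        rw [← Matrix.one_mul (x i * e'), ← h2, Matrix.mul_assoc, ← Matrix.mul_assoc e,
          ← Matrix.mul_smul, ← Matrix.smul_mul, ← he, Matrix.mul_assoc, h1, Matrix.mul_one]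
      apply hf0
      rw [← Matrix.mul_one f, ← h2, ← Matrix.mul_assoc, this, Matrix.zero_mul]
    obtain ⟨e, he⟩ := self_ext_vanish h h₁ h₂ hI (inv_ne_zero hψ) hno
      (v := fun i => v i * f) (by
        ext1 j
        have := congrArg (fun M => ψ⁻¹ • (M * f)) (congrFun hv j)
        simp only [d1_apply, Pi.zero_apply, Matrix.zero_mul, Matrix.sum_mul, Matrix.smul_mul,
          Matrix.add_mul, Matrix.mul_assoc, hf, smul_zero, Finset.smul_sum, smul_add,
          Matrix.mul_smul] at this
        simp only [d1_apply, Pi.smul_apply, Matrix.smul_mul, Matrix.mul_assoc, Pi.zero_apply,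
          smul_add]
        refine Eq.trans (Finset.sum_congr rfl fun p _ => Finset.sum_congr rfl fun q _ => ?_) this
        rw [smul_comm (ψ⁻¹) (E.w j p q) (x p * (v q * f)), smul_comm (ψ⁻¹) (E.w j p q) (ψ • _),
          inv_smul_smul₀ hψ])
    refine ⟨ψ⁻¹ • (e * g), ?_⟩
    ext1 i
    have := congrArg (fun M => M * g) (congrFun he i)
    simp only [d0_apply, Pi.smul_apply] at this ⊢
    rw [Matrix.mul_assoc (v i), hfg, Matrix.mul_one] at this
    rw [← this, Matrix.sub_mul, Matrix.mul_smul, Matrix.smul_mul, Matrix.smul_mul, Matrix.smul_mul,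
      Matrix.mul_assoc e g, hg, Matrix.mul_smul, inv_smul_smul₀ hψ, Matrix.mul_assoc,
      Matrix.mul_assoc]

end Consequences

section Rigid

open Module

variable {k : Type u} [Field k] {n : Type} [Fintype n] [DecidableEq n]
variable {E : Env k} {ζ : k} {x : Fin 3 → Matrix n n k}
variable [IsAlgClosed k] [CharZero k]

lemma R1_mul_left (h : IsPt E ζ x) {f g : Matrix n n k} {μ : k}
    (hg : ∀ i, g * x i = μ • (x i * g)) (hgf : g * f = 1)
    {v : Fin 3 → Matrix n n k} (hv : (fun i => f * v i) ∈ (pen h h).R1) : v ∈ (pen h h).R1 := by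
  obtain ⟨p, q, hpq⟩ := (pen h h).mem_R1.1 hv
  refine (pen h h).mem_R1.2 ⟨μ • (g * p), g * q, ?_⟩
  ext1 i
  have := congrFun hpq i
  simp only [pen, d0_apply, Pi.add_apply, Pi.zero_apply, Matrix.mul_zero, Matrix.zero_mul,
    sub_zero, zero_sub, Matrix.mul_smul] at this ⊢
  rw [← Matrix.one_mul (v i), ← hgf, Matrix.mul_assoc g f, ← this, Matrix.mul_add, ← Matrix.mul_assoc g (x i),
    hg, Matrix.mul_neg]
  simp [Matrix.mul_assoc]

variable (h : IsPt E ζ x) (hrig : ∀ u, d1 E.w x x u = 0 → IsGauge x u) (hN : E.N = 3)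
include hrig

lemma rigid_no_intertwiner {l : k} (hl : l ≠ 0) {v : Fin 3 → Matrix n n k}
    (hv : d1 E.w (l • x) x v = 0) (hvR : v ∉ (pen h h).R1) (f : Matrix n n k)
    (hf : ∀ i, x i * f = l • (f * x i)) : f = 0 := by
  by_contra hf0
  obtain ⟨g, hfg, hgf⟩ := schur (x := l • x) (ev_smul_surj hl h.surj) h.surj hf0 fun i => by
    rw [hf, Pi.smul_apply, Matrix.mul_smul]
  have hg : ∀ i, g * x i = l • (x i * g) := fun i => by
    rw [← Matrix.mul_one (g * x i), ← hfg, ← Matrix.mul_assoc, Matrix.mul_assoc g, hf,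
      Matrix.mul_smul, Matrix.smul_mul, ← Matrix.mul_assoc g, hgf, Matrix.one_mul]
  refine hvR (R1_mul_left h hg hgf (gauge_mem_R1 h (hrig _ ?_)))
  ext1 j
  have := congrArg (fun M => f * M) (congrFun hv j)
  simp only [d1_apply, Pi.zero_apply, Matrix.mul_zero, Matrix.mul_sum, Matrix.mul_smul,
    Matrix.mul_add, Pi.smul_apply, Matrix.smul_mul] at this
  simpa only [d1_apply, ← Matrix.mul_assoc, hf, Matrix.smul_mul, Pi.zero_apply] using this

include hN

omit hrig in
lemma cube_of_cocycle {l : k} (hl : l ≠ 0) {v : Fin 3 → Matrix n n k}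
    (hv : d1 E.w (l • x) x v = 0) (hvR : v ∉ (pen h h).R1) : l ^ 3 = 1 := by
  by_contra hc
  have key := E.D.hk1 (l • x) x (h.smul hl).rel h.rel v
  have hz : ev (l • x) E.z = (l ^ E.N * ζ) • (1 : Matrix n n k) := (h.smul hl).cen
  rw [hv, map_zero, add_zero] at key
  have h1 : (fun i => cz E.z (l • x) x (v i)) = ((l ^ 3 - 1) * ζ) • v := by
    ext1 i
    rw [cz, hz, h.cen, hN]
    simp only [Matrix.smul_mul, Matrix.one_mul, Matrix.mul_smul, Matrix.mul_one, Pi.smul_apply]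
    module
  rw [h1] at key
  have hne : (l ^ 3 - 1) * ζ ≠ 0 := mul_ne_zero (sub_ne_zero.2 hc) h.hζ
  apply hvR
  rw [pen_d0 h h] at key
  rw [← inv_smul_smul₀ hne v, key]
  exact (pen h h).R1.smul_mem _ ((pen h h).R1.add_mem
    ((pen h h).R1.smul_mem _ ((pen h h).mem_R1.2 ⟨evL E.D.L1 (l • x) x v, 0, by rw [map_zero, add_zero]⟩))
    ((pen h h).mem_R1.2 ⟨0, evL E.D.L1 (l • x) x v, by rw [map_zero, zero_add]⟩))

lemma rigid_eig {l : k} (hl : l ≠ 0) {v : Fin 3 → Matrix n n k}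
    (hv : d1 E.w (l • x) x v = 0) (hvR : v ∉ (pen h h).R1) :
    l ^ 2 + l + 1 = 0 ∧ ∀ f : (pen h h).H0, ∃ c : k, (f : Matrix n n k) = c • 1 := by
  have h3 := cube_of_cocycle h hN hl hv hvR
  have hno := rigid_no_intertwiner h hrig hl hv hvR
  have hn : Nonempty n := by
    by_contra hc
    rw [not_nonempty_iff] at hc
    apply hvR
    have : v = 0 := by ext i a; exact hc.elim a
    rw [this]; exact zero_mem _
  have hl1 : l ≠ 1 := by
    rintro rfl
    exact one_ne_zero (hno 1 (by simp))
  have hω : l ^ 2 + l + 1 = 0 := by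
    have : (l - 1) * (l ^ 2 + l + 1) = 0 := by linear_combination h3
    exact (mul_eq_zero.1 this).resolve_left (sub_ne_zero.2 hl1)
  refine ⟨hω, ?_⟩
  have hP3 := psi_pow h
  rw [hN] at hP3
  have hP3' : ∀ f, psi h (psi h (psi h f)) = f := fun f => LinearMap.congr_fun hP3 f
  have k1 : ∀ f : (pen h h).H0, psi h f = l • f → f = 0 := fun f hf => by
    refine Subtype.ext (hno f fun i => ?_)
    rw [psi_rel h, hf, Submodule.coe_smul, Matrix.smul_mul]
  have k2 : ∀ f : (pen h h).H0, psi h f = (l ^ 2) • f → f = 0 := fun f hf => by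
    by_contra hf0
    have hf' : ∀ i, x i * (f : Matrix n n k) = (l ^ 2) • ((f : Matrix n n k) * x i) := fun i => by
      rw [psi_rel h, hf, Submodule.coe_smul, Matrix.smul_mul]
    have hfn : (f : Matrix n n k) ≠ 0 := fun hc => hf0 (Subtype.ext hc)
    have hl2 : l ^ 2 ≠ 0 := pow_ne_zero _ hl
    obtain ⟨g, hfg, hgf⟩ := schur (x := (l ^ 2) • x) (ev_smul_surj hl2 h.surj) h.surj hfn
      fun i => by rw [hf', Pi.smul_apply, Matrix.mul_smul]
    have hg : g = 0 := hno g fun i => by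
      have : g * x i = (l ^ 2) • (x i * g) := by
        rw [← Matrix.mul_one (g * x i), ← hfg, ← Matrix.mul_assoc, Matrix.mul_assoc g, hf',
          Matrix.mul_smul, Matrix.smul_mul, ← Matrix.mul_assoc g, hgf, Matrix.one_mul]
      rw [this, smul_smul, show l * l ^ 2 = 1 by linear_combination h3, one_smul]
    rw [hg, Matrix.mul_zero] at hfg
    exact one_ne_zero hfg.symm
  intro f
  have hfix : psi h f = f := by
    have e1 : psi h f - f = 0 := by
      refine k1 _ ?_
      rw [← sub_eq_zero]
      refine k2 _ ?_
      rw [← sub_eq_zero]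
      simp only [map_sub, map_smul, hP3', smul_sub, smul_smul]
      have a1 : l ^ 2 * l = 1 := by linear_combination h3
      have a2 : l ^ 2 = -l - 1 := by linear_combination hω
      rw [a1, a2]
      module
    exact sub_eq_zero.1 e1
  exact h.irr _ fun i => by rw [psi_rel h, hfix]

lemma rigid_lef [Nonempty n] : lef h h ≠ 0 := by
  have hone : (⟨1, one_mem_H0 h⟩ : (pen h h).H0) ≠ 0 := fun hc =>
    one_ne_zero (congrArg Subtype.val hc)
  have hp1 : (pen h h).p0 (1 : Matrix n n k) = -1 := by
    have : (psi h ⟨1, one_mem_H0 h⟩ : Matrix n n k) = 1 := by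
      obtain ⟨g, hg⟩ := h.surj 1
      have e := psi_rel h ⟨1, one_mem_H0 h⟩
      have e' : ∀ i, (psi h ⟨1, one_mem_H0 h⟩ : Matrix n n k) * x i = x i := fun i => by
        rw [← e]; exact Matrix.mul_one _
      have := (pen h h).B0_p0 (one_mem_H0 h)
      have hs := (pen h h).hs0
      have e3 : (pen h h).B0 (psi h ⟨1, one_mem_H0 h⟩ : Matrix n n k) = (pen h h).B0 1 := by
        ext1 i; simp only [pen, d0_apply, Pi.zero_apply, Matrix.zero_mul, Matrix.one_mul]
        exact congrArg (fun M => 0 - M) (e' i)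
      have e4 := congrArg (pen h h).s0 e3
      rwa [hs, hs] at e4
    rw [psi_coe] at this
    exact neg_eq_iff_eq_neg.1 this
  have hfr := (pen h h).finrank_H1 pen_finrank
  have hpos : 0 < finrank k (pen h h).H0 := by
    have := nontrivial_of_ne _ _ hone
    exact finrank_pos
  have eig : ∀ φ : k, Module.End.HasEigenvalue (pen h h).h1 φ →
      φ ≠ 0 ∧ (-φ⁻¹) ^ 2 + (-φ⁻¹) + 1 = 0 ∧
        ∀ f : (pen h h).H0, ∃ c : k, (f : Matrix n n k) = c • 1 := by
    intro φ hφ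
    obtain ⟨q, hq⟩ := hφ.exists_hasEigenvector
    obtain ⟨⟨v, hv⟩, rfl⟩ := Submodule.Quotient.mk_surjective _ q
    have hnv : v ∉ (pen h h).R1 := fun hc => hq.2 ((Submodule.Quotient.mk_eq_zero _).2 hc)
    have he : (pen h h).p1 v - φ • v ∈ (pen h h).R1 :=
      (Submodule.Quotient.eq ((pen h h).R1.submoduleOf (pen h h).Z1)).1 hq.apply_eq_smul
    obtain ⟨h0, v', hv', hZ', hA⟩ := (pen h h).exists_cocycle hv hnv he
    refine ⟨h0, rigid_eig h hrig hN (neg_ne_zero.2 (inv_ne_zero h0)) (v := v') ?_ hv'⟩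
    rw [pen_d1 h h, hA, smul_smul, neg_mul, inv_mul_cancel₀ h0, neg_one_smul, neg_add_cancel]
  have hnt : Nontrivial (pen h h).H1 := by
    rw [← finrank_pos_iff (R := k)]; omega
  obtain ⟨φ₀, hφ₀⟩ := Module.End.exists_eigenvalue (pen h h).h1
  have hsc := (eig φ₀ hφ₀).2.2
  have hH0 : finrank k (pen h h).H0 = 1 := by
    refine finrank_eq_one (⟨1, one_mem_H0 h⟩ : (pen h h).H0) hone fun f => ?_
    obtain ⟨c, hc⟩ := hsc f
    exact ⟨c, Subtype.ext hc.symm⟩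
  have hh0 : (pen h h).h0 = (-1 : k) • LinearMap.id := by
    ext1 f
    obtain ⟨c, hc⟩ := hsc f
    refine Subtype.ext ?_
    change (pen h h).p0 (f : Matrix n n k) = (-1 : k) • (f : Matrix n n k)
    rw [hc, map_smul, hp1]; simp
  have hIt : (pen h h).I3 ≤ LinearMap.ker (Matrix.traceLinearMap n k k) := by
    rintro _ ⟨v, rfl⟩
    have := pen_dual h h 1 v
    rw [(Pen.mem_H0 _).1 (one_mem_H0 h), Matrix.one_mul] at this
    rw [LinearMap.mem_ker]
    refine this.trans ?_
    simp [pr]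
  set τ : (Matrix n n k ⧸ (pen h h).I3) →ₗ[k] k :=
    (pen h h).I3.liftQ (Matrix.traceLinearMap n k k) hIt with hτ
  have hτs : Function.Surjective τ := by
    refine LinearMap.surjective (f := τ) ?_
    intro hc
    have := LinearMap.congr_fun hc ((pen h h).I3.mkQ 1)
    have h2 : τ ((pen h h).I3.mkQ 1) = Matrix.trace (1 : Matrix n n k) := rfl
    rw [h2] at this
    simp at this
  have hle := pen_I3_finrank h
  have hge := LinearMap.finrank_le_finrank_of_surjective hτs
  rw [finrank_self] at hge
  have hq1 : finrank k (Matrix n n k ⧸ (pen h h).I3) = 1 := by omega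
  have hτi : Function.Injective τ :=
    (LinearMap.injective_iff_surjective_of_finrank_eq_finrank (by rw [hq1, finrank_self])).2 hτs
  have hh2 : (pen h h).h2 = (-1 : k) • LinearMap.id := by
    ext1
    ext1 M
    apply hτi
    change Matrix.trace ((pen h h).A2 ((pen h h).s2 M)) = τ ((-1 : k) • (pen h h).I3.mkQ M)
    rw [map_smul]
    change _ = (-1 : k) • Matrix.trace M
    have : ∀ o, Matrix.trace ((pen h h).A2 o) = - Matrix.trace ((pen h h).B2 o) := by
      intro o
      simp [pen, d2_apply, trace_sum, Matrix.trace_mul_comm (x _)]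
    rw [this, (pen h h).hs3]; simp
  have hH1 : finrank k (pen h h).H1 = 2 := by omega
  rw [lef, (pen h h).lefschetz, hh0, hh2, map_smul, map_smul, LinearMap.trace_id,
    LinearMap.trace_id, hH0, hq1,
    Module.End.trace_eq_sum_roots_charpoly_of_splits (IsAlgClosed.splits _)]
  have hcard : Multiset.card ((pen h h).h1.charpoly.roots) = 2 := by
    rw [← (IsAlgClosed.splits _).natDegree_eq_card_roots, LinearMap.charpoly_natDegree, hH1]
  obtain ⟨r₁, r₂, hr⟩ := Multiset.card_eq_two.1 hcard
  have hroot : ∀ r ∈ (pen h h).h1.charpoly.roots, Module.End.HasEigenvalue (pen h h).h1 r := fun r hr => by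
    rw [Module.End.hasEigenvalue_iff_isRoot_charpoly]
    exact (Polynomial.mem_roots'.1 hr).2
  have a₁ := eig r₁ (hroot _ (by rw [hr]; simp))
  have a₂ := eig r₂ (hroot _ (by rw [hr]; simp))
  rw [hr]
  simp only [Multiset.insert_eq_cons, Multiset.sum_cons, Multiset.sum_singleton]
  have b₁ : r₁ ^ 2 - r₁ + 1 = 0 := by
    have := a₁.2.1; have := a₁.1; field_simp at *; linear_combination a₁.2.1
  have b₂ : r₂ ^ 2 - r₂ + 1 = 0 := by
    have := a₂.2.1; have := a₂.1; field_simp at *; linear_combination a₂.2.1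
  intro hc
  have e : r₂ = -2 - r₁ := by
    simp at hc; linear_combination -hc
  rw [e] at b₂
  have e2 : r₁ = -1 := by
    have : (6 : k) * (r₁ + 1) = 0 := by linear_combination b₂ - b₁
    have := (mul_eq_zero.1 this).resolve_left (by norm_num)
    linear_combination this
  rw [e2] at b₁
  norm_num at b₁

end Rigid

section Arcs

open MvPolynomial

variable {k : Type u} [Field k] {n : Type} [Fintype n] [DecidableEq n]

/-- The coefficient matrix of a polynomial matrix. -/
def mco (e : Fin 3 →₀ ℕ) : Matrix n n (MvPolynomial (Fin 3) k) →ₗ[k] Matrix n n k :=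
  (lcoeff k e).mapMatrix

lemma mco_apply (e : Fin 3 →₀ ℕ) (A : Matrix n n (MvPolynomial (Fin 3) k)) (i j : n) :
    mco e A i j = coeff e (A i j) := rfl

lemma mco_mul (e : Fin 3 →₀ ℕ) (A B : Matrix n n (MvPolynomial (Fin 3) k)) :
    mco e (A * B) = ∑ p ∈ Finset.HasAntidiagonal.antidiagonal e, mco p.1 A * mco p.2 B := by
  ext i j
  simp only [mco_apply, Matrix.mul_apply, coeff_sum, coeff_mul, Matrix.sum_apply]
  exact Finset.sum_comm

/-- All coefficients in degrees below `N` vanish. -/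
def HV (N : ℕ) (A : Matrix n n (MvPolynomial (Fin 3) k)) : Prop :=
  ∀ e : Fin 3 →₀ ℕ, e.degree < N → mco e A = 0

lemma degree_antidiagonal {e : Fin 3 →₀ ℕ} {p : (Fin 3 →₀ ℕ) × (Fin 3 →₀ ℕ)}
    (hp : p ∈ Finset.HasAntidiagonal.antidiagonal e) : p.1.degree + p.2.degree = e.degree := by
  rw [Finset.HasAntidiagonal.mem_antidiagonal] at hp
  rw [← hp, map_add]

lemma mco_mul_of_right {N : ℕ} {B : Matrix n n (MvPolynomial (Fin 3) k)} (hB : HV N B)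
    {e : Fin 3 →₀ ℕ} (he : e.degree ≤ N) (A : Matrix n n (MvPolynomial (Fin 3) k)) :
    mco e (A * B) = mco 0 A * mco e B := by
  rw [mco_mul, Finset.sum_eq_single (0, e)]
  · intro p hp hne
    have h1 := degree_antidiagonal hp
    by_cases h2 : p.1.degree = 0
    · exfalso
      apply hne
      rw [Finsupp.degree_eq_zero_iff] at h2
      rw [Finset.HasAntidiagonal.mem_antidiagonal, h2, zero_add] at hp
      exact Prod.ext h2 hp
    · rw [hB p.2 (by omega), Matrix.mul_zero]
  · intro h; exact absurd (Finset.HasAntidiagonal.mem_antidiagonal.2 (zero_add e)) h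

lemma mco_mul_of_left {N : ℕ} {A : Matrix n n (MvPolynomial (Fin 3) k)} (hA : HV N A)
    {e : Fin 3 →₀ ℕ} (he : e.degree ≤ N) (B : Matrix n n (MvPolynomial (Fin 3) k)) :
    mco e (A * B) = mco e A * mco 0 B := by
  rw [mco_mul, Finset.sum_eq_single (e, 0)]
  · intro p hp hne
    have h1 := degree_antidiagonal hp
    by_cases h2 : p.2.degree = 0
    · exfalso
      apply hne
      rw [Finsupp.degree_eq_zero_iff] at h2
      rw [Finset.HasAntidiagonal.mem_antidiagonal, h2, add_zero] at hp
      exact Prod.ext hp h2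
    · rw [hA p.1 (by omega), Matrix.zero_mul]
  · intro h; exact absurd (Finset.HasAntidiagonal.mem_antidiagonal.2 (add_zero e)) h

lemma HV.mul_left {N : ℕ} {B : Matrix n n (MvPolynomial (Fin 3) k)} (hB : HV N B)
    (A : Matrix n n (MvPolynomial (Fin 3) k)) : HV N (A * B) := fun e he => by
  rw [mco_mul_of_right hB he.le, hB e he, Matrix.mul_zero]

lemma HV.mul_right {N : ℕ} {A : Matrix n n (MvPolynomial (Fin 3) k)} (hA : HV N A)
    (B : Matrix n n (MvPolynomial (Fin 3) k)) : HV N (A * B) := fun e he => by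
  rw [mco_mul_of_left hA he.le, hA e he, Matrix.zero_mul]

lemma mco_zero_ev (X : Fin 3 → Matrix n n (MvPolynomial (Fin 3) k))
    (f : FreeAlgebra k (Fin 3)) : mco 0 (ev X f) = ev (fun i => mco 0 (X i)) f := by
  have h := map_ev (k := k) (aeval (fun _ : Fin 3 => (0 : k))) X f
  have h0 : ∀ A : Matrix n n (MvPolynomial (Fin 3) k),
      (aeval (fun _ : Fin 3 => (0 : k))).mapMatrix A = mco 0 A := fun A => by
    ext i j
    have := aeval_zero (S₁ := k) (A i j)
    exact this
  simpa only [h0] using h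

/-- The operator `M ↦ Σ_{e ∈ s} M_e t^e`. -/
def mmono (e : Fin 3 →₀ ℕ) (M : Matrix n n k) : Matrix n n (MvPolynomial (Fin 3) k) :=
  (monomial e : k →ₗ[k] _).mapMatrix M

lemma mco_mmono (e e' : Fin 3 →₀ ℕ) (M : Matrix n n k) :
    mco e (mmono e' M) = if e' = e then M else 0 := by
  ext i j
  rw [mco_apply]
  simp only [mmono, LinearMap.mapMatrix_apply, Matrix.map_apply, coeff_monomial]
  split <;> rfl

section Potential

variable {R : Type u} [CommRing R] [Algebra k R]

lemma deriv_trace_mul (D : Derivation k R R) (A B : Matrix n n R) :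
    D (trace (A * B)) = trace (A.map D * B) + trace (A * B.map D) := by
  simp only [trace, Matrix.diag, Matrix.mul_apply, map_sum, Derivation.leibniz, smul_eq_mul,
    Matrix.map_apply, ← Finset.sum_add_distrib]
  refine Finset.sum_congr rfl fun i _ => Finset.sum_congr rfl fun j _ => ?_
  ring

lemma deriv_mul (D : Derivation k R R) (A B : Matrix n n R) :
    (A * B).map D = A.map D * B + A * B.map D := by
  ext i j
  simp only [Matrix.mul_apply, map_sum, Derivation.leibniz, smul_eq_mul,
    Matrix.map_apply, ← Finset.sum_add_distrib, Matrix.add_apply]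
  refine Finset.sum_congr rfl fun i _ => ?_
  ring

lemma deriv_potential (D : Derivation k R R) {w : Fin 3 → Fin 3 → Fin 3 → k}
    (hw : ∀ i j l, w i j l = w j l i) (X : Fin 3 → Matrix n n R) :
    D (∑ j, trace (X j * relAt w X j)) = (3 : R) * ∑ j, trace ((X j).map D * relAt w X j) := by
  have h1 : ∀ Y : Fin 3 → Matrix n n R, ∑ j, trace (Y j * relAt w X j)
      = ∑ j, ∑ i, ∑ l, w j i l • trace (Y j * (X i * X l)) := fun Y => by
    refine Finset.sum_congr rfl fun j _ => ?_
    simp only [relAt, Matrix.mul_sum, trace_sum, Matrix.mul_smul, trace_smul]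
  rw [h1, h1 (fun j => (X j).map D)]
  simp only [map_sum, Derivation.map_smul, deriv_trace_mul, deriv_mul, Matrix.mul_add, trace_add,
    smul_add, Finset.sum_add_distrib]
  have h2 : ∑ j, ∑ i, ∑ l, w j i l • trace (X j * ((X i).map D * X l))
      = ∑ j, ∑ i, ∑ l, w j i l • trace ((X j).map D * (X i * X l)) := by
    rw [sum_rot]
    rw [sum_rot]
    refine Finset.sum_congr rfl fun j _ => Finset.sum_congr rfl fun i _ =>
      Finset.sum_congr rfl fun l _ => ?_
    rw [hw j i l, hw i l j]
    rw [← Matrix.mul_assoc, trace_mul_comm, trace_mul_cycle']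
  have h3 : ∑ j, ∑ i, ∑ l, w j i l • trace (X j * (X i * (X l).map D))
      = ∑ j, ∑ i, ∑ l, w j i l • trace ((X j).map D * (X i * X l)) := by
    rw [sum_rot]
    refine Finset.sum_congr rfl fun j _ => Finset.sum_congr rfl fun i _ =>
      Finset.sum_congr rfl fun l _ => ?_
    rw [hw j i l]
    rw [trace_mul_cycle', trace_mul_cycle']
  rw [h2, h3]
  ring

lemma sum_comm_rel {A : Type*} [Ring A] [Algebra k A] {w : Fin 3 → Fin 3 → Fin 3 → k}
    (hw : ∀ i j l, w i j l = w j l i) (X : Fin 3 → A) :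
    ∑ j, (X j * relAt w X j - relAt w X j * X j) = 0 := by
  rw [Finset.sum_sub_distrib, sub_eq_zero]
  simp only [relAt, Finset.mul_sum, Finset.sum_mul, mul_smul_comm, smul_mul_assoc]
  rw [sum_rot]
  refine Finset.sum_congr rfl fun j _ => Finset.sum_congr rfl fun i _ =>
      Finset.sum_congr rfl fun l _ => ?_
  rw [← hw, mul_assoc]

end Potential

variable {E : Env k} {ζ : k} {x : Fin 3 → Matrix n n k} [CharZero k]

lemma mco_potential {N : ℕ} {X : Fin 3 → Matrix n n (MvPolynomial (Fin 3) k)}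
    (hX0 : ∀ i, mco 0 (X i) = x i) (hX : ∀ j, HV N (relAt E.w X j)) {e : Fin 3 →₀ ℕ}
    (he : e.degree = N) (hN : N ≠ 0) : ∑ j, trace (x j * mco e (relAt E.w X j)) = 0 := by
  have tr_mco : ∀ (e : Fin 3 →₀ ℕ) (A : Matrix n n (MvPolynomial (Fin 3) k)),
      trace (mco e A) = coeff e (trace A) := fun e A => by
    simp [trace, coeff_sum, mco_apply]
  have h1 : ∑ j, trace (x j * mco e (relAt E.w X j))
      = coeff e (∑ j, trace (X j * relAt E.w X j)) := by
    rw [coeff_sum]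
    refine Finset.sum_congr rfl fun j _ => ?_
    rw [← tr_mco, mco_mul_of_right (hX j) he.le, hX0]
  rw [h1]
  obtain ⟨i, hi⟩ : ∃ i, e i ≠ 0 := by
    by_contra hc
    push Not at hc
    apply hN
    rw [← he, Finsupp.degree_eq_zero_iff]
    ext i; exact hc i
  obtain ⟨e', rfl⟩ : ∃ e', e = e' + Finsupp.single i 1 := by
    refine ⟨e - Finsupp.single i 1, (tsub_add_cancel_of_le ?_).symm⟩
    rw [Finsupp.single_le_iff]
    omega
  have h2 := congrArg (coeff e') (deriv_potential (pderiv i) E.hw X)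
  rw [coeff_pderiv] at h2
  have h3 : coeff e' ((3 : MvPolynomial (Fin 3) k)
      * ∑ j, trace ((X j).map (pderiv i) * relAt E.w X j)) = 0 := by
    have : (3 : MvPolynomial (Fin 3) k) = C 3 := (map_ofNat C 3).symm
    rw [this, coeff_C_mul, coeff_sum, Finset.sum_eq_zero, mul_zero]
    intro j _
    have hd : e'.degree < N := by
      rw [map_add, Finsupp.degree_single] at he
      omega
    rw [← tr_mco, mco_mul_of_right (hX j) hd.le, hX j e' hd, Matrix.mul_zero, trace_zero]
  rw [h3] at h2
  refine (mul_eq_zero.1 h2).resolve_right ?_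
  exact_mod_cast Nat.succ_ne_zero (e' i)

lemma mco_d2 {N : ℕ} {X : Fin 3 → Matrix n n (MvPolynomial (Fin 3) k)}
    (hX0 : ∀ i, mco 0 (X i) = x i) (hX : ∀ j, HV N (relAt E.w X j)) {e : Fin 3 →₀ ℕ}
    (he : e.degree = N) : d2 x x (fun j => mco e (relAt E.w X j)) = 0 := by
  have := congrArg (mco e) (sum_comm_rel E.hw X)
  rw [map_sum, map_zero] at this
  rw [d2_apply, ← this]
  refine Finset.sum_congr rfl fun j _ => ?_
  rw [map_sub, mco_mul_of_right (hX j) he.le, mco_mul_of_left (hX j) he.le, hX0]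

lemma mco_sandRel {N : ℕ} {X : Fin 3 → Matrix n n (MvPolynomial (Fin 3) k)}
    (hX0 : ∀ i, mco 0 (X i) = x i) (hX : ∀ j, HV N (relAt E.w X j)) {e : Fin 3 →₀ ℕ}
    (he : e.degree ≤ N) (L : Sand k) :
    mco e (ev X (sandRel E.w L)) = evL L x x (fun j => mco e (relAt E.w X j)) := by
  have hx : (fun i => mco 0 (X i)) = x := funext hX0
  rw [sandRel, evL_apply, map_list_sum, map_list_sum, List.map_map, List.map_map]
  refine congrArg List.sum (List.map_congr_left fun t _ => ?_)
  simp only [Function.comp_apply, map_mul, lift_rel]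
  rw [mco_mul_of_left ((hX _).mul_left _) he, mco_mul_of_right (hX _) he, mco_zero_ev,
    mco_zero_ev, hx]

lemma mco_hh2 (h : IsPt E ζ x) {N : ℕ} {X : Fin 3 → Matrix n n (MvPolynomial (Fin 3) k)}
    (hX0 : ∀ i, mco 0 (X i) = x i) (hX : ∀ j, HV N (relAt E.w X j)) {e : Fin 3 →₀ ℕ}
    (he : e.degree = N) :
    ∃ a, E.D.hh2 x x (fun j => mco e (relAt E.w X j)) = d0 x x a := by
  have h1 : ∀ e : Fin 3 →₀ ℕ, e.degree ≤ N → ∀ i,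
      mco e (ev X E.z * X i - X i * ev X E.z)
        = evL (E.D.L2 i) x x (fun j => mco e (relAt E.w X j)) := fun e he i => by
    rw [← mco_sandRel hX0 hX he, ← E.D.h2]
    simp
  have h2 : ∀ e : Fin 3 →₀ ℕ, (∀ e' : Fin 3 →₀ ℕ, e'.degree < e.degree →
      ∃ c : k, mco e' (ev X E.z) = c • (1 : Matrix n n k)) → ∀ i,
      mco e (ev X E.z * X i - X i * ev X E.z)
        = mco e (ev X E.z) * x i - x i * mco e (ev X E.z) := fun e hsc i => by
    rw [map_sub, mco_mul, mco_mul]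
    have hswap : ∑ p ∈ Finset.HasAntidiagonal.antidiagonal e, mco p.1 (X i) * mco p.2 (ev X E.z)
        = ∑ p ∈ Finset.HasAntidiagonal.antidiagonal e,
          mco p.2 (X i) * mco p.1 (ev X E.z) := by
      exact Finsupp.sum_antidiagonal_swap e fun a b => mco a (X i) * mco b (ev X E.z)
    rw [hswap, ← Finset.sum_sub_distrib, Finset.sum_eq_single (e, 0)]
    · rw [hX0]
    · intro p hp hne
      have hd := degree_antidiagonal hp
      have h0 : p.2.degree ≠ 0 := fun hc => by
        rw [Finsupp.degree_eq_zero_iff] at hc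
        rw [Finset.HasAntidiagonal.mem_antidiagonal, hc, add_zero] at hp
        exact hne (Prod.ext hp hc)
      obtain ⟨c, hc⟩ := hsc p.1 (by omega)
      rw [hc]; simp
    · intro hc; exact absurd (Finset.HasAntidiagonal.mem_antidiagonal.2 (add_zero e)) hc
  have h3 : ∀ d, d < N → ∀ e : Fin 3 →₀ ℕ, e.degree = d →
      ∃ c : k, mco e (ev X E.z) = c • (1 : Matrix n n k) := by
    intro d
    induction d using Nat.strong_induction_on with
    | _ d ih =>
      intro hd e hed
      refine h.irr _ fun i => ?_
      have e2 := h2 e (fun e' he' => ih e'.degree (by omega) (by omega) e' rfl) i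
      rw [h1 e (by omega)] at e2
      have : (fun j => mco e (relAt E.w X j)) = 0 := funext fun j => hX j e (by omega)
      rw [this, map_zero] at e2
      exact (sub_eq_zero.1 e2.symm).symm
  refine ⟨-mco e (ev X E.z), ?_⟩
  ext1 i
  have e2 := h2 e (fun e' he' => h3 _ (by omega) e' rfl) i
  rw [h1 e he.le] at e2
  rw [d0_apply]
  refine e2.trans ?_
  rw [Matrix.mul_neg, Matrix.neg_mul]
  abel

lemma exists_arc_step (h : IsPt E ζ x) {N : ℕ} (hN : N ≠ 0)
    {X : Fin 3 → Matrix n n (MvPolynomial (Fin 3) k)}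
    (hX0 : ∀ i, mco 0 (X i) = x i) (hX : ∀ j, HV N (relAt E.w X j)) :
    ∃ Y : Fin 3 → Matrix n n (MvPolynomial (Fin 3) k), (∀ i, HV N (Y i)) ∧
      ∀ j, HV (N + 1) (relAt E.w (X - Y) j) := by
  have hy : ∀ e : Fin 3 →₀ ℕ, ∃ y, e.degree = N →
      d1 E.w x x y = fun j => mco e (relAt E.w X j) := fun e => by
    by_cases he : e.degree = N
    · obtain ⟨y, hy⟩ := exists_d1_of_unobstructed h _ (mco_potential hX0 hX he hN)
        (mco_d2 hX0 hX he) (mco_hh2 h hX0 hX he)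
      exact ⟨y, fun _ => hy⟩
    · exact ⟨0, fun hc => absurd hc he⟩
  choose y hy using hy
  set Y : Fin 3 → Matrix n n (MvPolynomial (Fin 3) k) := fun i =>
    ∑ e ∈ (Finset.univ : Finset (Fin 3)).finsuppAntidiag N, mmono e (y e i) with hYd
  have hYc : ∀ e i, mco e (Y i) = if e.degree = N then y e i else 0 := fun e i => by
    rw [hYd]
    simp only [map_sum, mco_mmono, Finset.sum_ite_eq', Finset.mem_finsuppAntidiag]
    refine if_congr ?_ rfl rfl
    rw [Finsupp.degree_eq_sum]
    simp
  have hYN : ∀ i, HV N (Y i) := fun i e he => by rw [hYc, if_neg he.ne]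
  refine ⟨Y, hYN, fun j e he => ?_⟩
  have key : relAt E.w (X - Y) j = relAt E.w X j
      - ∑ i, ∑ l, E.w j i l • (X i * Y l + Y i * X l) + ∑ i, ∑ l, E.w j i l • (Y i * Y l) := by
    simp only [relAt, ← Finset.sum_sub_distrib, ← Finset.sum_add_distrib, ← smul_sub, ← smul_add,
      Pi.sub_apply]
    refine Finset.sum_congr rfl fun i _ => Finset.sum_congr rfl fun l _ => ?_
    rw [sub_mul, mul_sub, mul_sub]
    congr 1
    abel
  have hle : e.degree ≤ N := by omega
  have hY0 : ∀ i, mco 0 (Y i) = 0 := fun i => hYN i 0 (by simpa using Nat.pos_of_ne_zero hN)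
  rw [key]
  simp only [map_add, map_sub, map_sum, map_smul, mco_mul_of_right (hYN _) hle,
    mco_mul_of_left (hYN _) hle, hX0, hY0, Matrix.zero_mul, Matrix.mul_zero, smul_zero,
    Finset.sum_const_zero, add_zero]
  by_cases hd : e.degree = N
  · have := congrFun (hy e hd) j
    rw [d1_apply] at this
    simp only [hYc, if_pos hd]
    rw [this, sub_self]
  · have hlt : e.degree < N := by omega
    rw [hX j e hlt]
    simp [hYN _ e hlt]

/-- Every family of first order deformations extends to a multi-parameter deformation to any
order. -/
lemma exists_arc (h : IsPt E ζ x) (u : Fin 3 → Fin 3 → Matrix n n k)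
    (hu : ∀ a, d1 E.w x x (u a) = 0) (N : ℕ) :
    ∃ X : Fin 3 → Matrix n n (MvPolynomial (Fin 3) k), (∀ i, mco 0 (X i) = x i) ∧
      (∀ a i, mco (Finsupp.single a 1) (X i) = u a i) ∧ ∀ j, HV (N + 2) (relAt E.w X j) := by
  induction N with
  | zero =>
    set X : Fin 3 → Matrix n n (MvPolynomial (Fin 3) k) := fun i =>
      mmono 0 (x i) + ∑ a, mmono (Finsupp.single a 1) (u a i) with hXd
    have hX0 : ∀ i, mco 0 (X i) = x i := fun i => by
      simp [hXd, mco_mmono]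
    have hX1 : ∀ a i, mco (Finsupp.single a 1) (X i) = u a i := fun a i => by
      simp only [hXd, map_add, map_sum, mco_mmono]
      rw [if_neg (by simp [eq_comm]), zero_add, Finset.sum_eq_single a]
      · simp
      · intro b _ hb
        rw [if_neg]
        intro hc
        exact hb (Finsupp.single_left_injective one_ne_zero hc)
      · simp
    refine ⟨X, hX0, hX1, fun j e he => ?_⟩
    rcases Nat.lt_or_ge e.degree 1 with hd | hd
    · have : e = 0 := (Finsupp.degree_eq_zero_iff _).1 (by omega)
      subst this
      rw [relAt, ← h.rel j]
      simp only [map_sum, map_smul, mco_mul, relAt]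
      simp [hX0]
    · have hd1 : e.degree = 1 := by omega
      obtain ⟨a, rfl⟩ : ∃ a, e = Finsupp.single a 1 := by
        obtain ⟨a, ha⟩ : ∃ a, e a ≠ 0 := by
          by_contra hc
          push Not at hc
          have : e = 0 := by ext i; exact hc i
          simp [this] at hd1
        have hle : Finsupp.single a 1 ≤ e := Finsupp.single_le_iff.2 (by omega)
        obtain ⟨e', rfl⟩ := exists_add_of_le hle
        rw [map_add, Finsupp.degree_single] at hd1
        have : e' = 0 := (Finsupp.degree_eq_zero_iff _).1 (by omega)
        exact ⟨a, by rw [this, add_zero]⟩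
      have := congrFun (hu a) j
      rw [d1_apply] at this
      simp only [relAt, map_sum, map_smul, mco_mul]
      refine Eq.trans ?_ this
      refine Finset.sum_congr rfl fun i _ => Finset.sum_congr rfl fun l _ => ?_
      rw [Finsupp.antidiagonal_single]
      simp [Finset.Nat.antidiagonal_succ, hX0, hX1]
  | succ N ih =>
    obtain ⟨X, hX0, hX1, hX⟩ := ih
    obtain ⟨Y, hY, hXY⟩ := exists_arc_step h (by omega) hX0 hX
    refine ⟨X - Y, fun i => ?_, fun a i => ?_, hXY⟩
    · rw [Pi.sub_apply, map_sub, hX0, hY i 0 (by simp), sub_zero]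
    · rw [Pi.sub_apply, map_sub, hX1, hY i _ (by rw [Finsupp.degree_single]; omega), sub_zero]

end Arcs

section Filtration
variable {k : Type u} [Field k] {S : Type u} [Ring S] [Algebra k S]
  {m n : Type} [Fintype m] [DecidableEq m] [Fintype n] [DecidableEq n]

/-- Two-sided ideals, as linear subspaces. -/
def TS (W : Submodule k S) : Prop := ∀ a, ∀ f ∈ W, a * f ∈ W ∧ f * a ∈ W

lemma TS.mul {W W' : Submodule k S} (h : TS W) (h' : TS W') : TS (W * W') := fun a f hf => by
  refine ⟨?_, ?_⟩
  · induction hf using Submodule.mul_induction_on' with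
    | mem_mul_mem p hp q hq =>
      rw [← mul_assoc]; exact Submodule.mul_mem_mul (h a p hp).1 hq
    | add p _ q _ ih1 ih2 => rw [mul_add]; exact add_mem ih1 ih2
  · induction hf using Submodule.mul_induction_on' with
    | mem_mul_mem p hp q hq =>
      rw [mul_assoc]; exact Submodule.mul_mem_mul hp (h' a q hq).2
    | add p _ q _ ih1 ih2 => rw [add_mul]; exact add_mem ih1 ih2

lemma TS.pow {W : Submodule k S} (h : TS W) (j : ℕ) : TS (W ^ (j + 1)) := by
  induction j with
  | zero => simpa using h
  | succ j ih => rw [pow_succ]; exact ih.mul h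

lemma TS.mul_le_left {W W' : Submodule k S} (h : TS W) : W * W' ≤ W :=
  Submodule.mul_le.2 fun p hp q _ => (h q p hp).2

lemma TS.mul_le_right {W W' : Submodule k S} (h : TS W') : W * W' ≤ W' :=
  Submodule.mul_le.2 fun p _ q hq => (h p q hq).1

lemma TS.pow_le {W : Submodule k S} (h : TS W) {i j : ℕ} (hij : i ≤ j) :
    W ^ (j + 1) ≤ W ^ (i + 1) := by
  induction hij with
  | refl => exact le_rfl
  | step _ ih => exact le_trans (by rw [pow_succ]; exact (h.pow _).mul_le_left) ih

/-- The kernel of a representation, as a linear subspace. -/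
def K (V : S →ₐ[k] Matrix n n k) : Submodule k S := LinearMap.ker V.toLinearMap

lemma mem_K {V : S →ₐ[k] Matrix n n k} {f : S} : f ∈ K V ↔ V f = 0 := Iff.rfl

lemma ts_K (V : S →ₐ[k] Matrix n n k) : TS (K V) := fun a f hf => by
  rw [mem_K] at hf
  constructor <;> simp [mem_K, hf]

lemma sum_single_mul_single (p : n) :
    ∑ i, single i p (1 : k) * single p i 1 = (1 : Matrix n n k) := by
  simp only [single_mul_single_same, mul_one]
  ext a b
  simp only [Matrix.sum_apply, single_apply, one_apply]
  by_cases h : a = b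
  · subst h; simp
  · rw [if_neg h]
    exact Finset.sum_eq_zero fun i _ => if_neg fun hc => h (hc.1.symm.trans hc.2)

lemma single_mul_eq_sum (p i : n) (A : Matrix n n k) :
    single p i 1 * A = ∑ l, A i l • single p l (1 : k) := by
  ext a b
  simp only [Matrix.sum_apply, Matrix.smul_apply, single_apply, Matrix.mul_apply, smul_eq_mul]
  by_cases h : p = a <;> simp [h]

lemma mul_single_eq_sum (j q : n) (A : Matrix n n k) :
    A * single j q 1 = ∑ l, A l j • single l q (1 : k) := by
  ext a b
  simp only [Matrix.sum_apply, Matrix.smul_apply, single_apply, Matrix.mul_apply, smul_eq_mul]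
  by_cases h : q = b <;> simp [h]

/-- Bimodule maps to matrices detect elements of a quotient bimodule. -/
lemma exists_bimod [Nonempty m] [Nonempty n] {V : S →ₐ[k] Matrix m m k}
    {V' : S →ₐ[k] Matrix n n k} (hV : Function.Surjective V) (hV' : Function.Surjective V')
    {W W' : Submodule k S} (hW : TS W) (hl : K V * W' ≤ W) (hr : W' * K V' ≤ W)
    {f : S} (hf : f ∈ W') (hfW : f ∉ W) :
    ∃ θ : S →ₗ[k] Matrix m n k, (∀ t ∈ W, θ t = 0) ∧ θ f ≠ 0 ∧
      (∀ a, ∀ t ∈ W', θ (a * t) = V a * θ t) ∧ ∀ a, ∀ t ∈ W', θ (t * a) = θ t * V' a := by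
  obtain ⟨p0⟩ := ‹Nonempty m›
  obtain ⟨q0⟩ := ‹Nonempty n›
  choose ε hε using hV
  choose ε' hε' using hV'
  have key : ∃ i j, ε (single p0 i 1) * f * ε' (single j q0 1) ∉ W := by
    by_contra hc
    push Not at hc
    apply hfW
    have h1 : (1 - ∑ i, ε (single i p0 1) * ε (single p0 i 1)) * f ∈ W := by
      refine hl (Submodule.mul_mem_mul ?_ hf)
      simp only [mem_K, map_sub, map_one, map_sum, map_mul, hε]
      rw [sum_single_mul_single, sub_self]
    have h2 : f * (1 - ∑ j, ε' (single j q0 1) * ε' (single q0 j 1)) ∈ W := by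
      refine hr (Submodule.mul_mem_mul hf ?_)
      simp only [mem_K, map_sub, map_one, map_sum, map_mul, hε']
      rw [sum_single_mul_single, sub_self]
    have h3 : (∑ i, ε (single i p0 1) * ε (single p0 i 1)) * f
        * (∑ j, ε' (single j q0 1) * ε' (single q0 j 1)) ∈ W := by
      rw [Finset.sum_mul, Finset.sum_mul]
      refine sum_mem fun i _ => ?_
      rw [Finset.mul_sum]
      refine sum_mem fun j _ => ?_
      have := (hW (ε' (single q0 j 1)) _ (hW (ε (single i p0 1)) _ (hc i j)).1).2
      simpa only [mul_assoc] using this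
    have h4 := (hW (∑ i, ε (single i p0 1) * ε (single p0 i 1)) _ h2).1
    have h5 := add_mem h1 (add_mem h4 h3)
    convert h5 using 1
    noncomm_ring
  obtain ⟨i, j, hij⟩ := key
  obtain ⟨ℓ, hℓ, hℓW⟩ := Submodule.exists_le_ker_of_notMem hij
  have hℓ0 : ∀ t ∈ W, ℓ t = 0 := fun t ht => hℓW ht
  refine ⟨{ toFun := fun t => Matrix.of fun i j => ℓ (ε (single p0 i 1) * t * ε' (single j q0 1))
            map_add' := fun s t => by ext; simp [mul_add, add_mul]
            map_smul' := fun c t => by ext; simp }, fun t ht => ?_, fun hc => ?_,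
    fun a t ht => ?_, fun a t ht => ?_⟩
  · ext i j
    exact hℓ0 _ (hW _ _ (hW _ _ ht).1).2
  · exact hℓ (congrFun (congrFun hc i) j)
  · ext i j
    simp only [LinearMap.coe_mk, AddHom.coe_mk, of_apply, Matrix.mul_apply]
    have h1 : (ε (single p0 i 1) * a - ∑ l, V a i l • ε (single p0 l 1)) * t ∈ W := by
      refine hl (Submodule.mul_mem_mul ?_ ht)
      simp only [mem_K, map_sub, map_sum, map_mul, map_smul, hε, single_mul_eq_sum, sub_self]
    have h2 := hℓ0 _ (hW (ε' (single j q0 1)) _ h1).2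
    rw [sub_mul, sub_mul, map_sub, sub_eq_zero, Finset.sum_mul, Finset.sum_mul, map_sum,
      mul_assoc _ a] at h2
    rw [h2]
    exact Finset.sum_congr rfl fun l _ => by rw [smul_mul_assoc, smul_mul_assoc, map_smul]; rfl
  · ext i j
    simp only [LinearMap.coe_mk, AddHom.coe_mk, of_apply, Matrix.mul_apply]
    have h1 : t * (a * ε' (single j q0 1) - ∑ l, V' a l j • ε' (single l q0 1)) ∈ W := by
      refine hr (Submodule.mul_mem_mul ht ?_)
      simp only [mem_K, map_sub, map_sum, map_mul, map_smul, hε', mul_single_eq_sum, sub_self]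
    have h2 := hℓ0 _ (hW (ε (single p0 i 1)) _ h1).1
    rw [mul_sub, mul_sub, map_sub, sub_eq_zero, Finset.mul_sum, Finset.mul_sum, map_sum,
      ← mul_assoc t, ← mul_assoc, ← mul_assoc (ε _)] at h2
    rw [← mul_assoc (ε _) t a, h2]
    refine Finset.sum_congr rfl fun l _ => ?_
    rw [mul_smul_comm, mul_smul_comm, map_smul, smul_eq_mul, mul_comm, ← mul_assoc]

/-- Multiplicative sections modulo powers of the kernel. -/
structure Sect (V : S →ₐ[k] Matrix n n k) (σ : Matrix n n k →ₗ[k] S) (j : ℕ) : Prop where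
  sec : ∀ a, V (σ a) = a
  one : σ 1 = 1
  mul : ∀ a b, σ a * σ b - σ (a * b) ∈ K V ^ (j + 1)

lemma exists_sect [Nonempty n] {V : S →ₐ[k] Matrix n n k} (hV : Function.Surjective V) (j : ℕ) :
    ∃ σ, Sect V σ j := by
  induction j with
  | zero =>
    obtain ⟨σ, hσ⟩ := V.toLinearMap.exists_rightInverse_of_surjective
      (LinearMap.range_eq_top.2 hV)
    have hσ' : ∀ a, V (σ a) = a := fun a => congrArg (fun f => f a) hσ
    obtain ⟨p0⟩ := ‹Nonempty n›
    let σ' : Matrix n n k →ₗ[k] S := σ + (Matrix.entryLinearMap k k p0 p0).smulRight (1 - σ 1)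
    have h' : ∀ a, σ' a = σ a + a p0 p0 • (1 - σ 1) := fun a => rfl
    have hs : ∀ a, V (σ' a) = a := fun a => by simp [h', hσ']
    refine ⟨σ', hs, by simp [h'], fun a b => ?_⟩
    rw [zero_add, pow_one, mem_K, map_sub, map_mul, hs, hs, hs, sub_self]
  | succ j ih =>
    obtain ⟨σ, hσ⟩ := ih
    obtain ⟨p0⟩ := ‹Nonempty n›
    let c : Matrix n n k → Matrix n n k → S := fun a b => σ a * σ b - σ (a * b)
    let h : Matrix n n k →ₗ[k] S :=
      { toFun := fun a => ∑ i, c a (single i p0 1) * σ (single p0 i 1)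
        map_add' := fun a b => by
          rw [← Finset.sum_add_distrib]
          refine Finset.sum_congr rfl fun i _ => ?_
          simp only [c, map_add, add_mul, sub_mul]; abel
        map_smul' := fun r a => by
          rw [RingHom.id_apply, Finset.smul_sum]
          refine Finset.sum_congr rfl fun i _ => ?_
          simp only [c, map_smul, smul_mul_assoc, ← smul_sub] }
    have hT := ts_K V
    have hTj : TS (K V ^ (j + 1)) := hT.pow j
    have hTj' : TS (K V ^ (j + 1 + 1)) := hT.pow (j + 1)
    have hc : ∀ a b, c a b ∈ K V ^ (j + 1) := hσ.mul
    have hJ : ∀ f ∈ K V ^ (j + 1), ∀ g ∈ K V ^ (j + 1), f * g ∈ K V ^ (j + 1 + 1) := by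
      intro f hf g hg
      rw [pow_succ (K V) (j + 1)]
      refine Submodule.mul_mem_mul hf ?_
      have := hT.pow_le (Nat.zero_le j) hg
      simpa using this
    have hh : ∀ a, h a ∈ K V ^ (j + 1) := fun a => sum_mem fun i _ => (hTj _ _ (hc _ _)).2
    have hcoc : ∀ a b e, σ a * c b e + c a (b * e) = c (a * b) e + c a b * σ e :=
      fun a b e => by simp only [c, mul_assoc]; noncomm_ring
    have hV0 : ∀ f ∈ K V ^ (j + 1), V f = 0 := fun f hf => by
      have := hT.pow_le (Nat.zero_le j) hf
      simpa [mem_K] using this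
    have hunit : (∑ i, σ (single i p0 1) * σ (single p0 i 1)) - 1 ∈ K V ^ (j + 1) := by
      have : ∑ i, c (single i p0 1) (single p0 i 1) ∈ K V ^ (j + 1) := sum_mem fun i _ => hc _ _
      simp only [c, Finset.sum_sub_distrib] at this
      rwa [← map_sum, sum_single_mul_single, hσ.one] at this
    refine ⟨σ - h, fun a => ?_, ?_, fun a b => ?_⟩
    · rw [LinearMap.sub_apply, map_sub, hσ.sec, hV0 _ (hh a), sub_zero]
    · rw [LinearMap.sub_apply, hσ.one, sub_eq_self]
      refine Finset.sum_eq_zero fun i _ => ?_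
      simp [c, hσ.one]
    · -- the correction is a coboundary
      have e1 : σ a * h b - h (a * b)
          = c a b * (∑ i, σ (single i p0 1) * σ (single p0 i 1))
            - ∑ i, c a (b * single i p0 1) * σ (single p0 i 1) := by
        simp only [h, LinearMap.coe_mk, AddHom.coe_mk]
        rw [Finset.mul_sum, Finset.mul_sum, ← Finset.sum_sub_distrib, ← Finset.sum_sub_distrib]
        refine Finset.sum_congr rfl fun i _ => ?_
        rw [← mul_assoc, ← mul_assoc, ← sub_mul, ← sub_mul, sub_eq_sub_iff_add_eq_add.2]
        rw [hcoc]; abel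
      have e2 : ∑ i, c a (b * single i p0 1) * σ (single p0 i 1)
          = ∑ l, c a (single l p0 1) * σ (single p0 l 1 * b) := by
        have hlin : ∀ i, c a (b * single i p0 1) = ∑ l, b l i • c a (single l p0 1) := fun i => by
          rw [mul_single_eq_sum]
          simp only [c, map_sum, Finset.mul_sum, map_smul, mul_smul_comm, smul_sub, Finset.sum_sub_distrib]
        simp only [hlin, single_mul_eq_sum, map_sum, map_smul, Finset.sum_mul, Finset.mul_sum,
          smul_mul_assoc, mul_smul_comm]
        exact Finset.sum_comm
      have e3 : h a * σ b - ∑ l, c a (single l p0 1) * σ (single p0 l 1 * b)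
          ∈ K V ^ (j + 1 + 1) := by
        simp only [h, LinearMap.coe_mk, AddHom.coe_mk]
        rw [Finset.sum_mul, ← Finset.sum_sub_distrib]
        refine sum_mem fun l _ => ?_
        rw [mul_assoc, ← mul_sub]
        exact hJ _ (hc _ _) _ (hc _ _)
      have e4 := hJ _ (hc a b) _ hunit
      have e5 := hJ _ (hh a) _ (hh b)
      have := sub_mem e5 (add_mem e3 e4)
      convert this using 1
      rw [← e2]
      have e1' : h (a * b) = σ a * h b - (c a b * (∑ i, σ (single i p0 1) * σ (single p0 i 1))
            - ∑ i, c a (b * single i p0 1) * σ (single p0 i 1)) := by rw [← e1]; abel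
      simp only [LinearMap.sub_apply]
      rw [e1']
      simp only [mul_sub, sub_mul, mul_one]
      have : c a b = σ a * σ b - σ (a * b) := rfl
      rw [this]
      abel

end Filtration

section Structure
variable {k : Type u} [Field k] {S : Type u} [Ring S] [Algebra k S]
  {n : Type} [Fintype n] [DecidableEq n]

lemma exists_inner_of_derivation [Nonempty n] (D : Matrix n n k →ₗ[k] Matrix n n k)
    (hD : ∀ a b, D (a * b) = a * D b + D a * b) : ∃ w, ∀ a, D a = w * a - a * w := by
  obtain ⟨p⟩ := ‹Nonempty n›
  refine ⟨∑ i, D (single i p 1) * single p i 1, fun a => ?_⟩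
  have h1 : a * ∑ i, D (single i p 1) * single p i 1
      = ∑ i, D (a * single i p 1) * single p i 1 - D a := by
    rw [Finset.mul_sum, eq_sub_iff_add_eq]
    conv_lhs => rw [← mul_one (D a), ← sum_single_mul_single p, Finset.mul_sum]
    rw [← Finset.sum_add_distrib]
    refine Finset.sum_congr rfl fun i _ => ?_
    rw [hD, add_mul, mul_assoc, mul_assoc]
  have h2 : ∑ i, D (a * single i p 1) * single p i 1
      = (∑ i, D (single i p 1) * single p i 1) * a := by
    rw [Finset.sum_mul]
    simp only [mul_assoc, single_mul_eq_sum, Matrix.mul_sum, Matrix.mul_smul]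
    simp only [mul_single_eq_sum _ _ a, map_sum, map_smul, Matrix.sum_mul, Matrix.smul_mul]
    exact Finset.sum_comm
  rw [h1, h2, sub_sub_cancel]

/-- Derivations with values in the matrix bimodule of a representation. -/
def IsDer (V : S →ₐ[k] Matrix n n k) (δ : S →ₗ[k] Matrix n n k) : Prop :=
  ∀ s t, δ (s * t) = V s * δ t + δ s * V t

/-- A complete independent system of three derivations satisfying the commutativity constraint. -/
structure Frame (V : S →ₐ[k] Matrix n n k) (σ : Matrix n n k →ₗ[k] S)
    (δ : Fin 3 → S →ₗ[k] Matrix n n k) (z : S) : Prop where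
  surj : Function.Surjective V
  sect : Sect V σ 2
  der : ∀ b, IsDer V (δ b)
  sec : ∀ b a, δ b (σ a) = 0
  complete : ∀ δ', IsDer V δ' → ∃ (c : Fin 3 → k) (w : Matrix n n k),
    ∀ s, δ' s = ∑ b, c b • δ b s + (w * V s - V s * w)
  indep : ∀ c : Fin 3 → k, (∀ s, ∑ b, c b • δ b s = 0) → c = 0
  com : ∀ (φ : Fin 3 → Fin 3 → k) (ρ : S →ₗ[k] Matrix n n k),
    (∀ s t, ρ (s * t) = V s * ρ t + ρ s * V t + ∑ a, ∑ b, φ a b • (δ a s * δ b t)) →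
    φ 0 1 = φ 1 0
  zcen : ∀ s, z * s = s * z
  zK : V z = 0
  zδ : ∀ b, δ b z = if b = 2 then 1 else 0

variable {V : S →ₐ[k] Matrix n n k} {σ : Matrix n n k →ₗ[k] S}
  {δ : Fin 3 → S →ₗ[k] Matrix n n k} {z : S} [Nonempty n]

lemma IsDer.zero_of_mem_sq {δ : S →ₗ[k] Matrix n n k} (h : IsDer V δ) {f : S}
    (hf : f ∈ K V ^ 2) : δ f = 0 := by
  rw [pow_two] at hf
  induction hf using Submodule.mul_induction_on' with
  | mem_mul_mem p hp q hq => rw [h, mem_K.1 hp, mem_K.1 hq]; simp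
  | add p _ q _ ih1 ih2 => rw [map_add, ih1, ih2, add_zero]

lemma K_pow_le {i j : ℕ} (hi : i ≠ 0) (hij : i ≤ j) : K V ^ j ≤ K V ^ i := by
  obtain ⟨i, rfl⟩ := Nat.exists_eq_succ_of_ne_zero hi
  obtain ⟨j, rfl⟩ := Nat.exists_eq_succ_of_ne_zero (show j ≠ 0 by omega)
  exact (ts_K V).pow_le (by omega)

lemma K_pow_ts {i : ℕ} (hi : i ≠ 0) : TS (K V ^ i) := by
  obtain ⟨i, rfl⟩ := Nat.exists_eq_succ_of_ne_zero hi
  exact (ts_K V).pow i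

lemma K_pow_mul {i j l : ℕ} (h : i + j = l) {f g : S} (hf : f ∈ K V ^ i) (hg : g ∈ K V ^ j) :
    f * g ∈ K V ^ l := by
  rw [← h, pow_add]; exact Submodule.mul_mem_mul hf hg

lemma Frame.mem_sq (F : Frame V σ δ z) {f : S} (hf : V f = 0) (hδ : ∀ b, δ b f = 0) :
    f ∈ K V ^ 2 := by
  by_contra hc
  obtain ⟨θ, h0, hθ, hl, hr⟩ := exists_bimod F.surj F.surj (K_pow_ts (V := V) two_ne_zero)
    (W' := K V) (by rw [pow_two]) (by rw [pow_two]) (mem_K.2 hf) hc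
  have hs := F.sect.sec
  have hk : ∀ s, s - σ (V s) ∈ K V := fun s => by rw [mem_K, map_sub, hs, sub_self]
  let δ' : S →ₗ[k] Matrix n n k := θ ∘ₗ (LinearMap.id - σ ∘ₗ V.toLinearMap)
  have hδ' : ∀ s, δ' s = θ (s - σ (V s)) := fun s => rfl
  obtain ⟨c, w, h⟩ := F.complete δ' fun s t => by
    have e : s * t - σ (V (s * t)) = s * (t - σ (V t)) + (s - σ (V s)) * σ (V t)
        + (σ (V s) * σ (V t) - σ (V s * V t)) := by
      rw [map_mul]; noncomm_ring
    rw [hδ', e, map_add, map_add, hl _ _ (hk t), hr _ _ (hk s), hs,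
      h0 _ (K_pow_le two_ne_zero (by norm_num) (F.sect.mul _ _)), add_zero]
    rfl
  have := h f
  rw [hδ', hf, map_zero, sub_zero] at this
  apply hθ
  rw [this]
  simp [hδ]

lemma Frame.exists_coord (F : Frame V σ δ z) (a : Fin 3) :
    ∃ f, V f = 0 ∧ ∀ b, δ b f = if b = a then 1 else 0 := by
  let W : Submodule k (Fin 3 → k) :=
    { carrier := {c | ∃ f, V f = 0 ∧ ∀ b, δ b f = c b • (1 : Matrix n n k)}
      add_mem' := by
        rintro c c' ⟨f, hf, hc⟩ ⟨f', hf', hc'⟩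
        exact ⟨f + f', by rw [map_add, hf, hf', add_zero], fun b => by
          rw [map_add, hc, hc', Pi.add_apply, add_smul]⟩
      zero_mem' := ⟨0, map_zero V, fun b => by simp⟩
      smul_mem' := by
        rintro r c ⟨f, hf, hc⟩
        exact ⟨r • f, by rw [map_smul, hf, smul_zero], fun b => by
          rw [map_smul, hc, Pi.smul_apply, smul_eq_mul, mul_smul]⟩ }
  have hW : W = ⊤ := by
    by_contra hne
    obtain ⟨ℓ, hℓ0, hℓ⟩ := Submodule.exists_le_ker_of_lt_top W (lt_top_iff_ne_top.2 hne)
    apply hℓ0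
    have hs := F.sect.sec
    obtain ⟨p⟩ := ‹Nonempty n›
    have hsum : ∀ y, ℓ y = ∑ b, ℓ (Pi.single b 1) * y b := fun y => by
      conv_lhs => rw [← Finset.univ_sum_single y, map_sum]
      refine Finset.sum_congr rfl fun b _ => ?_
      rw [mul_comm, ← smul_eq_mul, ← map_smul, ← Pi.single_smul, smul_eq_mul, mul_one]
    have h1 : ∀ f, V f = 0 → ∑ b, ℓ (Pi.single b 1) • δ b f = 0 := by
      intro f hf
      ext i j
      have hmem : (fun b => δ b f i j) ∈ W := by
        refine ⟨∑ l, σ (single l i 1) * f * σ (single j l 1), ?_, fun b => ?_⟩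
        · simp [hf]
        · simp only [map_sum, F.der b _ _, map_mul, hs, hf, F.sec, mul_zero, add_zero, zero_add]
          simp only [single_mul_mul_single, one_mul, mul_one]
          rw [← Matrix.sum_single_one, Finset.smul_sum]
          exact Finset.sum_congr rfl fun l _ => by rw [smul_single, smul_eq_mul, mul_one]
      have h2 : ℓ (fun b => δ b f i j) = 0 := hℓ hmem
      rw [hsum] at h2
      simpa [Matrix.sum_apply] using h2
    have h3 := F.indep (fun b => ℓ (Pi.single b 1)) fun s => by
      have h := h1 (s - σ (V s)) (by rw [map_sub, hs, sub_self])
      simpa [F.sec] using h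
    refine LinearMap.pi_ext' fun b => LinearMap.ext_ring ?_
    simpa using congrFun h3 b
  have : Pi.single a (1 : k) ∈ W := hW ▸ trivial
  obtain ⟨f, hf, h⟩ := this
  refine ⟨f, hf, fun b => ?_⟩
  rw [h, Pi.single_apply, ite_smul, one_smul, zero_smul]

lemma Frame.exists_params (F : Frame V σ δ z) : ∃ s : Fin 3 → S, s 2 = z ∧ (∀ a, V (s a) = 0) ∧
    (∀ a b, δ b (s a) = if b = a then 1 else 0) ∧
    ∀ a c, s a * σ c - σ c * s a ∈ K V ^ 3 := by
  choose f hf hδ using F.exists_coord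
  have hs := F.sect.sec
  obtain ⟨p⟩ := ‹Nonempty n›
  have hKu : ∀ u, V u = 0 → ∀ g ∈ K V ^ 3, u * g ∈ K V ^ 3 ∧ g * u ∈ K V ^ 3 := fun u _ g hg =>
    K_pow_ts (V := V) three_ne_zero u g hg
  let g : Fin 3 → S := fun a => ∑ i, σ (single i p 1) * f a * σ (single p i 1)
  have hgV : ∀ a, V (g a) = 0 := fun a => by simp [g, hf]
  have hgδ : ∀ a b, δ b (g a) = if b = a then 1 else 0 := fun a b => by
    simp only [g, map_sum, F.der b _ _, map_mul, hs, hf, F.sec, mul_zero, add_zero, zero_add, hδ]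
    split_ifs
    · simp only [mul_one, sum_single_mul_single]
    · simp
  have hgc : ∀ a c, g a * σ c - σ c * g a ∈ K V ^ 3 := fun a c => by
    have h1 : ∑ i, σ (single i p 1) * f a * (σ (single p i 1) * σ c - σ (single p i 1 * c))
        ∈ K V ^ 3 := sum_mem fun i _ =>
      (K_pow_ts (V := V) three_ne_zero _ _ (F.sect.mul _ _)).1
    have h2 : ∑ i, (σ c * σ (single i p 1) - σ (c * single i p 1)) * (f a * σ (single p i 1))
        ∈ K V ^ 3 := sum_mem fun i _ =>
      (K_pow_ts (V := V) three_ne_zero _ _ (F.sect.mul _ _)).2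
    have h3 : ∑ i, σ (single i p 1) * f a * σ (single p i 1 * c)
        = ∑ i, σ (c * single i p 1) * (f a * σ (single p i 1)) := by
      simp only [single_mul_eq_sum, mul_single_eq_sum, map_sum, map_smul, Finset.mul_sum,
        Finset.sum_mul, mul_smul_comm, smul_mul_assoc, mul_assoc]
      exact Finset.sum_comm
    have h4 := sub_mem h1 h2
    simp only [mul_sub, sub_mul, Finset.sum_sub_distrib] at h4
    rw [h3] at h4
    convert h4 using 1
    simp only [g, Finset.sum_mul, Finset.mul_sum, mul_assoc]
    abel
  refine ⟨fun a => if a = 2 then z else g a, by simp, fun a => ?_, fun a b => ?_, fun a c => ?_⟩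
  · dsimp only; split_ifs
    exacts [F.zK, hgV a]
  · dsimp only
    by_cases ha : a = 2
    · rw [if_pos ha, F.zδ, ha]
    · rw [if_neg ha, hgδ]
  · dsimp only
    split_ifs
    · rw [F.zcen, sub_self]; exact zero_mem _
    · exact hgc a c

/-- Local coordinates at a representation. -/
structure Coord (V : S →ₐ[k] Matrix n n k) (σ : Matrix n n k →ₗ[k] S)
    (δ : Fin 3 → S →ₗ[k] Matrix n n k) (z : S) (s : Fin 3 → S) : Prop extends Frame V σ δ z where
  s2 : s 2 = z
  sK : ∀ a, V (s a) = 0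
  sδ : ∀ a b, δ b (s a) = if b = a then 1 else 0
  sσ : ∀ a c, s a * σ c - σ c * s a ∈ K V ^ 3

variable {s : Fin 3 → S}

lemma Coord.rem_mem (C : Coord V σ δ z s) (f : S) :
    f - σ (V f) - ∑ a, σ (δ a f) * s a ∈ K V ^ 2 := by
  have hs := C.sect.sec
  refine C.mem_sq ?_ fun b => ?_
  · simp [hs, C.sK]
  · simp only [map_sub, map_sum, C.der b _ _, C.sδ, C.sec, hs, sub_zero, zero_mul, add_zero]
    rw [Finset.sum_eq_single b]
    · simp
    · intro a _ hab; rw [if_neg (Ne.symm hab), mul_zero]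
    · simp

lemma scalar_of_comm (M : Matrix n n k) (h : ∀ a, a * M = M * a) :
    ∃ c : k, M = c • (1 : Matrix n n k) := by
  obtain ⟨c, hc⟩ := mem_range_scalar_of_commute_single (M := M) fun i j _ => h _
  exact ⟨c, by rw [← hc]; ext i j; simp [one_apply, diagonal_apply]⟩

lemma Coord.comm01 (C : Coord V σ δ z s) : s 0 * s 1 - s 1 * s 0 ∈ K V ^ 3 := by
  by_contra hc
  have hs := C.sect.sec
  have hss : ∀ a b, s a * s b ∈ K V ^ 2 := fun a b =>
    K_pow_mul (i := 1) (j := 1) rfl (by rw [pow_one]; exact C.sK a)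
      (by rw [pow_one]; exact C.sK b)
  obtain ⟨θ, h0, hθ, hl, hr⟩ := exists_bimod C.surj C.surj (K_pow_ts (V := V) three_ne_zero)
    (W' := K V ^ 2) (by rw [← pow_succ']) (by rw [← pow_succ])
    (sub_mem (hss 0 1) (hss 1 0)) hc
  have h3 : ∀ f g, f - g ∈ K V ^ 3 → θ f = θ g := fun f g h => by
    rw [← sub_eq_zero, ← map_sub, h0 _ h]
  have T3 := K_pow_ts (V := V) three_ne_zero
  have hφ : ∀ a b, ∃ c : k, θ (s a * s b) = c • (1 : Matrix n n k) := fun a b => by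
    refine scalar_of_comm _ fun c => ?_
    have e1 := hl (σ c) _ (hss a b)
    have e2 := hr (σ c) _ (hss a b)
    rw [hs] at e1 e2
    rw [← e1, ← e2]
    refine (h3 _ _ ?_).symm
    have := add_mem (T3 (s a) _ (C.sσ b c)).1 (T3 (s b) _ (C.sσ a c)).2
    convert this using 1
    noncomm_ring
  choose φ hφ using hφ
  let Nf : S →ₗ[k] S := LinearMap.id - σ ∘ₗ V.toLinearMap
    - ∑ a, (LinearMap.mulRight k (s a)) ∘ₗ σ ∘ₗ δ a
  have hN : ∀ f, Nf f = f - σ (V f) - ∑ a, σ (δ a f) * s a := fun f => by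
    simp [Nf, LinearMap.sum_apply]
  have hN2 : ∀ f, Nf f ∈ K V ^ 2 := fun f => by rw [hN]; exact C.rem_mem f
  have key := C.com φ (θ ∘ₗ Nf) fun f g => by
    simp only [LinearMap.comp_apply]
    rw [← hl _ _ (hN2 g), ← hs (V g), ← hr _ _ (hN2 f)]
    have hφ2 : ∀ a b, φ a b • (δ a f * δ b g) = θ (σ (δ a f) * σ (δ b g) * (s a * s b)) :=
      fun a b => by
        rw [hl _ _ (hss a b), hφ, map_mul, hs, hs, mul_smul_comm, mul_one]
    simp only [hφ2, ← map_sum, ← map_add]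
    refine h3 _ _ ?_
    have p1 := C.sect.mul (V f) (V g)
    have p2 := fun b => (T3 (s b) _ (C.sect.mul (V f) (δ b g))).2
    have p3 : ∀ b, Nf f * σ (δ b g) * s b ∈ K V ^ 3 := fun b =>
      K_pow_mul (i := 2) (j := 1) rfl ((K_pow_ts (V := V) two_ne_zero _ _ (hN2 f)).2)
        (by rw [pow_one]; exact C.sK b)
    have p4 := fun a => (T3 (σ (δ a f)) _ (C.sσ a (V g))).1
    have p5 := fun a => (T3 (s a) _ (C.sect.mul (δ a f) (V g))).2
    have p6 := fun a b => (T3 (s b) _ (T3 (σ (δ a f)) _ (C.sσ a (δ b g))).1).2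
    have hsum := add_mem (add_mem (add_mem p1 (sum_mem fun b (_ : b ∈ Finset.univ) =>
        add_mem (p2 b) (p3 b)))
      (sum_mem fun a (_ : a ∈ Finset.univ) => add_mem (p4 a) (p5 a)))
      (sum_mem fun a (_ : a ∈ Finset.univ) => sum_mem fun b (_ : b ∈ Finset.univ) => p6 a b)
    convert hsum using 1
    have hNf : f = σ (V f) + ∑ a, σ (δ a f) * s a + Nf f := by rw [hN]; abel
    rw [hN (f * g), hN g]
    simp only [C.der _ f g, map_mul, map_add]
    generalize Nf f = N at *
    generalize σ (V f * V g) = u0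
    simp only [Finset.sum_add_distrib, Finset.mul_sum, mul_sub, sub_mul, add_mul,
      Finset.sum_sub_distrib, mul_assoc]
    have q1 : f * σ (V g) = σ (V f) * σ (V g) + ∑ a, σ (δ a f) * (s a * σ (V g))
        + N * σ (V g) := by
      conv_lhs => rw [hNf]
      simp only [add_mul, Finset.sum_mul, mul_assoc]
    have q2 : ∑ b, f * (σ (δ b g) * s b) = ∑ b, σ (V f) * (σ (δ b g) * s b)
        + ∑ a, ∑ b, σ (δ a f) * (s a * (σ (δ b g) * s b)) + ∑ b, N * (σ (δ b g) * s b) := by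
      rw [Finset.sum_comm, ← Finset.sum_add_distrib, ← Finset.sum_add_distrib]
      refine Finset.sum_congr rfl fun b _ => ?_
      conv_lhs => rw [hNf]
      simp only [add_mul, Finset.sum_mul, mul_assoc]
    rw [q1, q2]
    abel
  apply hθ
  rw [map_sub, hφ, hφ, key, sub_self]

end Structure

section Structure
variable {k : Type u} [Field k] {S : Type u} [Ring S] [Algebra k S]
  {n : Type} [Fintype n] [DecidableEq n] [Nonempty n]
  {V : S →ₐ[k] Matrix n n k} {σ : Matrix n n k →ₗ[k] S}
  {δ : Fin 3 → S →ₗ[k] Matrix n n k} {z : S} {s : Fin 3 → S}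

lemma Coord.comm (C : Coord V σ δ z s) (a b : Fin 3) : s a * s b - s b * s a ∈ K V ^ 3 := by
  have h2 : ∀ f, s 2 * f - f * s 2 ∈ K V ^ 3 := fun f => by
    rw [C.s2, C.zcen, sub_self]; exact zero_mem _
  have hneg : ∀ f g : S, f - g ∈ K V ^ 3 → g - f ∈ K V ^ 3 := fun f g h => by
    rw [← neg_sub]; exact neg_mem h
  have h01 := C.comm01
  have h0 : ∀ f : S, f - f ∈ K V ^ 3 := fun f => by rw [sub_self]; exact zero_mem _
  fin_cases a <;> fin_cases b
  exacts [h0 _, h01, hneg _ _ (h2 _), hneg _ _ h01, h0 _, hneg _ _ (h2 _), h2 _, h2 _, h2 _]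

/-- Products of parameters. -/
def lp (s : Fin 3 → S) (l : List (Fin 3)) : S := (l.map s).prod

@[simp] lemma lp_nil (s : Fin 3 → S) : lp s [] = 1 := rfl

@[simp] lemma lp_cons (s : Fin 3 → S) (a : Fin 3) (l : List (Fin 3)) :
    lp s (a :: l) = s a * lp s l := by simp [lp]

lemma Coord.sK1 (C : Coord V σ δ z s) (a : Fin 3) : s a ∈ K V ^ 1 := by
  rw [pow_one]; exact C.sK a

lemma Coord.lp_mem (C : Coord V σ δ z s) (l : List (Fin 3)) : lp s l ∈ K V ^ l.length := by
  induction l with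
  | nil => exact Submodule.mem_one.2 ⟨1, map_one _⟩
  | cons a l ih =>
    rw [lp_cons, List.length_cons]
    exact K_pow_mul (add_comm _ _) (C.sK1 a) ih

lemma Coord.lp_perm (C : Coord V σ δ z s) {l l' : List (Fin 3)} (h : l.Perm l') :
    lp s l - lp s l' ∈ K V ^ (l.length + 1) := by
  induction h with
  | nil => simp
  | cons a _ ih =>
    rw [lp_cons, lp_cons, ← mul_sub, List.length_cons]
    exact K_pow_mul (add_comm _ _) (C.sK1 a) ih
  | swap a b l =>
    rw [lp_cons, lp_cons, lp_cons, lp_cons, ← mul_assoc, ← mul_assoc, ← sub_mul]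
    exact K_pow_mul (by simp; ring) (C.comm b a) (C.lp_mem l)
  | trans h1 _ ih1 ih2 =>
    rw [← h1.length_eq] at ih2
    simpa using add_mem ih1 ih2

/-- Monomials in the parameters. -/
def mon (s : Fin 3 → S) (e : Fin 3 →₀ ℕ) : S := lp s (Finsupp.toMultiset e).toList

lemma length_toList (e : Fin 3 →₀ ℕ) : (Finsupp.toMultiset e).toList.length = e.degree := by
  rw [Multiset.length_toList, Finsupp.card_toMultiset]
  rfl

lemma Coord.mon_mem (C : Coord V σ δ z s) (e : Fin 3 →₀ ℕ) : mon s e ∈ K V ^ e.degree := by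
  rw [← length_toList e]; exact C.lp_mem _

lemma Coord.mul_mon (C : Coord V σ δ z s) (a : Fin 3) (e : Fin 3 →₀ ℕ) :
    s a * mon s e - mon s (Finsupp.single a 1 + e) ∈ K V ^ (e.degree + 2) := by
  rw [mon, ← lp_cons]
  have := C.lp_perm (l := a :: (Finsupp.toMultiset e).toList)
    (l' := (Finsupp.toMultiset (Finsupp.single a 1 + e)).toList) (by
      rw [← Multiset.coe_eq_coe, ← Multiset.cons_coe, Multiset.coe_toList, Multiset.coe_toList,
        map_add, Finsupp.toMultiset_single, one_nsmul, Multiset.singleton_add])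
  rwa [List.length_cons, length_toList] at this

/-- Exponents of a given degree. -/
def expo (i : ℕ) : Finset (Fin 3 →₀ ℕ) := (Finset.univ : Finset (Fin 3)).finsuppAntidiag i

lemma mem_expo {i : ℕ} {e : Fin 3 →₀ ℕ} : e ∈ expo i ↔ e.degree = i := by
  rw [expo, Finset.mem_finsuppAntidiag, Finsupp.degree_eq_sum]
  simp

/-- Homogeneous polynomials in the parameters. -/
def hpoly (σ : Matrix n n k →ₗ[k] S) (s : Fin 3 → S) (i : ℕ) :
    ((Fin 3 →₀ ℕ) → Matrix n n k) →ₗ[k] S where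
  toFun c := ∑ e ∈ expo i, σ (c e) * mon s e
  map_add' c c' := by simp [add_mul, Finset.sum_add_distrib]
  map_smul' r c := by simp [Finset.smul_sum]

lemma hpoly_apply (i : ℕ) (c : (Fin 3 →₀ ℕ) → Matrix n n k) :
    hpoly σ s i c = ∑ e ∈ expo i, σ (c e) * mon s e := rfl

lemma mon_mem_hpoly {i : ℕ} {e : Fin 3 →₀ ℕ} (he : e.degree = i) (c : Matrix n n k) :
    σ c * mon s e ∈ LinearMap.range (hpoly σ s i) := by
  refine ⟨Pi.single e c, ?_⟩
  rw [hpoly_apply, Finset.sum_eq_single e]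
  · simp
  · intro b _ hb; rw [Pi.single_eq_of_ne hb]; simp
  · intro h; exact absurd (mem_expo.2 he) h

lemma Coord.pow_le (C : Coord V σ δ z s) {i : ℕ} (hi : i ≠ 0) :
    K V ^ i ≤ LinearMap.range (hpoly σ s i) ⊔ K V ^ (i + 1) := by
  have hone : ∀ f ∈ K V, f - ∑ a, σ (δ a f) * s a ∈ K V ^ 2 := fun f hf => by
    have := C.rem_mem f
    rwa [mem_K.1 hf, map_zero, sub_zero] at this
  obtain ⟨i, rfl⟩ := Nat.exists_eq_succ_of_ne_zero hi
  clear hi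
  induction i with
  | zero =>
    intro f hf
    rw [Nat.succ_eq_add_one, zero_add, pow_one] at hf
    have h1 := hone f hf
    rw [← add_sub_cancel (∑ a, σ (δ a f) * s a) f]
    refine Submodule.add_mem_sup (sum_mem fun a _ => ?_) h1
    have := mon_mem_hpoly (σ := σ) (s := s) (i := 1) (e := Finsupp.single a 1) (by simp) (δ a f)
    simpa [mon, lp] using this
  | succ i ih =>
    rw [Nat.succ_eq_add_one, pow_succ', Submodule.mul_le]
    intro p hp q hq
    have hp1 : p ∈ K V ^ 1 := by rwa [pow_one]
    obtain ⟨u, hu, v, hv, rfl⟩ := Submodule.mem_sup.1 (ih hq)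
    rw [mul_add]
    refine add_mem ?_ (Submodule.mem_sup_right (K_pow_mul (by omega) hp1 hv))
    obtain ⟨c, rfl⟩ := hu
    rw [hpoly_apply, Finset.mul_sum]
    refine sum_mem fun e he => ?_
    rw [mem_expo] at he
    have hme := C.mon_mem e
    rw [he] at hme
    rw [← sub_add_cancel p (∑ a, σ (δ a p) * s a), add_mul]
    have T : ∀ j, TS (K V ^ (j + 1)) := (ts_K V).pow
    refine add_mem (Submodule.mem_sup_right ?_) ?_
    · rw [← mul_assoc]
      exact K_pow_mul (by omega) (T 1 _ _ (hone p hp)).2 hme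
    · rw [Finset.sum_mul]
      refine sum_mem fun a _ => ?_
      have h1 : σ (δ a p) * (s a * σ (c e) - σ (c e) * s a) * mon s e ∈ K V ^ (i + 1 + 1 + 1) :=
        K_pow_le (by omega) (by omega) (K_pow_mul (l := 3 + (i + 1)) rfl
          (T 2 _ _ (C.sσ a (c e))).1 hme)
      have h2 : (σ (δ a p) * σ (c e) - σ (δ a p * c e)) * s a * mon s e
          ∈ K V ^ (i + 1 + 1 + 1) :=
        K_pow_le (by omega) (by omega) (K_pow_mul (l := 3 + (i + 1)) rfl
          (T 2 _ _ (C.sect.mul _ _)).2 hme)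
      have h3 : σ (δ a p * c e) * (s a * mon s e - mon s (Finsupp.single a 1 + e))
          ∈ K V ^ (i + 1 + 1 + 1) := by
        have := C.mul_mon a e
        rw [he] at this
        exact (T (i + 2) _ _ this).1
      have h4 := mon_mem_hpoly (σ := σ) (s := s) (i := i + 1 + 1)
        (e := Finsupp.single a 1 + e) (by rw [map_add, Finsupp.degree_single, he]; omega)
        (δ a p * c e)
      have := Submodule.add_mem_sup h4 (add_mem (add_mem h1 h2) h3)
      convert this using 1
      noncomm_ring

/-- Jets of a deformation of a representation. -/
structure Jet (V : S →ₐ[k] Matrix n n k) (δ : Fin 3 → S →ₗ[k] Matrix n n k) (J : ℕ)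
    (Φ : (Fin 3 →₀ ℕ) → S →ₗ[k] Matrix n n k) : Prop where
  zero : ∀ f, Φ 0 f = V f
  one : ∀ a f, Φ (Finsupp.single a 1) f = δ a f
  mul : ∀ e : Fin 3 →₀ ℕ, e.degree < J → ∀ f g,
    Φ e (f * g) = ∑ p ∈ Finset.HasAntidiagonal.antidiagonal e, Φ p.1 f * Φ p.2 g

variable {J : ℕ} {Φ : (Fin 3 →₀ ℕ) → S →ₗ[k] Matrix n n k}

lemma Jet.eq_zero (H : Jet V δ J Φ) {i : ℕ} (hi : i ≠ 0) {f : S} (hf : f ∈ K V ^ i)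
    {e : Fin 3 →₀ ℕ} (he : e.degree < i) (heJ : e.degree < J) : Φ e f = 0 := by
  obtain ⟨i, rfl⟩ := Nat.exists_eq_succ_of_ne_zero hi
  clear hi
  induction i generalizing f e with
  | zero =>
    have : e = 0 := (Finsupp.degree_eq_zero_iff _).1 (by omega)
    rw [this, H.zero]
    rwa [Nat.succ_eq_add_one, zero_add, pow_one] at hf
  | succ i ih =>
    rw [Nat.succ_eq_add_one, pow_succ'] at hf
    induction hf using Submodule.mul_induction_on' with
    | mem_mul_mem p hp q hq =>
      rw [H.mul e heJ]
      refine Finset.sum_eq_zero fun d hd => ?_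
      have hdeg := degree_antidiagonal hd
      by_cases h0 : d.1.degree = 0
      · rw [(Finsupp.degree_eq_zero_iff _).1 h0, H.zero, mem_K.1 hp, zero_mul]
      · rw [ih (f := q) (e := d.2) (by omega) hq (by omega), mul_zero]
    | add p _ q _ ih1 ih2 => rw [map_add, ih1, ih2, add_zero]

lemma exists_single_add {e : Fin 3 →₀ ℕ} (he : e.degree = 1) : ∃ a, e = Finsupp.single a 1 := by
  obtain ⟨a, ha⟩ : ∃ a, e a ≠ 0 := by
    by_contra hc
    push Not at hc
    have : e = 0 := by ext i; exact hc i
    simp [this] at he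
  have hle : Finsupp.single a 1 ≤ e := Finsupp.single_le_iff.2 (by omega)
  obtain ⟨e', rfl⟩ := exists_add_of_le hle
  rw [map_add, Finsupp.degree_single] at he
  have : e' = 0 := (Finsupp.degree_eq_zero_iff _).1 (by omega)
  exact ⟨a, by rw [this, add_zero]⟩

lemma toMultiset_cons (a : Fin 3) (e : Fin 3 →₀ ℕ) :
    Finsupp.toMultiset (Finsupp.single a 1 + e) = a ::ₘ Finsupp.toMultiset e := by
  rw [map_add, Finsupp.toMultiset_single, one_nsmul, Multiset.singleton_add]

lemma toMultiset_cons_iff (a : Fin 3) (e : Fin 3 →₀ ℕ) (l : List (Fin 3)) :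
    Finsupp.toMultiset (Finsupp.single a 1 + e) = ((a :: l : List (Fin 3)) : Multiset (Fin 3)) ↔
      Finsupp.toMultiset e = (l : Multiset (Fin 3)) := by
  rw [toMultiset_cons, ← Multiset.cons_coe]
  exact Multiset.cons_inj_right a

lemma Coord.jet_lp (C : Coord V σ δ z s) (H : Jet V δ J Φ) (l : List (Fin 3))
    (hl : l.length < J) (e : Fin 3 →₀ ℕ) (he : e.degree = l.length) :
    Φ e (lp s l) = if Finsupp.toMultiset e = (l : Multiset (Fin 3)) then 1 else 0 := by
  induction l generalizing e with
  | nil =>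
    have : e = 0 := (Finsupp.degree_eq_zero_iff _).1 (by simpa using he)
    rw [this, H.zero]; simp
  | cons a l ih =>
    rw [List.length_cons] at he hl
    rw [lp_cons, H.mul e (by omega)]
    have hz : ∀ d ∈ Finset.HasAntidiagonal.antidiagonal e, d.1 ≠ Finsupp.single a 1 →
        Φ d.1 (s a) * Φ d.2 (lp s l) = 0 := fun d hd hne => by
      have hdeg := degree_antidiagonal hd
      rcases Nat.lt_trichotomy d.1.degree 1 with h | h | h
      · rw [(Finsupp.degree_eq_zero_iff d.1).1 (by omega), H.zero, C.sK, zero_mul]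
      · obtain ⟨b, hb⟩ := exists_single_add h
        rw [hb, H.one, C.sδ, if_neg, zero_mul]
        rintro rfl; exact hne hb
      · rw [H.eq_zero (f := lp s l) (i := l.length) _ (C.lp_mem l) (by omega) (by omega), mul_zero]
        omega
    by_cases hle : Finsupp.single a 1 ≤ e
    · obtain ⟨e', rfl⟩ := exists_add_of_le hle
      rw [map_add, Finsupp.degree_single] at he
      rw [Finset.sum_eq_single (Finsupp.single a 1, e')]
      · rw [H.one, C.sδ, if_pos rfl, one_mul, ih (by omega) e' (by omega)]
        exact if_congr (toMultiset_cons_iff a e' l).symm rfl rfl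
      · intro d hd hne
        refine hz d hd fun hc => hne ?_
        rw [Finset.HasAntidiagonal.mem_antidiagonal, hc] at hd
        exact Prod.ext hc (add_left_cancel hd)
      · intro h
        exact (h (Finset.HasAntidiagonal.mem_antidiagonal.2 (by simp))).elim
    · rw [if_neg]
      · refine Finset.sum_eq_zero fun d hd => hz d hd fun hc => hle ?_
        rw [Finset.HasAntidiagonal.mem_antidiagonal] at hd
        rw [← hc, ← hd]; exact le_self_add
      · intro hc
        apply hle
        have hmem : a ∈ Finsupp.toMultiset e := by rw [hc]; simp
        rw [Finsupp.mem_toMultiset] at hmem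
        rw [Finsupp.single_le_iff]
        have := Finsupp.mem_support_iff.1 hmem
        omega

lemma Coord.jet_term (C : Coord V σ δ z s) (H : Jet V δ J Φ) {e e' : Fin 3 →₀ ℕ}
    (he : e.degree = e'.degree) (hJ : e.degree < J) (c : Matrix n n k) :
    Φ e (σ c * mon s e') = if e = e' then c else 0 := by
  have hm : Φ e (mon s e') = if e = e' then 1 else 0 := by
    rw [mon, C.jet_lp H _ (by rw [length_toList]; omega) e (by rw [length_toList, he]),
      Multiset.coe_toList]
    exact if_congr ((Function.LeftInverse.injective Finsupp.toMultiset_toFinsupp).eq_iff) rfl rfl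
  rw [H.mul e hJ, Finset.sum_eq_single (0, e)]
  · rw [H.zero, C.sect.sec, hm, mul_ite, mul_one, mul_zero]
  · intro d hd hne
    have hdeg := degree_antidiagonal hd
    have h0 : d.1.degree ≠ 0 := fun h0 => by
      have h1 := (Finsupp.degree_eq_zero_iff d.1).1 h0
      rw [Finset.HasAntidiagonal.mem_antidiagonal, h1, zero_add] at hd
      exact hne (Prod.ext h1 hd)
    rw [H.eq_zero (f := mon s e') (i := e'.degree) (by omega) (C.mon_mem e') (by omega) (by omega),
      mul_zero]
  · intro h
    exact absurd (Finset.HasAntidiagonal.mem_antidiagonal.2 (zero_add e)) h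

lemma Coord.jet_hpoly (C : Coord V σ δ z s) (H : Jet V δ J Φ) {e : Fin 3 →₀ ℕ}
    (hJ : e.degree < J) (c : (Fin 3 →₀ ℕ) → Matrix n n k) :
    Φ e (hpoly σ s e.degree c) = c e := by
  rw [hpoly_apply, map_sum, Finset.sum_eq_single e]
  · rw [C.jet_term H rfl hJ, if_pos rfl]
  · intro e' he' hne
    rw [C.jet_term H (mem_expo.1 he').symm hJ, if_neg (Ne.symm hne)]
  · intro h; exact absurd (mem_expo.2 rfl) h

/-- An element whose jet vanishes to order `i` lies in the `i`-th power of the kernel. -/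
lemma Coord.mem_pow_of_jet (C : Coord V σ δ z s) (H : Jet V δ J Φ) {i : ℕ} (hi : i ≠ 0)
    (hiJ : i ≤ J) {f : S} (hf : ∀ e : Fin 3 →₀ ℕ, e.degree < i → Φ e f = 0) : f ∈ K V ^ i := by
  obtain ⟨i, rfl⟩ := Nat.exists_eq_succ_of_ne_zero hi
  clear hi
  induction i with
  | zero =>
    rw [Nat.succ_eq_add_one, zero_add, pow_one, mem_K, ← H.zero]
    exact hf 0 (by simp)
  | succ i ih =>
    obtain ⟨u, ⟨c, rfl⟩, v, hv, rfl⟩ := Submodule.mem_sup.1 (C.pow_le (Nat.succ_ne_zero i)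
      (ih (by omega) fun e he => hf e (by omega)))
    have hc : hpoly σ s (i + 1) c = 0 := by
      rw [hpoly_apply]
      refine Finset.sum_eq_zero fun e he => ?_
      rw [mem_expo] at he
      have h1 := hf e (by omega)
      rw [map_add, H.eq_zero (i := i + 1 + 1) (by omega) hv (by omega) (by omega), add_zero] at h1
      have h2 := C.jet_hpoly H (e := e) (by omega) c
      rw [he] at h2
      rw [← h2, h1, map_zero, zero_mul]
    rw [Nat.succ_eq_add_one] at *
    rw [hc, zero_add]
    exact hv

/-- Every jet is the jet of an element. -/
lemma Coord.exists_jet (C : Coord V σ δ z s) (H : Jet V δ J Φ)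
    (q : (Fin 3 →₀ ℕ) → Matrix n n k) (i : ℕ) (hiJ : i ≤ J) :
    ∃ f, ∀ e : Fin 3 →₀ ℕ, e.degree < i → Φ e f = q e := by
  induction i with
  | zero => exact ⟨0, fun e he => absurd he (Nat.not_lt_zero _)⟩
  | succ i ih =>
    obtain ⟨f, hf⟩ := ih (by omega)
    refine ⟨f + hpoly σ s i fun e => q e - Φ e f, fun e he => ?_⟩
    rw [map_add]
    rcases Nat.lt_or_ge e.degree i with h | h
    · rw [hf e h, add_eq_left, hpoly_apply, map_sum]
      refine Finset.sum_eq_zero fun e' he' => ?_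
      rw [mem_expo] at he'
      have hm := C.mon_mem e'
      rw [he'] at hm
      exact H.eq_zero (by omega) (K_pow_ts (V := V) (by omega) _ _ hm).1 h (by omega)
    · obtain rfl : e.degree = i := by omega
      rw [C.jet_hpoly H (by omega), add_sub_cancel]

end Structure

section Link
variable {k : Type u} [Field k] {S : Type u} [Ring S] [Algebra k S]
  {n : Type} [Fintype n] [DecidableEq n]
  {w : Fin 3 → Fin 3 → Fin 3 → k} {π : FreeAlgebra k (Fin 3) →ₐ[k] S}

/-- `π` presents `S` as the algebra with the quadratic relations attached to `w`. -/
structure Pres (w : Fin 3 → Fin 3 → Fin 3 → k) (π : FreeAlgebra k (Fin 3) →ₐ[k] S) : Prop where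
  surj : Function.Surjective π
  rel : ∀ j, π (rel w j) = 0
  ker : ∀ f, π f = 0 → ∃ L, f = sandRel w L

lemma exists_factor (hπ : Function.Surjective π) {M : Type*} [AddCommGroup M] [Module k M]
    (T : FreeAlgebra k (Fin 3) →ₗ[k] M) (h : ∀ f, π f = 0 → T f = 0) :
    ∃ δ : S →ₗ[k] M, ∀ f, δ (π f) = T f := by
  obtain ⟨g, hg⟩ := π.toLinearMap.exists_rightInverse_of_surjective
    (LinearMap.range_eq_top.2 hπ)
  refine ⟨T ∘ₗ g, fun f => ?_⟩
  have h1 : π (g (π f)) = π f := LinearMap.congr_fun hg (π f)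
  rw [LinearMap.comp_apply, ← sub_eq_zero, ← map_sub]
  exact h _ (by rw [map_sub, h1, sub_self])

lemma map_eq_ev (V : S →ₐ[k] Matrix n n k) {x : Fin 3 → Matrix n n k}
    (hx : ∀ i, V (π (FreeAlgebra.ι k i)) = x i) (f : FreeAlgebra k (Fin 3)) :
    V (π f) = ev x f := by
  have : V.comp π = ev x := FreeAlgebra.hom_ext (by ext1 i; simp [hx])
  exact AlgHom.congr_fun this f

lemma Pres.relAt_zero (P : Pres w π) {V : S →ₐ[k] Matrix n n k} {x : Fin 3 → Matrix n n k}
    (hx : ∀ i, V (π (FreeAlgebra.ι k i)) = x i) (j : Fin 3) : relAt w x j = 0 := by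
  rw [← lift_rel, ← map_eq_ev V hx, P.rel, map_zero]

lemma Pres.exists_der (P : Pres w π) {V : S →ₐ[k] Matrix n n k} {x : Fin 3 → Matrix n n k}
    (hx : ∀ i, V (π (FreeAlgebra.ι k i)) = x i) {u : Fin 3 → Matrix n n k}
    (hu : d1 w x x u = 0) :
    ∃ δ : S →ₗ[k] Matrix n n k, IsDer V δ ∧ ∀ f, δ (π f) = dlt x x u f := by
  obtain ⟨δ, hδ⟩ := exists_factor P.surj
    { toFun := dlt (k := k) x x u
      map_add' := dlt_add x x u
      map_smul' := dlt_smul x x u } fun f hf => by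
    obtain ⟨L, rfl⟩ := P.ker f hf
    change dlt x x u _ = 0
    rw [dlt_sandRel w L x x (P.relAt_zero hx) (P.relAt_zero hx), hu, map_zero]
  refine ⟨δ, fun s t => ?_, hδ⟩
  obtain ⟨f, rfl⟩ := P.surj s
  obtain ⟨g, rfl⟩ := P.surj t
  rw [← map_mul, hδ, hδ, hδ, map_eq_ev V hx, map_eq_ev V hx]
  exact dlt_mul x x u f g

lemma IsDer.one {V : S →ₐ[k] Matrix n n k} {δ : S →ₗ[k] Matrix n n k} (h : IsDer V δ) :
    δ 1 = 0 := by
  have := h 1 1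
  rwa [_root_.mul_one, map_one V, Matrix.one_mul, Matrix.mul_one, left_eq_add] at this

lemma Pres.der_ext (P : Pres w π) {V : S →ₐ[k] Matrix n n k} {δ δ' : S →ₗ[k] Matrix n n k}
    (h : IsDer V δ) (h' : IsDer V δ')
    (he : ∀ i, δ (π (FreeAlgebra.ι k i)) = δ' (π (FreeAlgebra.ι k i))) (s : S) : δ s = δ' s := by
  obtain ⟨f, rfl⟩ := P.surj s
  induction f using FreeAlgebra.induction with
  | grade0 r => rw [AlgHom.commutes, Algebra.algebraMap_eq_smul_one, map_smul, map_smul, h.one,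
      h'.one]
  | grade1 i => exact he i
  | mul a b ha hb => rw [map_mul, h, h', ha, hb]
  | add a b ha hb => rw [map_add, map_add, map_add, ha, hb]

lemma Pres.d1_der (P : Pres w π) {V : S →ₐ[k] Matrix n n k} {x : Fin 3 → Matrix n n k}
    (hx : ∀ i, V (π (FreeAlgebra.ι k i)) = x i) {δ : S →ₗ[k] Matrix n n k}
    (h : IsDer V δ) : d1 w x x (fun i => δ (π (FreeAlgebra.ι k i))) = 0 := by
  ext1 j
  have := congrArg δ (P.rel j)
  rw [map_zero] at this
  rw [Pi.zero_apply, ← this, d1_apply]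
  simp only [SklyaninAux.rel, map_sum, map_smul, map_mul, h _ _, hx]

lemma isDer_inner (V : S →ₐ[k] Matrix n n k) (W : Matrix n n k) :
    IsDer V ((LinearMap.mulLeft k W - LinearMap.mulRight k W) ∘ₗ V.toLinearMap) := fun s t => by
  simp only [LinearMap.comp_apply, LinearMap.sub_apply, LinearMap.mulLeft_apply,
    LinearMap.mulRight_apply, AlgHom.toLinearMap_apply, map_mul]
  noncomm_ring

lemma IsDer.add {V : S →ₐ[k] Matrix n n k} {δ δ' : S →ₗ[k] Matrix n n k} (h : IsDer V δ)
    (h' : IsDer V δ') : IsDer V (δ + δ') := fun s t => by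
  simp only [LinearMap.add_apply, h s t, h' s t, mul_add, add_mul]; abel

lemma IsDer.smul {V : S →ₐ[k] Matrix n n k} {δ : S →ₗ[k] Matrix n n k} (h : IsDer V δ) (c : k) :
    IsDer V (c • δ) := fun s t => by
  simp only [LinearMap.smul_apply, h s t, mul_smul_comm, smul_mul_assoc, smul_add]

lemma Homog.dlt_self {N : ℕ} {z : FreeAlgebra k (Fin 3)} (hz : Homog N z)
    (x : Fin 3 → Matrix n n k) : dlt x x x z = (N : k) • ev x z := by
  unfold Homog at hz
  refine Submodule.pow_induction_on_left' (Submodule.span k (Set.range (FreeAlgebra.ι k)))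
    (C := fun n z _ => dlt x x x z = (n : k) • ev x z) ?_ ?_ ?_ hz
  · intro a; rw [dlt_algebraMap]; simp
  · intro y z i _ _ hy hz; rw [map_add, dlt_add, hy, hz, smul_add]
  · intro m hm i z hz ih
    have : dlt x x x m = ev x m := by
      clear ih
      induction hm using Submodule.span_induction with
      | mem y hy => obtain ⟨i, rfl⟩ := hy; rw [dlt_ι]; simp
      | zero => simpa using dlt_algebraMap (k := k) x x x 0
      | add y z _ _ hy hz => rw [dlt_add, map_add, hy, hz]
      | smul c y _ hy => rw [dlt_smul, map_smul, hy]
    rw [dlt_mul, map_mul, ih, this, Nat.cast_succ, add_smul, one_smul, mul_smul_comm]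

variable {E : Env k} {ζ : k} {x : Fin 3 → Matrix n n k}

lemma Pres.central (P : Pres E.w π) (s : S) : π E.z * s = s * π E.z := by
  have h0 : ∀ L, π (sandRel E.w L) = 0 := fun L => by
    rw [sandRel, map_list_sum, List.map_map]
    refine List.sum_eq_zero fun t ht => ?_
    obtain ⟨y, _, rfl⟩ := List.mem_map.1 ht
    simp [P.rel]
  obtain ⟨f, rfl⟩ := P.surj s
  induction f using FreeAlgebra.induction with
  | grade0 r => rw [AlgHom.commutes]; exact (Algebra.commutes _ _).symm
  | grade1 i => rw [← sub_eq_zero, ← map_mul, ← map_mul, ← map_sub, E.D.h2, h0]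
  | mul a b ha hb => rw [map_mul, ← mul_assoc, ha, mul_assoc, hb, mul_assoc]
  | add a b ha hb => rw [map_add, mul_add, add_mul, ha, hb]

lemma IsDer.central_scalar [Nonempty n] {V : S →ₐ[k] Matrix n n k} (hV : Function.Surjective V)
    {δ : S →ₗ[k] Matrix n n k} (h : IsDer V δ) {z : S} (hz : ∀ s, z * s = s * z)
    {ζ : k} (hζ : V z = ζ • (1 : Matrix n n k)) : ∃ c : k, δ z = c • (1 : Matrix n n k) := by
  refine scalar_of_comm (δ z) fun a => ?_
  obtain ⟨s, rfl⟩ := hV a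
  have := congrArg δ (hz s)
  rw [h, h, hζ, Matrix.smul_mul, Matrix.mul_smul, Matrix.one_mul, Matrix.mul_one,
    add_comm (V s * δ z)] at this
  exact (add_left_cancel this).symm

lemma Pres.der_euler (P : Pres E.w π) {V : S →ₐ[k] Matrix n n k}
    (hx : ∀ i, V (π (FreeAlgebra.ι k i)) = x i) (h : IsPt E ζ x) :
    ∃ δ : S →ₗ[k] Matrix n n k, IsDer V δ ∧ (∀ i, δ (π (FreeAlgebra.ι k i)) = x i) ∧
      δ (π E.z) = (E.N * ζ : k) • (1 : Matrix n n k) := by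
  have hd : d1 E.w x x x = 0 := by
    ext1 j
    have h1 : d1 E.w x x x j = relAt E.w x j + relAt E.w x j := by
      simp only [d1_apply, relAt, smul_add, Finset.sum_add_distrib]
    rw [h1, h.rel, add_zero]; rfl
  obtain ⟨δ, h1, h2⟩ := P.exists_der hx hd
  exact ⟨δ, h1, fun i => by rw [h2, dlt_ι], by rw [h2, E.hz.dlt_self, h.cen, smul_smul]⟩

lemma sum_front {M : Type*} [AddCommMonoid M] (f : Fin 3 → Fin 3 → Fin 3 → Fin 3 → M) :
    ∑ j, ∑ i, ∑ l, ∑ a, f j i l a = ∑ a, ∑ j, ∑ i, ∑ l, f j i l a := by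
  symm
  rw [Finset.sum_comm]
  refine Finset.sum_congr rfl fun j _ => ?_
  rw [Finset.sum_comm]
  exact Finset.sum_congr rfl fun i _ => Finset.sum_comm

/-- The constraint imposed by a second order operator on the symplectic pairing. -/
lemma Pres.com_aux [CharZero k] (P : Pres E.w π) {V : S →ₐ[k] Matrix n n k}
    (hx : ∀ i, V (π (FreeAlgebra.ι k i)) = x i) (h : IsPt E ζ x)
    {δ : Fin 3 → S →ₗ[k] Matrix n n k} (u : Fin 3 → Fin 3 → Matrix n n k)
    (hu : ∀ b i, δ b (π (FreeAlgebra.ι k i)) = u b i)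
    (φ : Fin 3 → Fin 3 → k) (ρ : S →ₗ[k] Matrix n n k)
    (hρ : ∀ s t, ρ (s * t) = V s * ρ t + ρ s * V t + ∑ a, ∑ b, φ a b • (δ a s * δ b t)) :
    ∑ a, ∑ b, φ a b * om E.w x (u a) (u b) = 0 := by
  have hd : d1 E.w x x x = 0 := by
    ext1 j
    have h1 : d1 E.w x x x j = relAt E.w x j + relAt E.w x j := by
      simp only [d1_apply, relAt, smul_add, Finset.sum_add_distrib]
    rw [h1, h.rel, add_zero]; rfl
  set r : Fin 3 → Matrix n n k := fun i => ρ (π (FreeAlgebra.ι k i)) with hr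
  have h1 : ∀ j, d1 E.w x x r j
      + ∑ i, ∑ l, E.w j i l • ∑ a, ∑ b, φ a b • (u a i * u b l) = 0 := fun j => by
    have := congrArg ρ (P.rel j)
    rw [map_zero] at this
    rw [← this, d1_apply, ← Finset.sum_add_distrib]
    simp only [← Finset.sum_add_distrib, ← smul_add, SklyaninAux.rel, map_sum, map_smul, map_mul,
      hρ, hx, hu, hr]
  have h2 : pr (d1 E.w x x r) x = 0 := by
    rw [pr_d1 E.hw, hd]; simp [pr]
  have h3 : ∑ j, trace ((∑ i, ∑ l, E.w j i l • ∑ a, ∑ b, φ a b • (u a i * u b l)) * x j) = 0 := by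
    have : ∑ j, trace ((d1 E.w x x r j
      + ∑ i, ∑ l, E.w j i l • ∑ a, ∑ b, φ a b • (u a i * u b l)) * x j) = 0 := by
      simp [h1]
    simp only [Matrix.add_mul, trace_add, Finset.sum_add_distrib] at this
    rwa [show ∑ j, trace (d1 E.w x x r j * x j) = 0 from h2, zero_add] at this
  rw [← h3]
  have h4 : ∀ a b, om E.w x (u a) (u b)
      = ∑ j, ∑ i, ∑ l, E.w j i l * trace (u a i * u b l * x j) := fun a b => by
    rw [om_eq, sum_rot fun j i l => E.w j i l * trace (u a i * u b l * x j)]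
    refine Finset.sum_congr rfl fun j _ => Finset.sum_congr rfl fun i _ =>
      Finset.sum_congr rfl fun l _ => ?_
    rw [E.hw j i l, Matrix.trace_mul_comm (u a l * u b j), Matrix.mul_assoc]
  simp only [h4, Finset.sum_mul, smul_mul_assoc, trace_sum, trace_smul, smul_eq_mul,
    Finset.mul_sum]
  rw [sum_front fun j i l a => ∑ b, E.w j i l * (φ a b * trace (u a i * u b l * x j))]
  refine Finset.sum_congr rfl fun a _ => ?_
  rw [sum_front fun j i l b => E.w j i l * (φ a b * trace (u a i * u b l * x j))]
  refine Finset.sum_congr rfl fun b _ => Finset.sum_congr rfl fun j _ =>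
    Finset.sum_congr rfl fun i _ => Finset.sum_congr rfl fun l _ => ?_
  ring

end Link

section Build
variable {k : Type u} [Field k] [CharZero k] [IsAlgClosed k] {S : Type u} [Ring S] [Algebra k S]
  {n : Type} [Fintype n] [DecidableEq n] [Nonempty n]
  {π : FreeAlgebra k (Fin 3) →ₐ[k] S} {E : Env k} {ζ : k} {x : Fin 3 → Matrix n n k}

lemma Pres.exists_frame (P : Pres E.w π) {V : S →ₐ[k] Matrix n n k}
    (hV : Function.Surjective V)
    (hx : ∀ i, V (π (FreeAlgebra.ι k i)) = x i) (h : IsPt E ζ x) {u₁ u₂ : Fin 3 → Matrix n n k}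
    (h₁ : d1 E.w x x u₁ = 0) (h₂ : d1 E.w x x u₂ = 0) (ho : om E.w x u₁ u₂ ≠ 0) :
    ∃ σ δ, Frame V σ δ ((E.N * ζ : k)⁻¹ • (π E.z - algebraMap k S ζ)) := by
  obtain ⟨σ, hσ⟩ := exists_sect hV 2
  have hI := indep_of_om h h₁ h₂ ho
  obtain ⟨D₁, k₁, e₁⟩ := P.exists_der hx h₁
  obtain ⟨D₂, k₂, e₂⟩ := P.exists_der hx h₂
  obtain ⟨D₃, k₃, e₃, z₃⟩ := P.der_euler hx h
  have hNζ : (E.N * ζ : k) ≠ 0 := gz_ne h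
  set z : S := (E.N * ζ : k)⁻¹ • (π E.z - algebraMap k S ζ) with hz
  have hVz : V (π E.z) = ζ • (1 : Matrix n n k) := by rw [map_eq_ev V hx, h.cen]
  have zcen : ∀ s, z * s = s * z := fun s => by
    rw [hz, smul_mul_assoc, mul_smul_comm, sub_mul, mul_sub, P.central, Algebra.commutes]
  have zK : V z = 0 := by
    rw [hz, map_smul, map_sub, hVz, AlgHom.commutes, Algebra.algebraMap_eq_smul_one, sub_self,
      smul_zero]
  have zK' : V z = (0 : k) • (1 : Matrix n n k) := by rw [zK, zero_smul]
  have hd3 : D₃ z = 1 := by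
    rw [hz, map_smul, map_sub, z₃, Algebra.algebraMap_eq_smul_one, map_smul, k₃.one, smul_zero,
      sub_zero, smul_smul, inv_mul_cancel₀ hNζ, one_smul]
  obtain ⟨β₁, hβ₁⟩ := k₁.central_scalar hV zcen zK'
  obtain ⟨β₂, hβ₂⟩ := k₂.central_scalar hV zcen zK'
  have hfix : ∀ D : S →ₗ[k] Matrix n n k, IsDer V D → ∃ W, ∀ a, D (σ a) = W * a - a * W := by
    intro D hD
    refine exists_inner_of_derivation (D ∘ₗ σ) fun a b => ?_
    have h1 := hD.zero_of_mem_sq (K_pow_le two_ne_zero (by norm_num) (hσ.mul a b))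
    rw [map_sub, sub_eq_zero, hD, hσ.sec, hσ.sec] at h1
    exact h1.symm
  have hmod : ∀ D : S →ₗ[k] Matrix n n k, IsDer V D → ∃ (D' : S →ₗ[k] Matrix n n k)
      (W : Matrix n n k), IsDer V D' ∧ (∀ a, D' (σ a) = 0) ∧
      ∀ s, D' s = D s + (V s * W - W * V s) := by
    intro D hD
    obtain ⟨W, hW⟩ := hfix D hD
    refine ⟨D + (LinearMap.mulLeft k (-W) - LinearMap.mulRight k (-W)) ∘ₗ V.toLinearMap, W,
      hD.add (isDer_inner V _), fun a => ?_, fun s => ?_⟩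
    · simp [hW, hσ.sec]
    · simp; abel
  obtain ⟨F₁, W₁, f₁, s₁, q₁⟩ := hmod (D₁ + (-β₁) • D₃) (k₁.add (k₃.smul _))
  obtain ⟨F₂, W₂, f₂, s₂, q₂⟩ := hmod (D₂ + (-β₂) • D₃) (k₂.add (k₃.smul _))
  obtain ⟨F₃, W₃, f₃, s₃, q₃⟩ := hmod D₃ k₃
  have t₁ : F₁ z = 0 := by rw [q₁, zK]; simp [hβ₁, hd3]
  have t₂ : F₂ z = 0 := by rw [q₂, zK]; simp [hβ₂, hd3]
  have t₃ : F₃ z = 1 := by rw [q₃, zK]; simp [hd3]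
  have c₁ : ∀ i, F₁ (π (FreeAlgebra.ι k i)) = u₁ i - β₁ • x i + (x i * W₁ - W₁ * x i) :=
    fun i => by rw [q₁, hx]; simp [e₁, e₃, dlt_ι, sub_eq_add_neg]
  have c₂ : ∀ i, F₂ (π (FreeAlgebra.ι k i)) = u₂ i - β₂ • x i + (x i * W₂ - W₂ * x i) :=
    fun i => by rw [q₂, hx]; simp [e₂, e₃, dlt_ι, sub_eq_add_neg]
  have c₃ : ∀ i, F₃ (π (FreeAlgebra.ι k i)) = x i + (x i * W₃ - W₃ * x i) :=
    fun i => by rw [q₃, hx, e₃]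
  set δ : Fin 3 → S →ₗ[k] Matrix n n k := ![F₁, F₂, F₃] with hδ
  have hder : ∀ b, IsDer V (δ b) := fun b => by fin_cases b <;> assumption
  refine ⟨σ, δ, hV, hσ, hder, fun b a => by fin_cases b <;> simp [hδ, s₁, s₂, s₃], ?_, ?_, ?_,
    zcen, zK, fun b => by fin_cases b <;> simp [hδ, t₁, t₂, t₃]⟩
  · intro δ' hδ'
    obtain ⟨a₁, a₂, c, f, hg⟩ := exists_comb h h₁ h₂ hI (P.d1_der hx hδ')
    refine ⟨![a₁, a₂, c + a₁ * β₁ + a₂ * β₂],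
      a₁ • W₁ + a₂ • W₂ + (c + a₁ * β₁ + a₂ * β₂) • W₃ - f, ?_⟩
    have := P.der_ext hδ' ((((f₁.smul a₁).add (f₂.smul a₂)).add
      (f₃.smul (c + a₁ * β₁ + a₂ * β₂))).add
      (isDer_inner V (a₁ • W₁ + a₂ • W₂ + (c + a₁ * β₁ + a₂ * β₂) • W₃ - f))) fun i => ?_
    · intro s
      rw [this s]
      simp [Fin.sum_univ_three, hδ]
    · have := congrFun hg i
      simp only [Pi.sub_apply, Pi.add_apply, Pi.smul_apply, d0_apply] at this
      rw [sub_eq_iff_eq_add] at this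
      rw [this]
      simp only [LinearMap.add_apply, LinearMap.smul_apply, LinearMap.comp_apply,
        LinearMap.sub_apply, LinearMap.mulLeft_apply, LinearMap.mulRight_apply,
        AlgHom.toLinearMap_apply, hx, c₁, c₂, c₃, Matrix.add_mul, Matrix.mul_add, Matrix.sub_mul,
        Matrix.mul_sub, Matrix.smul_mul, Matrix.mul_smul]
      module
  · intro c hc
    have h0 : IsGauge x (c 0 • u₁ + c 1 • u₂) := by
      refine ⟨c 0 * β₁ + c 1 * β₂ - c 2, -(c 0 • W₁ + c 1 • W₂ + c 2 • W₃), ?_⟩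
      ext1 i
      have := hc (π (FreeAlgebra.ι k i))
      simp only [Fin.sum_univ_three] at this
      rw [show δ 0 = F₁ from rfl, show δ 1 = F₂ from rfl, show δ 2 = F₃ from rfl, c₁, c₂, c₃]
        at this
      simp only [Pi.add_apply, Pi.smul_apply, d0_apply, Matrix.mul_neg, Matrix.neg_mul,
        Matrix.mul_add, Matrix.add_mul, Matrix.mul_smul, Matrix.smul_mul]
      linear_combination (norm := module) (1 : k) • this
    obtain ⟨h0, h1⟩ := hI _ _ h0
    have h2 := hc z
    simp only [Fin.sum_univ_three] at h2
    rw [show δ 2 = F₃ from rfl, t₃, h0, h1, zero_smul, zero_smul, zero_add, zero_add] at h2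
    have h3 : c 2 = 0 := by
      by_contra hne
      exact one_ne_zero ((smul_eq_zero.1 h2).resolve_left hne)
    ext b; fin_cases b <;> assumption
  · intro φ ρ hρ
    let v : Fin 3 → Fin 3 → Matrix n n k := fun b i => δ b (π (FreeAlgebra.ι k i))
    have hv : ∀ b, d1 E.w x x (v b) = 0 := fun b => P.d1_der hx (hder b)
    have hs := P.com_aux hx h v (fun _ _ => rfl) φ ρ hρ
    have g₁ : IsGauge x (v 0 - u₁) := ⟨-β₁, W₁, by
      ext1 i; simp only [Pi.sub_apply, v]; rw [show δ 0 = F₁ from rfl, c₁]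
      simp only [Pi.add_apply, Pi.smul_apply, d0_apply]; module⟩
    have g₂ : IsGauge x (v 1 - u₂) := ⟨-β₂, W₂, by
      ext1 i; simp only [Pi.sub_apply, v]; rw [show δ 1 = F₂ from rfl, c₂]
      simp only [Pi.add_apply, Pi.smul_apply, d0_apply]; module⟩
    have g₃ : IsGauge x (v 2) := ⟨1, W₃, by
      ext1 i; simp only [v]; rw [show δ 2 = F₃ from rfl, c₃]
      simp only [Pi.add_apply, Pi.smul_apply, d0_apply]; module⟩
    have o2 : ∀ b, om E.w x (v b) (v 2) = 0 := fun b => om_gauge h (hv b) g₃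
    have o2' : ∀ b, om E.w x (v 2) (v b) = 0 := fun b => by
      rw [om_antisymm E.hw (hv 2) (hv b), o2, neg_zero]
    have o01 : om E.w x (v 0) (v 1) = om E.w x u₁ u₂ := by
      have e1 : om E.w x (v 0) (v 1) = om E.w x (v 0) u₂ := by
        have := om_gauge h (hv 0) g₂
        rw [show v 1 = u₂ + (v 1 - u₂) by abel, om_add_right, this, add_zero]
      have e2 : om E.w x u₂ (v 0) = om E.w x u₂ u₁ := by
        have := om_gauge h h₂ g₁
        rw [show v 0 = u₁ + (v 0 - u₁) by abel, om_add_right, this, add_zero]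
      rw [e1, om_antisymm E.hw (hv 0) h₂, e2, om_antisymm E.hw h₁ h₂]
    simp only [Fin.sum_univ_three, o2, o2', om_self E.hw (hv _)] at hs
    rw [om_antisymm E.hw (hv 1) (hv 0), o01] at hs
    have : (φ 0 1 - φ 1 0) * om E.w x u₁ u₂ = 0 := by linear_combination hs
    exact sub_eq_zero.1 ((mul_eq_zero.1 this).resolve_right ho)

lemma Pres.exists_jets (P : Pres E.w π) {V : S →ₐ[k] Matrix n n k}
    (hx : ∀ i, V (π (FreeAlgebra.ι k i)) = x i) (h : IsPt E ζ x)
    {δ : Fin 3 → S →ₗ[k] Matrix n n k} (hδ : ∀ b, IsDer V (δ b)) (J : ℕ) :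
    ∃ Φ, Jet V δ J Φ := by
  obtain ⟨X, X0, X1, hX⟩ := exists_arc h (fun b i => δ b (π (FreeAlgebra.ι k i)))
    (fun b => P.d1_der hx (hδ b)) J
  have hex : ∀ e : Fin 3 →₀ ℕ, ∃ Φ : S →ₗ[k] Matrix n n k, e.degree < J + 2 →
      ∀ f, Φ (π f) = mco e (ev X f) := by
    intro e
    by_cases he : e.degree < J + 2
    · obtain ⟨Φ, hΦ⟩ := exists_factor P.surj (mco e ∘ₗ (ev X).toLinearMap) fun f hf => by
        obtain ⟨L, rfl⟩ := P.ker f hf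
        change mco e (ev X _) = 0
        rw [mco_sandRel X0 hX he.le]
        have : (fun j => mco e (relAt E.w X j)) = 0 := by
          ext1 j; exact hX j e he
        rw [this, map_zero]
      exact ⟨Φ, fun _ => hΦ⟩
    · exact ⟨0, fun h => absurd h he⟩
  choose Φ hΦ using hex
  have hmul : ∀ e : Fin 3 →₀ ℕ, e.degree < J + 2 → ∀ f g,
      Φ e (f * g) = ∑ p ∈ Finset.HasAntidiagonal.antidiagonal e, Φ p.1 f * Φ p.2 g := by
    intro e he f g
    obtain ⟨f, rfl⟩ := P.surj f
    obtain ⟨g, rfl⟩ := P.surj g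
    rw [← map_mul, hΦ e he, map_mul, mco_mul]
    refine Finset.sum_congr rfl fun p hp => ?_
    have := degree_antidiagonal hp
    rw [hΦ _ (by omega), hΦ _ (by omega)]
  have hzero : ∀ f, Φ 0 f = V f := fun f => by
    obtain ⟨f, rfl⟩ := P.surj f
    rw [hΦ 0 (by simp), mco_zero_ev, map_eq_ev V hx]
    congr 2
    ext1 i; exact X0 i
  refine ⟨Φ, hzero, fun a => ?_, fun e he => hmul e (by omega)⟩
  have hs : (Finsupp.single a 1 : Fin 3 →₀ ℕ).degree < J + 2 := by simp
  refine P.der_ext (fun s t => ?_) (hδ a) fun i => by rw [hΦ _ hs, FreeAlgebra.lift_ι_apply, X1]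
  rw [hmul _ hs, Finsupp.antidiagonal_single]
  rw [Finset.sum_map, Finset.Nat.antidiagonal_succ]
  simp [hzero]

end Build

section Separation
variable {k : Type u} [Field k] {S : Type u} [Ring S] [Algebra k S]
  {m n : Type} [Fintype m] [DecidableEq m] [Fintype n] [DecidableEq n]

/-- All derivations from `V'` to `V` are inner. -/
def AllInner (V : S →ₐ[k] Matrix m m k) (V' : S →ₐ[k] Matrix n n k) : Prop :=
  ∀ δ : S →ₗ[k] Matrix m n k, (∀ s t, δ (s * t) = V s * δ t + δ s * V' t) →
    ∃ e : Matrix m n k, ∀ s, δ s = V s * e - e * V' s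

lemma Pres.allInner {w : Fin 3 → Fin 3 → Fin 3 → k} {π : FreeAlgebra k (Fin 3) →ₐ[k] S}
    (P : Pres w π) {V : S →ₐ[k] Matrix m m k} {V' : S →ₐ[k] Matrix n n k}
    {x : Fin 3 → Matrix m m k} {x' : Fin 3 → Matrix n n k}
    (hx : ∀ i, V (π (FreeAlgebra.ι k i)) = x i) (hx' : ∀ i, V' (π (FreeAlgebra.ι k i)) = x' i)
    (hext : ∀ v : Fin 3 → Matrix m n k, d1 w x x' v = 0 → ∃ e, d0 x x' e = v) :
    AllInner V V' := fun δ hδ => by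
  obtain ⟨e, he⟩ := hext (fun i => δ (π (FreeAlgebra.ι k i))) (by
    ext1 j
    have := congrArg δ (P.rel j)
    rw [map_zero] at this
    rw [Pi.zero_apply, ← this, d1_apply]
    simp only [SklyaninAux.rel, map_sum, map_smul, map_mul, hδ _ _, hx, hx'])
  refine ⟨e, fun s => ?_⟩
  have h1 : δ 1 = 0 := by
    have := hδ 1 1
    rwa [_root_.mul_one, map_one V, map_one V', Matrix.one_mul, Matrix.mul_one,
      left_eq_add] at this
  obtain ⟨f, rfl⟩ := P.surj s
  induction f using FreeAlgebra.induction with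
  | grade0 r => rw [AlgHom.commutes, Algebra.algebraMap_eq_smul_one, map_smul, map_smul, map_smul,
      h1, map_one V, map_one V']; simp
  | grade1 i => rw [hx, hx', ← congrFun he i]; rfl
  | mul a b ha hb =>
    rw [map_mul, hδ, ha, hb, map_mul V, map_mul V', Matrix.mul_sub, Matrix.sub_mul, Matrix.mul_assoc,
      Matrix.mul_assoc, Matrix.mul_assoc]
    abel
  | add a b ha hb => rw [map_add, map_add, ha, hb, map_add V, map_add V', Matrix.mul_add,
      Matrix.add_mul]; abel

lemma AllInner.inf_le [Nonempty m] [Nonempty n] {V : S →ₐ[k] Matrix m m k}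
    {V' : S →ₐ[k] Matrix n n k} (hV : Function.Surjective V) (hV' : Function.Surjective V')
    (h : AllInner V V') {e : S} (he : V e = 1) (he' : V' e = 0) : K V ⊓ K V' ≤ K V * K V' := by
  intro f hf
  by_contra hfW
  obtain ⟨θ, -, hθf, hl, hr⟩ := exists_bimod hV hV' ((ts_K V).mul (ts_K V')) (W' := K V ⊓ K V')
    (Submodule.mul_le.2 fun p hp q hq => Submodule.mul_mem_mul hp hq.2)
    (Submodule.mul_le.2 fun p hp q hq => Submodule.mul_mem_mul hp.1 hq) hf hfW
  have hcom : ∀ s, e * s - s * e ∈ K V ⊓ K V' := fun s => by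
    simp [Submodule.mem_inf, mem_K, he, he']
  obtain ⟨w, hw⟩ := h (θ ∘ₗ (LinearMap.mulLeft k e - LinearMap.mulRight k e)) fun s t => by
    simp only [LinearMap.comp_apply, LinearMap.sub_apply, LinearMap.mulLeft_apply,
      LinearMap.mulRight_apply]
    rw [← hl _ _ (hcom t), ← hr _ _ (hcom s), ← map_add]
    refine congrArg θ ?_
    noncomm_ring
  have h1 := hw f
  rw [mem_K.1 hf.1, mem_K.1 hf.2, Matrix.zero_mul, Matrix.mul_zero, sub_zero] at h1
  simp only [LinearMap.comp_apply, LinearMap.sub_apply, LinearMap.mulLeft_apply,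
      LinearMap.mulRight_apply, map_sub] at h1
  rw [hl _ _ hf, hr _ _ hf, he, he', Matrix.one_mul, Matrix.mul_zero, sub_zero] at h1
  exact hθf h1

lemma exists_separator [Nonempty m] [Nonempty n] {V : S →ₐ[k] Matrix m m k}
    {V' : S →ₐ[k] Matrix n n k} (hV : Function.Surjective V) (hV' : Function.Surjective V')
    (hne : ∀ f : Matrix n m k, (∀ s, V' s * f = f * V s) → f = 0) : ∃ e, V e = 1 ∧ V' e = 0 := by
  by_cases hle : K V ≤ K V'
  · exfalso
    obtain ⟨p⟩ := ‹Nonempty m›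
    choose ε hε using hV
    have hlift : ∀ s t, V s = V t → V' s = V' t := fun s t hst => by
      rw [← sub_eq_zero, ← map_sub]
      exact hle (by rw [mem_K, map_sub, hst, sub_self])
    have hp : ∃ q, ∃ a, V' (ε (single p p 1)) a q ≠ 0 := by
      by_contra hc
      push Not at hc
      have h0 : V' (ε (single p p 1)) = 0 := by ext a q; exact hc q a
      have h1 : V' (∑ i, ε (single i p 1) * ε (single p p 1) * ε (single p i 1)) = V' 1 := by
        refine hlift _ _ ?_
        simp only [map_sum, map_mul, hε, single_mul_single_same, _root_.mul_one, map_one V]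
        rw [← sum_single_mul_single p]
        exact Finset.sum_congr rfl fun i _ => by rw [single_mul_single_same, _root_.mul_one]
      rw [map_sum, map_one V'] at h1
      simp only [map_mul, h0, Matrix.mul_zero, Matrix.zero_mul, Finset.sum_const_zero] at h1
      exact zero_ne_one h1
    obtain ⟨q, a, ha⟩ := hp
    have := hne (Matrix.of fun a i => V' (ε (single i p 1)) a q) fun s => by
      ext a i
      have h1 : V' (s * ε (single i p 1)) = V' (∑ l, V s l i • ε (single l p 1)) := by
        refine hlift _ _ ?_
        simp only [map_sum, map_mul, map_smul, hε, mul_single_eq_sum]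
      have h2 := congrFun (congrFun h1 a) q
      rw [map_mul, map_sum, Matrix.mul_apply, Matrix.sum_apply] at h2
      rw [Matrix.mul_apply, Matrix.mul_apply]
      simp only [of_apply]
      rw [h2]
      exact Finset.sum_congr rfl fun l _ => by rw [map_smul, Matrix.smul_apply, smul_eq_mul, mul_comm]
    exact ha (congrFun (congrFun this a) p)
  · obtain ⟨f, hf, hf'⟩ := SetLike.not_le_iff_exists.1 hle
    obtain ⟨a, b, hab⟩ : ∃ a b, V' f a b ≠ 0 := by
      by_contra hc
      push Not at hc
      exact hf' (Matrix.ext hc)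
    choose ε hε using hV'
    refine ⟨1 - (V' f a b)⁻¹ • ∑ p, ε (single p a 1) * f * ε (single b p 1), ?_, ?_⟩
    · rw [map_sub, map_one V, map_smul, map_sum]
      simp [mem_K.1 hf]
    · rw [map_sub, map_one V', map_smul, map_sum, sub_eq_zero, ← sum_single_mul_single a,
        Finset.smul_sum]
      refine Finset.sum_congr rfl fun p _ => ?_
      rw [map_mul, map_mul, hε, hε]
      rw [single_mul_mul_single, single_mul_single_same, smul_single]
      simp [hab]

end Separation

section Coprime
variable {k : Type u} [Field k] {S : Type u} [Ring S] [Algebra k S]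

lemma coprime_mul {A B C : Submodule k S} (hA : TS A) (hB : (1 : S) ∈ A ⊔ B)
    (hC : (1 : S) ∈ A ⊔ C) : (1 : S) ∈ A ⊔ B * C := by
  obtain ⟨a, ha, b, hb, hab⟩ := Submodule.mem_sup.1 hB
  obtain ⟨a', ha', c, hc, hac⟩ := Submodule.mem_sup.1 hC
  refine Submodule.mem_sup.2 ⟨a * (a' + c) + b * a', add_mem (hA _ _ ha).2 (hA _ _ ha').1, b * c,
    Submodule.mul_mem_mul hb hc, ?_⟩
  calc a * (a' + c) + b * a' + b * c = (a + b) * (a' + c) := by noncomm_ring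
    _ = 1 := by rw [hab, hac, mul_one]

lemma coprime_prod {A : Submodule k S} (hA : TS A) (l : List (Submodule k S))
    (h : ∀ B ∈ l, (1 : S) ∈ A ⊔ B) : (1 : S) ∈ A ⊔ l.prod := by
  induction l with
  | nil => exact (le_sup_right : _ ≤ A ⊔ (1 : Submodule k S)) (Submodule.one_le.1 le_rfl)
  | cons B l ih =>
    rw [List.prod_cons]
    exact coprime_mul hA (h _ (by simp)) (ih fun C hC => h _ (by simp [hC]))

lemma coprime_pow {A B : Submodule k S} (hA : TS A) (h : (1 : S) ∈ A ⊔ B) (j : ℕ) :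
    (1 : S) ∈ A ⊔ B ^ j := by
  rw [← List.prod_replicate]
  exact coprime_prod hA _ fun C hC => by rwa [List.eq_of_mem_replicate hC]

lemma prod_le_of_mem {l : List (Submodule k S)} (hl : ∀ B ∈ l, TS B) {B : Submodule k S}
    (hB : B ∈ l) : l.prod ≤ B := by
  induction l with
  | nil => simp at hB
  | cons C l ih =>
    rw [List.prod_cons]
    by_cases hne : l = []
    · subst hne
      simp only [List.mem_singleton] at hB
      simp [hB]
    rcases List.mem_cons.1 hB with rfl | hB
    · exact (hl _ (by simp)).mul_le_left
    · exact (mul_le_mul' le_rfl (ih (fun D hD => hl _ (by simp [hD])) hB)).trans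
        ((hl _ (by simp [hB])).mul_le_right)

lemma TS.prod {l : List (Submodule k S)} (hne : l ≠ []) (hl : ∀ B ∈ l, TS B) : TS l.prod := by
  induction l with
  | nil => exact absurd rfl hne
  | cons C l ih =>
    rw [List.prod_cons]
    by_cases hne : l = []
    · subst hne; simpa using hl
    · exact (hl _ (by simp)).mul (ih hne fun D hD => hl _ (by simp [hD]))

/-- Idempotent-like elements separating one of the maximal ideals over a central ideal. -/
lemma exists_near_central {ι : Type*} [Fintype ι] {M W : Submodule k S} {L : ι → Submodule k S}
    (hM : TS M) (hL : ∀ i, TS (L i)) (hc : ∀ i, L i ≠ M → Commute M (L i))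
    (hco : ∀ i, L i ≠ M → (1 : S) ∈ M ⊔ L i) {N : ℕ} (hN : (⨅ i, L i) ^ (N + 1) ≤ W) {i₀ : ι}
    (hi₀ : L i₀ ≠ M) (j : ℕ) :
    ∃ e ∈ L i₀, 1 - e ∈ M ∧ ∀ s, e * s - s * e ∈ W ^ (j + 1) := by
  classical
  let l : List (Submodule k S) := ((Finset.univ.filter fun i => L i ≠ M).toList).map L
  have hl : ∀ B ∈ l, ∃ i, L i ≠ M ∧ L i = B := fun B hB => by
    simpa [l] using hB
  have hl' : ∀ i, L i ≠ M → L i ∈ l := fun i hi => by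
    simp only [l, List.mem_map, Finset.mem_toList, Finset.mem_filter, Finset.mem_univ, true_and]
    exact ⟨i, hi, rfl⟩
  have hlTS : ∀ B ∈ l, TS B := fun B hB => by
    obtain ⟨i, -, rfl⟩ := hl B hB; exact hL i
  set P := l.prod with hP
  have hne : l ≠ [] := List.ne_nil_of_mem (hl' i₀ hi₀)
  have hPTS : TS P := TS.prod hne hlTS
  have hcom : Commute M P := Commute.list_prod_right _ _ fun B hB => by
    obtain ⟨i, hi, rfl⟩ := hl B hB; exact hc i hi
  have hle : M * P ≤ ⨅ i, L i := le_iInf fun i => by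
    by_cases hi : L i = M
    · rw [hi]; exact hM.mul_le_left
    · exact hPTS.mul_le_right.trans (prod_le_of_mem hlTS (hl' i hi))
  obtain ⟨t, ht⟩ : ∃ t, (N + 1) * (j + 1) = t + 1 := ⟨_, (Nat.succ_pred_eq_of_pos (by positivity)).symm⟩
  have hW : M ^ (t + 1) * P ^ (t + 1) ≤ W ^ (j + 1) := by
    rw [← hcom.mul_pow, ← ht, pow_mul]
    exact pow_le_pow_left' ((pow_le_pow_left' hle _).trans hN) _
  have hW' : P ^ (t + 1) * M ^ (t + 1) ≤ W ^ (j + 1) := by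
    rw [((hcom.pow_pow _ _).eq).symm]; exact hW
  have h1 : (1 : S) ∈ M ^ (t + 1) ⊔ P ^ (t + 1) := by
    refine coprime_pow (hM.pow t) ?_ _
    rw [sup_comm]
    refine coprime_pow hPTS ?_ _
    rw [sup_comm]
    exact coprime_prod hM _ fun B hB => by
      obtain ⟨i, hi, rfl⟩ := hl B hB; exact hco i hi
  obtain ⟨f, hf, e, he, hfe⟩ := Submodule.mem_sup.1 h1
  have hf' : 1 - e = f := by rw [← hfe]; abel
  have hpow1 : ∀ {A : Submodule k S}, TS A → A ^ (t + 1) ≤ A := fun hA => by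
    simpa using hA.pow_le (Nat.zero_le t)
  refine ⟨e, prod_le_of_mem hlTS (hl' _ hi₀) (hpow1 hPTS he), hf' ▸ hpow1 hM hf, fun s => ?_⟩
  have h2 := hW' (Submodule.mul_mem_mul (hPTS.pow t s e he).2 hf)
  have h3 := hW (Submodule.mul_mem_mul (hM.pow t s f hf).2 he)
  have : e * s - s * e = e * s * f - f * s * e := by rw [← hf']; noncomm_ring
  rw [this]
  exact sub_mem h2 h3

end Coprime

section Simples
variable {k : Type u} [Field k] [IsAlgClosed k] {S : Type u} [Ring S] [Algebra k S]

/-- The simple modules of a finite-dimensional quotient. -/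
lemma exists_simples {A : Type u} [Ring A] [Algebra k A] [Module.Finite k A] (p : S →ₐ[k] A)
    (hp : Function.Surjective p) :
    ∃ (r : ℕ) (d : Fin r → ℕ) (V : ∀ i, S →ₐ[k] Matrix (Fin (d i)) (Fin (d i)) k) (N : ℕ),
      (∀ i, d i ≠ 0) ∧ (∀ i, Function.Surjective (V i)) ∧
      (∀ i, LinearMap.ker p.toLinearMap ≤ K (V i)) ∧
      (⨅ i, K (V i)) ^ (N + 1) ≤ LinearMap.ker p.toLinearMap := by
  have : IsArtinianRing A := isArtinian_of_tower k inferInstance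
  have : IsSemisimpleRing (A ⧸ Ring.jacobson A) := IsSemiprimaryRing.isSemisimpleRing
  obtain ⟨r, d, hd, ⟨φ⟩⟩ :=
    IsSemisimpleRing.exists_algEquiv_pi_matrix_of_isAlgClosed (F := k) (R := A ⧸ Ring.jacobson A)
  obtain ⟨N, hN⟩ := IsSemiprimaryRing.isNilpotent (R := A)
  refine ⟨r, d, fun i => (Pi.evalAlgHom k (fun i => Matrix (Fin (d i)) (Fin (d i)) k) i).comp ((φ : _ →ₐ[k] _).comp
    ((Ideal.Quotient.mkₐ k (Ring.jacobson A)).comp p)), N, fun i => (hd i).ne, fun i => ?_,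
    fun i f hf => ?_, ?_⟩
  · exact (Function.surjective_eval i).comp (φ.surjective.comp
      ((Ideal.Quotient.mkₐ_surjective k _).comp hp))
  · have : p f = 0 := hf
    simp [mem_K, this]
  · have hle : ∀ f ∈ (⨅ i, K ((Pi.evalAlgHom k (fun i => Matrix (Fin (d i)) (Fin (d i)) k) i).comp ((φ : _ →ₐ[k] _).comp
        ((Ideal.Quotient.mkₐ k (Ring.jacobson A)).comp p)))), p f ∈ Ring.jacobson A := fun f hf => by
      rw [Submodule.mem_iInf] at hf
      have : φ (Ideal.Quotient.mkₐ k (Ring.jacobson A) (p f)) = 0 := funext fun i => hf i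
      rw [EmbeddingLike.map_eq_zero_iff] at this
      exact Ideal.Quotient.eq_zero_iff_mem.1 this
    have hpow : ∀ j, ∀ f ∈ (⨅ i, K ((Pi.evalAlgHom k (fun i => Matrix (Fin (d i)) (Fin (d i)) k) i).comp ((φ : _ →ₐ[k] _).comp
        ((Ideal.Quotient.mkₐ k (Ring.jacobson A)).comp p)))) ^ (j + 1),
        p f ∈ (Ring.jacobson A) ^ (j + 1) := by
      intro j
      induction j with
      | zero => simpa [Submodule.pow_one] using hle
      | succ j ih =>
        intro f hf
        rw [pow_succ] at hf
        rw [Submodule.pow_succ]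
        induction hf using Submodule.mul_induction_on' with
        | mem_mul_mem a ha b hb => rw [map_mul]; exact Submodule.mul_mem_mul (ih a ha) (hle b hb)
        | add a _ b _ ha hb => rw [map_add]; exact add_mem ha hb
    intro f hf
    have h1 := hpow N f hf
    rw [Submodule.pow_succ, hN, zero_mul] at h1
    exact h1

end Simples

section Central

lemma exists_artin_rees {R : Type*} [CommRing R] [IsNoetherianRing R] {M M' : Type*}
    [AddCommGroup M] [Module R M] [AddCommGroup M'] [Module R M'] [Module.Finite R M']
    (c : M →ₗ[R] M') (I : Ideal R) (i : ℕ) : ∃ J, ∀ f, c f ∈ I ^ J • (⊤ : Submodule R M') →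
      ∃ f' ∈ I ^ i • (⊤ : Submodule R M), c f = c f' := by
  obtain ⟨q, hq⟩ := I.exists_pow_inf_eq_pow_smul (LinearMap.range c)
  refine ⟨q + i, fun f hf => ?_⟩
  have h1 : c f ∈ I ^ (q + i) • (⊤ : Submodule R M') ⊓ LinearMap.range c := ⟨hf, f, rfl⟩
  rw [hq _ (by omega), show q + i - q = i by omega] at h1
  have h2 := Submodule.smul_mono (le_refl (I ^ i)) (inf_le_right : I ^ q • (⊤ : Submodule R M') ⊓
    LinearMap.range c ≤ _) h1
  rw [LinearMap.range_eq_map, ← Submodule.map_smul''] at h2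
  obtain ⟨f', hf', h⟩ := h2
  exact ⟨f', hf', h.symm⟩

lemma mem_smul_top_pi {R : Type*} [CommRing R] {M : Type*} [AddCommGroup M] [Module R M]
    {I : Ideal R} {v : Fin 3 → M} (h : ∀ l, v l ∈ I • (⊤ : Submodule R M)) :
    v ∈ I • (⊤ : Submodule R (Fin 3 → M)) := by
  rw [← Finset.univ_sum_single v]
  refine sum_mem fun l _ => ?_
  have := Submodule.mem_map_of_mem (f := LinearMap.single R (fun _ : Fin 3 => M) l) (h l)
  rw [Submodule.map_smul''] at this
  exact Submodule.smul_mono (le_refl I) le_top this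

variable {k : Type u} [Field k] {S : Type u} [Ring S] [Algebra k S] {Z : Type u} [CommRing Z]
  [Algebra k Z] [Algebra Z S] [IsScalarTower k Z S]
  {n : Type} [Fintype n] [DecidableEq n]

/-- `Z` is the center of `S`. -/
structure CenterOf (S Z : Type*) [Ring S] [CommRing Z] [Algebra Z S] : Prop where
  inj : Function.Injective (algebraMap Z S)
  cen : ∀ s : S, (∀ t, s * t = t * s) → ∃ z : Z, algebraMap Z S z = s

lemma CenterOf.fg [Module.Finite Z S] (hZ : CenterOf S Z) (hS : (⊤ : Subalgebra k S).FG) :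
    IsNoetherianRing Z ∧ Algebra.FiniteType k Z := by
  obtain ⟨B, hB, hBS⟩ := exists_subalgebra_of_fg k Z S hS (Module.Finite.fg_top)
  have : Algebra.FiniteType k B := (Subalgebra.fg_iff_finiteType B).1 hB
  have : IsNoetherianRing B := Algebra.FiniteType.isNoetherianRing k B
  have : Module.Finite B S := ⟨hBS⟩
  have hf : Module.Finite B Z := Module.Finite.of_injective
    ((Algebra.linearMap Z S).restrictScalars B) hZ.inj
  refine ⟨isNoetherian_of_isNoetherianRing_of_finite B Z |> fun h => ?_,
    Algebra.FiniteType.trans (S := B) inferInstance inferInstance⟩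
  exact isNoetherian_of_tower B h

lemma exists_residue [IsAlgClosed k] [Algebra.FiniteType k Z] {m : Ideal Z} (hm : m.IsMaximal)
    (z : Z) : ∃ c : k, z - algebraMap k Z c ∈ m := by
  let _ := Ideal.Quotient.field m
  have : Algebra.FiniteType k (Z ⧸ m) := Algebra.FiniteType.of_surjective
    (Ideal.Quotient.mkₐ k m) (Ideal.Quotient.mkₐ_surjective k m)
  have : Module.Finite k (Z ⧸ m) := finite_of_finite_type_of_isJacobsonRing k _
  obtain ⟨c, hc⟩ := (IsAlgClosed.algebraMap_bijective_of_isIntegral (k := k) (K := Z ⧸ m)).2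
    (Ideal.Quotient.mk m z)
  exact ⟨c, Ideal.Quotient.eq.1 hc.symm⟩

lemma smul_top_mul {I J : Ideal Z} {f g : S} (hf : f ∈ I • (⊤ : Submodule Z S))
    (hg : g ∈ J • (⊤ : Submodule Z S)) : f * g ∈ (I * J) • (⊤ : Submodule Z S) := by
  have h1 : ∀ t : S, t * g ∈ J • (⊤ : Submodule Z S) := fun t => by
    refine Submodule.smul_induction_on hg (fun r hr x _ => ?_) fun x y hx hy => ?_
    · rw [mul_smul_comm]; exact Submodule.smul_mem_smul hr trivial
    · rw [mul_add]; exact add_mem hx hy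
  rw [Submodule.mul_smul]
  refine Submodule.smul_induction_on hf (fun r hr x _ => ?_) fun x y hx hy => ?_
  · rw [smul_mul_assoc]; exact Submodule.smul_mem_smul hr (h1 x)
  · rw [add_mul]; exact add_mem hx hy

lemma smul_top_ts (I : Ideal Z) : TS ((I • (⊤ : Submodule Z S)).restrictScalars k) := by
  intro a f hf
  have hf' : f ∈ I • (⊤ : Submodule Z S) := hf
  have ht : a ∈ (⊤ : Ideal Z) • (⊤ : Submodule Z S) := by simp
  have h1 := smul_top_mul ht hf'
  have h2 := smul_top_mul hf' ht
  rw [Ideal.top_mul] at h1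
  rw [Ideal.mul_top] at h2
  exact ⟨h1, h2⟩

lemma smul_top_pow (I : Ideal Z) (j : ℕ) : ((I • (⊤ : Submodule Z S)).restrictScalars k) ^ (j + 1) ≤
    (I ^ (j + 1) • (⊤ : Submodule Z S)).restrictScalars k := by
  induction j with
  | zero => simp
  | succ j ih =>
    rw [pow_succ, pow_succ I]
    exact Submodule.mul_le.2 fun f hf g hg => smul_top_mul (ih hf) hg

lemma pow_smul_le_K [Nonempty n] {V : S →ₐ[k] Matrix n n k} {m : Ideal Z}
    (hV : ∀ z ∈ m, V (algebraMap Z S z) = 0) {i : ℕ} (hi : i ≠ 0) :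
    (m ^ i • (⊤ : Submodule Z S)).restrictScalars k ≤ K V ^ i := by
  have h1 : ∀ j, ∀ z ∈ m ^ (j + 1), algebraMap Z S z ∈ K V ^ (j + 1) := by
    intro j
    induction j with
    | zero => intro z hz; simpa [mem_K] using hV z (by simpa using hz)
    | succ j ih =>
      intro z hz
      rw [pow_succ] at hz
      induction hz using Submodule.mul_induction_on' with
      | mem_mul_mem a ha b hb =>
        rw [map_mul, pow_succ]; exact Submodule.mul_mem_mul (ih a ha) (hV b hb)
      | add a _ b _ ha hb => rw [map_add]; exact add_mem ha hb
  obtain ⟨j, rfl⟩ := Nat.exists_eq_succ_of_ne_zero hi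
  intro f hf
  have hf' : f ∈ m ^ (j + 1) • (⊤ : Submodule Z S) := hf
  clear hf
  refine Submodule.smul_induction_on hf' (fun r hr x _ => ?_) fun x y hx hy => add_mem hx hy
  rw [Algebra.smul_def]; exact (K_pow_ts (V := V) hi x _ (h1 j r hr)).2

lemma mem_of_map_eq_zero [Nonempty n] {V : S →ₐ[k] Matrix n n k} {m : Ideal Z} (hm : m.IsMaximal)
    (hV : ∀ z ∈ m, V (algebraMap Z S z) = 0) {z : Z} (hz : V (algebraMap Z S z) = 0) : z ∈ m := by
  by_contra hc
  obtain ⟨y, i, hi, h⟩ := hm.exists_inv hc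
  have := congrArg (fun t => V (algebraMap Z S t)) h
  simp only [map_add, map_mul, hz, hV i hi, map_one, mul_zero, add_zero] at this
  exact zero_ne_one this

/-- Elements commuting with everything up to high order are close to central ones. -/
lemma CenterOf.exists_approx [IsNoetherianRing Z] [Module.Finite Z S] (hZ : CenterOf S Z)
    {π : FreeAlgebra k (Fin 3) →ₐ[k] S} (hπ : Function.Surjective π) (m : Ideal Z) (i : ℕ) :
    ∃ J, ∀ f : S, (∀ s, f * s - s * f ∈ m ^ J • (⊤ : Submodule Z S)) →
      ∃ z : Z, f - algebraMap Z S z ∈ m ^ i • (⊤ : Submodule Z S) := by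
  let g : Fin 3 → S := fun l => π (FreeAlgebra.ι k l)
  obtain ⟨J, hJ⟩ := exists_artin_rees (LinearMap.pi fun l =>
    LinearMap.mulRight Z (g l) - LinearMap.mulLeft Z (g l)) m i
  refine ⟨J, fun f hf => ?_⟩
  obtain ⟨f', hf', h⟩ := hJ f (mem_smul_top_pi fun l => hf (g l))
  obtain ⟨z, hz⟩ := hZ.cen (f - f') fun t => by
    obtain ⟨t, rfl⟩ := hπ t
    induction t using FreeAlgebra.induction with
    | grade0 r => rw [AlgHom.commutes, Algebra.commutes]
    | grade1 l =>
      have := congrFun h l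
      simp only [LinearMap.pi_apply, LinearMap.sub_apply, LinearMap.mulRight_apply,
        LinearMap.mulLeft_apply] at this
      rw [sub_mul, mul_sub, sub_eq_sub_iff_sub_eq_sub]
      exact this
    | mul a b ha hb => rw [map_mul, ← mul_assoc, ha, mul_assoc, hb, mul_assoc]
    | add a b ha hb => rw [map_add, mul_add, add_mul, ha, hb]
  exact ⟨z, by rw [hz, sub_sub_cancel]; exact hf'⟩

lemma CenterOf.exists_strict [IsNoetherianRing Z] [Module.Finite Z S] (hZ : CenterOf S Z)
    (m : Ideal Z) (i : ℕ) :
    ∃ J, ∀ z : Z, algebraMap Z S z ∈ m ^ J • (⊤ : Submodule Z S) → z ∈ m ^ i := by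
  obtain ⟨J, hJ⟩ := exists_artin_rees (Algebra.linearMap Z S) m i
  refine ⟨J, fun z hz => ?_⟩
  obtain ⟨z', hz', h⟩ := hJ z hz
  rw [hZ.inj h]
  simpa using hz'

end Central

section Local
variable {k : Type u} [Field k] [IsAlgClosed k] {S : Type u} [Ring S] [Algebra k S] {Z : Type u}
  [CommRing Z] [Algebra k Z] [Algebra Z S] [IsScalarTower k Z S]

/-- The simple modules lying over a maximal ideal of the center. -/
lemma exists_reps_over [Algebra.FiniteType k Z] [Module.Finite Z S] {m : Ideal Z}
    (hm : m.IsMaximal) :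
    ∃ (r : ℕ) (d : Fin r → ℕ) (V : ∀ i, S →ₐ[k] Matrix (Fin (d i)) (Fin (d i)) k) (N : ℕ),
      (∀ i, d i ≠ 0) ∧ (∀ i, Function.Surjective (V i)) ∧
      (∀ i, ∀ z ∈ m, V i (algebraMap Z S z) = 0) ∧
      (⨅ i, K (V i)) ^ (N + 1) ≤ (m • (⊤ : Submodule Z S)).restrictScalars k := by
  have hts := smul_top_ts (k := k) (S := S) m
  let I : Ideal S :=
    { carrier := (m • (⊤ : Submodule Z S) : Submodule Z S)
      add_mem' := fun h h' => add_mem h h'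
      zero_mem' := zero_mem _
      smul_mem' := fun a f hf => (hts a f hf).1 }
  have hI : ∀ f, f ∈ I ↔ f ∈ m • (⊤ : Submodule Z S) := fun f => Iff.rfl
  have : I.IsTwoSided := ⟨fun b hf => (hts b _ hf).2⟩
  have hfin : Module.Finite k (S ⧸ I) := by
    obtain ⟨t, ht⟩ := Module.Finite.fg_top (R := Z) (M := S)
    classical
    refine ⟨⟨t.image (Ideal.Quotient.mkₐ k I), ?_⟩⟩
    rw [Finset.coe_image, eq_top_iff]
    intro s _
    obtain ⟨s, rfl⟩ := Ideal.Quotient.mkₐ_surjective k I s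
    have hs : s ∈ Submodule.span Z (t : Set S) := ht ▸ trivial
    induction hs using Submodule.span_induction with
    | mem x hx => exact Submodule.subset_span ⟨x, hx, rfl⟩
    | zero => rw [map_zero]; exact zero_mem _
    | add x y _ _ hx hy => rw [map_add]; exact add_mem (hx trivial) (hy trivial)
    | smul z x _ hx =>
      obtain ⟨c, hc⟩ := exists_residue (k := k) hm z
      have h1 : z • x - c • x ∈ I := by
        rw [hI, ← algebraMap_smul Z c x, ← sub_smul]
        exact Submodule.smul_mem_smul hc trivial
      have h2 : Ideal.Quotient.mkₐ k I (z • x) = c • Ideal.Quotient.mkₐ k I x := by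
        rw [← map_smul]
        exact Ideal.Quotient.eq.2 h1
      rw [h2]
      exact Submodule.smul_mem _ _ (hx trivial)
  obtain ⟨r, d, V, N, h1, h2, h3, h4⟩ := exists_simples (Ideal.Quotient.mkₐ k I)
    (Ideal.Quotient.mkₐ_surjective k I)
  refine ⟨r, d, V, N, h1, h2, fun i z hz => ?_, fun f hf => ?_⟩
  · refine mem_K.1 (h3 i ?_)
    refine Ideal.Quotient.eq_zero_iff_mem.2 ?_
    rw [hI, ← mul_one (algebraMap Z S z), ← Algebra.smul_def]
    exact Submodule.smul_mem_smul hz trivial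
  · exact Ideal.Quotient.eq_zero_iff_mem.1 (h4 hf)

lemma eval_center [Algebra.FiniteType k Z] {n : Type} [Fintype n] [DecidableEq n] {m : Ideal Z}
    {V : S →ₐ[k] Matrix n n k} (hV : ∀ z ∈ m, V (algebraMap Z S z) = 0) {z : Z} {c : k}
    (hc : z - algebraMap k Z c ∈ m) : V (algebraMap Z S z) = c • (1 : Matrix n n k) := by
  have := hV _ hc
  rw [map_sub, map_sub, sub_eq_zero, ← IsScalarTower.algebraMap_apply] at this
  rw [this, AlgHom.commutes, Algebra.algebraMap_eq_smul_one]

lemma K_le_of_intertwiner {m n : Type} [Fintype m] [DecidableEq m] [Fintype n] [DecidableEq n]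
    {π : FreeAlgebra k (Fin 3) →ₐ[k] S} {V : S →ₐ[k] Matrix m m k} {V' : S →ₐ[k] Matrix n n k}
    (hπ : Function.Surjective π) (hV : Function.Surjective V) (hV' : Function.Surjective V')
    {f : Matrix n m k} (hf0 : f ≠ 0) (hf : ∀ s, V' s * f = f * V s) : K V = K V' := by
  obtain ⟨g, h1, h2⟩ := schur (x := fun i => V (π (FreeAlgebra.ι k i)))
    (x' := fun i => V' (π (FreeAlgebra.ι k i)))
    (fun A => by
      obtain ⟨s, hs⟩ := hV A
      obtain ⟨p, rfl⟩ := hπ s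
      exact ⟨p, by rw [← map_eq_ev V (fun _ => rfl), hs]⟩)
    (fun A => by
      obtain ⟨s, hs⟩ := hV' A
      obtain ⟨p, rfl⟩ := hπ s
      exact ⟨p, by rw [← map_eq_ev V' (fun _ => rfl), hs]⟩) hf0 (fun i => hf _)
  ext s
  rw [mem_K, mem_K]
  constructor <;> intro h
  · have := hf s
    rw [h, Matrix.mul_zero] at this
    rw [← Matrix.mul_one (V' s), ← h1, ← Matrix.mul_assoc, this, Matrix.zero_mul]
  · have := hf s
    rw [h, Matrix.zero_mul] at this
    rw [← Matrix.one_mul (V s), ← h2, Matrix.mul_assoc, ← this, Matrix.mul_zero]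

variable [CharZero k]

/-- Over a maximal ideal there is only one simple module, when one of them is not rigid. -/
lemma Pres.exists_pow_le {n : Type} [Fintype n] [DecidableEq n] [Nonempty n]
    {π : FreeAlgebra k (Fin 3) →ₐ[k] S} {E : Env k} {ζ : k} {x : Fin 3 → Matrix n n k}
    [IsNoetherianRing Z] [Algebra.FiniteType k Z] [Module.Finite Z S] (hZ : CenterOf S Z)
    (P : Pres E.w π) {V : S →ₐ[k] Matrix n n k} (hV : Function.Surjective V)
    (hx : ∀ i, V (π (FreeAlgebra.ι k i)) = x i) (h : IsPt E ζ x) {u₁ u₂ : Fin 3 → Matrix n n k}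
    (h₁ : d1 E.w x x u₁ = 0) (h₂ : d1 E.w x x u₂ = 0) (ho : om E.w x u₁ u₂ ≠ 0)
    {m : Ideal Z} (hm : m.IsMaximal) (hVm : ∀ z ∈ m, V (algebraMap Z S z) = 0) :
    ∃ N, K V ^ (N + 1) ≤ (m • (⊤ : Submodule Z S)).restrictScalars k := by
  obtain ⟨r, d, U, N, hd, hU, hUm, hN⟩ := exists_reps_over (k := k) (S := S) hm
  have hne : ∀ i, Nonempty (Fin (d i)) := fun i => ⟨⟨0, Nat.pos_of_ne_zero (hd i)⟩⟩
  by_cases hall : ∀ i, K (U i) = K V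
  · refine ⟨N, le_trans (pow_le_pow_left' (le_iInf fun i => (hall i).ge) _) hN⟩
  exfalso
  push Not at hall
  obtain ⟨i₀, hi₀⟩ := hall
  obtain ⟨z₀, hz₀⟩ := hZ.cen (π E.z) fun t => P.central t
  obtain ⟨c₀, hc₀⟩ := exists_residue (k := k) hm z₀
  have hsc : c₀ = ζ := by
    have e1 := eval_center hVm hc₀
    rw [hz₀, map_eq_ev V hx, h.cen] at e1
    obtain ⟨p⟩ := ‹Nonempty n›
    have := congrFun (congrFun e1 p) p
    simpa using this.symm
  have hI := indep_of_om h h₁ h₂ ho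
  have hpt : ∀ i, IsPt E ζ (fun l => U i (π (FreeAlgebra.ι k l))) := fun i =>
    ⟨P.relAt_zero fun _ => rfl, fun A => by
      obtain ⟨s, hs⟩ := hU i A
      obtain ⟨p, rfl⟩ := P.surj s
      exact ⟨p, by rw [← map_eq_ev (U i) (fun _ => rfl), hs]⟩, by
      rw [← map_eq_ev (U i) (fun _ => rfl), ← hz₀, eval_center (hUm i) hc₀, hsc], h.hζ⟩
  have hno : ∀ i, K (U i) ≠ K V → ∀ f : Matrix (Fin (d i)) n k,
      (∀ s, U i s * f = f * V s) → f = 0 := fun i hi f hf => by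
    by_contra hf0
    exact hi (K_le_of_intertwiner P.surj hV (hU i) hf0 hf).symm
  have hno' : ∀ i, K (U i) ≠ K V → ∀ f : Matrix n (Fin (d i)) k,
      (∀ s, V s * f = f * U i s) → f = 0 := fun i hi f hf => by
    by_contra hf0
    exact hi (K_le_of_intertwiner P.surj (hU i) hV hf0 hf)
  have hpair : ∀ i, K (U i) ≠ K V → _ := fun i hi =>
    ext_vanish_pair h (hpt i) h₁ h₂ hI fun f hf => hno i hi f fun s => by
      obtain ⟨p, rfl⟩ := P.surj s
      rw [map_eq_ev (U i) (fun _ => rfl), map_eq_ev V hx]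
      exact ev_intertwine hf p
  obtain ⟨J, hJ⟩ := hZ.exists_approx P.surj m 1
  obtain ⟨e, he, he', hcom⟩ := exists_near_central (L := fun i => K (U i)) (ts_K V)
    (fun i => ts_K (U i)) (fun i hi => by
      obtain ⟨e, e1, e2⟩ := exists_separator hV (hU i) (hno i hi)
      obtain ⟨f, f1, f2⟩ := exists_separator (hU i) hV (hno' i hi)
      have a1 := (P.allInner hx (fun _ => rfl) (hpair i hi).2).inf_le hV (hU i) e1 e2
      have a2 := (P.allInner (fun _ => rfl) hx (hpair i hi).1).inf_le (hU i) hV f1 f2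
      refine le_antisymm (le_trans ?_ a2) (le_trans ?_ a1)
      · exact le_inf (ts_K (U i)).mul_le_right (ts_K V).mul_le_left
      · exact le_inf (ts_K V).mul_le_right (ts_K (U i)).mul_le_left)
    (fun i hi => by
      obtain ⟨e, e1, e2⟩ := exists_separator hV (hU i) (hno i hi)
      refine Submodule.mem_sup.2 ⟨1 - e, by rw [mem_K, map_sub, map_one V, e1, sub_self], e, e2,
        sub_add_cancel _ _⟩) hN hi₀ J
  obtain ⟨z, hz⟩ := hJ e fun s =>
    Submodule.smul_mono (Ideal.pow_le_pow_right (Nat.le_succ J)) le_rfl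
      (smul_top_pow m J (hcom s))
  obtain ⟨c, hc⟩ := exists_residue (k := k) hm z
  have hkill : ∀ {l : Type} [Fintype l] [DecidableEq l] [Nonempty l] {W : S →ₐ[k] Matrix l l k},
      (∀ z ∈ m, W (algebraMap Z S z) = 0) → W e = c • (1 : Matrix l l k) := by
    intro l _ _ _ W hW
    have := pow_smul_le_K hW one_ne_zero hz
    rw [pow_one, mem_K, map_sub, sub_eq_zero, eval_center hW hc] at this
    exact this
  have k1 := hkill (hUm i₀)
  have k2 := hkill hVm
  have he1 : V e = 1 := by
    rw [mem_K, map_sub, map_one V, sub_eq_zero] at he'; exact he'.symm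
  have he2 : U i₀ e = 0 := he
  rw [he2] at k1
  have hc0 : c = 0 := by
    obtain ⟨p⟩ := hne i₀
    simpa using (congrFun (congrFun k1 p) p).symm
  rw [he1, hc0, zero_smul] at k2
  exact one_ne_zero k2

end Local

lemma finrank_cotangent_eq {R : Type*} [CommRing R] {m : Ideal R} (hm : m.IsMaximal)
    {r : ℕ} (t : Fin r → R) (ht : ∀ a, t a ∈ m)
    (hli : ∀ c : Fin r → R, ∑ a, c a * t a ∈ m ^ 2 → ∀ a, c a ∈ m)
    (hsp : ∀ z ∈ m, ∃ c : Fin r → R, z - ∑ a, c a * t a ∈ m ^ 2) :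
    Module.finrank (R ⧸ m) m.Cotangent = r := by
  have : Nontrivial (R ⧸ m) := Ideal.Quotient.nontrivial_iff.2 hm.ne_top
  let v : Fin r → m.Cotangent := fun a => m.toCotangent ⟨t a, ht a⟩
  have key : ∀ c : Fin r → R, ∑ a, (Ideal.Quotient.mk m (c a)) • v a =
      m.toCotangent (∑ a, c a • (⟨t a, ht a⟩ : m)) := fun c => by
    rw [map_sum]
    refine Finset.sum_congr rfl fun a _ => ?_
    rw [map_smul]
    rfl
  have hval : ∀ c : Fin r → R, ((∑ a, c a • (⟨t a, ht a⟩ : m) : m) : R) = ∑ a, c a * t a :=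
    fun c => by simp
  have h1 : LinearIndependent (R ⧸ m) v := by
    rw [Fintype.linearIndependent_iff]
    intro g hg
    choose c hc using fun a => Ideal.Quotient.mk_surjective (I := m) (g a)
    have h2 := key c
    simp only [hc] at h2
    rw [hg, eq_comm, Ideal.toCotangent_eq_zero, hval] at h2
    intro a
    rw [← hc a]
    exact Ideal.Quotient.eq_zero_iff_mem.2 (hli c h2 a)
  have h2 : ⊤ ≤ Submodule.span (R ⧸ m) (Set.range v) := by
    rintro x -
    obtain ⟨⟨z, hz⟩, rfl⟩ := m.toCotangent_surjective x
    obtain ⟨c, hc⟩ := hsp z hz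
    have h3 : m.toCotangent ⟨z, hz⟩ = ∑ a, (Ideal.Quotient.mk m (c a)) • v a := by
      rw [key, Ideal.toCotangent_eq, hval]
      exact hc
    rw [h3]
    exact sum_mem fun a _ => Submodule.smul_mem _ _ (Submodule.subset_span ⟨a, rfl⟩)
  rw [Module.finrank_eq_card_basis (Module.Basis.mk h1 h2), Fintype.card_fin]

section Jets
variable {k : Type u} [Field k] {S : Type u} [Ring S] [Algebra k S]
  {n : Type} [Fintype n] [DecidableEq n] [Nonempty n]
  {V : S →ₐ[k] Matrix n n k} {σ : Matrix n n k →ₗ[k] S}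
  {δ : Fin 3 → S →ₗ[k] Matrix n n k} {z : S} {s : Fin 3 → S}
  {J : ℕ} {Φ : (Fin 3 →₀ ℕ) → S →ₗ[k] Matrix n n k}

lemma Jet.mul_swap (H : Jet V δ J Φ) {e : Fin 3 →₀ ℕ} (he : e.degree < J) (f g : S) :
    Φ e (g * f) = ∑ p ∈ Finset.HasAntidiagonal.antidiagonal e, Φ p.2 g * Φ p.1 f := by
  rw [H.mul e he]
  refine Finset.sum_nbij' Prod.swap Prod.swap ?_ ?_ (fun _ _ => rfl) (fun _ _ => rfl)
    fun _ _ => rfl <;>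
  · intro p hp
    rw [Finset.HasAntidiagonal.mem_antidiagonal] at hp ⊢
    rw [← hp, add_comm]
    rfl

lemma degree_le_of_mem {e : Fin 3 →₀ ℕ} {p : (Fin 3 →₀ ℕ) × (Fin 3 →₀ ℕ)}
    (hp : p ∈ Finset.HasAntidiagonal.antidiagonal e) : p.1.degree + p.2.degree = e.degree := by
  rw [← Finset.HasAntidiagonal.mem_antidiagonal.1 hp, map_add]

lemma Jet.comm_of_scalar (H : Jet V δ J Φ) {f : S} {q : (Fin 3 →₀ ℕ) → k}
    (hf : ∀ e : Fin 3 →₀ ℕ, e.degree < J → Φ e f = q e • (1 : Matrix n n k))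
    {e : Fin 3 →₀ ℕ} (he : e.degree < J) (g : S) : Φ e (f * g - g * f) = 0 := by
  rw [map_sub, H.mul e he, H.mul_swap he, sub_eq_zero]
  refine Finset.sum_congr rfl fun p hp => ?_
  have := degree_le_of_mem hp
  rw [hf p.1 (by omega)]
  simp

lemma Jet.exists_scalar (H : Jet V δ J Φ) (hV : Function.Surjective V) {z : S}
    (hz : ∀ s, z * s = s * z) (e : Fin 3 →₀ ℕ) (he : e.degree < J) :
    ∃ c : k, Φ e z = c • (1 : Matrix n n k) := by
  induction hd : e.degree using Nat.strong_induction_on generalizing e with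
  | _ d ih =>
  refine scalar_of_comm _ fun A => ?_
  obtain ⟨g, rfl⟩ := hV A
  have h1 : ∑ p ∈ Finset.HasAntidiagonal.antidiagonal e,
      (Φ p.1 z * Φ p.2 g - Φ p.2 g * Φ p.1 z) = 0 := by
    rw [Finset.sum_sub_distrib, ← H.mul e he, ← H.mul_swap he, hz, sub_self]
  rw [Finset.sum_eq_single (e, 0)] at h1
  · rw [H.zero, sub_eq_zero] at h1
    exact h1.symm
  · intro p hp hne
    have h2 := degree_le_of_mem hp
    have h3 : p.2.degree ≠ 0 := fun h => hne (by
      have h4 := (Finsupp.degree_eq_zero_iff _).1 h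
      have h5 := Finset.HasAntidiagonal.mem_antidiagonal.1 hp
      rw [h4, add_zero] at h5
      exact Prod.ext h5 h4)
    obtain ⟨c, hc⟩ := ih p.1.degree (by omega) p.1 (by omega) rfl
    rw [hc]
    simp
  · intro h
    exact absurd (Finset.HasAntidiagonal.mem_antidiagonal.2 (add_zero e)) h

lemma Jet.mul_delta (H : Jet V δ J Φ) {i : ℕ} (hiJ : i ≤ J) {f g : S} {a b : Fin 3 →₀ ℕ}
    (hf : ∀ e : Fin 3 →₀ ℕ, e.degree < i → Φ e f = if e = a then 1 else 0)
    (hg : ∀ e : Fin 3 →₀ ℕ, e.degree < i → Φ e g = if e = b then 1 else 0)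
    (e : Fin 3 →₀ ℕ) (he : e.degree < i) :
    Φ e (f * g) = if e = a + b then 1 else 0 := by
  have h1 : ∀ p ∈ Finset.HasAntidiagonal.antidiagonal e,
      Φ p.1 f * Φ p.2 g = if p = (a, b) then 1 else 0 := fun p hp => by
    have h2 := degree_le_of_mem hp
    rw [hf _ (by omega), hg _ (by omega), ite_mul, zero_mul, one_mul, ← ite_and]
    exact if_congr (Prod.ext_iff (x := p) (y := (a, b))).symm rfl rfl
  rw [H.mul e (by omega), Finset.sum_congr rfl h1, Finset.sum_ite_eq']
  exact if_congr (by rw [Finset.HasAntidiagonal.mem_antidiagonal, eq_comm]) rfl rfl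

end Jets

section Main
variable {k : Type u} [Field k] [IsAlgClosed k] {S : Type u} [Ring S] [Algebra k S] {Z : Type u}
  [CommRing Z] [Algebra k Z] [Algebra Z S] [IsScalarTower k Z S]
  {n : Type} [Fintype n] [DecidableEq n] [Nonempty n]
  {V : S →ₐ[k] Matrix n n k} {σ : Matrix n n k →ₗ[k] S}
  {δ : Fin 3 → S →ₗ[k] Matrix n n k} {z : S} {s : Fin 3 → S}

lemma Coord.finrank_cotangent [IsNoetherianRing Z] [Module.Finite Z S] (hZ : CenterOf S Z)
    {π : FreeAlgebra k (Fin 3) →ₐ[k] S} (hπ : Function.Surjective π)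
    (C : Coord V σ δ z s) (hJ : ∀ J, ∃ Φ, Jet V δ J Φ) {m : Ideal Z} (hm : m.IsMaximal)
    (hVm : ∀ z ∈ m, V (algebraMap Z S z) = 0) {N : ℕ}
    (hN : K V ^ (N + 1) ≤ (m • (⊤ : Submodule Z S)).restrictScalars k) :
    Module.finrank (Z ⧸ m) m.Cotangent = 3 := by
  have hpow : ∀ j, K V ^ ((N + 1) * (j + 2)) ≤ (m ^ j • (⊤ : Submodule Z S)).restrictScalars k := by
    intro j
    rw [pow_mul]
    refine le_trans (pow_le_pow_left' hN _) (le_trans (smul_top_pow m (j + 1)) ?_)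
    have hle : m ^ (j + 1 + 1) ≤ m ^ j := Ideal.pow_le_pow_right (by omega)
    exact fun f hf => Submodule.smul_mono hle (le_refl (⊤ : Submodule Z S)) hf
  obtain ⟨J₂, hJ₂⟩ := hZ.exists_strict m 2
  obtain ⟨i, hi2, hi⟩ : ∃ i, 2 ≤ i ∧ K V ^ i ≤ (m ^ J₂ • (⊤ : Submodule Z S)).restrictScalars k :=
    ⟨(N + 1) * (J₂ + 2), by nlinarith, hpow J₂⟩
  obtain ⟨J₁, hJ₁⟩ := hZ.exists_approx hπ m i
  obtain ⟨R, hR0, hR⟩ : ∃ i, i ≠ 0 ∧ K V ^ i ≤ (m ^ J₁ • (⊤ : Submodule Z S)).restrictScalars k :=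
    ⟨(N + 1) * (J₁ + 2), by positivity, hpow J₁⟩
  obtain ⟨Φ, H⟩ := hJ (max i R)
  have hiM : i ≤ max i R := le_max_left _ _
  have hRM : R ≤ max i R := le_max_right _ _
  have hcen : ∀ z : Z, ∀ s : S, algebraMap Z S z * s = s * algebraMap Z S z :=
    fun z s => Algebra.commutes z s
  have hmK : ∀ z ∈ m ^ 2, algebraMap Z S z ∈ K V ^ 2 := fun z hz => by
    have h1 : algebraMap Z S z ∈ m ^ 2 • (⊤ : Submodule Z S) := by
      rw [← mul_one (algebraMap Z S z), ← Algebra.smul_def]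
      exact Submodule.smul_mem_smul hz Submodule.mem_top
    exact pow_smul_le_K hVm two_ne_zero h1
  have h4 : ∀ e₀ : Fin 3 →₀ ℕ, e₀ ≠ 0 → ∃ z ∈ m, ∀ e : Fin 3 →₀ ℕ, e.degree < i →
      Φ e (algebraMap Z S z) = if e = e₀ then 1 else 0 := by
    intro e₀ he₀
    obtain ⟨f, hf⟩ := C.exists_jet H (fun e => if e = e₀ then 1 else 0) (max i R) le_rfl
    obtain ⟨z, hz⟩ := hJ₁ f fun t => hR <| C.mem_pow_of_jet H hR0 hRM fun e he =>
      H.comm_of_scalar (q := fun e => if e = e₀ then 1 else 0)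
        (fun e he => by rw [hf e he]; split_ifs <;> simp) (by omega) t
    have hz' := pow_smul_le_K hVm (by omega) hz
    have hjet : ∀ e : Fin 3 →₀ ℕ, e.degree < i →
        Φ e (algebraMap Z S z) = if e = e₀ then 1 else 0 := fun e he => by
      have h5 := H.eq_zero (by omega) hz' he (by omega)
      rw [map_sub, hf e (by omega), sub_eq_zero] at h5
      exact h5.symm
    refine ⟨z, mem_of_map_eq_zero hm hVm ?_, hjet⟩
    rw [← H.zero, hjet 0 (by simp; omega), if_neg (Ne.symm he₀)]
  have hs0 : ∀ a : Fin 3, Finsupp.single a 1 ≠ (0 : Fin 3 →₀ ℕ) := fun a => by simp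
  have h6 : ∀ e₀ : Fin 3 →₀ ℕ, ∃ z : Z, 2 ≤ e₀.degree → z ∈ m ^ 2 ∧ ∀ e : Fin 3 →₀ ℕ,
      e.degree < i → Φ e (algebraMap Z S z) = if e = e₀ then 1 else 0 := by
    intro e₀
    by_cases he₀ : 2 ≤ e₀.degree
    swap
    · exact ⟨0, fun h => absurd h he₀⟩
    obtain ⟨a, ha⟩ : ∃ a, e₀ a ≠ 0 := by
      by_contra hc
      push Not at hc
      have : e₀ = 0 := by ext i; exact hc i
      simp [this] at he₀
    obtain ⟨e', rfl⟩ := exists_add_of_le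
      (Finsupp.single_le_iff.2 (by omega) : Finsupp.single a 1 ≤ e₀)
    have he' : e' ≠ 0 := by
      rintro rfl
      simp at he₀
    obtain ⟨z₁, m₁, j₁⟩ := h4 _ (hs0 a)
    obtain ⟨z₂, m₂, j₂⟩ := h4 _ he'
    refine ⟨z₁ * z₂, fun _ => ⟨by rw [pow_two]; exact Ideal.mul_mem_mul m₁ m₂, fun e he => ?_⟩⟩
    rw [map_mul]
    exact H.mul_delta hiM j₁ j₂ e he
  choose y hy using h6
  have h7 : ∀ z ∈ m, (∀ a, δ a (algebraMap Z S z) = 0) → z ∈ m ^ 2 := by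
    intro z hz hδ
    choose t ht using fun e : Fin 3 →₀ ℕ => (show ∃ c : k, e.degree < max i R →
        Φ e (algebraMap Z S z) = c • (1 : Matrix n n k) by
      by_cases he : e.degree < max i R
      · obtain ⟨c, hc⟩ := H.exists_scalar C.surj (hcen z) e he
        exact ⟨c, fun _ => hc⟩
      · exact ⟨0, fun h => absurd h he⟩)
    let F : Finset (Fin 3 →₀ ℕ) := (Finset.Ico 2 i).biUnion expo
    have hF : ∀ e, e ∈ F ↔ 2 ≤ e.degree ∧ e.degree < i := fun e => by
      simp only [F, Finset.mem_biUnion, Finset.mem_Ico, mem_expo]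
      constructor
      · rintro ⟨_, h, rfl⟩; exact h
      · intro h; exact ⟨_, h, rfl⟩
    let yy : Z := ∑ e ∈ F, t e • y e
    have hyy : yy ∈ m ^ 2 := sum_mem fun e he => by
      rw [Algebra.smul_def]
      exact Ideal.mul_mem_left _ _ (hy e ((hF e).1 he).1).1
    have hyj : ∀ e : Fin 3 →₀ ℕ, e.degree < i →
        Φ e (algebraMap Z S yy) = if e ∈ F then t e • 1 else 0 := by
      intro e he
      have hlin : algebraMap Z S yy = ∑ e ∈ F, t e • algebraMap Z S (y e) := by
        simp only [yy, map_sum]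
        refine Finset.sum_congr rfl fun e _ => ?_
        rw [Algebra.algebraMap_eq_smul_one, Algebra.algebraMap_eq_smul_one, smul_assoc]
      rw [hlin, map_sum, ← Finset.sum_ite_eq F e fun e => t e • (1 : Matrix n n k)]
      refine Finset.sum_congr rfl fun e' he' => ?_
      rw [map_smul, (hy e' ((hF e').1 he').1).2 e he, smul_ite, smul_zero]
    have hzy : algebraMap Z S (z - yy) ∈ K V ^ i := by
      refine C.mem_pow_of_jet H (by omega) hiM fun e he => ?_
      rw [map_sub, map_sub, hyj e he]
      split_ifs with hc
      · rw [ht e (by omega), sub_self]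
      · have h8 : e.degree < 2 := by
          by_contra h9
          exact hc ((hF e).2 ⟨by omega, he⟩)
        rw [sub_zero]
        rcases Nat.lt_or_ge e.degree 1 with h9 | h9
        · rw [(Finsupp.degree_eq_zero_iff e).1 (by omega), H.zero, hVm z hz]
        · obtain ⟨a, rfl⟩ := exists_single_add (show e.degree = 1 by omega)
          rw [H.one, hδ]
    rw [← sub_add_cancel z yy]
    exact add_mem (hJ₂ _ (hi hzy)) hyy
  choose z₁ m₁ j₁ using fun a : Fin 3 => h4 _ (hs0 a)
  have hδz : ∀ a b, δ b (algebraMap Z S (z₁ a)) = if b = a then 1 else 0 := fun a b => by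
    rw [← H.one, j₁ a _ (by simp; omega)]
    exact if_congr (Finsupp.single_left_injective one_ne_zero).eq_iff rfl rfl
  have hδs : ∀ (c : Fin 3 → Z) b, δ b (algebraMap Z S (∑ a, c a * z₁ a)) =
      V (algebraMap Z S (c b)) := fun c b => by
    rw [map_sum, map_sum]
    have : ∀ a, δ b (algebraMap Z S (c a * z₁ a)) =
        if b = a then V (algebraMap Z S (c a)) else 0 := fun a => by
      rw [map_mul, C.der b, hδz, hVm _ (m₁ a)]
      simp
    rw [Finset.sum_congr rfl fun a _ => this a, Finset.sum_ite_eq, if_pos (Finset.mem_univ b)]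
  refine finrank_cotangent_eq hm z₁ m₁ (fun c hc a => ?_) fun z hz => ?_
  · refine mem_of_map_eq_zero hm hVm ?_
    rw [← hδs, ← H.one]
    exact H.eq_zero two_ne_zero (hmK _ hc) (by simp) (by simp; omega)
  · choose t ht using fun a : Fin 3 => H.exists_scalar C.surj (hcen z) (Finsupp.single a 1)
      (by simp; omega)
    refine ⟨fun a => algebraMap k Z (t a), h7 _ (sub_mem hz (sum_mem fun a _ =>
      Ideal.mul_mem_left _ _ (m₁ a))) fun b => ?_⟩
    rw [map_sub, map_sub, hδs, ← H.one, ht, ← IsScalarTower.algebraMap_apply, AlgHom.commutes,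
      Algebra.algebraMap_eq_smul_one, sub_self]

variable [CharZero k]

lemma Pres.fg {w : Fin 3 → Fin 3 → Fin 3 → k} {π : FreeAlgebra k (Fin 3) →ₐ[k] S}
    (P : Pres w π) : (⊤ : Subalgebra k S).FG := by
  have : Algebra.FiniteType k S := Algebra.FiniteType.of_surjective π P.surj
  exact this.1

/-- A point of the center supporting a non-rigid simple module is smooth. -/
theorem Pres.finrank_cotangent [Module.Finite Z S] (hZ : CenterOf S Z)
    {π : FreeAlgebra k (Fin 3) →ₐ[k] S} {E : Env k} {ζ : k} {x : Fin 3 → Matrix n n k}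
    (P : Pres E.w π) (hV : Function.Surjective V)
    (hx : ∀ i, V (π (FreeAlgebra.ι k i)) = x i) (h : IsPt E ζ x) {u : Fin 3 → Matrix n n k}
    (hu : d1 E.w x x u = 0) (hg : ¬ IsGauge x u)
    {m : Ideal Z} (hm : m.IsMaximal) (hVm : ∀ z ∈ m, V (algebraMap Z S z) = 0) :
    Module.finrank (Z ⧸ m) m.Cotangent = 3 := by
  obtain ⟨_, _⟩ := hZ.fg P.fg
  obtain ⟨u', hu', ho⟩ := exists_partner h hu hg
  obtain ⟨N, hN⟩ := P.exists_pow_le hZ hV hx h hu hu' ho hm hVm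
  obtain ⟨σ, δ, F⟩ := P.exists_frame hV hx h hu hu' ho
  obtain ⟨s, s2, sK, sδ, sσ⟩ := F.exists_params
  exact (Coord.mk F s2 sK sδ sσ).finrank_cotangent hZ P.surj
    (P.exists_jets hx h F.der) hm hVm hN

end Main

section Lift
variable {k : Type u} [Field k] {S : Type u} [Ring S] [Algebra k S]
  {w : Fin 3 → Fin 3 → Fin 3 → k} {π : FreeAlgebra k (Fin 3) →ₐ[k] S}

lemma lift_sandRel {A : Type*} [Ring A] [Algebra k A] {y : Fin 3 → A}
    (hy : ∀ j, relAt w y j = 0) (L : Sand k) : FreeAlgebra.lift k y (sandRel w L) = 0 := by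
  rw [sandRel, map_list_sum, List.map_map]
  refine List.sum_eq_zero fun t ht => ?_
  obtain ⟨y, _, rfl⟩ := List.mem_map.1 ht
  simp [lift_rel, hy]

/-- The universal property of the presentation. -/
lemma Pres.exists_lift (P : Pres w π) {A : Type*} [Ring A] [Algebra k A] {y : Fin 3 → A}
    (hy : ∀ j, relAt w y j = 0) : ∃ φ : S →ₐ[k] A, ∀ f, φ (π f) = FreeAlgebra.lift k y f := by
  obtain ⟨T, hT⟩ := exists_factor P.surj (FreeAlgebra.lift k y).toLinearMap fun f hf => by
    obtain ⟨L, rfl⟩ := P.ker f hf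
    exact lift_sandRel hy L
  refine ⟨AlgHom.ofLinearMap T ?_ fun s t => ?_, hT⟩
  · rw [← map_one π, hT]; exact map_one (FreeAlgebra.lift k y)
  · obtain ⟨f, rfl⟩ := P.surj s
    obtain ⟨g, rfl⟩ := P.surj t
    rw [← map_mul, hT, hT, hT]; exact map_mul (FreeAlgebra.lift k y) _ _

lemma Homog.zero (N : ℕ) : Homog N (0 : FreeAlgebra k (Fin 3)) := Submodule.zero_mem _

lemma Homog.add {N : ℕ} {f g : FreeAlgebra k (Fin 3)} (hf : Homog N f) (hg : Homog N g) :
    Homog N (f + g) := Submodule.add_mem _ hf hg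

lemma Homog.smul {N : ℕ} {f : FreeAlgebra k (Fin 3)} (c : k) (hf : Homog N f) :
    Homog N (c • f) := Submodule.smul_mem _ c hf

lemma Homog.ι (i : Fin 3) : Homog 1 (FreeAlgebra.ι k i) := by
  rw [Homog, pow_one]
  exact Submodule.subset_span ⟨i, rfl⟩

lemma Homog.mul {M N : ℕ} {f g : FreeAlgebra k (Fin 3)} (hf : Homog M f) (hg : Homog N g) :
    Homog (M + N) (f * g) := by
  rw [Homog, pow_add]
  exact Submodule.mul_mem_mul hf hg

/-- Every noncommutative polynomial is a finite sum of homogeneous ones. -/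
lemma exists_homog (f : FreeAlgebra k (Fin 3)) :
    ∃ (s : Finset ℕ) (p : ℕ → FreeAlgebra k (Fin 3)), (∀ n, Homog n (p n)) ∧ f = ∑ n ∈ s, p n := by
  let H : ℕ → Submodule k (FreeAlgebra k (Fin 3)) := fun n =>
    Submodule.span k (Set.range (FreeAlgebra.ι k : Fin 3 → FreeAlgebra k (Fin 3))) ^ n
  have hle : ∀ n, H n ≤ ⨆ n, H n := le_iSup H
  have hmul : (⨆ n, H n) * (⨆ n, H n) ≤ ⨆ n, H n := by
    rw [Submodule.iSup_mul]
    refine iSup_le fun i => ?_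
    rw [Submodule.mul_iSup]
    exact iSup_le fun j => (pow_add _ i j).symm.le.trans (hle (i + j))
  have hf : f ∈ ⨆ n, H n := by
    induction f using FreeAlgebra.induction with
    | grade0 r =>
      refine hle 0 ?_
      rw [show H 0 = 1 from pow_zero _]
      exact Submodule.mem_one.2 ⟨r, rfl⟩
    | grade1 i => exact hle 1 (Homog.ι i)
    | add f g hf hg => exact add_mem hf hg
    | mul f g hf hg => exact hmul (Submodule.mul_mem_mul hf hg)
  obtain ⟨p, hp, hs⟩ := (Submodule.mem_iSup_iff_exists_finsupp H f).1 hf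
  exact ⟨p.support, p, hp, hs.symm⟩

/-- Vanishing of a polynomial with vector coefficients at all nonzero points. -/
lemma eq_zero_of_sum_pow [Infinite k] {M : Type*} [AddCommGroup M] [Module k M] (s : Finset ℕ)
    (v : ℕ → M) (h : ∀ l : k, l ≠ 0 → ∑ n ∈ s, l ^ n • v n = 0) : ∀ n ∈ s, v n = 0 := by
  intro n hn
  rw [← Module.forall_dual_apply_eq_zero_iff k]
  intro φ
  let q : Polynomial k := ∑ n ∈ s, Polynomial.monomial n (φ (v n))
  have hq : q = 0 := by
    refine Polynomial.eq_zero_of_infinite_isRoot q (Set.Infinite.mono ?_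
      (Set.finite_singleton (0 : k)).infinite_compl)
    intro l hl
    have := congrArg φ (h l hl)
    rw [map_sum, map_zero] at this
    rw [Set.mem_ofPred_eq, Polynomial.IsRoot, Polynomial.eval_finsetSum, ← this]
    refine Finset.sum_congr rfl fun n _ => ?_
    rw [Polynomial.eval_monomial, map_smul, smul_eq_mul, mul_comm]
  have h2 := congrArg (fun p => Polynomial.coeff p n) hq
  simpa [q, Polynomial.finsetSum_coeff, Polynomial.coeff_monomial, hn] using h2

variable [Infinite k]

/-- Homogeneous components of central elements are central. -/
lemma Pres.central_component (P : Pres w π) (s : Finset ℕ) (p : ℕ → FreeAlgebra k (Fin 3))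
    (hp : ∀ n, Homog n (p n)) (hc : ∀ t, π (∑ n ∈ s, p n) * t = t * π (∑ n ∈ s, p n)) :
    ∀ n ∈ s, ∀ t, π (p n) * t = t * π (p n) := by
  have key : ∀ i, ∀ n ∈ s, π (p n) * π (FreeAlgebra.ι k i) - π (FreeAlgebra.ι k i) * π (p n) = 0 := by
    intro i
    refine eq_zero_of_sum_pow (k := k) s _ fun l hl => ?_
    obtain ⟨φ, hφ⟩ := P.exists_lift (y := fun i => l • π (FreeAlgebra.ι k i)) fun j => by
      have h1 := P.rel j
      rw [show π = FreeAlgebra.lift k fun i => π (FreeAlgebra.ι k i) from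
        FreeAlgebra.hom_ext (by ext1 i; simp), lift_rel] at h1
      simp only [relAt, smul_mul_smul_comm] at h1 ⊢
      simp only [smul_comm _ (l * l), ← Finset.smul_sum, h1, smul_zero]
    have h2 : ∀ n, φ (π (p n)) = l ^ n • π (p n) := fun n => by
      rw [hφ, (hp n).lift_smul]
      congr 1
      exact AlgHom.congr_fun (FreeAlgebra.hom_ext (by ext1 i; simp)) _
    have h3 := congrArg φ (hc (π (FreeAlgebra.ι k i)))
    simp only [map_mul, map_sum, h2, hφ, FreeAlgebra.lift_ι_apply] at h3
    have h4 : l • (∑ n ∈ s, l ^ n • (π (p n) * π (FreeAlgebra.ι k i) -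
        π (FreeAlgebra.ι k i) * π (p n))) = 0 := by
      rw [← sub_eq_zero] at h3
      rw [← h3, mul_smul_comm, smul_mul_assoc, ← smul_sub, Finset.sum_mul, Finset.mul_sum,
        ← Finset.sum_sub_distrib]
      simp only [smul_sub, smul_mul_assoc, mul_smul_comm]
    exact (smul_eq_zero.1 h4).resolve_left hl
  intro n hn t
  obtain ⟨f, rfl⟩ := P.surj t
  induction f using FreeAlgebra.induction with
  | grade0 r => rw [AlgHom.commutes]; exact (Algebra.commutes _ _).symm
  | grade1 i => exact sub_eq_zero.1 (key i n hn)
  | add f g hf hg => rw [map_add, mul_add, add_mul, hf, hg]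
  | mul f g hf hg => rw [map_mul, ← mul_assoc, hf, mul_assoc, hg, mul_assoc]

/-- The environment attached to a homogeneous central element. -/
lemma Pres.exists_env (P : Pres w π) (hw : ∀ i j l, w i j l = w j l i) {N : ℕ} (hN : N ≠ 0)
    {z : FreeAlgebra k (Fin 3)} (hz : Homog N z) (hc : ∀ t, π z * t = t * π z) :
    ∃ E : Env k, E.w = w ∧ E.z = z ∧ E.N = N := by
  obtain ⟨L1, h1⟩ := exists_deriv z
  choose L2 h2 using fun i => P.ker (z * FreeAlgebra.ι k i - FreeAlgebra.ι k i * z) (by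
    rw [map_sub, map_mul, map_mul, hc, sub_self])
  exact ⟨⟨w, hw, z, N, hN, hz, ⟨L1, L2, h1, h2⟩⟩, rfl, rfl, rfl⟩

end Lift

section Point
variable {k : Type u} [Field k] [IsAlgClosed k] [CharZero k] {S : Type u} [Ring S] [Algebra k S]
  {Z : Type u} [CommRing Z] [Algebra k Z] [Algebra Z S] [IsScalarTower k Z S]
  {w : Fin 3 → Fin 3 → Fin 3 → k} {π : FreeAlgebra k (Fin 3) →ₐ[k] S}

/-- Some simple module lies over any maximal ideal of the center. -/
lemma CenterOf.exists_rep [Algebra.FiniteType k Z] [Module.Finite Z S] (hZ : CenterOf S Z)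
    {m : Ideal Z} (hm : m.IsMaximal) :
    ∃ (d : ℕ) (V : S →ₐ[k] Matrix (Fin d) (Fin d) k), d ≠ 0 ∧ Function.Surjective V ∧
      ∀ z ∈ m, V (algebraMap Z S z) = 0 := by
  obtain ⟨r, d, V, N, hd, hV, hVm, hN⟩ := exists_reps_over (k := k) (S := S) hm
  rcases Nat.eq_zero_or_pos r with rfl | hr
  · exfalso
    have h1 : (⊤ : Submodule Z S) ≤ m • ⊤ := by
      intro s _
      refine hN (?_ : s ∈ (⨅ i, K (V i)) ^ (N + 1))
      rw [iInf_of_empty]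
      have h2 : ∀ n : ℕ, s ∈ (⊤ : Submodule k S) ^ (n + 1) := fun n => by
        induction n with
        | zero => simp
        | succ n ih =>
          rw [pow_succ, ← mul_one s]
          exact Submodule.mul_mem_mul ih Submodule.mem_top
      exact h2 N
    obtain ⟨y, h2, h3⟩ := Submodule.exists_sub_one_mem_and_smul_eq_zero_of_fg_of_le_smul m
      (⊤ : Submodule Z S) Module.Finite.fg_top h1
    have h4 := h3 1 trivial
    rw [Algebra.smul_def, mul_one] at h4
    rw [hZ.inj (h4.trans (map_zero (algebraMap Z S)).symm), zero_sub] at h2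
    exact hm.ne_top ((Ideal.eq_top_iff_one m).2 (by simpa using neg_mem h2))
  · exact ⟨d ⟨0, hr⟩, V ⟨0, hr⟩, hd _, hV _, hVm _⟩

/-- Away from the origin, some homogeneous central element takes a nonzero value. -/
lemma Pres.exists_isPt [Algebra.FiniteType k Z] (hZ : CenterOf S Z)
    (P : Pres w π) (hw : ∀ i j l, w i j l = w j l i) {m : Ideal Z} (hm : m.IsMaximal)
    {n : Type} [Fintype n] [DecidableEq n] [Nonempty n]
    {V : S →ₐ[k] Matrix n n k} (hV : Function.Surjective V)
    (hVm : ∀ z ∈ m, V (algebraMap Z S z) = 0)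
    {ε : S →ₐ[k] k} (hε : ∀ i, ε (π (FreeAlgebra.ι k i)) = 0)
    {z : Z} (hz : ε (algebraMap Z S z) = 0) (hzm : z ∉ m) :
    ∃ (E : Env k) (ζ : k), E.w = w ∧ IsPt E ζ fun i => V (π (FreeAlgebra.ι k i)) := by
  obtain ⟨f, hf⟩ := P.surj (algebraMap Z S z)
  obtain ⟨s, p, hp, rfl⟩ := exists_homog f
  have hcen := P.central_component s p hp fun t => by rw [hf]; exact Algebra.commutes _ _
  have hε0 : ∀ f, ε (π f) = FreeAlgebra.lift k (fun _ : Fin 3 => (0 : k)) f := fun f => by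
    have : ε.comp π = FreeAlgebra.lift k (fun _ : Fin 3 => (0 : k)) :=
      FreeAlgebra.hom_ext (by ext1 i; simp [hε])
    exact AlgHom.congr_fun this f
  have hεn : ∀ n, n ≠ 0 → ε (π (p n)) = 0 := fun n hn => by
    have h1 := (hp n).lift_smul (R := k) 0 (fun _ : Fin 3 => (0 : k))
    rw [zero_pow hn] at h1
    rw [hε0]
    simpa using h1
  have h0 : 0 ∈ s → π (p 0) = 0 := fun h0s => by
    have h1 := hp 0
    rw [Homog, pow_zero, Submodule.mem_one] at h1
    obtain ⟨c, hc⟩ := h1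
    have h2 : ε (π (p 0)) = 0 := by
      rw [← hf, map_sum, map_sum, Finset.sum_eq_single_of_mem 0 h0s fun n _ hn => hεn n hn] at hz
      exact hz
    rw [← hc, AlgHom.commutes, AlgHom.commutes] at h2
    have h3 : c = 0 := h2
    rw [← hc, h3, map_zero, map_zero]
  obtain ⟨N, hN, hVN⟩ : ∃ n ∈ s, V (π (p n)) ≠ 0 := by
    by_contra hc
    push Not at hc
    refine hzm (mem_of_map_eq_zero hm hVm ?_)
    rw [← hf, map_sum, map_sum]
    exact Finset.sum_eq_zero hc
  have hN0 : N ≠ 0 := by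
    rintro rfl
    exact hVN (by rw [h0 hN, map_zero])
  obtain ⟨E, hEw, hEz, hEN⟩ := P.exists_env hw hN0 (hp N) (hcen N hN)
  obtain ⟨zN, hzN⟩ := hZ.cen _ (hcen N hN)
  obtain ⟨c, hc⟩ := exists_residue (k := k) hm zN
  have h1 := eval_center hVm hc
  rw [hzN] at h1
  refine ⟨E, c, hEw, ?_, fun A => ?_, ?_, ?_⟩
  · rw [hEw]; exact P.relAt_zero fun _ => rfl
  · obtain ⟨s, rfl⟩ := hV A
    obtain ⟨f, rfl⟩ := P.surj s
    exact ⟨f, (map_eq_ev V (fun _ => rfl) f).symm⟩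
  · rw [← map_eq_ev V (fun _ => rfl), hEz, h1]
  · rintro rfl
    exact hVN (by rw [h1, zero_smul])

end Point

section Concrete
variable (k : Type u) [Field k] (a b c : k)

/-- The tensor of the Sklyanin relations. -/
def skw (j i l : Fin 3) : k :=
  if i = j ∧ l = j then c else if i = j + 1 ∧ l = j + 2 then a
    else if i = j + 2 ∧ l = j + 1 then b else 0

lemma skw_cyclic (i j l : Fin 3) : skw k a b c i j l = skw k a b c j l i := by
  fin_cases i <;> fin_cases j <;> fin_cases l <;> rfl

lemma relAt_skw {A : Type*} [Ring A] [Algebra k A] (x : Fin 3 → A) (j : Fin 3) :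
    relAt (skw k a b c) x j =
      a • (x (j + 1) * x (j + 2)) + b • (x (j + 2) * x (j + 1)) + c • (x j * x j) := by
  fin_cases j <;> simp [relAt, skw, Fin.sum_univ_three] <;> abel

lemma rel_eq_relAt (w : Fin 3 → Fin 3 → Fin 3 → k) (j : Fin 3) :
    rel w j = relAt w (FreeAlgebra.ι k) j := rfl

/-- The presentation of the Sklyanin algebra. -/
def skπ : FreeAlgebra k (Fin 3) →ₐ[k] Sklyanin k a b c :=
  RingQuot.mkAlgHom k (SklyaninRel k a b c)

lemma skRel_rel (j : Fin 3) : SklyaninRel k a b c (rel (skw k a b c) j) 0 := by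
  rw [rel_eq_relAt, relAt_skw]
  fin_cases j
  exacts [SklyaninRel.r1, SklyaninRel.r2, SklyaninRel.r3]

lemma exists_of_skRel {f g : FreeAlgebra k (Fin 3)} (h : SklyaninRel k a b c f g) :
    g = 0 ∧ ∃ j, f = rel (skw k a b c) j := by
  cases h
  · exact ⟨rfl, 0, by rw [rel_eq_relAt, relAt_skw]; rfl⟩
  · exact ⟨rfl, 1, by rw [rel_eq_relAt, relAt_skw]; rfl⟩
  · exact ⟨rfl, 2, by rw [rel_eq_relAt, relAt_skw]; rfl⟩

/-- The two-sided ideal generated by the relations of a tensor. -/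
def relIdeal (w : Fin 3 → Fin 3 → Fin 3 → k) : TwoSidedIdeal (FreeAlgebra k (Fin 3)) :=
  TwoSidedIdeal.mk' {f | ∃ L, f = sandRel w L} ⟨[], rfl⟩
    (by
      rintro _ _ ⟨L, rfl⟩ ⟨L', rfl⟩
      exact ⟨L ++ L', by simp [sandRel]⟩)
    (by
      rintro _ ⟨L, rfl⟩
      refine ⟨L.map fun t => (-t.1, t.2), ?_⟩
      induction L with
      | nil => simp [sandRel]
      | cons t L ih =>
        simp only [sandRel, List.map_cons, List.sum_cons, neg_add] at ih ⊢
        rw [ih, neg_mul, neg_mul])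
    (by
      rintro f _ ⟨L, rfl⟩
      refine ⟨L.map fun t => (f * t.1, t.2), ?_⟩
      induction L with
      | nil => simp [sandRel]
      | cons t L ih =>
        simp only [sandRel, List.map_cons, List.sum_cons, mul_add] at ih ⊢
        rw [ih]; simp only [mul_assoc])
    (by
      rintro _ f ⟨L, rfl⟩
      refine ⟨L.map fun t => (t.1, t.2.1, t.2.2 * f), ?_⟩
      induction L with
      | nil => simp [sandRel]
      | cons t L ih =>
        simp only [sandRel, List.map_cons, List.sum_cons, add_mul] at ih ⊢
        rw [ih]; simp only [mul_assoc])

lemma mem_relIdeal {w : Fin 3 → Fin 3 → Fin 3 → k} {f : FreeAlgebra k (Fin 3)} :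
    f ∈ relIdeal k w ↔ ∃ L, f = sandRel w L :=
  TwoSidedIdeal.mem_mk' _ _ _ _ _ _ f

lemma sk_pres : Pres (skw k a b c) (skπ k a b c) where
  surj := RingQuot.mkAlgHom_surjective k _
  rel j := (RingQuot.mkAlgHom_rel k (skRel_rel k a b c j)).trans (map_zero _)
  ker f hf := by
    let I := relIdeal k (skw k a b c)
    let q : FreeAlgebra k (Fin 3) →ₐ[k] I.ringCon.Quotient :=
      { (I.ringCon.mk' : FreeAlgebra k (Fin 3) →+* I.ringCon.Quotient) with
        commutes' := fun r => rfl }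
    have hq : ∀ g, q g = 0 ↔ g ∈ I := fun g => by
      rw [TwoSidedIdeal.mem_iff]
      exact I.ringCon.eq
    let φ : RingQuot (SklyaninRel k a b c) →ₐ[k] I.ringCon.Quotient :=
      RingQuot.liftAlgHom k ⟨q, fun f g h => by
        obtain ⟨rfl, j, rfl⟩ := exists_of_skRel k a b c h
        rw [map_zero, hq, mem_relIdeal]
        exact ⟨[(1, j, 1)], by simp [sandRel]⟩⟩
    have h1 : q f = φ (RingQuot.mkAlgHom k (SklyaninRel k a b c) f) :=
      (RingQuot.liftAlgHom_mkAlgHom_apply k _ _ _).symm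
    rw [← mem_relIdeal, ← hq, h1, show RingQuot.mkAlgHom k (SklyaninRel k a b c) f = 0 from hf,
      map_zero]

end Concrete

section GCentral
variable {k : Type*} [Field k] {A : Type*} [Ring A] [Algebra k A] {a b c : k}

lemma mul_mul_quad {p q s : A} (u v : A) (h : a • (p * q) + b • (q * p) + c • (s * s) = 0) :
    a • (u * (v * (p * q))) + b • (u * (v * (q * p))) + c • (u * (v * (s * s))) = 0 := by
  simpa only [mul_add, mul_smul_comm, mul_zero] using congrArg (fun t => u * (v * t)) h

lemma mul_quad_mul {p q s : A} (u v : A) (h : a • (p * q) + b • (q * p) + c • (s * s) = 0) :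
    a • (u * (p * (q * v))) + b • (u * (q * (p * v))) + c • (u * (s * (s * v))) = 0 := by
  simpa only [mul_add, add_mul, mul_smul_comm, smul_mul_assoc, mul_zero, zero_mul, mul_assoc]
    using congrArg (fun t => u * (t * v)) h

lemma quad_mul_mul {p q s : A} (u v : A) (h : a • (p * q) + b • (q * p) + c • (s * s) = 0) :
    a • (p * (q * (u * v))) + b • (q * (p * (u * v))) + c • (s * (s * (u * v))) = 0 := by
  simpa only [add_mul, smul_mul_assoc, zero_mul, mul_assoc] using congrArg (fun t => t * (u * v)) h

/-- The canonical cubic expression. -/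
def gel (a b c : k) (x y z : A) : A :=
  (c * (c ^ 3 - b ^ 3)) • (y * y * y) + (b * (c ^ 3 - a ^ 3)) • (y * x * z)
    + (a * (b ^ 3 - c ^ 3)) • (x * y * z) + (c * (a ^ 3 - c ^ 3)) • (x * x * x)

set_option maxHeartbeats 4000000 in
lemma gel_comm_x {x y z : A} (hx : a • (y * z) + b • (z * y) + c • (x * x) = 0)
    (hy : a • (z * x) + b • (x * z) + c • (y * y) = 0)
    (hz : a • (x * y) + b • (y * x) + c • (z * z) = 0) :
    x * gel a b c x y z = gel a b c x y z * x := by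
  simp only [gel, mul_add, add_mul, mul_smul_comm, smul_mul_assoc, mul_assoc]
  linear_combination (norm := module)
      (-b ^ 3 : k) • mul_mul_quad x y hy
      + (-c ^ 3 : k) • mul_mul_quad x z hz
      + (a ^ 2 * b : k) • mul_mul_quad y x hy
      + (b ^ 2 * c : k) • mul_mul_quad y y hz
      + (2 * a * c ^ 2 : k) • mul_mul_quad y z hx
      + (b * c ^ 2 : k) • mul_mul_quad z y hx
      + (c ^ 3 : k) • mul_quad_mul x y hy
      + (b ^ 3 + c ^ 3 : k) • mul_quad_mul x z hz
      + (-2 * c ^ 3 : k) • mul_quad_mul y x hy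
      + (-a * b * c : k) • mul_quad_mul y y hz
      + (-c ^ 3 : k) • mul_quad_mul z x hz
      + (a * b * c : k) • mul_quad_mul z z hy
      + (-a ^ 2 * b : k) • quad_mul_mul x z hz
      + (c ^ 3 : k) • quad_mul_mul y x hy
      + (-2 * a * c ^ 2 : k) • quad_mul_mul y z hx
      + (c ^ 3 : k) • quad_mul_mul z x hz
      + (-b * c ^ 2 : k) • quad_mul_mul z y hx
      + (-b ^ 2 * c : k) • quad_mul_mul z z hy

set_option maxHeartbeats 4000000 in
lemma gel_comm_y {x y z : A} (hx : a • (y * z) + b • (z * y) + c • (x * x) = 0)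
    (hy : a • (z * x) + b • (x * z) + c • (y * y) = 0)
    (hz : a • (x * y) + b • (y * x) + c • (z * z) = 0) :
    y * gel a b c x y z = gel a b c x y z * y := by
  simp only [gel, mul_add, add_mul, mul_smul_comm, smul_mul_assoc, mul_assoc]
  linear_combination (norm := module)
      (2 * c ^ 3 - b ^ 3 - a ^ 3 : k) • mul_mul_quad y y hy
      + (c ^ 3 - b ^ 3 : k) • mul_mul_quad y z hz
      + (a * c ^ 2 : k) • mul_mul_quad z x hy
      + (a ^ 2 * b : k) • mul_mul_quad z y hz
      + (b ^ 2 * c : k) • mul_mul_quad z z hx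
      + (a * b * c : k) • mul_quad_mul x x hz
      + (-c ^ 3 + b ^ 3 + a ^ 3 : k) • mul_quad_mul y x hx
      + (b ^ 3 - 2 * c ^ 3 + a ^ 3 : k) • mul_quad_mul y y hy
      + (-c ^ 3 + b ^ 3 : k) • mul_quad_mul y z hz
      + (-c ^ 3 : k) • mul_quad_mul z y hz
      + (-a * b * c : k) • mul_quad_mul z z hx
      + (-b ^ 2 * c : k) • quad_mul_mul x x hz
      + (-a ^ 3 + c ^ 3 : k) • quad_mul_mul x y hx
      + (-a ^ 2 * b : k) • quad_mul_mul y x hx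
      + (-a * c ^ 2 : k) • quad_mul_mul z x hy
      + (-b ^ 3 + c ^ 3 : k) • quad_mul_mul z y hz

set_option maxHeartbeats 4000000 in
lemma gel_comm_z {x y z : A} (hx : a • (y * z) + b • (z * y) + c • (x * x) = 0)
    (hy : a • (z * x) + b • (x * z) + c • (y * y) = 0)
    (hz : a • (x * y) + b • (y * x) + c • (z * z) = 0) :
    z * gel a b c x y z = gel a b c x y z * z := by
  simp only [gel, mul_add, add_mul, mul_smul_comm, smul_mul_assoc, mul_assoc]
  linear_combination (norm := module)
      (-b * c ^ 2 : k) • mul_mul_quad y x hz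
      + (-a ^ 2 * c : k) • mul_mul_quad y y hx
      + (-a * b ^ 2 : k) • mul_mul_quad y z hy
      + (c ^ 3 - b ^ 3 : k) • mul_mul_quad z y hy
      + (-a * b * c : k) • mul_quad_mul x x hy
      + (a * b * c : k) • mul_quad_mul y y hx
      + (-c ^ 3 + a ^ 3 + b ^ 3 : k) • mul_quad_mul y z hy
      + (-c ^ 3 : k) • mul_quad_mul z x hx
      + (b ^ 3 - c ^ 3 : k) • mul_quad_mul z z hz
      + (a ^ 2 * c : k) • quad_mul_mul x x hy
      + (c ^ 3 - a ^ 3 : k) • quad_mul_mul x z hx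
      + (b * c ^ 2 : k) • quad_mul_mul y x hz
      + (a * b ^ 2 : k) • quad_mul_mul z x hx
      + (c ^ 3 - b ^ 3 : k) • quad_mul_mul z z hz

end GCentral

section Cross
variable {k : Type*} [Field k] {M : Type*} [AddCommGroup M] [Module k M]

/-- The cross product of two vectors. -/
def crs (f g : Fin 3 → k) (i : Fin 3) : k := f (i + 1) * g (i + 2) - f (i + 2) * g (i + 1)

lemma exists_dot_eq_one {n : Fin 3 → k} (hn : n ≠ 0) :
    ∃ q : Fin 3 → k, n 0 * q 0 + n 1 * q 1 + n 2 * q 2 = 1 := by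
  obtain ⟨i, hi⟩ := Function.ne_iff.1 hn
  have hi' : n i ≠ 0 := hi
  refine ⟨Pi.single i (n i)⁻¹, ?_⟩
  fin_cases i <;> simp_all

lemma exists_crs_eq {n : Fin 3 → k} (hn : n ≠ 0) : ∃ f g : Fin 3 → k, crs f g = n := by
  obtain ⟨i, hi⟩ := Function.ne_iff.1 hn
  have hi' : n i ≠ 0 := hi
  refine ⟨crs n (Pi.single (i + 1) 1), crs n (Pi.single (i + 2) (n i)⁻¹), ?_⟩
  funext j
  fin_cases i <;> fin_cases j <;> simp_all [crs] <;> field_simp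

lemma eq_crs {m e : Fin 3 → k} (hm : m ≠ 0) (h : m 0 * e 0 + m 1 * e 1 + m 2 * e 2 = 0) :
    ∃ q, e = crs m q := by
  obtain ⟨r, hr⟩ := exists_dot_eq_one hm
  refine ⟨crs e r, ?_⟩
  funext j
  fin_cases j <;> simp only [crs] <;> simp
  · linear_combination (-e 0) * hr + r 0 * h
  · linear_combination (-e 1) * hr + r 1 * h
  · linear_combination (-e 2) * hr + r 2 * h

/-- Vector valued Cramer rule. -/
lemma decomp {f g : Fin 3 → k} (hn : crs f g ≠ 0) {X : Fin 3 → M}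
    (hX : crs f g 0 • X 0 + crs f g 1 • X 1 + crs f g 2 • X 2 = 0) :
    ∃ z z' : M, ∀ i, X i = f i • z + g i • z' := by
  obtain ⟨r, hr⟩ := exists_dot_eq_one hn
  refine ⟨crs g r 0 • X 0 + crs g r 1 • X 1 + crs g r 2 • X 2,
    crs r f 0 • X 0 + crs r f 1 • X 1 + crs r f 2 • X 2, fun i => ?_⟩
  rw [← one_smul k (X i), ← hr]
  have h2 : r i • (crs f g 0 • X 0 + crs f g 1 • X 1 + crs f g 2 • X 2) = 0 := by
    rw [hX, smul_zero]
  rw [← sub_eq_zero, ← h2]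
  fin_cases i <;> simp [crs] <;> module

lemma eq_zero_of_crs {f g : Fin 3 → k} (hn : crs f g ≠ 0) {z z' : M}
    (h : ∀ i, f i • z + g i • z' = 0) : z = 0 ∧ z' = 0 := by
  obtain ⟨i, hi⟩ := Function.ne_iff.1 hn
  have hi' : crs f g i ≠ 0 := hi
  refine ⟨(smul_eq_zero_iff_right hi').1 ?_, (smul_eq_zero_iff_right hi').1 ?_⟩
  · have h1 : crs f g i • z = g (i + 2) • (f (i + 1) • z + g (i + 1) • z')
        - g (i + 1) • (f (i + 2) • z + g (i + 2) • z') := by simp only [crs]; module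
    rw [h1, h, h, smul_zero, smul_zero, sub_zero]
  · have h1 : crs f g i • z' = f (i + 1) • (f (i + 2) • z + g (i + 2) • z')
        - f (i + 2) • (f (i + 1) • z + g (i + 1) • z') := by simp only [crs]; module
    rw [h1, h, h, smul_zero, smul_zero, sub_zero]

lemma exists_smul_of_crs {p e : Fin 3 → k} (hp : p ≠ 0) (h : crs p e = 0) :
    ∃ t : k, e = t • p := by
  obtain ⟨r, hr⟩ := exists_dot_eq_one hp
  have h0 := congrFun h 0
  have h1 := congrFun h 1
  have h2 := congrFun h 2
  simp [crs] at h0 h1 h2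
  refine ⟨r 0 * e 0 + r 1 * e 1 + r 2 * e 2, ?_⟩
  funext i
  fin_cases i <;> simp
  · linear_combination (-e 0) * hr + r 2 * h1 - r 1 * h2
  · linear_combination (-e 1) * hr - r 2 * h0 + r 0 * h2
  · linear_combination (-e 2) * hr + r 1 * h0 - r 0 * h1

/-- A pencil of square matrices has a degenerate member. -/
lemma exists_pencil [IsAlgClosed k] {n : Type*} [Fintype n] [DecidableEq n] [Nonempty n]
    (A B : Matrix n n k) :
    ∃ s t : k, (s ≠ 0 ∨ t ≠ 0) ∧ ∃ u : n → k, u ≠ 0 ∧ s • (A *ᵥ u) + t • (B *ᵥ u) = 0 := by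
  by_cases hB : B.det = 0
  · obtain ⟨u, hu, h⟩ := Matrix.exists_mulVec_eq_zero_iff.2 hB
    exact ⟨0, 1, Or.inr one_ne_zero, u, hu, by simp [h]⟩
  · obtain ⟨μ, hμ⟩ := Module.End.exists_eigenvalue (Matrix.toLin' (B⁻¹ * A))
    obtain ⟨u, hu⟩ := hμ.exists_hasEigenvector
    have h1 := hu.apply_eq_smul
    refine ⟨1, -μ, Or.inl one_ne_zero, u, hu.2, ?_⟩
    have h2 : B *ᵥ ((B⁻¹ * A) *ᵥ u) = A *ᵥ u := by
      rw [Matrix.mulVec_mulVec, ← mul_assoc, Matrix.mul_nonsing_inv _ (isUnit_iff_ne_zero.2 hB),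
        one_mul]
    rw [Matrix.toLin'_apply] at h1
    rw [h1, Matrix.mulVec_smul] at h2
    rw [← h2]
    module

end Cross

section Cubic
variable {k : Type*} [Field k] [CharZero k] {a b c : k}

/-- The cubic form of point modules. -/
def cub (a b c : k) (p : Fin 3 → k) : k :=
  (a ^ 3 + b ^ 3 + c ^ 3) * (p 0 * p 1 * p 2) - a * b * c * (p 0 ^ 3 + p 1 ^ 3 + p 2 ^ 3)

lemma cub_smul (t : k) (p : Fin 3 → k) : cub a b c (t • p) = t ^ 3 * cub a b c p := by
  simp only [cub, Pi.smul_apply, smul_eq_mul]; ring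

lemma no_line_aux {K L r s : k} (hL : L ≠ 0) (h : (3 * L) ^ 3 ≠ K ^ 3)
    (hz : ∀ x y : k, K * (x * y * (r * x + s * y)) - L * (x ^ 3 + y ^ 3 + (r * x + s * y) ^ 3) = 0) :
    False := by
  have h1 := hz 1 0
  have h2 := hz 0 1
  have h3 := hz 1 1
  have h4 := hz 1 (-1)
  have hr : r ^ 3 = -1 := by
    have : L * (1 + r ^ 3) = 0 := by linear_combination -h1
    linear_combination (mul_eq_zero.1 this).resolve_left hL
  have hs : s ^ 3 = -1 := by
    have : L * (1 + s ^ 3) = 0 := by linear_combination -h2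
    linear_combination (mul_eq_zero.1 this).resolve_left hL
  have hK : K - 3 * L * r * s ≠ 0 := fun h0 => h (by
    have : K = 3 * L * r * s := by linear_combination h0
    rw [this]
    linear_combination (- 27 * L ^ 3 * s ^ 3) * hr + 27 * L ^ 3 * hs)
  have h5 : (K - 3 * L * r * s) * (r + s) = 0 := by
    linear_combination h3 + L * hr + L * hs
  have h6 : (K - 3 * L * r * s) * (r - s) = 0 := by
    linear_combination -h4 - L * hr + L * hs
  have h7 := (mul_eq_zero.1 h5).resolve_left hK
  have h8 := (mul_eq_zero.1 h6).resolve_left hK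
  have h9 : r = 0 := by
    have : (2 : k) * r = 0 := by linear_combination h7 + h8
    exact (mul_eq_zero.1 this).resolve_left two_ne_zero
  rw [h9] at hr
  norm_num at hr

lemma exists_cub_ne_zero (habc : a * b * c ≠ 0)
    (hdeg : (3 * a * b * c) ^ 3 ≠ (a ^ 3 + b ^ 3 + c ^ 3) ^ 3) {m : Fin 3 → k} (hm : m ≠ 0) :
    ∃ q, cub a b c (crs m q) ≠ 0 := by
  by_contra hq
  push Not at hq
  have h0 : ∀ e : Fin 3 → k, m 0 * e 0 + m 1 * e 1 + m 2 * e 2 = 0 → cub a b c e = 0 :=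
    fun e he => by
      obtain ⟨q, rfl⟩ := eq_crs hm he
      exact hq q
  obtain ⟨i, hi⟩ := Function.ne_iff.1 hm
  have hi' : m i ≠ 0 := hi
  have hd' : (3 * (a * b * c)) ^ 3 ≠ (a ^ 3 + b ^ 3 + c ^ 3) ^ 3 := by
    simpa only [mul_assoc] using hdeg
  refine no_line_aux (r := -(m (i + 1) / m i)) (s := -(m (i + 2) / m i)) habc hd' fun x y => ?_
  fin_cases i
  · have := h0 ![-(m 1 / m 0) * x + -(m 2 / m 0) * y, x, y]
      (by simp at hi' ⊢; field_simp; ring)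
    simp [cub] at this ⊢
    linear_combination this
  · have := h0 ![y, -(m 2 / m 1) * x + -(m 0 / m 1) * y, x]
      (by simp at hi' ⊢; field_simp; ring)
    simp [cub] at this ⊢
    linear_combination this
  · have := h0 ![x, y, -(m 0 / m 2) * x + -(m 1 / m 2) * y]
      (by simp at hi' ⊢; field_simp; ring)
    simp [cub] at this ⊢
    linear_combination this

end Cubic

section PointVector
variable {k : Type*} [Field k] {M : Type*} [AddCommGroup M] [Module k M]
  {a b c : k}

/-- The contraction of the tensor of relations in its last slot. -/
def nmat (a b c : k) (p q : Fin 3 → k) (j : Fin 3) : k :=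
  c * p j * q j + a * p (j + 2) * q (j + 1) + b * p (j + 1) * q (j + 2)

/-- The contraction of the tensor of relations in its first and last slots. -/
def cmat (a b c : k) (r p : Fin 3 → k) (i : Fin 3) : k :=
  c * r i * p i + b * r (i + 1) * p (i + 2) + a * r (i + 2) * p (i + 1)

lemma crs_nmat (r e f g : Fin 3 → k) (h : crs f g = cmat a b c r e) (j : Fin 3) :
    crs (nmat a b c e f) (nmat a b c e g) j = cub a b c e * r j := by
  have h0 := congrFun h 0
  have h1 := congrFun h 1
  have h2 := congrFun h 2
  fin_cases j <;> simp [crs, nmat, cmat, cub] at h0 h1 h2 ⊢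
  · linear_combination (c ^ 2 * e 1 * e 2 - a * b * e 0 ^ 2) * h0 +
      (a ^ 2 * e 0 * e 1 - b * c * e 2 ^ 2) * h1 + (b ^ 2 * e 0 * e 2 - a * c * e 1 ^ 2) * h2
  · linear_combination (c ^ 2 * e 2 * e 0 - a * b * e 1 ^ 2) * h1 +
      (a ^ 2 * e 1 * e 2 - b * c * e 0 ^ 2) * h2 + (b ^ 2 * e 1 * e 0 - a * c * e 2 ^ 2) * h0
  · linear_combination (c ^ 2 * e 0 * e 1 - a * b * e 2 ^ 2) * h2 +
      (a ^ 2 * e 2 * e 0 - b * c * e 1 ^ 2) * h0 + (b ^ 2 * e 2 * e 1 - a * c * e 0 ^ 2) * h1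

set_option maxHeartbeats 2000000 in
lemma cubic_apply {X : Fin 3 → M →ₗ[k] M} {u u1 y y1 y' : M}
    (h0 : ∀ u, a • X 1 (X 2 u) + b • X 2 (X 1 u) + c • X 0 (X 0 u) = 0)
    (h1 : ∀ u, a • X 2 (X 0 u) + b • X 0 (X 2 u) + c • X 1 (X 1 u) = 0)
    (h2 : ∀ u, a • X 0 (X 1 u) + b • X 1 (X 0 u) + c • X 2 (X 2 u) = 0)
    {v0 v1 v2 q0 q1 q2 e0 e1 e2 m0 m1 m2 r0 r1 r2 : k}
    (hu0 : X 0 u = b • y1 + v0 • u1) (hu1 : X 1 u = a • y1 + v1 • u1)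
    (hu2 : X 2 u = c • y1 + v2 • u1) (hv0 : X 0 u1 = e0 • y + a • y')
    (hv1 : X 1 u1 = e1 • y + b • y') (hv2 : X 2 u1 = e2 • y + c • y')
    (hm0 : m0 = c * v0 - b * v2) (hm1 : m1 = a * v2 - c * v1) (hm2 : m2 = b * v1 - a * v0)
    (he0 : e0 = m1 * q2 - m2 * q1) (he1 : e1 = m2 * q0 - m0 * q2) (he2 : e2 = m0 * q1 - m1 * q0)
    (hr0 : r0 = b * (c ^ 3 - a ^ 3)) (hr1 : r1 = a * (b ^ 3 - c ^ 3))
    (hr2 : r2 = c * (a ^ 3 - b ^ 3))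
    (hn : (c * r0 * e0 + b * r1 * e2 + a * r2 * e1) • X 0 y
      + (c * r1 * e1 + b * r2 * e0 + a * r0 * e2) • X 1 y
      + (c * r2 * e2 + b * r0 * e1 + a * r1 * e0) • X 2 y = 0) :
    (a * q0 + b * q1 + c * q2) • ((c * (c ^ 3 - b ^ 3)) • X 1 (X 1 (X 1 u))
      + (b * (c ^ 3 - a ^ 3)) • X 1 (X 0 (X 2 u)) + (a * (b ^ 3 - c ^ 3)) • X 0 (X 1 (X 2 u))
      + (c * (a ^ 3 - c ^ 3)) • X 0 (X 0 (X 0 u)))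
    + ((c * r0 * e0 + b * r1 * e2 + a * r2 * e1) • X 0 y'
      + (c * r1 * e1 + b * r2 * e0 + a * r0 * e2) • X 1 y'
      + (c * r2 * e2 + b * r0 * e1 + a * r1 * e0) • X 2 y') = 0 := by

  have R00 := congrArg (X 0) (h0 u)
  have R02 := congrArg (X 0) (h2 u)
  have R10 := congrArg (X 1) (h0 u)
  have R12 := congrArg (X 1) (h2 u)
  have S0 := h0 u1
  have S1 := h1 u1
  have S2 := h2 u1
  simp only [hu0, hu1, hu2, hv0, hv1, hv2, map_add, map_smul, map_zero] at R00 R02 R10 R12 S0 S1 S2 ⊢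

  subst hr0 hr1 hr2 he0 he1 he2 hm0 hm1 hm2

  linear_combination (norm := module) (-(a * q0 + b * q1 + c * q2) * c ^ 3) • R00 + ((a * q0 + b * q1 + c * q2) * (a * b * c)) • R02
    + ((a * q0 + b * q1 + c * q2) * c ^ 3) • R10 - ((a * q0 + b * q1 + c * q2) * (a * b * c)) • R12
    + (-v1 * q0 * (b * c ^ 3) - v1 * q1 * (a ^ 2 * b ^ 2) - v1 * q2 * (a ^ 2 * b * c) + v2 * q0 * (a * b * c ^ 2) + v2 * q1 * (b ^ 2 * c ^ 2) + v2 * q2 * (b * c ^ 3)) • S0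
    + (v0 * q0 * (a ^ 2 * b ^ 2) + v0 * q1 * (a * b ^ 3) + v0 * q2 * (a * b ^ 2 * c) + v1 * q0 * (a * c ^ 3) - v1 * q0 * (a * b ^ 3) - v2 * q0 * (a ^ 2 * c ^ 2) - v2 * q1 * (a * b * c ^ 2) - v2 * q2 * (a * c ^ 3)) • S1
    + (-v0 * q0 * (a * b ^ 2 * c) - v0 * q1 * (b ^ 3 * c) - v0 * q2 * (b ^ 2 * c ^ 2) + v1 * q0 * (b ^ 3 * c) + v1 * q1 * (a ^ 2 * b * c) + v1 * q2 * (a ^ 2 * c ^ 2)) • S2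
    + (-v0 * q1 - v2 * q2) • hn

/-- If the canonical cubic acts as zero, there is a point vector. -/
lemma exists_point [IsAlgClosed k] [CharZero k] {n : Type*} [Fintype n] [DecidableEq n] [Nonempty n]
    (habc : a * b * c ≠ 0) (hdeg : (3 * a * b * c) ^ 3 ≠ (a ^ 3 + b ^ 3 + c ^ 3) ^ 3)
    (x : Fin 3 → Matrix n n k)
    (h0 : a • (x 1 * x 2) + b • (x 2 * x 1) + c • (x 0 * x 0) = 0)
    (h1 : a • (x 2 * x 0) + b • (x 0 * x 2) + c • (x 1 * x 1) = 0)
    (h2 : a • (x 0 * x 1) + b • (x 1 * x 0) + c • (x 2 * x 2) = 0)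
    (hg : gel a b c (x 0) (x 1) (x 2) = 0) :
    ∃ u : n → k, u ≠ 0 ∧ ∃ (p : Fin 3 → k) (u' : n → k), ∀ i, x i *ᵥ u = p i • u' := by
  obtain ⟨⟨ha, hb⟩, hc⟩ : (a ≠ 0 ∧ b ≠ 0) ∧ c ≠ 0 := by simpa [mul_ne_zero_iff] using habc
  obtain ⟨s, t, hst, u, hu, hℓ⟩ := exists_pencil (a • x 0 - b • x 1) (c • x 1 - a • x 2)
  set X : Fin 3 → (n → k) →ₗ[k] (n → k) := fun i => Matrix.mulVecLin (x i) with hXdef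
  have hX : ∀ i v, x i *ᵥ v = X i v := fun i v => rfl
  have H0 : ∀ u, a • X 1 (X 2 u) + b • X 2 (X 1 u) + c • X 0 (X 0 u) = 0 := fun u => by
    simpa only [add_mulVec, smul_mulVec, ← mulVec_mulVec, hX, zero_mulVec] using
      congrArg (· *ᵥ u) h0
  have H1 : ∀ u, a • X 2 (X 0 u) + b • X 0 (X 2 u) + c • X 1 (X 1 u) = 0 := fun u => by
    simpa only [add_mulVec, smul_mulVec, ← mulVec_mulVec, hX, zero_mulVec] using
      congrArg (· *ᵥ u) h1
  have H2 : ∀ u, a • X 0 (X 1 u) + b • X 1 (X 0 u) + c • X 2 (X 2 u) = 0 := fun u => by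
    simpa only [add_mulVec, smul_mulVec, ← mulVec_mulVec, hX, zero_mulVec] using
      congrArg (· *ᵥ u) h2
  have HG : ∀ u, (c * (c ^ 3 - b ^ 3)) • X 1 (X 1 (X 1 u))
      + (b * (c ^ 3 - a ^ 3)) • X 1 (X 0 (X 2 u)) + (a * (b ^ 3 - c ^ 3)) • X 0 (X 1 (X 2 u))
      + (c * (a ^ 3 - c ^ 3)) • X 0 (X 0 (X 0 u)) = 0 := fun u => by
    simpa only [gel, add_mulVec, smul_mulVec, mul_assoc, ← mulVec_mulVec, hX, zero_mulVec] using
      congrArg (· *ᵥ u) hg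
  have hL : (s * a) • X 0 u + (t * c - s * b) • X 1 u + (-(t * a)) • X 2 u = 0 := by
    rw [← hℓ, sub_mulVec, sub_mulVec]
    simp only [smul_mulVec, hX]
    module
  simp only [hX]
  clear_value X
  clear hX h0 h1 h2 hg hXdef hℓ
  have hℓ0 : (![s * a, t * c - s * b, -(t * a)] : Fin 3 → k) ≠ 0 := fun h => by
    have e0 := congrFun h 0
    have e2 := congrFun h 2
    simp [ha] at e0 e2
    exact hst.elim (fun h => h e0) fun h => h e2
  have hp0 : (![b, a, c] : Fin 3 → k) ≠ 0 := fun h => hb (by simpa using congrFun h 0)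
  obtain ⟨q', hq'⟩ := exists_dot_eq_one hp0
  obtain ⟨v, hv⟩ : ∃ v, crs ![b, a, c] v = ![s * a, t * c - s * b, -(t * a)] := by
    refine ⟨crs ![s * a, t * c - s * b, -(t * a)] q', ?_⟩
    funext i
    fin_cases i <;> simp [crs] at hq' ⊢
    · linear_combination s * a * hq'
    · linear_combination (t * c - s * b) * hq'
    · linear_combination (-(t * a)) * hq'
  obtain ⟨y1, u1, hu1⟩ := decomp (f := ![b, a, c]) (g := v) (X := fun i => X i u)
    (by rw [hv]; exact hℓ0) (by rw [hv]; simpa using hL)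
  by_cases hu10 : u1 = 0
  · exact ⟨u, hu, _, y1, fun i => by rw [hu1 i, hu10, smul_zero, add_zero]⟩
  have e0 := hu1 0
  have e1 := hu1 1
  have e2 := hu1 2
  simp at e0 e1 e2
  obtain ⟨m, hmdef⟩ : ∃ m : Fin 3 → k,
    m = ![c * v 0 - b * v 2, a * v 2 - c * v 1, b * v 1 - a * v 0] := ⟨_, rfl⟩
  have hm : m ≠ 0 := fun h => hℓ0 (by
    rw [← hv]
    have g0 := congrFun h 0
    have g1 := congrFun h 1
    have g2 := congrFun h 2
    simp [hmdef] at g0 g1 g2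
    funext i
    fin_cases i <;> simp [crs]
    · linear_combination g1
    · linear_combination g0
    · linear_combination g2)
  have hmu : m 0 • X 0 u1 + m 1 • X 1 u1 + m 2 • X 2 u1 = 0 := by
    have g0 := H0 u
    have g1 := H1 u
    simp only [e0, e1, e2, map_add, map_smul] at g0 g1
    simp [hmdef]
    linear_combination (norm := module) (1 : k) • g0 - (1 : k) • g1
  obtain ⟨q, hq⟩ := exists_cub_ne_zero habc hdeg hm
  have hpm2 : (![a, b, c] : Fin 3 → k) ≠ 0 := fun h => ha (by simpa using congrFun h 0)
  have hcr : ∀ i, crs (crs m q) ![a, b, c] i = -(a * q 0 + b * q 1 + c * q 2) * m i := fun i => by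
    fin_cases i <;> simp [crs, hmdef] <;> ring
  have hQ : a * q 0 + b * q 1 + c * q 2 ≠ 0 := fun h => hq (by
    obtain ⟨t, ht⟩ := exists_smul_of_crs (e := crs m q) hpm2 (by
      funext i
      have := hcr i
      rw [h, neg_zero, zero_mul] at this
      rw [Pi.zero_apply, ← neg_eq_zero, ← this]
      simp only [crs, neg_sub]
      exact congrArg₂ (· - ·) (mul_comm _ _) (mul_comm _ _))
    rw [ht, cub_smul]
    simp [cub]
    right; ring)
  obtain ⟨e, hedef⟩ : ∃ e, e = crs m q := ⟨_, rfl⟩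
  rw [← hedef] at hq hcr
  obtain ⟨y, y', hy⟩ := decomp (f := e) (g := ![a, b, c]) (X := fun i => X i u1)
    (fun h => by
      obtain ⟨i, hi⟩ := Function.ne_iff.1 hm
      have := hcr i
      rw [h, Pi.zero_apply, eq_comm, neg_mul, neg_eq_zero] at this
      exact hi ((mul_eq_zero.1 this).resolve_left hQ))
    (by
      rw [hcr, hcr, hcr]
      linear_combination (norm := module) (-(a * q 0 + b * q 1 + c * q 2)) • hmu)
  have f0 := hy 0
  have f1 := hy 1
  have f2 := hy 2
  simp at f0 f1 f2
  obtain ⟨r, hrdef⟩ : ∃ r : Fin 3 → k,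
    r = ![b * (c ^ 3 - a ^ 3), a * (b ^ 3 - c ^ 3), c * (a ^ 3 - b ^ 3)] := ⟨_, rfl⟩
  have hr : r ≠ 0 := fun h => hdeg (by
    have g0 := congrFun h 0
    have g1 := congrFun h 1
    simp [hrdef, ha, hb, sub_eq_zero] at g0 g1
    rw [show (3 * a * b * c) ^ 3 = 27 * a ^ 3 * b ^ 3 * c ^ 3 by ring, g1, g0]
    ring)
  have hnm : ∀ i, r 0 * nmat a b c ![a, b, c] i 0 + r 1 * nmat a b c ![a, b, c] i 1
      + r 2 * nmat a b c ![a, b, c] i 2 = 0 := fun i => by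
    simp [nmat, hrdef]; ring
  have K0 := H0 u1
  have K1 := H1 u1
  have K2 := H2 u1
  simp only [f0, f1, f2, map_add, map_smul] at K0 K1 K2
  have hn1 : cmat a b c r e 0 • X 0 y + cmat a b c r e 1 • X 1 y + cmat a b c r e 2 • X 2 y = 0 := by
    simp [cmat, hrdef]
    linear_combination (norm := module) (b * (c ^ 3 - a ^ 3)) • K0 + (a * (b ^ 3 - c ^ 3)) • K1
      + (c * (a ^ 3 - b ^ 3)) • K2
  have hn2 : cmat a b c r e 0 • X 0 y' + cmat a b c r e 1 • X 1 y'
      + cmat a b c r e 2 • X 2 y' = 0 := by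
    have := cubic_apply (q0 := q 0) (q1 := q 1) (q2 := q 2) H0 H1 H2 e0 e1 e2 f0 f1 f2 rfl rfl rfl
      (by rw [hedef, hmdef]; simp [crs]) (by rw [hedef, hmdef]; simp [crs])
      (by rw [hedef, hmdef]; simp [crs]) rfl rfl rfl
      (by simpa [cmat, hrdef] using hn1)
    rw [HG, smul_zero, zero_add] at this
    simpa [cmat, hrdef] using this
  have hn0 : cmat a b c r e ≠ 0 := fun h => by
    obtain ⟨i, hi⟩ := Function.ne_iff.1 hr
    have := crs_nmat (a := a) (b := b) (c := c) r e 0 0 (by rw [h]; funext i; simp [crs]) i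
    simp [nmat, crs] at this
    exact this.elim hq hi
  obtain ⟨f, f', hff⟩ := exists_crs_eq hn0
  rw [← hff] at hn0 hn1 hn2
  obtain ⟨z1, z2, hz⟩ := decomp (X := fun i => X i y) hn0 hn1
  obtain ⟨z3, z4, hz'⟩ := decomp (X := fun i => X i y') hn0 hn2
  have hA := crs_nmat (a := a) (b := b) (c := c) r e f f' hff
  have hA0 : crs (nmat a b c e f) (nmat a b c e f') ≠ 0 := fun h => by
    obtain ⟨i, hi⟩ := Function.ne_iff.1 hr
    have := hA i
    rw [h, Pi.zero_apply, eq_comm] at this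
    exact hi ((mul_eq_zero.1 this).resolve_left hq)
  obtain ⟨r1, r2, hB⟩ := decomp (X := fun i => nmat a b c ![a, b, c] f i) hA0 (by
    rw [hA, hA, hA]; simp only [smul_eq_mul]; linear_combination cub a b c e * hnm f)
  obtain ⟨s1, s2, hB'⟩ := decomp (X := fun i => nmat a b c ![a, b, c] f' i) hA0 (by
    rw [hA, hA, hA]; simp only [smul_eq_mul]; linear_combination cub a b c e * hnm f')
  simp only [smul_eq_mul] at hB hB' hz hz'
  simp only [hz, hz'] at K0 K1 K2
  obtain ⟨hZ1, hZ2⟩ := eq_zero_of_crs (z := z1 + r1 • z3 + s1 • z4) (z' := z2 + r2 • z3 + s2 • z4)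
    hA0 (fun i => by
      have hBi := hB i
      have hBi' := hB' i
      have h3 : nmat a b c e f i • z1 + nmat a b c e f' i • z2 + nmat a b c ![a, b, c] f i • z3
          + nmat a b c ![a, b, c] f' i • z4 = 0 := by
        fin_cases i <;> simp [nmat]
        · linear_combination (norm := module) (1 : k) • K0
        · linear_combination (norm := module) (1 : k) • K1
        · linear_combination (norm := module) (1 : k) • K2
      rw [hBi, hBi'] at h3
      rw [← h3]
      module)
  obtain ⟨α, β, hαβ, ω, hω, hR⟩ := exists_pencil !![r1, r2; s1, s2] (1 : Matrix (Fin 2) (Fin 2) k)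
  have R0 := congrFun hR 0
  have R1 := congrFun hR 1
  simp [dotProduct, Fin.sum_univ_two] at R0 R1
  have hα : α ≠ 0 := fun h => by
    rw [h] at R0 R1
    have hβ : β ≠ 0 := hαβ.resolve_left fun h' => h' h
    simp [hβ] at R0 R1
    exact hω (by funext i; fin_cases i; exacts [R0, R1])
  by_cases hY : α • y - β • y' = 0
  · refine ⟨u1, hu10, fun i => e i * (β / α) + (![a, b, c] : Fin 3 → k) i, y', fun i => ?_⟩
    have : y = (β / α) • y' := by
      rw [div_eq_inv_mul, mul_smul, ← sub_eq_zero.1 hY, smul_smul, inv_mul_cancel₀ hα, one_smul]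
    rw [hy i, this]; module
  · have hYi : ∀ i, X i (α • y - β • y') = f i • (α • z1 - β • z3) + f' i • (α • z2 - β • z4) :=
      fun i => by rw [map_sub, map_smul, map_smul, hz, hz']; module
    have hlin : ω 0 • (α • z1 - β • z3) + ω 1 • (α • z2 - β • z4) = 0 := by
      linear_combination (norm := module) (ω 0 * α) • hZ1 + (ω 1 * α) • hZ2
        - R0 • (1 : k) • z3 - R1 • (1 : k) • z4
    refine ⟨_, hY, ?_⟩
    by_cases hω0 : ω 0 = 0
    · have hω1 : ω 1 ≠ 0 := fun h => hω (by funext i; fin_cases i; exacts [hω0, h])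
      rw [hω0, zero_smul, zero_add, smul_eq_zero_iff_right hω1] at hlin
      exact ⟨f, _, fun i => by rw [hYi, hlin, smul_zero, add_zero]⟩
    · refine ⟨fun i => f' i - ω 1 / ω 0 * f i, α • z2 - β • z4, fun i => ?_⟩
      have h5 : α • z1 - β • z3 = -(ω 1 / ω 0) • (α • z2 - β • z4) := by
        have h6 := congrArg (fun z => (ω 0)⁻¹ • z) hlin
        simp only [smul_add, smul_smul, smul_zero, inv_mul_cancel₀ hω0, one_smul] at h6
        rw [eq_neg_of_add_eq_zero_left h6, div_eq_inv_mul, neg_smul]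
      rw [hYi, h5]
      module

end PointVector

section Tangent
variable {k : Type*} [Field k] {a b c : k} {p q dp dq : Fin 3 → k}

/-- The gradient of the cubic form `cub`. -/
def grd (a b c : k) (p : Fin 3 → k) (i : Fin 3) : k :=
  (a ^ 3 + b ^ 3 + c ^ 3) * (p (i + 1) * p (i + 2)) - 3 * (a * b * c) * p i ^ 2

/-- The rows of the matrix of the linear map `nmat a b c p`. -/
def nrow (a b c : k) (p : Fin 3 → k) (j : Fin 3) : Fin 3 → k :=
  fun i => if i = j then c * p j else if i = j + 1 then a * p (j + 2) else b * p (j + 1)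

lemma grd_comm (p : Fin 3 → k) : grd b a c p = grd a b c p := by
  funext i; simp only [grd]; ring

lemma nmat_comm (p q : Fin 3 → k) : nmat b a c q p = nmat a b c p q := by
  funext j; simp only [nmat]; ring

lemma grd_ne_zero (habc : a * b * c ≠ 0) (hdeg : (3 * a * b * c) ^ 3 ≠ (a ^ 3 + b ^ 3 + c ^ 3) ^ 3)
    (h3 : (3 : k) ≠ 0) (hp : p ≠ 0) : grd a b c p ≠ 0 := fun h => hp (by
  have g0 := congrFun h 0
  have g1 := congrFun h 1
  have g2 := congrFun h 2
  simp [grd] at g0 g1 g2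
  have h1 : ((3 * a * b * c) ^ 3 - (a ^ 3 + b ^ 3 + c ^ 3) ^ 3) * (p 0 * p 1 * p 2) ^ 2 = 0 := by
    have e0 := sub_eq_zero.1 g0
    have e1 := sub_eq_zero.1 g1
    have e2 := sub_eq_zero.1 g2
    have : ((a ^ 3 + b ^ 3 + c ^ 3) * (p 1 * p 2)) * ((a ^ 3 + b ^ 3 + c ^ 3) * (p 2 * p 0))
      * ((a ^ 3 + b ^ 3 + c ^ 3) * (p 0 * p 1)) = (3 * (a * b * c) * p 0 ^ 2)
      * (3 * (a * b * c) * p 1 ^ 2) * (3 * (a * b * c) * p 2 ^ 2) := by rw [e0, e1, e2]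
    linear_combination -this
  have h2 : p 0 * p 1 * p 2 = 0 :=
    pow_eq_zero_iff two_ne_zero |>.1 ((mul_eq_zero.1 h1).resolve_left (sub_ne_zero.2 hdeg))
  have h9 : (3 * (a * b * c)) ≠ 0 := mul_ne_zero h3 habc
  have key : ∀ y : k, 3 * (a * b * c) * y ^ 2 * y = (a ^ 3 + b ^ 3 + c ^ 3) * (p 0 * p 1 * p 2) →
      y = 0 := fun y h => by
    rw [h2, mul_zero, mul_assoc, mul_eq_zero] at h
    have := h.resolve_left h9
    exact (pow_eq_zero_iff three_ne_zero).1 (by rw [← this]; ring)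
  funext i
  fin_cases i
  · exact key (p 0) (by linear_combination -p 0 * g0)
  · exact key (p 1) (by linear_combination -p 1 * g1)
  · exact key (p 2) (by linear_combination -p 2 * g2))

/-- The cofactors of the matrix of `nmat a b c p`. -/
def ncof (a b c : k) (p : Fin 3 → k) (j : Fin 3) : Fin 3 → k :=
  crs (nrow a b c p (j + 1)) (nrow a b c p (j + 2))

lemma ncof_apply (p : Fin 3 → k) (j : Fin 3) :
    ncof a b c p j = fun i => if i = j then c ^ 2 * p (j + 1) * p (j + 2) - a * b * p j ^ 2
      else if i = j + 1 then a ^ 2 * p j * p (j + 1) - b * c * p (j + 2) ^ 2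
      else b ^ 2 * p (j + 2) * p j - a * c * p (j + 1) ^ 2 := by
  funext i
  fin_cases j <;> fin_cases i <;> simp [ncof, nrow, crs] <;> ring

lemma sum_nrow_ncof (p : Fin 3 → k) (i : Fin 3) :
    nrow b a c (ncof a b c p 0) 0 i + nrow b a c (ncof a b c p 1) 1 i
      + nrow b a c (ncof a b c p 2) 2 i = grd a b c p i := by
  simp only [ncof_apply]
  fin_cases i <;> simp [nrow, grd] <;> ring

lemma nrow_smul (t : k) (p : Fin 3 → k) (j : Fin 3) : nrow a b c (t • p) j = t • nrow a b c p j := by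
  funext i
  fin_cases j <;> fin_cases i <;> simp [nrow] <;> ring

lemma crs_crs_eq_zero {f g q : Fin 3 → k} (hf : f 0 * q 0 + f 1 * q 1 + f 2 * q 2 = 0)
    (hg : g 0 * q 0 + g 1 * q 1 + g 2 * q 2 = 0) : crs q (crs f g) = 0 := by
  funext i
  fin_cases i <;> simp [crs]
  · linear_combination f 0 * hg - g 0 * hf
  · linear_combination f 1 * hg - g 1 * hf
  · linear_combination f 2 * hg - g 2 * hf

lemma nrow_dot (p q : Fin 3 → k) (j : Fin 3) : nrow a b c p j 0 * q 0 + nrow a b c p j 1 * q 1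
    + nrow a b c p j 2 * q 2 = nmat a b c p q j := by
  fin_cases j <;> simp [nrow, nmat] <;> ring

lemma exists_ncof (h : nmat a b c p q = 0) (hq : q ≠ 0) : ∃ ℓ : Fin 3 → k,
    ∀ j, ncof a b c p j = ℓ j • q := by
  have : ∀ j, ∃ t : k, ncof a b c p j = t • q := fun j => by
    refine exists_smul_of_crs hq (crs_crs_eq_zero ?_ ?_)
    · rw [nrow_dot, h]; rfl
    · rw [nrow_dot, h]; rfl
  choose ℓ hℓ using this
  exact ⟨ℓ, hℓ⟩

lemma grd_eq_sum {ℓ : Fin 3 → k} (hℓ : ∀ j, ncof a b c p j = ℓ j • q) (i : Fin 3) :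
    grd a b c p i = ℓ 0 * nrow b a c q 0 i + ℓ 1 * nrow b a c q 1 i + ℓ 2 * nrow b a c q 2 i := by
  rw [← sum_nrow_ncof]
  simp only [hℓ, nrow_smul, Pi.smul_apply, smul_eq_mul]

lemma ncof_dot (p : Fin 3 → k) (r i : Fin 3) :
    ncof a b c p 0 r * nrow a b c p 0 i + ncof a b c p 1 r * nrow a b c p 1 i
      + ncof a b c p 2 r * nrow a b c p 2 i = if r = i then cub a b c p else 0 := by
  simp only [ncof_apply]
  fin_cases i <;> fin_cases r <;> simp [nrow, cub] <;> ring

lemma cub_eq_zero (h : nmat a b c p q = 0) (hq : q ≠ 0) : cub a b c p = 0 := by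
  obtain ⟨r, hr⟩ := Function.ne_iff.1 hq
  refine (mul_eq_zero.1 (?_ : q r * cub a b c p = 0)).resolve_left hr
  have g0 := (nrow_dot p q 0).trans (congrFun h 0)
  have g1 := (nrow_dot p q 1).trans (congrFun h 1)
  have g2 := (nrow_dot p q 2).trans (congrFun h 2)
  have h0 := ncof_dot (a := a) (b := b) (c := c) p r 0
  have h1 := ncof_dot (a := a) (b := b) (c := c) p r 1
  have h2 := ncof_dot (a := a) (b := b) (c := c) p r 2
  have h3 : q r * cub a b c p = q 0 * (if r = 0 then cub a b c p else 0)
      + q 1 * (if r = 1 then cub a b c p else 0) + q 2 * (if r = 2 then cub a b c p else 0) := by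
    fin_cases r <;> simp
  rw [h3, ← h0, ← h1, ← h2]
  simp only [Pi.zero_apply] at g0 g1 g2
  linear_combination ncof a b c p 0 r * g0 + ncof a b c p 1 r * g1
    + ncof a b c p 2 r * g2

lemma crs_col_eq_zero {N : Fin 3 → Fin 3 → k} {m ℓ p dp G X : Fin 3 → k}
    (hm : ∀ j, crs (N (j + 1)) (N (j + 2)) = m j • p)
    (hG : ∀ i, G i = ℓ 0 * N 0 i + ℓ 1 * N 1 i + ℓ 2 * N 2 i)
    (hmN : ∀ i, m 0 * N 0 i + m 1 * N 1 i + m 2 * N 2 i = 0) (hd : crs p dp = G)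
    (hX : ∀ j, N j 0 * dp 0 + N j 1 * dp 1 + N j 2 * dp 2 - crs ℓ m j = X j) (i : Fin 3) :
    crs X (fun j => N j i) = 0 := by
  have h : ∀ r s, N (r + 1) (s + 1) * N (r + 2) (s + 2) - N (r + 1) (s + 2) * N (r + 2) (s + 1)
      = m r * p s := fun r s => congrFun (hm r) s
  have hd' : p (i + 1) * dp (i + 2) - p (i + 2) * dp (i + 1) = G i := congrFun hd i
  funext r
  have hr1 := h r (i + 1)
  have hr2 := h r (i + 2)
  have hs : ∀ j, N j i * dp i + N j (i + 1) * dp (i + 1) + N j (i + 2) * dp (i + 2)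
      - (ℓ (j + 1) * m (j + 2) - ℓ (j + 2) * m (j + 1)) = X j := fun j => by
    rw [← hX]
    fin_cases i <;> simp [crs] <;> ring
  have e1 : i + 1 + 1 = i + 2 := by fin_cases i <;> rfl
  have e2 : i + 1 + 2 = i := by fin_cases i <;> rfl
  have e3 : i + 2 + 1 = i := by fin_cases i <;> rfl
  have e4 : i + 2 + 2 = i + 1 := by fin_cases i <;> rfl
  have f1 : r + 1 + 1 = r + 2 := by fin_cases r <;> rfl
  have f2 : r + 1 + 2 = r := by fin_cases r <;> rfl
  have f3 : r + 2 + 1 = r := by fin_cases r <;> rfl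
  have f4 : r + 2 + 2 = r + 1 := by fin_cases r <;> rfl
  have hG' : G i = ℓ r * N r i + ℓ (r + 1) * N (r + 1) i + ℓ (r + 2) * N (r + 2) i := by
    rw [hG]; fin_cases r <;> simp <;> ring
  have hmN' : m r * N r i + m (r + 1) * N (r + 1) i + m (r + 2) * N (r + 2) i = 0 := by
    rw [← hmN i]; fin_cases r <;> simp <;> ring
  rw [e1, e2] at hr1
  rw [e3, e4] at hr2
  show X (r + 1) * N (r + 2) i - X (r + 2) * N (r + 1) i = 0
  rw [← hs, ← hs, f1, f2, f3, f4]
  linear_combination dp (i + 2) * hr1 - dp (i + 1) * hr2 + m r * hd' + m r * hG' + ℓ r * hmN'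

lemma nmat_half (hp : p ≠ 0) (hG : grd a b c q ≠ 0) (h : cub b a c q = 0)
    (hd : crs p dp = grd a b c p) {ℓ m : Fin 3 → k} (hℓ : ∀ j, ncof a b c p j = ℓ j • q)
    (hm : ∀ j, ncof b a c q j = m j • p) : nmat a b c dp q = crs ℓ m := by
  have hmN : ∀ i, m 0 * nrow b a c q 0 i + m 1 * nrow b a c q 1 i + m 2 * nrow b a c q 2 i = 0 := by
    intro i
    obtain ⟨r, hr⟩ := Function.ne_iff.1 hp
    have h1 := ncof_dot (a := b) (b := a) (c := c) q r i
    rw [h, ite_self] at h1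
    simp only [hm, Pi.smul_apply, smul_eq_mul] at h1
    refine (mul_eq_zero.1 (?_ : p r * _ = 0)).resolve_left hr
    rw [← h1]; ring
  have hG' := grd_eq_sum hℓ
  by_contra hX
  have hX0 : nmat a b c dp q - crs ℓ m ≠ 0 := fun h => hX (sub_eq_zero.1 h)
  have hcol : ∀ i, ∃ t : k, (fun j => nrow b a c q j i) = t • (nmat a b c dp q - crs ℓ m) :=
    fun i => by
      refine exists_smul_of_crs hX0 ?_
      refine crs_col_eq_zero hm hG' hmN hd (fun j => ?_) i
      rw [nrow_dot, nmat_comm, Pi.sub_apply]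
  choose t ht using hcol
  have hN : ∀ j i, nrow b a c q j i = t i * (nmat a b c dp q - crs ℓ m) j := fun j i =>
    congrFun (ht i) j
  have hm0 : m = 0 := by
    obtain ⟨r, hr⟩ := Function.ne_iff.1 hp
    funext j
    have h1 := congrFun (hm j) r
    simp only [ncof, crs, hN, Pi.smul_apply, smul_eq_mul] at h1
    exact (mul_eq_zero.1 (by rw [← h1]; ring : m j * p r = 0)).resolve_right hr
  apply hG
  funext i
  rw [← grd_comm, grd_eq_sum hm, hm0]
  simp

lemma tangent (hp : p ≠ 0) (hq : q ≠ 0) (hGp : grd a b c p ≠ 0) (hGq : grd a b c q ≠ 0)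
    (h : nmat a b c p q = 0) (hd : crs p dp = grd a b c p) (hd' : crs q dq = grd a b c q) (j : Fin 3) :
    nmat a b c dp q j + nmat a b c p dq j = 0 := by
  have h' : nmat b a c q p = 0 := by rw [nmat_comm, h]
  obtain ⟨ℓ, hℓ⟩ := exists_ncof h hq
  obtain ⟨m, hm⟩ := exists_ncof h' hp
  rw [nmat_half hp hGq (cub_eq_zero h' hp) hd hℓ hm, ← nmat_comm p dq,
    nmat_half hq (by rwa [grd_comm]) (cub_eq_zero h hq) (by rw [grd_comm, hd']) hm hℓ]
  simp only [crs]; ring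

end Tangent

section Direction
variable {k : Type*} [Field k] {a b c : k} {p : Fin 3 → k}

open Classical in
/-- A vector pairing to one with a given nonzero vector, homogeneous of degree `-1`. -/
def qf (p : Fin 3 → k) : Fin 3 → k :=
  if p 0 ≠ 0 then ![(p 0)⁻¹, 0, 0] else if p 1 ≠ 0 then ![0, (p 1)⁻¹, 0] else ![0, 0, (p 2)⁻¹]

lemma qf_dot (hp : p ≠ 0) : p 0 * qf p 0 + p 1 * qf p 1 + p 2 * qf p 2 = 1 := by
  by_cases h0 : p 0 = 0
  · by_cases h1 : p 1 = 0
    · have h2 : p 2 ≠ 0 := fun h2 => hp (by funext i; fin_cases i; exacts [h0, h1, h2])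
      simp [qf, h0, h1, h2]
    · simp [qf, h0, h1]
  · simp [qf, h0]

lemma qf_smul {t : k} (ht : t ≠ 0) (p : Fin 3 → k) : qf (t • p) = t⁻¹ • qf p := by
  by_cases h0 : p 0 = 0
  · by_cases h1 : p 1 = 0
    · simp [qf, h0, h1, mul_comm]
    · simp [qf, h0, h1, ht, mul_comm]
  · simp [qf, h0, ht, mul_comm]

/-- A tangent direction of the cubic curve, homogeneous of degree `1`. -/
def tdir (a b c : k) (p : Fin 3 → k) : Fin 3 → k := crs (grd a b c p) (qf p)

lemma crs_tdir (hp : p ≠ 0) (h : cub a b c p = 0) : crs p (tdir a b c p) = grd a b c p := by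
  have h1 := qf_dot hp
  have h2 : p 0 * grd a b c p 0 + p 1 * grd a b c p 1 + p 2 * grd a b c p 2 = 0 := by
    rw [← mul_zero (3 : k), ← h]
    simp [grd, cub]; ring
  funext i
  fin_cases i <;> simp [crs, tdir]
  · linear_combination grd a b c p 0 * h1 - qf p 0 * h2
  · linear_combination grd a b c p 1 * h1 - qf p 1 * h2
  · linear_combination grd a b c p 2 * h1 - qf p 2 * h2

lemma tdir_smul {t : k} (ht : t ≠ 0) (p : Fin 3 → k) : tdir a b c (t • p) = t • tdir a b c p := by
  have : grd a b c (t • p) = t ^ 2 • grd a b c p := by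
    funext i; simp only [grd, Pi.smul_apply, smul_eq_mul]; ring
  funext i
  simp only [tdir, this, qf_smul ht, crs, Pi.smul_apply, smul_eq_mul]
  field_simp

end Direction

section Chain
variable {k : Type*} [Field k] {M : Type*} [AddCommGroup M] [Module k M] {a b c : k}

lemma nrow_apply {X : Fin 3 → M →ₗ[k] M} {u u' : M} {p : Fin 3 → k}
    (h : ∀ j u, a • X (j + 1) (X (j + 2) u) + b • X (j + 2) (X (j + 1) u) + c • X j (X j u) = 0)
    (hu : ∀ i, X i u = p i • u') (j : Fin 3) :
    nrow a b c p j 0 • X 0 u' + nrow a b c p j 1 • X 1 u' + nrow a b c p j 2 • X 2 u' = 0 := by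
  rw [← h j u]
  simp only [hu, map_smul]
  fin_cases j <;> simp [nrow] <;> module

lemma exists_tensor {f g : Fin 3 → k} (hn : crs f g ≠ 0) {y : Fin 3 → M}
    (hf : f 0 • y 0 + f 1 • y 1 + f 2 • y 2 = 0) (hg : g 0 • y 0 + g 1 • y 1 + g 2 • y 2 = 0) :
    ∃ z : M, ∀ i, y i = crs f g i • z := by
  obtain ⟨q, hq⟩ := exists_dot_eq_one hn
  refine ⟨q 0 • y 0 + q 1 • y 1 + q 2 • y 2, fun i => ?_⟩
  rw [← one_smul k (y i), ← hq]
  fin_cases i <;> simp [crs]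
  · linear_combination (norm := module) (q 2 * g 1 - q 1 * g 2) • hf + (q 1 * f 2 - q 2 * f 1) • hg
  · linear_combination (norm := module) (q 0 * g 2 - q 2 * g 0) • hf + (q 2 * f 0 - q 0 * f 2) • hg
  · linear_combination (norm := module) (q 1 * g 0 - q 0 * g 1) • hf + (q 0 * f 1 - q 1 * f 0) • hg

lemma exists_next {X : Fin 3 → M →ₗ[k] M} {u u' : M} {p : Fin 3 → k}
    (h : ∀ j u, a • X (j + 1) (X (j + 2) u) + b • X (j + 2) (X (j + 1) u) + c • X j (X j u) = 0)
    (h0 : ∀ u, (∀ i, X i u = 0) → u = 0) (hG : grd a b c p ≠ 0)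
    (hu : ∀ i, X i u = p i • u') (hu' : u' ≠ 0) :
    ∃ (p' : Fin 3 → k) (u'' : M), p' ≠ 0 ∧ u'' ≠ 0 ∧ (∀ i, X i u' = p' i • u'') ∧
      nmat a b c p p' = 0 := by
  have hr := nrow_apply h hu
  obtain ⟨j, hj⟩ : ∃ j, ncof a b c p j ≠ 0 := by
    by_contra hc
    push Not at hc
    refine hG (funext fun i => ?_)
    have h1 : ∀ j : Fin 3, nrow b a c (0 : Fin 3 → k) j i = 0 := fun j => by
      fin_cases j <;> fin_cases i <;> simp [nrow]
    rw [← sum_nrow_ncof, hc, hc, hc, h1, h1, h1]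
    simp
  obtain ⟨z, hz⟩ := exists_tensor (y := fun i => X i u') hj (hr (j + 1)) (hr (j + 2))
  have hz0 : z ≠ 0 := fun hz0 => hu' (h0 _ fun i => by rw [hz, hz0, smul_zero])
  refine ⟨ncof a b c p j, z, hj, hz0, hz, funext fun i => ?_⟩
  have h2 := hr i
  rw [hz, hz, hz, smul_smul, smul_smul, smul_smul, ← add_smul, ← add_smul] at h2
  rw [← nrow_dot]
  exact (smul_eq_zero.1 h2).resolve_right hz0

lemma exists_chain {X : Fin 3 → M →ₗ[k] M} {u u' : M} {p : Fin 3 → k}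
    (h : ∀ j u, a • X (j + 1) (X (j + 2) u) + b • X (j + 2) (X (j + 1) u) + c • X j (X j u) = 0)
    (h0 : ∀ u, (∀ i, X i u = 0) → u = 0) (hG : ∀ p, p ≠ 0 → grd a b c p ≠ 0)
    (hu0 : u ≠ 0) (hu : ∀ i, X i u = p i • u') :
    ∃ (u : ℕ → M) (p : ℕ → Fin 3 → k), (∀ n, u n ≠ 0) ∧ (∀ n, p n ≠ 0) ∧
      (∀ n i, X i (u n) = p n i • u (n + 1)) ∧ ∀ n, nmat a b c (p n) (p (n + 1)) = 0 := by
  have hp : p ≠ 0 := fun hp => hu0 (h0 _ fun i => by rw [hu, hp, Pi.zero_apply, zero_smul])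
  have hu' : u' ≠ 0 := fun hu' => hu0 (h0 _ fun i => by rw [hu, hu', smul_zero])
  let T := {s : M × (Fin 3 → k) × M // s.1 ≠ 0 ∧ s.2.1 ≠ 0 ∧ s.2.2 ≠ 0 ∧ ∀ i, X i s.1 = s.2.1 i • s.2.2}
  have hs : ∀ s : T, ∃ s' : T, s'.1.1 = s.1.2.2 ∧ nmat a b c s.1.2.1 s'.1.2.1 = 0 := fun s => by
    obtain ⟨p', u'', h1, h2, h3, h4⟩ := exists_next h h0 (hG _ s.2.2.1) s.2.2.2.2 s.2.2.2.1
    exact ⟨⟨(s.1.2.2, p', u''), s.2.2.2.1, h1, h2, h3⟩, rfl, h4⟩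
  choose nx hnx1 hnx2 using hs
  let t : ℕ → T := fun n => nx^[n] ⟨(u, p, u'), hu0, hp, hu', hu⟩
  have ht : ∀ n, t (n + 1) = nx (t n) := fun n => Function.iterate_succ_apply' _ _ _
  refine ⟨fun n => (t n).1.1, fun n => (t n).1.2.1, fun n => (t n).2.1, fun n => (t n).2.2.1,
    fun n i => ?_, fun n => ?_⟩
  · simp only [ht, hnx1]; exact (t n).2.2.2.2 i
  · simp only [ht]; exact hnx2 _

/-- The first linear relation in a sequence. -/
lemma exists_first [FiniteDimensional k M] (u : ℕ → M) : ∃ d : ℕ,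
    LinearIndependent k (fun i : Fin d => u i) ∧ ∃ c : Fin d → k, u d = ∑ i, c i • u i := by
  classical
  have hex : ∃ d : ℕ, ¬ LinearIndependent k (fun i : Fin (d + 1) => u i) := by
    refine ⟨Module.finrank k M, fun h => ?_⟩
    have := h.fintype_card_le_finrank
    simp at this
  refine ⟨Nat.find hex, ?_, ?_⟩
  · rcases hn : Nat.find hex with _ | d
    · exact linearIndependent_empty_type
    · exact not_not.1 (Nat.find_min hex (by omega : d < Nat.find hex))
  · have h1 := Nat.find_spec hex
    have h2 : LinearIndependent k (fun i : Fin (Nat.find hex) => u i) := by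
      rcases hn : Nat.find hex with _ | d
      · exact linearIndependent_empty_type
      · exact not_not.1 (Nat.find_min hex (by omega : d < Nat.find hex))
    rw [linearIndependent_finSucc'] at h1
    have h3 : u (Nat.find hex) ∈ Submodule.span k (Set.range fun i : Fin (Nat.find hex) => u i) := by
      by_contra h4
      exact h1 ⟨h2, h4⟩
    obtain ⟨c, hc⟩ := (Submodule.mem_span_range_iff_exists_fun k).1 h3
    exact ⟨c, hc.symm⟩

end Chain

section Derivation
variable {k : Type*} [Field k] {M : Type*} [AddCommGroup M] [Module k M] {a b c : k}

lemma mem_span_range_of {d : ℕ} {u : ℕ → M} {i : ℕ} (hi : i < d) :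
    u i ∈ Submodule.span k (Set.range fun i : Fin d => u i) :=
  Submodule.subset_span ⟨⟨i, hi⟩, rfl⟩

lemma exists_derivation [FiniteDimensional k M] {X : Fin 3 → M →ₗ[k] M} {u : ℕ → M}
    {p : ℕ → Fin 3 → k} (hG : ∀ p, p ≠ 0 → grd a b c p ≠ 0) (hu : ∀ n, u n ≠ 0)
    (hp : ∀ n, p n ≠ 0) (hX : ∀ n i, X i (u n) = p n i • u (n + 1))
    (hn : ∀ n, nmat a b c (p n) (p (n + 1)) = 0)
    (hirr : ∀ W : Submodule k M, W ≠ ⊥ → (∀ i, ∀ w ∈ W, X i w ∈ W) → W = ⊤) :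
    ∃ v : Fin 3 → M →ₗ[k] M,
      (∀ j y, a • (X (j + 1) (v (j + 2) y) + v (j + 1) (X (j + 2) y))
        + b • (X (j + 2) (v (j + 1) y) + v (j + 2) (X (j + 1) y))
        + c • (X j (v j y) + v j (X j y)) = 0) ∧
      ¬ ∃ (γ : k) (f : M →ₗ[k] M), ∀ i y, v i y = γ • X i y + (X i (f y) - f (X i y)) := by
  obtain ⟨d, hLI, cf, hcf⟩ := exists_first (k := k) u
  have hd : 0 < d := by
    rcases d with _ | d
    · exact absurd (by rw [hcf]; simp) (hu 0)
    · omega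
  have hsp : Submodule.span k (Set.range fun i : Fin d => u i) = ⊤ := by
    refine hirr _ (fun h => hu 0 ?_) fun i w hw => ?_
    · have := mem_span_range_of (k := k) (u := u) hd
      rwa [h, Submodule.mem_bot] at this
    · induction hw using Submodule.span_induction with
      | mem w hw =>
        obtain ⟨l, rfl⟩ := hw
        simp only [hX]
        refine Submodule.smul_mem _ _ ?_
        rcases (Nat.succ_le_of_lt l.2).lt_or_eq with h | h
        · exact mem_span_range_of h
        · rw [show (l : ℕ) + 1 = d from h, hcf]
          exact Submodule.sum_mem _ fun i _ => Submodule.smul_mem _ _ (mem_span_range_of i.2)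
      | zero => rw [map_zero]; exact Submodule.zero_mem _
      | add w w' _ _ h h' => rw [map_add]; exact Submodule.add_mem _ h h'
      | smul t w _ h => rw [map_smul]; exact Submodule.smul_mem _ _ h
  have hXd : ∀ j, p d j • u (d + 1) = ∑ l : Fin d, (cf l * p l j) • u (l + 1) := fun j => by
    rw [← hX, hcf, map_sum]
    refine Finset.sum_congr rfl fun l _ => ?_
    rw [map_smul, hX, smul_smul]
  obtain ⟨j₀, hj₀⟩ : ∃ j, p d j ≠ 0 := Function.ne_iff.1 (hp d)
  have hsp' : Submodule.span k (Set.range fun i : Fin d => u (i + 1)) = ⊤ := by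
    have hmem : ∀ {i : ℕ}, i < d →
        u (i + 1) ∈ Submodule.span k (Set.range fun i : Fin d => u (i + 1)) :=
      fun hi => mem_span_range_of (u := fun i => u (i + 1)) hi
    refine hirr _ (fun h => hu 1 ?_) fun i w hw => ?_
    · have := hmem hd
      rwa [h, Submodule.mem_bot] at this
    · induction hw using Submodule.span_induction with
      | mem w hw =>
        obtain ⟨l, rfl⟩ := hw
        simp only [hX]
        refine Submodule.smul_mem _ _ ?_
        rcases (Nat.succ_le_of_lt l.2).lt_or_eq with h | h
        · exact hmem h
        · rw [show (l : ℕ) + 1 = d from h]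
          have h2 : p d j₀ • u (d + 1) ∈
              Submodule.span k (Set.range fun i : Fin d => u (i + 1)) := by
            rw [hXd]
            exact Submodule.sum_mem _ fun i _ => Submodule.smul_mem _ _ (hmem i.2)
          exact (Submodule.smul_mem_iff _ hj₀).1 h2
      | zero => rw [map_zero]; exact Submodule.zero_mem _
      | add w w' _ _ h h' => rw [map_add]; exact Submodule.add_mem _ h h'
      | smul t w _ h => rw [map_smul]; exact Submodule.smul_mem _ _ h
  let B := Module.Basis.mk hLI hsp.ge
  have hLI' : LinearIndependent k (fun i : Fin d => u (i + 1)) :=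
    linearIndependent_of_top_le_span_of_card_eq_finrank hsp'.ge
      (Module.finrank_eq_card_basis B).symm
  have hzero : ∀ g : Fin d → k, ∑ l, g l • u (l + 1) = 0 → ∀ l, g l = 0 :=
    Fintype.linearIndependent_iff.1 hLI'
  let v : Fin 3 → M →ₗ[k] M := fun i => B.constr k fun l => tdir a b c (p l) i • u (l + 1)
  have hv : ∀ i (l : Fin d), v i (u l) = tdir a b c (p l) i • u (l + 1) := fun i l => by
    have := B.constr_basis k (fun l => tdir a b c (p l) i • u (l + 1)) l
    rwa [show B l = u l from Module.Basis.mk_apply _ _ _] at this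
  have hpar : ∀ l : Fin d, cf l ≠ 0 → ∃ t : k, t ≠ 0 ∧ p l = t • p d := fun l hl => by
    have h1 : ∀ i j, p d i * p l j = p d j * p l i := fun i j => by
      have h2 : ∑ l : Fin d, (cf l * (p d i * p l j - p d j * p l i)) • u (l + 1) = 0 := by
        have h3 : p d i • (p d j • u (d + 1)) - p d j • (p d i • u (d + 1)) = 0 := by module
        rw [← h3, hXd, hXd, Finset.smul_sum, Finset.smul_sum, ← Finset.sum_sub_distrib]
        refine Finset.sum_congr rfl fun l _ => ?_
        module
      exact sub_eq_zero.1 ((mul_eq_zero.1 (hzero _ h2 l)).resolve_left hl)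
    obtain ⟨t, ht⟩ := exists_smul_of_crs (hp d) (e := p l) (by
      funext i
      rw [crs, h1, Pi.zero_apply, sub_self])
    refine ⟨t, fun h => hp l ?_, ht⟩
    rw [ht, h, zero_smul]
  have hvd : ∀ i, v i (u d) = tdir a b c (p d) i • u (d + 1) := fun i => by
    have h1 : p d j₀ • v i (u d) = tdir a b c (p d) i • (p d j₀ • u (d + 1)) := by
      rw [hXd, Finset.smul_sum]
      rw [hcf, map_sum, Finset.smul_sum]
      refine Finset.sum_congr rfl fun l _ => ?_
      rw [map_smul, hv]
      by_cases hl : cf l = 0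
      · rw [hl]; simp
      · obtain ⟨t, ht, hl⟩ := hpar l hl
        rw [hl, tdir_smul ht]
        simp only [Pi.smul_apply, smul_eq_mul]
        module
    rw [smul_comm] at h1
    exact smul_right_injective M hj₀ h1
  have hv' : ∀ i l, l ≤ d → v i (u l) = tdir a b c (p l) i • u (l + 1) := fun i l hl => by
    rcases hl.lt_or_eq with hl | rfl
    · exact hv i ⟨l, hl⟩
    · exact hvd i
  have hT : ∀ l, crs (p l) (tdir a b c (p l)) = grd a b c (p l) := fun l =>
    crs_tdir (hp l) (cub_eq_zero (hn l) (hp _))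
  refine ⟨v, fun j y => ?_, ?_⟩
  · let T : M →ₗ[k] M := a • (X (j + 1) ∘ₗ v (j + 2) + v (j + 1) ∘ₗ X (j + 2))
        + b • (X (j + 2) ∘ₗ v (j + 1) + v (j + 2) ∘ₗ X (j + 1)) + c • (X j ∘ₗ v j + v j ∘ₗ X j)
    suffices h : T = 0 from LinearMap.congr_fun h y
    refine B.ext fun l => ?_
    have h1 := tangent (hp l) (hp (l + 1)) (hG _ (hp l)) (hG _ (hp _)) (hn l) (hT l) (hT _) j
    rw [show B l = u l from Module.Basis.mk_apply _ _ _, LinearMap.zero_apply,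
      ← zero_smul k (u (l + 1 + 1)), ← h1]
    simp only [T, LinearMap.add_apply, LinearMap.smul_apply, LinearMap.comp_apply, hX, hv, map_smul,
      hv' _ _ (Nat.succ_le_of_lt l.2), nmat]
    module
  · rintro ⟨γ, f, hf⟩
    obtain ⟨q, hq⟩ := exists_dot_eq_one (hG _ (hp 0))
    let l0 : Fin d := ⟨0, hd⟩
    have h1 : ∀ i, tdir a b c (p 0) i • u 1
        = γ • (p 0 i • u 1) + (X i (f (u 0)) - p 0 i • f (u 1)) := fun i => by
      have h0 : v i (u 0) = tdir a b c (p 0) i • u 1 := hv i l0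
      rw [← h0, hf, hX 0, map_smul]
    have h2 : f (u 0) = ∑ l : Fin d, B.repr (f (u 0)) l • u l := by
      conv_lhs => rw [← B.sum_repr (f (u 0))]
      refine Finset.sum_congr rfl fun l _ => ?_
      rw [show B l = u l from Module.Basis.mk_apply _ _ _]
    have h3 : ∀ i, X i (f (u 0)) = ∑ l : Fin d, (B.repr (f (u 0)) l * p l i) • u (l + 1) := fun i => by
      conv_lhs => rw [h2]
      rw [map_sum]
      refine Finset.sum_congr rfl fun l _ => ?_
      rw [map_smul, hX, smul_smul]
    have h4 : crs q (p 0) 0 • X 0 (f (u 0)) + crs q (p 0) 1 • X 1 (f (u 0))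
        + crs q (p 0) 2 • X 2 (f (u 0)) = u 1 := by
      have e0 := congrFun (hT 0) 0
      have e1 := congrFun (hT 0) 1
      have e2 := congrFun (hT 0) 2
      rw [← one_smul k (u 1), ← hq, ← e0, ← e1, ← e2]
      simp [crs]
      linear_combination (norm := module) -(q 1 * p 0 2 - q 2 * p 0 1) • h1 0
        - (q 2 * p 0 0 - q 0 * p 0 2) • h1 1 - (q 0 * p 0 1 - q 1 * p 0 0) • h1 2
    have h5 : ∑ l : Fin d, (B.repr (f (u 0)) l * (crs q (p 0) 0 * p l 0 + crs q (p 0) 1 * p l 1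
        + crs q (p 0) 2 * p l 2) - if l = l0 then 1 else 0) • u (l + 1) = 0 := by
      rw [h3, h3, h3] at h4
      rw [← sub_eq_zero] at h4
      rw [← h4]
      simp only [sub_smul, Finset.sum_sub_distrib, ite_smul, one_smul, zero_smul,
        Finset.sum_ite_eq', Finset.mem_univ, if_true, Finset.smul_sum, ← Finset.sum_add_distrib]
      refine congrArg₂ (· - ·) (Finset.sum_congr rfl fun l _ => ?_) rfl
      module
    have h6 := hzero _ h5 l0
    rw [if_pos rfl] at h6
    simp only [crs, l0] at h6
    simp only [Fin.isValue, zero_add, Fin.reduceAdd] at h6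
    refine one_ne_zero (α := k) ?_
    linear_combination -h6

end Derivation

section Rigid
variable {k : Type u} [Field k] {n : Type} [Fintype n] [DecidableEq n] {a b c ζ : k} {E : Env k}
  {x : Fin 3 → Matrix n n k}

lemma IsPt.eq_zero_of_mulVec (h : IsPt E ζ x) {y : n → k} (hy : ∀ i, x i *ᵥ y = 0) : y = 0 := by
  have h1 : ∀ f, ev (k := k) x f *ᵥ y = FreeAlgebra.lift k (fun _ : Fin 3 => (0 : k)) f • y := fun f => by
    induction f using FreeAlgebra.induction with
    | grade0 r =>
      rw [AlgHom.commutes, AlgHom.commutes, Algebra.algebraMap_eq_smul_one, smul_mulVec, one_mulVec]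
      rfl
    | grade1 i => simp [hy]
    | mul a b ha hb => rw [map_mul, ← mulVec_mulVec, hb, mulVec_smul, ha, smul_smul, map_mul, mul_comm]
    | add a b ha hb => rw [map_add, add_mulVec, ha, hb, map_add, add_smul]
  have h2 := h1 E.z
  have h3 := E.hz.lift_smul (R := k) 0 (fun _ : Fin 3 => (0 : k))
  rw [zero_pow E.hN, zero_smul] at h3
  have h3' : FreeAlgebra.lift k (fun _ : Fin 3 => (0 : k)) E.z = 0 := by
    simpa using h3
  rw [h.cen, h3', zero_smul, smul_mulVec, one_mulVec] at h2
  exact (smul_eq_zero.1 h2).resolve_left h.hζ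

lemma IsPt.eq_top (h : IsPt E ζ x) {W : Submodule k (n → k)} (hW : W ≠ ⊥)
    (hx : ∀ i, ∀ w ∈ W, x i *ᵥ w ∈ W) : W = ⊤ := by
  have h1 : ∀ f, ∀ w ∈ W, ev (k := k) x f *ᵥ w ∈ W := fun f => by
    induction f using FreeAlgebra.induction with
    | grade0 r =>
      intro w hw
      rw [AlgHom.commutes, Algebra.algebraMap_eq_smul_one, smul_mulVec, one_mulVec]
      exact W.smul_mem _ hw
    | grade1 i => simpa using hx i
    | mul a b ha hb => intro w hw; rw [map_mul, ← mulVec_mulVec]; exact ha _ (hb _ hw)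
    | add a b ha hb => intro w hw; rw [map_add, add_mulVec]; exact W.add_mem (ha _ hw) (hb _ hw)
  obtain ⟨w, hw, hw0⟩ := W.exists_mem_ne_zero_of_ne_bot hW
  obtain ⟨i, hi⟩ := Function.ne_iff.1 hw0
  have hi : w i ≠ 0 := hi
  refine eq_top_iff.2 fun y _ => ?_
  obtain ⟨f, hf⟩ := h.surj (vecMulVec y (Pi.single i (w i)⁻¹))
  have h2 := h1 f w hw
  rw [hf, vecMulVec_mulVec] at h2
  simpa [hi] using h2

lemma d1_skw (x v : Fin 3 → Matrix n n k) (j : Fin 3) : d1 (skw k a b c) x x v j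
    = a • (x (j + 1) * v (j + 2) + v (j + 1) * x (j + 2))
      + b • (x (j + 2) * v (j + 1) + v (j + 2) * x (j + 1)) + c • (x j * v j + v j * x j) := by
  rw [d1_apply]
  fin_cases j <;> simp [skw, Fin.sum_univ_three] <;> abel

variable [IsAlgClosed k] [CharZero k] [Nonempty n]

/-- If the canonical cubic vanishes at a point, then the point is not rigid. -/
lemma IsPt.exists_not_isGauge (h : IsPt E ζ x) (hE : E.w = skw k a b c) (habc : a * b * c ≠ 0)
    (hdeg : (3 * a * b * c) ^ 3 ≠ (a ^ 3 + b ^ 3 + c ^ 3) ^ 3)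
    (hg : gel a b c (x 0) (x 1) (x 2) = 0) : ∃ v, d1 E.w x x v = 0 ∧ ¬ IsGauge x v := by
  have hrel : ∀ j, a • (x (j + 1) * x (j + 2)) + b • (x (j + 2) * x (j + 1)) + c • (x j * x j) = 0 :=
    fun j => by rw [← relAt_skw, ← hE, h.rel]
  obtain ⟨y, hy, p, y', hp⟩ := exists_point habc hdeg x (hrel 0) (hrel 1) (hrel 2) hg
  have hG : ∀ p, p ≠ 0 → grd a b c p ≠ 0 := fun p => grd_ne_zero habc hdeg three_ne_zero
  obtain ⟨u, p, hu, hp, hX, hn⟩ := exists_chain (X := fun i => (x i).mulVecLin) (fun j u => by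
    simpa only [add_mulVec, smul_mulVec, ← mulVec_mulVec, zero_mulVec, mulVecLin_apply] using
      congrArg (· *ᵥ u) (hrel j)) (fun u => h.eq_zero_of_mulVec) hG hy hp
  obtain ⟨v, hv, hv'⟩ := exists_derivation (X := fun i => (x i).mulVecLin) hG hu hp hX hn
    fun W => h.eq_top
  refine ⟨fun i => LinearMap.toMatrix' (v i), ?_, ?_⟩
  · rw [hE]
    funext j
    rw [d1_skw, Pi.zero_apply]
    refine Matrix.toLin'.injective (LinearMap.ext fun y => ?_)
    rw [map_zero, LinearMap.zero_apply, ← hv j y]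
    simp [Matrix.toLin'_mul]
  · rintro ⟨γ, f, hf⟩
    refine hv' ⟨γ, f.mulVecLin, fun i y => ?_⟩
    have h1 := congrArg (fun A => A *ᵥ y) (congrFun hf i)
    simpa [d0_apply, add_mulVec, sub_mulVec, smul_mulVec, ← mulVec_mulVec] using h1

end Rigid

section Shift
variable {k : Type*} [Field k] {A : Type*} [Ring A] [Algebra k A] {a b c : k}

lemma gel_shift {x y z : A} (hx : a • (y * z) + b • (z * y) + c • (x * x) = 0)
    (hy : a • (z * x) + b • (x * z) + c • (y * y) = 0)
    (hz : a • (x * y) + b • (y * x) + c • (z * z) = 0) :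
    gel a b c y z x = gel a b c x y z := by
  have h1 := congrArg (fun t => t * x) hx
  have h2 := congrArg (fun t => y * t) hy
  have h3 := congrArg (fun t => t * z) hz
  simp only [mul_add, add_mul, mul_smul_comm, smul_mul_assoc, mul_assoc, mul_zero, zero_mul]
    at h1 h2 h3
  simp only [gel, mul_assoc]
  linear_combination (norm := module) (c ^ 3 - a ^ 3 : k) • h1
    + (a ^ 3 + b ^ 3 - 2 * c ^ 3 : k) • h2 + (c ^ 3 - b ^ 3 : k) • h3

lemma gel_smul {o p q : k} (ho : o ^ 3 = 1) (hp : p ^ 3 = 1) (hq : o * p * q = 1) (x y z : A) :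
    gel a b c (o • x) (p • y) (q • z) = gel a b c x y z := by
  simp only [gel, mul_smul_comm, smul_mul_assoc, smul_smul]
  refine congrArg₂ (· + ·) (congrArg₂ (· + ·) (congrArg₂ (· + ·) ?_ ?_) ?_) ?_
  · exact congrArg (· • (y * y * y)) (by linear_combination (c * (c ^ 3 - b ^ 3)) * hp)
  · exact congrArg (· • (y * x * z)) (by linear_combination (b * (c ^ 3 - a ^ 3)) * hq)
  · exact congrArg (· • (x * y * z)) (by linear_combination (a * (b ^ 3 - c ^ 3)) * hq)
  · exact congrArg (· • (x * x * x)) (by linear_combination (c * (a ^ 3 - c ^ 3)) * ho)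

/-- Cyclic shift of the coordinates followed by the diagonal action of a cube root of unity. -/
def heis (o : k) (s : Fin 3) (x : Fin 3 → A) : Fin 3 → A := fun i => o ^ (i : ℕ) • x (i + s)

lemma quad_smul {o p q : k} (h : o * p = q * q) {x y z : A}
    (hr : a • (x * y) + b • (y * x) + c • (z * z) = 0) :
    a • ((o • x) * (p • y)) + b • ((p • y) * (o • x)) + c • ((q • z) * (q • z)) = 0 := by
  simp only [mul_smul_comm, smul_mul_assoc, smul_smul]
  have := congrArg (fun t => (q * q) • t) hr
  simp only [smul_add, smul_smul, smul_zero] at this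
  rw [← this]
  refine congrArg₂ (· + ·) (congrArg₂ (· + ·) ?_ ?_) ?_
  · exact congrArg (· • (x * y)) (by linear_combination a * h)
  · exact congrArg (· • (y * x)) (by linear_combination b * h)
  · exact congrArg (· • (z * z)) (by ring)

end Shift

section ShiftRel
variable {k : Type u} [Field k] {A : Type*} [Ring A] [Algebra k A] {a b c : k}

lemma relAt_heis {o : k} (ho : o ^ 3 = 1) (s : Fin 3) {x : Fin 3 → A}
    (hx : ∀ j, relAt (skw k a b c) x j = 0) (j : Fin 3) :
    relAt (skw k a b c) (heis o s x) j = 0 := by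
  have h := hx (j + s)
  rw [relAt_skw] at h ⊢
  rw [show j + s + 1 = j + 1 + s by abel, show j + s + 2 = j + 2 + s by abel] at h
  refine quad_smul ?_ h
  fin_cases j
  · simp; linear_combination ho
  · simp; ring
  · simp; linear_combination (-o) * ho

lemma gel_heis {o : k} (ho : o ^ 3 = 1) (s : Fin 3) {x : Fin 3 → A}
    (hx : ∀ j, relAt (skw k a b c) x j = 0) :
    gel a b c (heis o s x 0) (heis o s x 1) (heis o s x 2) = gel a b c (x 0) (x 1) (x 2) := by
  simp only [relAt_skw] at hx
  have e1 := gel_shift (hx 0) (hx 1) (hx 2)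
  have e2 := gel_shift (hx 1) (hx 2) (hx 0)
  simp only [Fin.isValue, zero_add] at e1 e2
  have : gel a b c (x (0 + s)) (x (1 + s)) (x (2 + s)) = gel a b c (x 0) (x 1) (x 2) := by
    fin_cases s
    · rfl
    · exact e1
    · exact e2.trans e1
  rw [← this]
  refine gel_smul ?_ ?_ ?_ _ _ _
  · simp
  · simpa using ho
  · simp; linear_combination ho

variable {n : Type} [Fintype n] [DecidableEq n]

lemma ev_heis_surjective {o : k} (ho : o ^ 3 = 1) (s : Fin 3) {x : Fin 3 → Matrix n n k}
    (hx : Function.Surjective (ev (k := k) x)) :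
    Function.Surjective (ev (k := k) (heis o s x)) := by
  have ho' : o ≠ 0 := by rintro rfl; simp at ho
  intro M
  obtain ⟨p, rfl⟩ := hx M
  have : (ev (k := k) (heis o s x)).comp (FreeAlgebra.lift k fun j =>
      (o ^ ((j - s : Fin 3) : ℕ))⁻¹ • FreeAlgebra.ι k (j - s)) = ev x := by
    refine FreeAlgebra.hom_ext ?_
    ext1 j
    simp [heis, smul_smul, ho']
  exact ⟨_, AlgHom.congr_fun this p⟩

/-- The canonical cubic as a noncommutative polynomial. -/
def gfree (k : Type u) [Field k] (a b c : k) : FreeAlgebra k (Fin 3) :=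
  gel a b c (FreeAlgebra.ι k 0) (FreeAlgebra.ι k 1) (FreeAlgebra.ι k 2)

lemma lift_gfree (x : Fin 3 → A) :
    FreeAlgebra.lift k x (gfree k a b c) = gel a b c (x 0) (x 1) (x 2) := by
  simp [gfree, gel]

lemma homog_gfree : Homog 3 (gfree k a b c) := by
  have h : ∀ i j l, Homog 3 (FreeAlgebra.ι k i * FreeAlgebra.ι k j * FreeAlgebra.ι k (l : Fin 3)) :=
    fun i j l => ((Homog.ι i).mul (Homog.ι j)).mul (Homog.ι l)
  exact ((((h _ _ _).smul _).add ((h _ _ _).smul _)).add ((h _ _ _).smul _)).add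
    ((h _ _ _).smul _)

lemma IsPt.heis {E : Env k} {ζ : k} {x : Fin 3 → Matrix n n k} (h : IsPt E ζ x)
    (hE : E.w = skw k a b c) (hz : E.z = gfree k a b c) {o : k} (ho : o ^ 3 = 1) (s : Fin 3) :
    IsPt E ζ (heis o s x) where
  rel := by
    have := h.rel
    rw [hE] at this ⊢
    exact relAt_heis ho s this
  surj := ev_heis_surjective ho s h.surj
  cen := by
    have h1 := h.rel
    rw [hE] at h1
    rw [← h.cen, hz, ev, lift_gfree, ev, lift_gfree, gel_heis ho s h1]
  hζ := h.hζ

end ShiftRel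

section Transitive
variable {k : Type u} [Field k] [IsAlgClosed k] [CharZero k] {a b c : k}
  {n m : Type} [Fintype n] [DecidableEq n] [Fintype m] [DecidableEq m] [Nonempty n] [Nonempty m]

lemma exists_cube_root_sum_ne {w : Fin 3 → k} {i : Fin 3} (hi : w i ≠ 0) :
    ∃ o : k, o ^ 3 = 1 ∧ ∑ i : Fin 3, o ^ (i : ℕ) * w i ≠ 0 := by
  obtain ⟨l, hl⟩ : ∃ l : k, l ^ 2 + l + 1 = 0 := by
    obtain ⟨l, hl⟩ := IsAlgClosed.exists_root
      (Polynomial.X ^ 2 + Polynomial.X + 1 : Polynomial k) (by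
        rw [show (Polynomial.X ^ 2 + Polynomial.X + 1 : Polynomial k)
          = Polynomial.X ^ 2 + Polynomial.X + Polynomial.C 1 by simp,
          show (Polynomial.X ^ 2 + Polynomial.X + Polynomial.C 1 : Polynomial k).degree = 2 by
            compute_degree!]
        exact two_ne_zero)
    exact ⟨l, by simpa using hl⟩
  have h3 : l ^ 3 = 1 := by linear_combination (l - 1) * hl
  by_contra hc
  push Not at hc
  have e0 := hc 1 (one_pow 3)
  have e1 := hc l h3
  have e2 := hc (l ^ 2) (by linear_combination (l ^ 3 + 1) * h3)
  simp only [Fin.sum_univ_three, Fin.val_zero, Fin.val_one, Fin.val_two, pow_zero, pow_one,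
    one_mul, one_pow] at e0 e1 e2
  have h30 : (3 : k) ≠ 0 := three_ne_zero
  refine hi ?_
  fin_cases i
  · refine (mul_eq_zero.1 (?_ : 3 * w 0 = 0)).resolve_left h30
    linear_combination e0 + e1 + e2 - (w 1 + w 2 * (l ^ 2 - l + 1)) * hl
  · refine (mul_eq_zero.1 (?_ : 3 * w 1 = 0)).resolve_left h30
    linear_combination e0 + l ^ 2 * e1 + l * e2 - (w 0) * hl - 2 * w 1 * h3
      - w 2 * (hl + (l + l ^ 2) * h3)
  · refine (mul_eq_zero.1 (?_ : 3 * w 2 = 0)).resolve_left h30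
    linear_combination e0 + l * e1 + l ^ 2 * e2 - (w 0) * hl - w 1 * (hl + l * h3)
      - w 2 * (2 + l ^ 3) * h3

/-- Any two rigid points are equivalent up to the Heisenberg symmetries and scaling. -/
theorem exists_twist_heis {E : Env k} (hE : E.w = skw k a b c) (hz : E.z = gfree k a b c)
    (hN : E.N = 3) {ζ ζ' : k} {x : Fin 3 → Matrix n n k} {x' : Fin 3 → Matrix m m k}
    (h : IsPt E ζ x) (h' : IsPt E ζ' x') (hr : ∀ u, d1 E.w x x u = 0 → IsGauge x u)
    (hr' : ∀ u, d1 E.w x' x' u = 0 → IsGauge x' u) :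
    ∃ (o : k) (s : Fin 3), o ^ 3 = 1 ∧ Twist x (heis o s x') := by
  obtain ⟨κ, hκ⟩ := exists_kappa h
  obtain ⟨κ', hκ'⟩ := exists_kappa h'
  obtain ⟨i, hi⟩ : ∃ i, κ i ≠ 0 := by
    by_contra hc
    push Not at hc
    refine rigid_lef h hr hN ?_
    rw [hκ]; simp [hc]
  obtain ⟨j, hj⟩ : ∃ i, trace (x' i) ≠ 0 := by
    by_contra hc
    push Not at hc
    refine rigid_lef h' hr' hN ?_
    rw [hκ']; simp [hc]
  obtain ⟨o, ho, hne⟩ := exists_cube_root_sum_ne (w := fun l => trace (x' (l + (j - i))) * κ l)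
    (i := i) (by simpa using ⟨hj, hi⟩)
  refine ⟨o, j - i, ho, ?_⟩
  by_contra hT
  refine hne ?_
  have := lef_eq_zero h (h'.heis hE hz ho (j - i)) hT
  rw [hκ] at this
  rw [← this]
  refine Finset.sum_congr rfl fun l _ => ?_
  rw [heis, trace_smul, smul_eq_mul, mul_assoc]

end Transitive

section Ideal
variable {k : Type u} [Field k] [IsAlgClosed k] [CharZero k] {a b c : k}
  {S : Type u} [Ring S] [Algebra k S]
  {Z : Type u} [CommRing Z] [Algebra k Z] [Algebra Z S] [IsScalarTower k Z S]
  {π : FreeAlgebra k (Fin 3) →ₐ[k] S}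

lemma Pres.gfree_central (P : Pres (skw k a b c) π) (t : S) :
    π (gfree k a b c) * t = t * π (gfree k a b c) := by
  let y := fun i => π (FreeAlgebra.ι k i)
  have hy : ∀ j, relAt (skw k a b c) y j = 0 := fun j => by
    rw [← P.rel j, rel_eq_relAt, map_relAt]
  simp only [relAt_skw] at hy
  have hg : π (gfree k a b c) = gel a b c (y 0) (y 1) (y 2) := by simp [gfree, gel, y]
  have hgen : ∀ i, π (gfree k a b c) * y i = y i * π (gfree k a b c) := fun i => by
    rw [hg]
    fin_cases i
    exacts [(gel_comm_x (hy 0) (hy 1) (hy 2)).symm, (gel_comm_y (hy 0) (hy 1) (hy 2)).symm,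
      (gel_comm_z (hy 0) (hy 1) (hy 2)).symm]
  obtain ⟨f, rfl⟩ := P.surj t
  induction f using FreeAlgebra.induction with
  | grade0 r => rw [AlgHom.commutes]; exact (Algebra.commutes _ _).symm
  | grade1 i => exact hgen i
  | mul p q hp hq => rw [map_mul, ← mul_assoc, hp, mul_assoc, hq, mul_assoc]
  | add p q hp hq => rw [map_add, mul_add, add_mul, hp, hq]

variable (k a b c) in
/-- The environment attached to the canonical cubic. -/
lemma exists_env_gfree : ∃ E : Env k, E.w = skw k a b c ∧ E.z = gfree k a b c ∧ E.N = 3 :=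
  (sk_pres k a b c).exists_env (skw_cyclic k a b c) three_ne_zero homog_gfree
    (sk_pres k a b c).gfree_central

/-- Over a singular point other than the origin there is a rigid simple module. -/
lemma Pres.exists_rigid [Module.Finite Z S] (hZ : CenterOf S Z) (P : Pres (skw k a b c) π)
    (habc : a * b * c ≠ 0) (hdeg : (3 * a * b * c) ^ 3 ≠ (a ^ 3 + b ^ 3 + c ^ 3) ^ 3)
    {E : Env k} (hE : E.w = skw k a b c) (hEz : E.z = gfree k a b c)
    {ε : S →ₐ[k] k} (hε : ∀ i, ε (π (FreeAlgebra.ι k i)) = 0) {m : Ideal Z} (hm : m.IsMaximal)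
    {z : Z} (hz : ε (algebraMap Z S z) = 0) (hzm : z ∉ m)
    (hs : Module.finrank (Z ⧸ m) m.Cotangent ≠ 3) :
    ∃ (d : ℕ) (V : S →ₐ[k] Matrix (Fin d) (Fin d) k) (ζ : k), d ≠ 0 ∧
      (∀ z ∈ m, V (algebraMap Z S z) = 0) ∧ IsPt E ζ (fun i => V (π (FreeAlgebra.ι k i))) ∧
      ∀ u, d1 E.w (fun i => V (π (FreeAlgebra.ι k i))) (fun i => V (π (FreeAlgebra.ι k i))) u = 0 →
        IsGauge (fun i => V (π (FreeAlgebra.ι k i))) u := by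
  obtain ⟨_, _⟩ := hZ.fg P.fg
  obtain ⟨d, V, hd, hV, hVm⟩ := hZ.exists_rep (k := k) hm
  have : Nonempty (Fin d) := ⟨⟨0, Nat.pos_of_ne_zero hd⟩⟩
  obtain ⟨E₀, ζ₀, hE₀, h₀⟩ := P.exists_isPt hZ (skw_cyclic k a b c) hm hV hVm hε hz hzm
  have P₀ : Pres E₀.w π := by rw [hE₀]; exact P
  have hr : ∀ u, d1 (skw k a b c) (fun i => V (π (FreeAlgebra.ι k i)))
      (fun i => V (π (FreeAlgebra.ι k i))) u = 0 →
      IsGauge (fun i => V (π (FreeAlgebra.ι k i))) u := by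
    intro u hu
    by_contra hg
    rw [← hE₀] at hu
    exact hs (P₀.finrank_cotangent hZ hV (fun _ => rfl) h₀ hu hg hm hVm)
  obtain ⟨γ, hγ⟩ := h₀.irr (V (π (gfree k a b c))) fun i =>
    (map_mul V _ _).symm.trans ((congrArg V (P.gfree_central _).symm).trans (map_mul V _ _))
  refine ⟨d, V, γ, hd, hVm, ⟨?_, h₀.surj, ?_, ?_⟩, by rw [hE]; exact hr⟩
  · have := h₀.rel
    rwa [hE₀, ← hE] at this
  · rw [hEz, ← hγ, ← map_eq_ev V fun _ => rfl]
  · rintro rfl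
    rw [zero_smul, map_eq_ev V fun _ => rfl, ev, lift_gfree] at hγ
    obtain ⟨v, hv, hg⟩ := h₀.exists_not_isGauge hE₀ habc hdeg hγ
    rw [hE₀] at hv
    exact hg (hr v hv)

end Ideal

section Symmetry
variable {k : Type u} [Field k] {a b c : k} {S : Type u} [Ring S] [Algebra k S]
  {π : FreeAlgebra k (Fin 3) →ₐ[k] S}

lemma Pres.exists_heis (P : Pres (skw k a b c) π) (r : k) {o : k} (ho : o ^ 3 = 1) (s : Fin 3) :
    ∃ φ : S →ₐ[k] S, ∀ i, φ (π (FreeAlgebra.ι k i))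
      = r • o ^ (i : ℕ) • π (FreeAlgebra.ι k (i + s)) := by
  have hy : ∀ j, relAt (skw k a b c) (fun i => π (FreeAlgebra.ι k i)) j = 0 := fun j => by
    rw [← P.rel j, rel_eq_relAt, map_relAt]
  obtain ⟨φ, hφ⟩ := P.exists_lift (y := fun i => r • heis o s (fun i => π (FreeAlgebra.ι k i)) i)
    fun j => by
      have := relAt_heis ho s hy j
      rw [relAt_skw] at this ⊢
      exact quad_smul rfl this
  exact ⟨φ, fun i => by rw [hφ, FreeAlgebra.lift_ι_apply]; rfl⟩

lemma Pres.algHom_ext (P : Pres (skw k a b c) π) {A : Type*} [Ring A] [Algebra k A]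
    {φ ψ : S →ₐ[k] A} (h : ∀ i, φ (π (FreeAlgebra.ι k i)) = ψ (π (FreeAlgebra.ι k i))) : φ = ψ := by
  have : φ.comp π = ψ.comp π := FreeAlgebra.hom_ext (funext h)
  ext s
  obtain ⟨f, rfl⟩ := P.surj s
  exact AlgHom.congr_fun this f

lemma pow_fin_three {o : k} (ho : o ^ 3 = 1) (i s : Fin 3) :
    o ^ (s : ℕ) * (o⁻¹ ^ ((i + s : Fin 3) : ℕ) * o ^ (i : ℕ)) = 1 := by
  have ho' : o ≠ 0 := by rintro rfl; simp at ho
  rw [inv_pow]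
  rw [← div_eq_inv_mul, mul_div_assoc', div_eq_one_iff_eq (pow_ne_zero _ ho')]
  fin_cases i <;> fin_cases s <;> simp <;>
    first | ring1 | linear_combination ho | linear_combination o * ho

/-- The Heisenberg symmetries combined with scaling are automorphisms. -/
lemma Pres.exists_algEquiv (P : Pres (skw k a b c) π) {r : k} (hr : r ≠ 0) {o : k}
    (ho : o ^ 3 = 1) (s : Fin 3) : ∃ Φ : S ≃ₐ[k] S, ∀ i, Φ (π (FreeAlgebra.ι k i))
      = r • o ^ (i : ℕ) • π (FreeAlgebra.ι k (i + s)) := by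
  obtain ⟨φ, hφ⟩ := P.exists_heis r ho s
  obtain ⟨ψ, hψ⟩ := P.exists_heis (r⁻¹ * o ^ (s : ℕ)) (o := o⁻¹) (by rw [inv_pow, ho, inv_one]) (-s)
  refine ⟨AlgEquiv.ofAlgHom φ ψ (P.algHom_ext fun i => ?_) (P.algHom_ext fun i => ?_), hφ⟩
  · have h := pow_fin_three ho (i + -s) s
    rw [neg_add_cancel_right] at h
    rw [AlgHom.comp_apply, hψ, map_smul, map_smul, hφ, neg_add_cancel_right, smul_smul, smul_smul,
      smul_smul, AlgHom.id_apply]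
    refine (congrArg (· • _) ?_).trans (one_smul k _)
    linear_combination (r⁻¹ * r) * h + inv_mul_cancel₀ hr
  · have h := pow_fin_three ho i s
    rw [AlgHom.comp_apply, hφ, map_smul, map_smul, hψ, add_neg_cancel_right, smul_smul, smul_smul,
      smul_smul, AlgHom.id_apply]
    refine (congrArg (· • _) ?_).trans (one_smul k _)
    linear_combination (r⁻¹ * r) * h + inv_mul_cancel₀ hr

end Symmetry

section Linking
variable {k : Type u} [Field k] [IsAlgClosed k] [CharZero k] {a b c : k}
  {S : Type u} [Ring S] [Algebra k S]
  {Z : Type u} [CommRing Z] [Algebra k Z] [Algebra Z S] [IsScalarTower k Z S]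
  {π : FreeAlgebra k (Fin 3) →ₐ[k] S}

lemma CenterOf.map_algEquiv (hZ : CenterOf S Z) (Φ : S ≃ₐ[k] S) (z : Z) :
    ∃ z', algebraMap Z S z' = Φ (algebraMap Z S z) :=
  hZ.cen _ fun t => by
    rw [← Φ.apply_symm_apply t, ← map_mul, Algebra.commutes, map_mul]

/-- An automorphism of the algebra exchanging two singular points of the center. -/
theorem Pres.exists_algEquiv_map [Module.Finite Z S] (hZ : CenterOf S Z)
    (P : Pres (skw k a b c) π) (habc : a * b * c ≠ 0)
    (hdeg : (3 * a * b * c) ^ 3 ≠ (a ^ 3 + b ^ 3 + c ^ 3) ^ 3)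
    {ε : S →ₐ[k] k} (hε : ∀ i, ε (π (FreeAlgebra.ι k i)) = 0)
    {m m' : Ideal Z} (hm : m.IsMaximal) (hm' : m'.IsMaximal)
    {z z' : Z} (hz : ε (algebraMap Z S z) = 0) (hzm : z ∉ m)
    (hz' : ε (algebraMap Z S z') = 0) (hzm' : z' ∉ m')
    (hs : Module.finrank (Z ⧸ m) m.Cotangent ≠ 3)
    (hs' : Module.finrank (Z ⧸ m') m'.Cotangent ≠ 3) :
    ∃ Φ : S ≃ₐ[k] S, (∀ z ∈ m, ∃ z' ∈ m', algebraMap Z S z' = Φ (algebraMap Z S z)) ∧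
      ∀ z' ∈ m', ∃ z ∈ m, algebraMap Z S z = Φ.symm (algebraMap Z S z') := by
  obtain ⟨E, hE, hEz, hEN⟩ := exists_env_gfree k a b c
  obtain ⟨d, V, ζ, hd, hVm, h, hr⟩ := P.exists_rigid hZ habc hdeg hE hEz hε hm hz hzm hs
  obtain ⟨d', V', ζ', hd', hVm', h', hr'⟩ := P.exists_rigid hZ habc hdeg hE hEz hε hm' hz' hzm' hs'
  have : Nonempty (Fin d) := ⟨⟨0, Nat.pos_of_ne_zero hd⟩⟩
  have : Nonempty (Fin d') := ⟨⟨0, Nat.pos_of_ne_zero hd'⟩⟩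
  obtain ⟨_, _⟩ := hZ.fg P.fg
  obtain ⟨o, s, ho, ψ, f, hψ, hf0, hf⟩ := exists_twist_heis hE hEz hEN h h' hr hr'
  obtain ⟨Φ, hΦ⟩ := P.exists_algEquiv (inv_ne_zero hψ) ho s
  obtain ⟨g, hfg, hgf⟩ := schur (x := ψ • fun i => V (π (FreeAlgebra.ι k i)))
    (ev_smul_surj hψ h.surj) (ev_heis_surjective ho s h'.surj) hf0 fun i => by
      rw [hf, Pi.smul_apply, Matrix.mul_smul]
  have key : ∀ t, V' (Φ t) * f = f * V t := by
    intro t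
    obtain ⟨p, rfl⟩ := P.surj t
    rw [map_eq_ev V fun _ => rfl, ← AlgEquiv.coe_toAlgHom, ← AlgHom.comp_apply,
      map_eq_ev (V'.comp Φ.toAlgHom) fun _ => rfl]
    refine ev_intertwine (fun i => ?_) p
    have h1 : V' (Φ (π (FreeAlgebra.ι k i)))
        = ψ⁻¹ • heis o s (fun i => V' (π (FreeAlgebra.ι k i))) i := by
      rw [hΦ, map_smul, map_smul]; rfl
    refine (congrArg (· * f) h1).trans ?_
    rw [Matrix.smul_mul, hf, smul_smul, inv_mul_cancel₀ hψ, one_smul]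
  refine ⟨Φ, fun z hz => ?_, fun z' hz' => ?_⟩
  · obtain ⟨y, hy⟩ := hZ.map_algEquiv Φ z
    refine ⟨y, mem_of_map_eq_zero hm' hVm' ?_, hy⟩
    rw [hy, ← Matrix.mul_one (V' _), ← hfg, ← Matrix.mul_assoc, key, hVm z hz, Matrix.mul_zero,
      Matrix.zero_mul]
  · obtain ⟨y, hy⟩ := hZ.map_algEquiv Φ.symm z'
    refine ⟨y, mem_of_map_eq_zero hm hVm ?_, hy⟩
    rw [hy, ← Matrix.one_mul (V _), ← hgf, Matrix.mul_assoc, ← key, Φ.apply_symm_apply, hVm' z' hz',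
      Matrix.zero_mul, Matrix.mul_zero]

end Linking

section Quotient
variable {k : Type u} [Field k] {a b c : k}

lemma nonempty_centralQuot_algEquiv
    {m m' : Ideal ↥(Subalgebra.center k (Sklyanin k a b c))}
    (Φ : Sklyanin k a b c ≃ₐ[k] Sklyanin k a b c)
    (h : ∀ z ∈ m, ∃ z' ∈ m', (z' : Sklyanin k a b c) = Φ z)
    (h' : ∀ z' ∈ m', ∃ z ∈ m, (z : Sklyanin k a b c) = Φ.symm z') :
    Nonempty (Sklyanin.centralQuot k a b c m ≃ₐ[k] Sklyanin.centralQuot k a b c m') := by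
  set I := TwoSidedIdeal.span
    ((fun z : ↥(Subalgebra.center k (Sklyanin k a b c)) => (z : Sklyanin k a b c)) ''
      (m : Set ↥(Subalgebra.center k (Sklyanin k a b c)))) with hI
  set J := TwoSidedIdeal.span
    ((fun z : ↥(Subalgebra.center k (Sklyanin k a b c)) => (z : Sklyanin k a b c)) ''
      (m' : Set ↥(Subalgebra.center k (Sklyanin k a b c)))) with hJ
  have h1 : I ≤ J.comap Φ := by
    rw [hI, TwoSidedIdeal.span_le]
    rintro _ ⟨z, hz, rfl⟩
    obtain ⟨z', hz', e⟩ := h z hz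
    exact (TwoSidedIdeal.mem_comap _).2 (by
      show Φ (z : Sklyanin k a b c) ∈ J
      rw [← e]; exact TwoSidedIdeal.subset_span ⟨z', hz', rfl⟩)
  have h2 : J ≤ I.comap Φ.symm := by
    rw [hJ, TwoSidedIdeal.span_le]
    rintro _ ⟨z, hz, rfl⟩
    obtain ⟨z', hz', e⟩ := h' z hz
    exact (TwoSidedIdeal.mem_comap _).2 (by
      show Φ.symm (z : Sklyanin k a b c) ∈ I
      rw [← e]; exact TwoSidedIdeal.subset_span ⟨z', hz', rfl⟩)
  have h3 : ∀ s, s ∈ I ↔ Φ s ∈ J := fun s =>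
    ⟨fun hs => (TwoSidedIdeal.mem_comap Φ).1 (h1 hs), fun hs => by
      have := (TwoSidedIdeal.mem_comap Φ.symm).1 (h2 hs)
      rwa [Φ.symm_apply_apply] at this⟩
  have h4 : I.ringCon = J.ringCon.comap (Φ : Sklyanin k a b c ≃+* Sklyanin k a b c) := by
    ext s t
    rw [RingCon.comap_rel, TwoSidedIdeal.rel_iff, TwoSidedIdeal.rel_iff, h3, map_sub]
    rfl
  let e : I.ringCon.Quotient ≃+* J.ringCon.Quotient := RingCon.congr _ h4
  let e' : I.ringCon.Quotient ≃ₐ[k] J.ringCon.Quotient := AlgEquiv.ofRingEquiv (f := e) fun r =>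
    congrArg J.ringCon.mk' (Φ.commutes r)
  exact ⟨e'⟩

/-- An algebra as an algebra over its center. -/
@[reducible] def centerAlgebra (k S : Type u) [Field k] [Ring S] [Algebra k S] :
    Algebra ↥(Subalgebra.center k S) S where
  algebraMap := (Subalgebra.center k S).val.toRingHom
  commutes' z s := (Subalgebra.mem_center_iff.1 z.2 s).symm
  smul_def' _ _ := rfl

attribute [local instance] centerAlgebra

lemma centerOf_center {S : Type u} [Ring S] [Algebra k S] :
    CenterOf S ↥(Subalgebra.center k S) where
  inj := Subtype.val_injective
  cen s hs := ⟨⟨s, Subalgebra.mem_center_iff.2 fun t => (hs t).symm⟩, rfl⟩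

lemma aug_skπ (i : Fin 3) : Sklyanin.aug k a b c (skπ k a b c (FreeAlgebra.ι k i)) = 0 := by
  rw [Sklyanin.aug, skπ]
  exact (RingQuot.liftAlgHom_mkAlgHom_apply k _ _ _).trans (FreeAlgebra.lift_ι_apply _ _)

lemma mem_augCenterIdeal {z : ↥(Subalgebra.center k (Sklyanin k a b c))} :
    z ∈ Sklyanin.augCenterIdeal k a b c ↔ Sklyanin.aug k a b c (z : Sklyanin k a b c) = 0 :=
  Iff.rfl

lemma exists_notMem {m : Ideal ↥(Subalgebra.center k (Sklyanin k a b c))} (hm : m.IsMaximal)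
    (h0 : m ≠ Sklyanin.augCenterIdeal k a b c) :
    ∃ z, Sklyanin.aug k a b c (algebraMap _ (Sklyanin k a b c) z) = 0 ∧ z ∉ m := by
  by_contra hc
  push Not at hc
  let q : ↥(Subalgebra.center k (Sklyanin k a b c)) →+* k :=
    (Sklyanin.aug k a b c).toRingHom.comp (Subalgebra.center k (Sklyanin k a b c)).val.toRingHom
  have hq : Function.Surjective q := fun r => ⟨algebraMap k _ r, (Sklyanin.aug k a b c).commutes r⟩
  have h1 : (RingHom.ker q).IsMaximal := RingHom.ker_isMaximal_of_surjective q hq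
  exact h0 (h1.eq_of_le hm.ne_top fun z hz => hc z hz).symm

end Quotient

end SklyaninAux

set_option synthInstance.maxHeartbeats 1000000 in
set_option maxHeartbeats 1000000 in
/-- Any two points of the singular locus of `maxSpec Z` other than the origin give
isomorphic central quotients of `S`: if `S = S(a,b,c)` is module-finite over its center `Z`
and `m, m'` are maximal ideals of `Z`, both different from `m₀ = Z ∩ ker ε` and with
`dim(m/m²) ≠ 3 ≠ dim(m'/m'²)`, then `S/(mS) ≅ S/(m'S)` as `k`-algebras. -/
theorem sklyanin_singular_central_quotients_isomorphic
    (k : Type*) [Field k] [IsAlgClosed k] [CharZero k]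
    (a b c : k) (habc : a * b * c ≠ 0)
    (hdeg : (3 * a * b * c) ^ 3 ≠ (a ^ 3 + b ^ 3 + c ^ 3) ^ 3)
    (hfin : Module.Finite ↥(Subalgebra.center k (Sklyanin k a b c)) (Sklyanin k a b c))
    (m m' : Ideal ↥(Subalgebra.center k (Sklyanin k a b c)))
    (hm : m.IsMaximal) (hm' : m'.IsMaximal)
    (hm0 : m ≠ Sklyanin.augCenterIdeal k a b c)
    (hm'0 : m' ≠ Sklyanin.augCenterIdeal k a b c)
    (hsing : Module.finrank (↥(Subalgebra.center k (Sklyanin k a b c)) ⧸ m) m.Cotangent ≠ 3)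
    (hsing' : Module.finrank (↥(Subalgebra.center k (Sklyanin k a b c)) ⧸ m') m'.Cotangent ≠ 3) :
    Nonempty (Sklyanin.centralQuot k a b c m ≃ₐ[k] Sklyanin.centralQuot k a b c m') := by
  let _ := SklyaninAux.centerAlgebra k (Sklyanin k a b c)
  have : IsScalarTower k ↥(Subalgebra.center k (Sklyanin k a b c)) (Sklyanin k a b c) :=
    IsScalarTower.of_algebraMap_eq fun _ => rfl
  obtain ⟨z, hz, hzm⟩ := SklyaninAux.exists_notMem hm hm0
  obtain ⟨z', hz', hzm'⟩ := SklyaninAux.exists_notMem hm' hm'0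
  obtain ⟨Φ, h1, h2⟩ := (SklyaninAux.sk_pres k a b c).exists_algEquiv_map SklyaninAux.centerOf_center habc hdeg
    (ε := Sklyanin.aug k a b c) SklyaninAux.aug_skπ hm hm' hz hzm hz' hzm' hsing hsing'
  exact SklyaninAux.nonempty_centralQuot_algEquiv Φ h1 h2

end
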